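/- There exists d₀ ∈ ℕ such that for every d ≥ d₀ the lattice ℤ^d recovers from fires: for every ε ∈ (0,1] there exists p ∈ (p_c(d), 1] such that the configuration ω̃_{p,ε} contains an infinite open cluster almost surely. -/

import Mathlib

open MeasureTheory Set

namespace Perc

/-- Vertices of the lattice `ℤ^d`. -/
abbrev V (d : ℕ) : Type := Fin d → ℤ

/-- Nearest-neighbour adjacency in `ℤ^d`: `‖x - y‖₁ = 1`. -/
def Adjacent {d : ℕ} (x y : V d) : Prop := (∑ i, |x i - y i|) = 1

/-- `e` is an edge of the nearest-neighbour lattice `ℤ^d`. -/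
def IsEdge {d : ℕ} (e : Sym2 (V d)) : Prop := ∃ x y : V d, Adjacent x y ∧ e = s(x, y)

/-- The edge set `E(ℤ^d)` of the nearest-neighbour lattice. -/
abbrev Edge (d : ℕ) : Type := {e : Sym2 (V d) // IsEdge e}

/-- A bond percolation configuration: each edge is open (`true`) or closed (`false`). -/
abbrev Config (d : ℕ) : Type := Edge d → Bool

/-- `x` and `y` are joined by an open edge of `ω`. -/
def OpenAdj {d : ℕ} (ω : Config d) (x y : V d) : Prop :=
  ∃ h : IsEdge s(x, y), ω ⟨s(x, y), h⟩ = true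

/-- `x` and `y` lie in the same open cluster of `ω`. -/
def Connected {d : ℕ} (ω : Config d) (x y : V d) : Prop :=
  Relation.ReflTransGen (OpenAdj ω) x y

/-- The open cluster of `ω` containing `x`. -/
def cluster {d : ℕ} (ω : Config d) (x : V d) : Set (V d) := {y | Connected ω x y}

/-- `x` lies in an infinite open cluster of `ω`. -/
def InInfinite {d : ℕ} (ω : Config d) (x : V d) : Prop := (cluster ω x).Infinite

/-- `𝒞∞(ω)`: the set of vertices lying in infinite open clusters. -/
def Cinf {d : ℕ} (ω : Config d) : Set (V d) := {x | InInfinite ω x}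

/-- `ω` has an infinite open cluster. -/
def HasInfCluster {d : ℕ} (ω : Config d) : Prop := ∃ x : V d, InInfinite ω x

/-- The Bernoulli(p) weight of a single edge state (`true ↦ p`, `false ↦ 1 - p`). -/
noncomputable def bernoulliCyl (p : ℝ) (b : Bool) : ENNReal :=
  if b then ENNReal.ofReal p else ENNReal.ofReal (1 - p)

/-- `μ` is the product Bernoulli(`p`) measure on configurations: it is a probability
measure whose finite-dimensional cylinder probabilities are the i.i.d. Bernoulli ones. -/
def IsBernoulli (d : ℕ) (p : ℝ) (μ : Measure (Config d)) : Prop :=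
  IsProbabilityMeasure μ ∧
    ∀ (t : Finset (Edge d)) (f : Edge d → Bool),
      μ {ω | ∀ e ∈ t, ω e = f e} = ∏ e ∈ t, bernoulliCyl p (f e)

/-- The critical probability `p_c` associated with a family `P p` of Bernoulli(`p`)
percolation measures. -/
noncomputable def pcOf (d : ℕ) (P : ℝ → Measure (Config d)) : ℝ :=
  sInf {p | p ∈ Icc (0 : ℝ) 1 ∧ 0 < P p {ω | HasInfCluster ω}}

/-- The monotone coupling randomness: `U` is the law of i.i.d. uniform-`[0,1]` labels on
the edges (characterized by its finite-dimensional distribution functions). -/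
def IsUniform (d : ℕ) (U : Measure (Edge d → ℝ)) : Prop :=
  IsProbabilityMeasure U ∧
    ∀ (t : Finset (Edge d)) (a : Edge d → ℝ),
      U {u | ∀ e ∈ t, u e ≤ a e} = ∏ e ∈ t, ENNReal.ofReal (min (max (a e) 0) 1)

/-- The configuration `ω_p` obtained from uniform labels `u` in the monotone coupling. -/
noncomputable def level {d : ℕ} (p : ℝ) (u : Edge d → ℝ) : Config d :=
  fun e => decide (u e ≤ p)

open Classical in
/-- `ω^S`: the configuration obtained from `ω` by closing every edge with an endpoint
in `S`. -/
noncomputable def closeOn {d : ℕ} (S : Set (V d)) (ω : Config d) : Config d :=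
  fun e => if ∃ x ∈ e.val, x ∈ S then false else ω e

/-- `ω̃_p` built from `ω_p`: keep an edge open iff it is open and its cluster is finite. -/
noncomputable def burn {d : ℕ} (ω : Config d) : Config d := closeOn (Cinf ω) ω

open Classical in
/-- The restriction of `ω` to edges with both endpoints in `R` (other edges closed). -/
noncomputable def restrictTo {d : ℕ} (R : Set (V d)) (ω : Config d) : Config d :=
  fun e => if ∀ x ∈ e.val, x ∈ R then ω e else false

/-- The box `B_x(L) = {y : ‖y - x‖_∞ ≤ L}`. -/
def box {d : ℕ} (x : V d) (L : ℕ) : Set (V d) := {y | ∀ i, |y i - x i| ≤ (L : ℤ)}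

/-- The sphere `∂B_x(L) = {y : ‖y - x‖_∞ = L}`. -/
def sphere {d : ℕ} (x : V d) (L : ℕ) : Set (V d) :=
  {y | (∀ i, |y i - x i| ≤ (L : ℤ)) ∧ ∃ i, |y i - x i| = (L : ℤ)}

/-- The slab `S_ℓ = {x : |x_i| ≤ ℓ for all coordinates i ≥ 3}` (`0`-indexed: `i ≥ 2`). -/
def slab (d : ℕ) (ℓ : ℕ) : Set (V d) := {x | ∀ i : Fin d, 2 ≤ (i : ℕ) → |x i| ≤ (ℓ : ℤ)}

/-- `x` is connected by an open path to some vertex of `S`. -/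
def ConnectedToSet {d : ℕ} (ω : Config d) (x : V d) (S : Set (V d)) : Prop :=
  ∃ y ∈ S, Connected ω x y

/-- The set of vertices `y ∈ S_ℓ ∩ B_x(3L)` with `y ↔ ∂B_y(L)`. -/
def armSet {d : ℕ} (ω : Config d) (x : V d) (ℓ L : ℕ) : Set (V d) :=
  {y | y ∈ slab d ℓ ∩ box x (3 * L) ∧ ConnectedToSet ω y (sphere y L)}

/-- The event `𝒜(x,ℓ,L,M)`: strictly fewer than `M` vertices `y ∈ S_ℓ ∩ B_x(3L)`
are connected to `∂B_y(L)`. -/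
def eventA {d : ℕ} (x : V d) (ℓ L M : ℕ) : Set (Config d) :=
  {ω | (armSet ω x ℓ L).Finite ∧ (armSet ω x ℓ L).ncard < M}

/-- The set `C` has `ℓ∞`-diameter strictly larger than `L`. -/
def DiamGT {d : ℕ} (C : Set (V d)) (L : ℕ) : Prop :=
  ∃ a ∈ C, ∃ b ∈ C, ∃ i, (L : ℤ) < |a i - b i|

/-- The event `ℰ(x,ℓ,L)`: in the restriction of `ω` to `S_ℓ ∩ B_x(3L)` there is an open
crossing from `∂B_x(L)` to `∂B_x(3L)`, and there is exactly one open cluster of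
`ℓ∞`-diameter larger than `L`. -/
def eventE {d : ℕ} (x : V d) (ℓ L : ℕ) : Set (Config d) :=
  {ω |
    (∃ a ∈ sphere x L, ∃ b ∈ sphere x (3 * L),
        Connected (restrictTo (slab d ℓ ∩ box x (3 * L)) ω) a b) ∧
      ∃! C : Set (V d),
        (∃ y : V d, C = cluster (restrictTo (slab d ℓ ∩ box x (3 * L)) ω) y) ∧ DiamGT C L}

/-- The event `ℬ(x,ℓ,L,M)`: `ω^S ∈ ℰ(x,ℓ,L)` for every `S ⊆ B_x(3L)` with `|S| ≤ M`. -/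
def eventB {d : ℕ} (x : V d) (ℓ L M : ℕ) : Set (Config d) :=
  {ω | ∀ S : Set (V d), S ⊆ box x (3 * L) → S.Finite → S.ncard ≤ M →
    closeOn S ω ∈ eventE x ℓ L}

/-- The embedding of `ℤ²` into `ℤ^d` (last `d - 2` coordinates zero). -/
def emb (d : ℕ) (u : ℤ × ℤ) : V d :=
  fun i => if (i : ℕ) = 0 then u.1 else if (i : ℕ) = 1 then u.2 else 0

/-- Nearest-neighbour adjacency in `ℤ²`. -/
def Adjacent₂ (u v : ℤ × ℤ) : Prop := |u.1 - v.1| + |u.2 - v.2| = 1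

/-- `A ⊆ ℤ²` is nearest-neighbour-connected. -/
def ConnSet₂ (A : Set (ℤ × ℤ)) : Prop :=
  ∀ a ∈ A, ∀ b ∈ A,
    Relation.ReflTransGen (fun u v => u ∈ A ∧ v ∈ A ∧ Adjacent₂ u v) a b


/-- `Q` is the joint law of the monotone-coupling uniform labels together with an
independent Bernoulli(`ε`) configuration `ω'_ε`. -/
def IsUniformWithBernoulli (d : ℕ) (ε : ℝ) (Q : Measure ((Edge d → ℝ) × Config d)) : Prop :=
  IsProbabilityMeasure Q ∧
    ∀ (t s : Finset (Edge d)) (a : Edge d → ℝ) (f : Edge d → Bool),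
      Q {x | (∀ e ∈ t, x.1 e ≤ a e) ∧ ∀ e ∈ s, x.2 e = f e} =
        (∏ e ∈ t, ENNReal.ofReal (min (max (a e) 0) 1)) * ∏ e ∈ s, bernoulliCyl ε (f e)

open ENNReal (ofReal ofReal_add ofReal_mul tsum_le_tsum tsum_comm tsum_add tsum_prod ofReal_one ofReal_le_ofReal le_tsum ofReal_ofNat inv_two_add_inv_two ofReal_inv_of_pos ofReal_natCast mul_ne_top ofReal_pow sum_le_tsum pow_ne_top ofReal_ne_top add_ne_top ofReal_toReal ofReal_le_ofReal_iff toReal_nonneg ofReal_zero)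
open Finset (mem_filter prod_const measurableSet_biUnion sum_image sum_congr single_le_sum sum_le_sum sum_add_distrib mul_sum sum_const card_univ sum_mul sum_le_card_nsmul mem_coe mem_product inl_mem_disjSum)
open Real (coe_toNNReal exp add_one_le_exp exp_nat_mul exp_le_exp exp_pos log)
open Filter (eventuallyEq_set Tendsto atTop eventually_ge_atTop eventually_atTop)
open Nat (pow_le_pow_left pow_le_pow_right succ_mul)
local notation "𝕀" => Icc (0:ℝ) 1

noncomputable section

/-- Pairs of configurations. -/
abbrev Pr (E : Type*) := (E → Bool) × (E → Bool)
/-- Kernels on the lattice. -/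
abbrev Fn (d : ℕ) := V d → ENNReal

lemma tsum_mul_left {f : α → ENNReal} : ∑' i, a * f i = a * ∑' i, f i := ENNReal.tsum_mul_left
lemma tsum_mul_right {f : α → ENNReal} : ∑' i, f i * a = (∑' i, f i) * a := ENNReal.tsum_mul_right


section Product
variable {E : Type*}

/-- Truncation of a real parameter to `[0,1]`. -/
def clamp (p : ℝ) : ℝ := max 0 (min 1 p)

lemma clamp_nonneg (p) : 0 ≤ clamp p := le_max_left _ _
lemma clamp_le_one (p) : clamp p ≤ 1 := max_le zero_le_one (min_le_left _ _)
lemma clamp_of_mem (hp : p ∈ 𝕀) : clamp p = p := by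
  simp [clamp, min_eq_right hp.2, max_eq_right hp.1]

/-- The weight of an edge state. -/
def wt (p : ℝ) (b : Bool) : ENNReal :=
  if b then ofReal (clamp p) else ofReal (1 - clamp p)

lemma wt_add (p) : wt p true + wt p false = 1 := by
  simp [wt]
  rw [← ofReal_add (clamp_nonneg p) (by linarith [clamp_le_one p])]
  simp

lemma wt_le_one (p) (b) : wt p b ≤ 1 := by
  rw [← wt_add p]; cases b <;> simp

lemma wt_ne_top (p) (b) : wt p b ≠ ⊤ := ne_top_of_le_ne_top ENNReal.one_ne_top (wt_le_one p b)

/-- The Bernoulli law on a single edge. -/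
def bern (p : ℝ) : Measure Bool :=
  wt p true • Measure.dirac true + wt p false • Measure.dirac false

lemma bern_singleton (p) (b) : bern p {b} = wt p b := by
  cases b <;> simp [bern]

instance (p : ℝ) : IsProbabilityMeasure (bern p) := ⟨by simp [bern, wt_add]⟩

/-- Product Bernoulli measure with density `p`. -/
def mu (p : ℝ) : Measure (E → Bool) := Measure.infinitePi fun _ => bern p

instance (p : ℝ) : IsProbabilityMeasure (mu p : Measure (E → Bool)) := by
  unfold mu; infer_instance

/-- The cylinder on which the coordinates in `t` agree with `f`. -/
def cyl (t : Finset E) (f : E → Bool) : Set (E → Bool) := {ω | ∀ e ∈ t, ω e = f e}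

lemma meas_coord (e) (b) : MeasurableSet {ω : E → Bool | ω e = b} :=
  measurableSet_eq_fun (measurable_pi_apply e) measurable_const

lemma meas_cyl (t) (f : E → Bool) : MeasurableSet (cyl t f) := by
  rw [(show cyl t f = ⋂ e ∈ t, {ω | ω e = f e} by aesop)]
  exact t.measurableSet_biInter fun e _ => meas_coord e _

lemma mu_cyl (p) (t) (f : E → Bool) : mu p (cyl t f) = ∏ e ∈ t, wt p (f e) := by
  rw [(show cyl t f = Set.pi t fun e => {f e} by tauto), mu, Measure.infinitePi_pi _ (fun _ _ => measurableSet_singleton _)]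
  simp [bern_singleton]

lemma mu_coord (p) (e : E) (b) : mu p {ω | ω e = b} = wt p b := by
  have := mu_cyl p {e} (fun _ => b)
  simpa [cyl] using this

/-- The π-system of cylinders with constant value `b`. -/
def cylSys (E : Type*) (b : Bool) : Set (Set (E → Bool)) := {s | ∃ t : Finset E, s = cyl t fun _ => b}

lemma isPiSystem_cylSys (b) : IsPiSystem (cylSys E b) := by
  classical
  rintro _ ⟨s, rfl⟩ _ ⟨t, rfl⟩ _
  refine ⟨s ∪ t, ?_⟩
  ext ω; simp [cyl, Finset.mem_union]
  grind

lemma generateFrom_cylSys (b) :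
    (inferInstance : MeasurableSpace (E → Bool)) = MeasurableSpace.generateFrom (cylSys E b) := by
  apply le_antisymm
  · refine iSup_le fun e => ?_; rw [MeasurableSpace.comap_le_iff_le_map]; intro s _
    have h1 : MeasurableSet[MeasurableSpace.generateFrom (cylSys E b)] {ω | ω e = b} := by
      apply MeasurableSpace.measurableSet_generateFrom; exact ⟨{e}, by simp [cyl]⟩
    have h2 : MeasurableSet[MeasurableSpace.generateFrom (cylSys E b)] {ω | ω e = !b} := by
      have : {ω | ω e = !b} = {ω : E → Bool | ω e = b}ᶜ := by
        ext ω; cases h : ω e <;> cases b <;> simp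
      simp_all
    have key : (fun ω => ω e) ⁻¹' s =
        ({ω | ω e = b} ∩ {_ω | b ∈ s}) ∪ ({ω : E → Bool | ω e = !b} ∩ {_ω | (!b) ∈ s}) := by
      ext ω; simp [mem_ofPred_eq]; cases h : ω e <;> cases b <;> simp
    change MeasurableSet[MeasurableSpace.generateFrom (cylSys E b)] ((fun ω => ω e) ⁻¹' s); simp_all
  · apply MeasurableSpace.generateFrom_le; rintro _ ⟨t, rfl⟩; exact meas_cyl _ _

lemma eq_mu_of_cyl (p) (b) (ν) [IsProbabilityMeasure ν]
    (h : ∀ t : Finset E, ν (cyl t fun _ => b) = wt p b ^ t.card) : ν = mu p := by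
  refine ext_of_generate_finite (cylSys E b) (generateFrom_cylSys b) (isPiSystem_cylSys b) ?_ (by simp)
  rintro _ ⟨t, rfl⟩
  rw [h, mu_cyl]; simp

lemma eq_mu_prod (p q) (b c) (ν)
    (h : ∀ t s : Finset E, ν ((cyl t fun _ => b) ×ˢ (cyl s fun _ => c)) =
      wt p b ^ t.card * wt q c ^ s.card) : (mu p).prod (mu q) = ν := by
  have span : ∀ r b, (mu r : Measure (E → Bool)).FiniteSpanningSetsIn (cylSys E b) := fun r b =>
    ⟨fun _ => univ, fun _ => ⟨∅, by simp [cyl]⟩, fun _ => by simp, by simp [iUnion_const]⟩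
  refine Measure.prod_eq_generateFrom (generateFrom_cylSys b).symm (generateFrom_cylSys c).symm
    (isPiSystem_cylSys b) (isPiSystem_cylSys c) (span p b) (span q c) ?_
  rintro _ ⟨t, rfl⟩ _ ⟨s, rfl⟩
  rw [h, mu_cyl, mu_cyl]; simp

open Classical in
/-- `ω` on `A` and `ω'` off `A`. -/
def mix (A : Set E) (ω ω' : E → Bool) : E → Bool := fun e => if e ∈ A then ω e else ω' e

lemma mix_mem (h : e ∈ A) : mix A ω ω' e = ω e := by simp [mix, h]
lemma mix_not_mem (h : e ∉ A) : mix A ω ω' e = ω' e := by simp [mix, h]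

lemma measurable_mix (A) : Measurable fun x : Pr E => mix A x.1 x.2 := by
  refine measurable_pi_iff.2 fun e => ?_
  by_cases h : e ∈ A
  · simp [mix, h]; exact (measurable_pi_apply e).comp measurable_fst
  · simp [mix, h]; exact (measurable_pi_apply e).comp measurable_snd

lemma map_mix (p) (A) :
    ((mu p).prod (mu p)).map (fun x : Pr E => mix A x.1 x.2) = mu p := by
  classical
  have : IsProbabilityMeasure (((mu p).prod (mu p)).map (fun x => mix A x.1 x.2)) :=
    Measure.isProbabilityMeasure_map (measurable_mix A).aemeasurable
  refine eq_mu_of_cyl p true _ fun t => ?_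
  rw [Measure.map_apply (measurable_mix A) (meas_cyl _ _)]
  have : (fun x => mix A x.1 x.2) ⁻¹' (cyl t fun _ => true) =
      (cyl (t.filter (· ∈ A)) fun _ => true) ×ˢ (cyl (t.filter (¬ · ∈ A)) fun _ => true) := by
    ext x; simp only [cyl, mem_preimage, mem_filter]; constructor
    · intro h
      exact ⟨fun e he => by have := h e he.1; rwa [mix_mem he.2] at this,
        fun e he => by have := h e he.1; rwa [mix_not_mem he.2] at this⟩
    · rintro ⟨h1, h2⟩ e he; by_cases hA : e ∈ A
      · rw [mix_mem hA]; exact h1 e ⟨he, hA⟩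
      · rw [mix_not_mem hA]; exact h2 e ⟨he, hA⟩
  rw [this, Measure.prod_prod, mu_cyl, mu_cyl]
  simp
  rw [← pow_add, Finset.card_filter_add_card_filter_not]

lemma mu_eq_mix (p) (A) (hF : MeasurableSet F) :
    mu p F = ((mu p).prod (mu p)) {x | mix A x.1 x.2 ∈ F} := by
  conv_lhs => rw [← map_mix p A]
  rw [Measure.map_apply (measurable_mix A) hF]; rfl

/-- The event `F` is determined by the coordinates in `A`. -/
def DepOn (F : Set (E → Bool)) (A : Set E) : Prop :=
  ∀ ω ω' : E → Bool, (∀ e ∈ A, ω e = ω' e) → ω ∈ F → ω' ∈ F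

lemma DepOn.iff (h : DepOn F A)
    (hω : ∀ e ∈ A, ω e = ω' e) : ω ∈ F ↔ ω' ∈ F :=
  ⟨h _ _ hω, h _ _ fun e he => (hω e he).symm⟩

lemma DepOn.mono (h : DepOn F A) (hAB : A ⊆ B) : DepOn F B :=
  fun ω ω' hω => h ω ω' fun e he => hω e (hAB he)

lemma DepOn.compl (h : DepOn F A) : DepOn Fᶜ A :=
  fun ω ω' hω hF hF' => hF (h ω' ω (fun e he => (hω e he).symm) hF')

lemma DepOn.inter (h : DepOn F A) (h' : DepOn G A) : DepOn (F ∩ G) A :=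
  fun ω ω' hω hF => ⟨h ω ω' hω hF.1, h' ω ω' hω hF.2⟩

lemma DepOn.iInter {F : ι → Set (E → Bool)} (h : ∀ i, DepOn (F i) A) :
    DepOn (⋂ i, F i) A := fun ω ω' hω hF => mem_iInter.2 fun i => h i ω ω' hω (mem_iInter.1 hF i)

lemma DepOn.iUnion {F : ι → Set (E → Bool)} (h : ∀ i, DepOn (F i) A) :
    DepOn (⋃ i, F i) A := fun ω ω' hω hF => by
  aesop

lemma mu_inter_of_depOn (p) (hF : MeasurableSet F) (hG : MeasurableSet G)
    (hFA : DepOn F A) (hGB : DepOn G B) (hAB : Disjoint A B) : mu p (F ∩ G) = mu p F * mu p G := by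
  rw [mu_eq_mix p A (hF.inter hG), ← Measure.prod_prod]
  congr 1
  ext x
  refine and_congr (hFA.iff fun e he => mix_mem he) (hGB.iff fun e he => mix_not_mem ?_)
  grind

open Classical in
/-- Set the coordinate `e` to `b`. -/
def setAt (e : E) (b : Bool) (ω : E → Bool) : E → Bool := Function.update ω e b

@[simp] lemma setAt_self (e : E) (b : Bool) (ω : E → Bool) : setAt e b ω e = b := by simp [setAt]
lemma setAt_ne (h : e' ≠ e) (b) (ω) : setAt e b ω e' = ω e' := by simp [setAt, h]

lemma measurable_setAt (e) (b) : Measurable (setAt e b : (E → Bool) → E → Bool) := by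
  refine measurable_pi_iff.2 fun e' => ?_
  by_cases h : e' = e
  · simp_all
  · simp [setAt_ne h]; exact measurable_pi_apply e'

lemma mu_eq_resample (p) (e) (hF : MeasurableSet F) :
    mu p F = wt p true * mu p (setAt e true ⁻¹' F) + wt p false * mu p (setAt e false ⁻¹' F) := by
  have key : ∀ b, mu p ({ω | ω e = b} ∩ F) = wt p b * mu p (setAt e b ⁻¹' F) := by
    intro b
    have : {ω | ω e = b} ∩ F = {ω | ω e = b} ∩ setAt e b ⁻¹' F := by
      ext ω; simp only [mem_inter_iff, mem_preimage]; refine and_congr_right fun h => ?_; have : setAt e b ω = ω := by rw [← h]; simp [setAt]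
      rw [this]
    rw [this, mu_inter_of_depOn p (A := {e}) (B := {e}ᶜ) (meas_coord _ _) (measurable_setAt e b hF), mu_coord]
    · intro ω ω' h; simp [h e rfl]
    · intro ω ω' h hω
      have : setAt e b ω' = setAt e b ω := by
        ext e'; by_cases he : e' = e
        · simp_all
        · rw [setAt_ne he, setAt_ne he, h e' he]
      simp_all
    · simp
  rw [← key, ← key, ← measure_union _ ((meas_coord _ _).inter hF)]
  · congr 1; ext ω; cases h : ω e <;> simp [h]
  · grind

/-- Union of two configurations. -/
def orc (ω ξ : E → Bool) : E → Bool := fun e => ω e || ξ e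

lemma measurable_orc : Measurable fun x : Pr E => orc x.1 x.2 := by
  refine measurable_pi_iff.2 fun e => ?_
  have h1 : Measurable fun x : Pr E => (x.1 e, x.2 e) :=
    ((measurable_pi_apply e).comp measurable_fst).prodMk ((measurable_pi_apply e).comp measurable_snd)
  exact (measurable_of_countable (fun y => y.1 || y.2)).comp h1

/-- Density of the union of independent configurations. -/
def uni (p s : ℝ) : ℝ := 1 - (1 - p) * (1 - s)

lemma map_orc (hp : p ∈ 𝕀) (hs : s ∈ 𝕀) :
    ((mu p).prod (mu s)).map (fun x : Pr E => orc x.1 x.2) = mu (uni p s) := by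
  have : IsProbabilityMeasure (((mu p).prod (mu s)).map (fun x : Pr E => orc x.1 x.2)) :=
    Measure.isProbabilityMeasure_map measurable_orc.aemeasurable
  refine eq_mu_of_cyl _ false _ fun t => ?_
  rw [Measure.map_apply measurable_orc (meas_cyl _ _)]
  have : (fun x => orc x.1 x.2) ⁻¹' (cyl t fun _ => false) =
      (cyl t fun _ => false) ×ˢ (cyl t fun _ => false) := by
    ext x; simp [cyl, orc, Bool.or_eq_false_iff]; grind
  rw [this, Measure.prod_prod, mu_cyl, mu_cyl]
  simp [← mul_pow]
  have h1 : uni p s ∈ 𝕀 := by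
    have := hp.1; have := hp.2; have := hs.1; have := hs.2
    unfold uni; constructor <;> nlinarith [mul_nonneg (sub_nonneg.2 hp.2) (sub_nonneg.2 hs.2), mul_le_one₀ (by linarith) (sub_nonneg.2 hs.2) (by linarith)]
  simp [wt, clamp_of_mem hp, clamp_of_mem hs, clamp_of_mem h1]
  rw [← ofReal_mul (sub_nonneg.2 hp.2)]
  congr 1; unfold uni; ring

lemma mu_uni (hp : p ∈ 𝕀) (hs : s ∈ 𝕀) (hF : MeasurableSet F) :
    mu (uni p s) F = ((mu p).prod (mu s)) {x | orc x.1 x.2 ∈ F} := by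
  rw [← map_orc hp hs, Measure.map_apply measurable_orc hF]; rfl

/-- Increasing events. -/
def Incr (F : Set (E → Bool)) : Prop := ∀ ω ω' : E → Bool, (∀ e, ω e = true → ω' e = true) → ω ∈ F → ω' ∈ F

lemma uni_mem (hp : p ∈ 𝕀) (hs : s ∈ 𝕀) : uni p s ∈ 𝕀 := by
  have := mul_nonneg (sub_nonneg.2 hp.2) (sub_nonneg.2 hs.2)
  have := mul_le_one₀ (by linarith [hp.1] : 1 - p ≤ 1) (sub_nonneg.2 hs.2) (by simp_all)
  unfold uni; constructor <;> linarith

lemma exists_uni (hpq : p ≤ q) (hq : q ≤ 1) :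
    ∃ s ∈ 𝕀, uni p s = q ∧ s * (1 - p) = q - p := by
  rcases eq_or_lt_of_le hpq with h | h
  · exact ⟨0, by simp, by simp [uni, h], by simp [h]⟩
  · have h1 : 0 < 1 - p := by linarith
    refine ⟨(q - p) / (1 - p), ⟨by apply div_nonneg <;> linarith, by rw [div_le_one h1]; linarith⟩, ?_, ?_⟩
    · unfold uni; field_simp; ring
    · field_simp

lemma mu_mono (hp : 0 ≤ p) (hpq : p ≤ q) (hq : q ≤ 1) (hF : MeasurableSet F)
    (hI : Incr F) : mu p F ≤ mu q F := by
  obtain ⟨s, hs, rfl, -⟩ := exists_uni hpq hq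
  rw [mu_uni ⟨hp, hpq.trans hq⟩ hs hF]
  calc mu p F = ((mu p).prod (mu s)) (F ×ˢ univ) := by simp
    _ ≤ _ := measure_mono fun x hx => hI _ _ (fun e he => by simp [orc, he]) hx.1

lemma wt_true (hp : p ∈ 𝕀) : wt p true = ofReal p := by simp [wt, clamp_of_mem hp]
lemma wt_false (hp : p ∈ 𝕀) : wt p false = ofReal (1 - p) := by simp [wt, clamp_of_mem hp]

lemma mu_uni_le (hp : p ∈ 𝕀) (hs : s ∈ 𝕀) {F : Set (E → Bool)} (hF : MeasurableSet F)
    (A : Finset E) (hA : DepOn F A) : mu (uni p s) F ≤ mu p F + A.card * ofReal s := by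
  rw [mu_uni hp hs hF]
  calc _ ≤ ((mu p).prod (mu s)) (F ×ˢ univ ∪ univ ×ˢ ⋃ e ∈ A, {ξ | ξ e = true}) := by
        refine measure_mono fun x hx => ?_; by_cases h : ∃ e ∈ A, x.2 e = true
        · simp_all
        · left; push Not at h; refine ⟨hA _ _ (fun e he => ?_) hx, trivial⟩; have := h e he; simp [orc, Bool.eq_false_iff.2 this]
    _ ≤ mu p F + mu s (⋃ e ∈ A, {ξ | ξ e = true}) := by
        refine (measure_union_le _ _).trans ?_; simp
    _ ≤ _ := by
        gcongr; refine (measure_biUnion_finset_le _ _).trans ?_; simp [mu_coord, wt_true hs]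

lemma IsBernoulli_eq (hp : p ∈ 𝕀) {ν : Measure (Config d)} (h : IsBernoulli d p ν) :
    ν = mu p := by
  have := h.1
  refine eq_mu_of_cyl p true ν fun t => ?_
  rw [cyl, h.2 t fun _ => true]
  simp [bernoulliCyl, wt_true hp]

lemma measurable_level (p) : Measurable (level p : (Edge d → ℝ) → Config d) := by
  refine measurable_pi_iff.2 fun e => ?_
  refine measurable_to_bool ?_
  rw [(show (fun u => level p u e) ⁻¹' {true} = {u | u e ≤ p} by ext; simp [level])]
  exact measurableSet_le (measurable_pi_apply e) measurable_const

lemma map_level_eq (hp : p ∈ 𝕀) (hε : ε ∈ 𝕀)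
    {Q : Measure ((Edge d → ℝ) × Config d)} (h : IsUniformWithBernoulli d ε Q) :
    Q.map (fun x => (level p x.1, x.2)) = (mu p).prod (mu ε) := by
  have hm : Measurable fun x : (Edge d → ℝ) × Config d => (level p x.1, x.2) :=
    ((measurable_level p).comp measurable_fst).prodMk measurable_snd
  refine (eq_mu_prod p ε true true _ fun t s => ?_).symm
  rw [Measure.map_apply hm ((meas_cyl _ _).prod (meas_cyl _ _))]
  have := h.2 t s (fun _ => p) (fun _ => true)
  have e : (fun x : (Edge d → ℝ) × Config d => (level p x.1, x.2)) ⁻¹' ((cyl t fun _ => true) ×ˢ (cyl s fun _ => true)) =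
      {x | (∀ e ∈ t, x.1 e ≤ p) ∧ ∀ e ∈ s, x.2 e = true} := by
    ext x; simp [cyl, level]
  rw [e, this]
  simp [bernoulliCyl, wt_true hp, wt_true hε, max_eq_left hp.1, min_eq_left hp.2]

end Product
end

noncomputable section

section Witness
variable {E : Type*}

open Classical in
/-- The configuration whose open edges are exactly those of `I`. -/
def ind (I : Finset E) : E → Bool := fun e => decide (e ∈ I)

lemma ind_eq_true : ind I e = true ↔ e ∈ I := by simp [ind]

/-- Configurations having a finite set of open edges which by itself realizes `F`. -/
def finW (F : Set (E → Bool)) : Set (E → Bool) := {ω | ∃ I : Finset E, (∀ e ∈ I, ω e = true) ∧ ind I ∈ F}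

lemma finW_subset (hF : Incr F) : finW F ⊆ F := by
  rintro ω ⟨I, hI, hF'⟩
  exact hF _ _ (fun e he => hI e (ind_eq_true.1 he)) hF'

lemma meas_finW [Countable E] (F : Set (E → Bool)) : MeasurableSet (finW F) := by
  have : finW F = ⋃ I ∈ {I | ind I ∈ F}, cyl I fun _ => true := by
    ext ω; simp [finW, cyl, exists_prop]; grind
  rw [this]
  exact MeasurableSet.biUnion (to_countable _) fun I _ => meas_cyl _ _

/-- Disjoint occurrence (through finite witnesses). -/
def sq (F G : Set (E → Bool)) : Set (E → Bool) :=
  {ω | ∃ I J : Finset E, Disjoint I J ∧ (∀ e ∈ I, ω e = true) ∧ (∀ e ∈ J, ω e = true) ∧ ind I ∈ F ∧ ind J ∈ G}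

lemma incr_sq (F G : Set (E → Bool)) : Incr (sq F G) := by
  rintro ω ω' h ⟨I, J, h1, h2, h3, h4⟩
  exact ⟨I, J, h1, fun e he => h e (h2 e he), fun e he => h e (h3 e he), h4⟩

/-- Intermediate events of the Bernoulli-splitting proof of the BK inequality. -/
def bkAux (F G : Set (E → Bool)) (B K : Finset E) : Set (Pr E) :=
  {x | ∃ I J : Finset E, I ⊆ B ∧ J ⊆ B ∧ (∀ e, e ∉ K → e ∈ I → e ∉ J) ∧ (∀ e ∈ I, x.1 e = true) ∧
    (∀ e ∈ J, (e ∈ K → x.2 e = true) ∧ (e ∉ K → x.1 e = true)) ∧ ind I ∈ F ∧ ind J ∈ G}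

lemma meas_bkAux (F G) (B K : Finset E) :
    MeasurableSet (bkAux F G B K) := by
  classical
  have : bkAux F G B K = ⋃ I ∈ B.powerset, ⋃ J ∈ B.powerset, ⋃ (_ : (∀ e, e ∉ K → e ∈ I → e ∉ J) ∧ ind I ∈ F ∧ ind J ∈ G),
      ({x | (∀ e ∈ I ∪ J.filter (· ∉ K), x.1 e = true)} ∩ {x | ∀ e ∈ J.filter (· ∈ K), x.2 e = true}) := by
    ext x; simp only [bkAux, mem_ofPred_eq, mem_iUnion, mem_inter_iff, exists_prop]; grind
  rw [this]
  exact measurableSet_biUnion _ fun I _ => measurableSet_biUnion _ fun J _ => MeasurableSet.iUnion fun _ => (measurable_fst (meas_cyl (I ∪ J.filter (· ∉ K)) fun _ => true)).inter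
    (measurable_snd (meas_cyl (J.filter (· ∈ K)) fun _ => true))

lemma prod_resample_fst (p) (e) {F : Set (Pr E)} (hF : MeasurableSet F) :
    ((mu p).prod (mu p)) F = wt p true * ((mu p).prod (mu p)) {x | (setAt e true x.1, x.2) ∈ F} +
      wt p false * ((mu p).prod (mu p)) {x | (setAt e false x.1, x.2) ∈ F} := by
  have hm : ∀ b, MeasurableSet {x : Pr E | (setAt e b x.1, x.2) ∈ F} := fun b =>
    (((measurable_setAt e b).comp measurable_fst).prodMk measurable_snd) hF
  rw [Measure.prod_apply_symm hF, Measure.prod_apply_symm (hm true), Measure.prod_apply_symm (hm false),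
    ← lintegral_const_mul _ (measurable_measure_prodMk_right (hm true)),
    ← lintegral_const_mul _ (measurable_measure_prodMk_right (hm false)),
    ← lintegral_add_left ((measurable_measure_prodMk_right (hm true)).const_mul _)]
  exact lintegral_congr fun y => mu_eq_resample p e (measurable_prodMk_right hF)

lemma prod_resample_snd (p) (e) {F : Set (Pr E)} (hF : MeasurableSet F) :
    ((mu p).prod (mu p)) F = wt p true * ((mu p).prod (mu p)) {x | (x.1, setAt e true x.2) ∈ F} +
      wt p false * ((mu p).prod (mu p)) {x | (x.1, setAt e false x.2) ∈ F} := by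
  have hm : ∀ b, MeasurableSet {x : Pr E | (x.1, setAt e b x.2) ∈ F} := fun b =>
    (measurable_fst.prodMk ((measurable_setAt e b).comp measurable_snd)) hF
  rw [Measure.prod_apply hF, Measure.prod_apply (hm true), Measure.prod_apply (hm false),
    ← lintegral_const_mul _ (measurable_measure_prodMk_left (hm true)),
    ← lintegral_const_mul _ (measurable_measure_prodMk_left (hm false)),
    ← lintegral_add_left ((measurable_measure_prodMk_left (hm true)).const_mul _)]
  exact lintegral_congr fun y => mu_eq_resample p e (measurable_prodMk_left hF)

lemma bkAux_step (p) (F G) (B K) (e : E) (he : e ∉ K) [DecidableEq E] :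
    ((mu p).prod (mu p)) (bkAux F G B K) ≤ ((mu p).prod (mu p)) (bkAux F G B (insert e K)) := by
  set M := (mu p : Measure (E → Bool)).prod (mu p)
  have hm2 := meas_bkAux F G B (insert e K)
  set f : Bool → Set (Pr E) := fun a => {x | (setAt e a x.1, x.2) ∈ bkAux F G B K}
  set g : Bool → Bool → Set (Pr E) :=
    fun a b => {x | (setAt e a x.1, setAt e b x.2) ∈ bkAux F G B (insert e K)}
  have hmg : ∀ b, MeasurableSet {x : Pr E | (setAt e b x.1, x.2) ∈ bkAux F G B (insert e K)} := fun b =>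
    (((measurable_setAt e b).comp measurable_fst).prodMk measurable_snd) hm2
  have hg : M (bkAux F G B (insert e K)) = wt p true * (wt p true * M (g true true) + wt p false * M (g true false)) +
      wt p false * (wt p true * M (g false true) + wt p false * M (g false false)) := by
    rw [prod_resample_fst p e hm2, prod_resample_snd p e (hmg true), prod_resample_snd p e (hmg false)]; rfl
  have hset : ∀ a ω e', e' ≠ e → setAt e a ω e' = ω e' := fun a ω e' h => setAt_ne h a ω
  have f0g : ∀ a b, f false ⊆ g a b := by
    rintro a b x ⟨I, J, a1, a2, a3, a4, a5, a6⟩; have hI : e ∉ I := fun h => by simpa using a4 e h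
    have hJ : e ∉ J := fun h => by simpa using (a5 e h).2 he
    refine ⟨I, J, a1, a2, fun e' h1 h2 => a3 e' (fun h => h1 (Finset.mem_insert_of_mem h)) h2, ?_, ?_, a6⟩
    · intro e' h'; have hne : e' ≠ e := fun h => hI (h ▸ h'); have := a4 e' h'; simpa [hset _ _ _ hne] using this
    · intro e' h'; have hne : e' ≠ e := fun h => hJ (h ▸ h'); have := a5 e' h'; simpa [hset _ _ _ hne, hne] using this
  have f1g : f true ⊆ g true false ∪ g false true := by
    rintro x ⟨I, J, a1, a2, a3, a4, a5, a6⟩; by_cases hJ : e ∈ J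
    · right; refine ⟨I, J, a1, a2, fun e' h1 h2 => a3 e' (fun h => h1 (Finset.mem_insert_of_mem h)) h2, ?_, ?_, a6⟩
      · intro e' h'; have hne : e' ≠ e := fun h => (fun h => a3 e he h hJ) (h ▸ h'); simpa [hset _ _ _ hne] using a4 e' h'
      · intro e' h'; by_cases hne : e' = e
        · subst hne; simp
        · simpa [hset _ _ _ hne, hne] using a5 e' h'
    · left; refine ⟨I, J, a1, a2, fun e' h1 h2 => a3 e' (fun h => h1 (Finset.mem_insert_of_mem h)) h2, ?_, ?_, a6⟩
      · intro e' h'; simpa using a4 e' h'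
      · intro e' h'; have hne : e' ≠ e := fun h => hJ (h ▸ h'); simpa [hset _ _ _ hne, hne] using a5 e' h'
  have f1g11 : f true ⊆ g true true := by
    refine f1g.trans (union_subset ?_ ?_)
    · rintro x ⟨I, J, a1, a2, a3, a4, a5, a6⟩; refine ⟨I, J, a1, a2, a3, a4, fun e' h' => ?_, a6⟩; have := a5 e' h'; by_cases hne : e' = e
      · subst hne; simp
      · simpa [hset _ _ _ hne, hne] using this
    · rintro x ⟨I, J, a1, a2, a3, a4, a5, a6⟩; refine ⟨I, J, a1, a2, a3, fun e' h' => ?_, fun e' h' => ?_, a6⟩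
      · by_cases hne : e' = e
        · subst hne; simp
        · simpa [hset _ _ _ hne] using a4 e' h'
      · have := a5 e' h'; by_cases hne : e' = e
        · subst hne; simp
        · simpa [hset _ _ _ hne, hne] using this
  have hm3 : MeasurableSet (g false true) :=
    (((measurable_setAt e false).comp measurable_fst).prodMk ((measurable_setAt e true).comp measurable_snd)) hm2
  have h10 : M (f true) + M (f false) ≤ M (g true false) + M (g false true) := by
    rw [← measure_union_add_inter _ hm3]; exact add_le_add (measure_mono f1g) (measure_mono (subset_inter (f0g _ _) (f0g _ _)))
  rw [prod_resample_fst p e (meas_bkAux F G B K), hg]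
  set a := wt p true; set b := wt p false
  calc a * M (f true) + b * M (f false)
      = (a + b) * (a * M (f true) + b * M (f false)) := by rw [wt_add p, one_mul]
    _ = a * (a * M (f true)) + a * b * (M (f true) + M (f false)) + b * (b * M (f false)) := by ring
    _ ≤ a * (a * M (g true true)) + a * b * (M (g true false) + M (g false true)) + b * (b * M (g false false)) := by
        gcongr; exact f0g _ _
    _ = _ := by ring

lemma bk [Countable E] (p) {F G : Set (E → Bool)} (hF : Incr F) (hG : Incr G) :
    mu p (sq F G) ≤ mu p F * mu p G := by
  classical
  set M := (mu p : Measure (E → Bool)).prod (mu p)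
  have key : ∀ B, mu p {ω | (ω, ω) ∈ bkAux F G B ∅} ≤ mu p F * mu p G := by
    intro B
    have h1 : mu p {ω | (ω, ω) ∈ bkAux F G B ∅} = M (bkAux F G B ∅) := by
      conv_rhs => rw [(show bkAux F G B ∅ = {ω | (ω, ω) ∈ bkAux F G B ∅} ×ˢ univ by ext x; simp [bkAux]), Measure.prod_prod]
      simp
    have h2 : ∀ K, M (bkAux F G B ∅) ≤ M (bkAux F G B K) := by
      intro K; induction K using Finset.induction_on with
      | empty => exact le_rfl
      | insert e K he ih => exact ih.trans (bkAux_step p F G B K e he)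
    rw [h1]; refine (h2 B).trans ?_; rw [← Measure.prod_prod]; refine measure_mono ?_; rintro x ⟨I, J, a1, a2, a3, a4, a5, a6, a7⟩
    exact ⟨hF _ _ (fun e he => a4 e (ind_eq_true.1 he)) a6,
      hG _ _ (fun e he => (a5 e (ind_eq_true.1 he)).1 (a2 (ind_eq_true.1 he))) a7⟩
  have hU : sq F G = ⋃ B, {ω | (ω, ω) ∈ bkAux F G B ∅} := by
    ext ω; simp only [mem_iUnion]; constructor
    · rintro ⟨I, J, h1, h2, h3, h4, h5⟩
      exact ⟨I ∪ J, I, J, Finset.subset_union_left, Finset.subset_union_right,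
        fun e _ hI hJ => (Finset.disjoint_left.1 h1) hI hJ, h2, fun e he => by simpa using h3 e he, h4, h5⟩
    · rintro ⟨B, I, J, h1, h2, h3, h4, h5, h6⟩
      exact ⟨I, J, Finset.disjoint_left.2 fun e => h3 e (by simp), h4, fun e he => by simpa using h5 e he, h6⟩
  rw [hU, Directed.measure_iUnion]
  · exact iSup_le key
  · refine directed_of_isDirected_le fun B B' h => ?_; rintro ω ⟨I, J, h1, h2, h3⟩; exact ⟨I, J, h1.trans h, h2.trans h, h3⟩

end Witness
end

noncomputable section

variable {d : ℕ}

lemma adjacent_symm (h : Adjacent x y) : Adjacent y x := by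
  unfold Adjacent at *; simpa only [abs_sub_comm] using h

lemma not_adjacent_self (x : V d) : ¬ Adjacent x x := by simp [Adjacent]

lemma isEdge_iff : IsEdge s(x, y) ↔ Adjacent x y := by
  constructor
  · rintro ⟨a, b, h, he⟩; rcases Sym2.eq_iff.1 he with ⟨rfl, rfl⟩ | ⟨rfl, rfl⟩; exacts [h, adjacent_symm h]
  · exact fun h => ⟨x, y, h, rfl⟩

/-- The edge between two adjacent vertices. -/
def mkE {x y : V d} (h : Adjacent x y) : Edge d := ⟨s(x, y), isEdge_iff.2 h⟩

lemma openAdj_iff : OpenAdj ω x y ↔ ∃ h : Adjacent x y, ω (mkE h) = true :=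
  ⟨fun ⟨h, h'⟩ => ⟨isEdge_iff.1 h, h'⟩, fun ⟨h, h'⟩ => ⟨isEdge_iff.2 h, h'⟩⟩

lemma mkE_symm (h : Adjacent x y) : mkE h = mkE (adjacent_symm h) := Subtype.ext Sym2.eq_swap

lemma OpenAdj.symm (h : OpenAdj ω x y) : OpenAdj ω y x := by
  obtain ⟨h, h'⟩ := openAdj_iff.1 h
  exact openAdj_iff.2 ⟨adjacent_symm h, by rwa [← mkE_symm]⟩

lemma OpenAdj.mono (hω : ∀ e, ω e = true → ω' e = true) (h : OpenAdj ω x y) :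
    OpenAdj ω' x y := h.imp fun _ h' => hω _ h'

instance : Countable (Edge d) := by
  have : Countable (Sym2 (V d)) := by unfold Sym2; infer_instance
  infer_instance

/-- The open subgraph of `ω` induced on `S`. -/
def og (ω : Config d) (S : Set (V d)) : SimpleGraph (V d) where
  Adj a b := a ∈ S ∧ b ∈ S ∧ OpenAdj ω a b
  symm := ⟨fun _ _ h => ⟨h.2.1, h.1, h.2.2.symm⟩⟩
  loopless := ⟨fun a h => not_adjacent_self a (openAdj_iff.1 h.2.2).1⟩

/-- `x` and `y` are joined by an open path of `ω` inside `S`. -/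
def Cn (S : Set (V d)) (ω : Config d) (x y : V d) : Prop := x ∈ S ∧ (og ω S).Reachable x y

/-- The event that `x` and `y` are connected inside `S`. -/
def cn (S : Set (V d)) (x y : V d) : Set (Config d) := {ω | Cn S ω x y}

/-- The cluster of `x` in `S`. -/
def cl (S : Set (V d)) (ω : Config d) (x : V d) : Set (V d) := {y | Cn S ω x y}

/-- The two-point function of percolation restricted to `S`. -/
def tau (p : ℝ) (S : Set (V d)) (x y : V d) : ENNReal := mu p (cn S x y)

variable {S R : Set (V d)} {ω ω' : Config d} {x y z v w : V d}

lemma Cn.refl (h : x ∈ S) : Cn S ω x x := ⟨h, .refl x⟩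

lemma Cn.trans (h : Cn S ω x y) (h' : Cn S ω y z) : Cn S ω x z := ⟨h.1, h.2.trans h'.2⟩

lemma Cn.step (hx : x ∈ S) (hy : y ∈ S) (h : OpenAdj ω x y) : Cn S ω x y :=
  ⟨hx, SimpleGraph.Adj.reachable ⟨hx, hy, h⟩⟩

lemma Cn.left (h : Cn S ω x y) : x ∈ S := h.1

lemma Cn.induct {P : V d → Prop} (h0 : P x)
    (h1 : ∀ a b, Cn S ω x a → P a → a ∈ S → b ∈ S → OpenAdj ω a b → P b) (h : Cn S ω x y) : P y := by
  have := (SimpleGraph.reachable_iff_reflTransGen x y).1 h.2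
  have h2 : Cn S ω x y ∧ P y := by
    induction this with
    | refl => exact ⟨Cn.refl h.1, h0⟩
    | tail _ hbc ih =>
      have := ih ⟨h.1, (SimpleGraph.reachable_iff_reflTransGen _ _).2 (by omega)⟩
      exact ⟨this.1.trans (Cn.step hbc.1 hbc.2.1 hbc.2.2), h1 _ _ this.1 this.2 hbc.1 hbc.2.1 hbc.2.2⟩
  exact h2.2

lemma Cn.right (h : Cn S ω x y) : y ∈ S := h.induct h.1 fun _ _ _ _ _ h _ => h

lemma Cn.symm (h : Cn S ω x y) : Cn S ω y x := ⟨h.right, h.2.symm⟩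

lemma Cn.mono (hS : S ⊆ R) (hω : ∀ e, ω e = true → ω' e = true) (h : Cn S ω x y) : Cn R ω' x y := by
  exact h.induct (Cn.refl (hS h.1)) fun a b _ ha haS hb hab => ha.trans (Cn.step (hS haS) (hS hb) (hab.mono hω))

lemma Cn.mono_set (hS : S ⊆ R) (h : Cn S ω x y) : Cn R ω x y := h.mono hS fun _ h => h

lemma Cn.congr_edges (hω : ∀ a b, ∀ h : Adjacent a b, a ∈ S → b ∈ S → ω (mkE h) = ω' (mkE h)) (h : Cn S ω x y) : Cn S ω' x y := by
  refine h.induct (Cn.refl h.1) fun a b _ ha haS hb hab => ha.trans (Cn.step haS hb ?_)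
  obtain ⟨h1, h2⟩ := openAdj_iff.1 hab
  exact openAdj_iff.2 ⟨h1, by rw [← hω a b h1 haS hb]; exact h2⟩

lemma cn_univ_iff : Cn univ ω x y ↔ Connected ω x y := by
  unfold Cn Connected
  rw [SimpleGraph.reachable_iff_reflTransGen]
  simp [og]

/-- Edges with both endpoints in `S`. -/
def edgesIn (S : Set (V d)) : Set (Edge d) := {e | ∀ x ∈ e.val, x ∈ S}
/-- Edges with at least one endpoint in `S`. -/
def edgesAt (S : Set (V d)) : Set (Edge d) := {e | ∃ x ∈ e.val, x ∈ S}

lemma mkE_mem_edgesIn (h : Adjacent x y) : mkE h ∈ edgesIn S ↔ x ∈ S ∧ y ∈ S := by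
  simp [mkE, edgesIn]
lemma mkE_mem_edgesAt (h : Adjacent x y) : mkE h ∈ edgesAt S ↔ x ∈ S ∨ y ∈ S := by
  simp [mkE, edgesAt]

lemma depOn_cn (S) (x y : V d) : DepOn (cn S x y) (edgesIn S) := fun _ _ hω h =>
  h.congr_edges fun _ _ h ha hb => hω _ ((mkE_mem_edgesIn h).2 ⟨ha, hb⟩)

lemma incr_cn (S) (x y : V d) : Incr (cn S x y) := fun _ _ hω h => Cn.mono Subset.rfl hω h

open Classical in
/-- The edges of a walk as a finite set of lattice edges. -/
def wE {G : SimpleGraph (V d)} {x y : V d} (W : G.Walk x y) : Finset (Edge d) :=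
  W.edges.toFinset.subtype IsEdge

lemma mem_wE {G : SimpleGraph (V d)} (W : G.Walk x y) : e ∈ wE W ↔ e.val ∈ W.edges := by
  simp [wE]

lemma open_of_mem_wE (W : (og ω S).Walk x y) (he : e ∈ wE W) : ω e = true := by
  obtain ⟨e, he'⟩ := e
  induction e with | _ a b =>
  exact (SimpleGraph.Walk.edges_subset_edgeSet W (mem_wE W |>.1 he)).2.2.2

lemma ind_wE_mem (W : (og ω S).Walk x y) (hx : x ∈ S) : ind (wE W) ∈ cn S x y := by
  refine ⟨hx, ?_⟩
  induction W with
  | nil => exact .refl _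
  | cons h W ih =>
    have h1 : (og (ind (wE (SimpleGraph.Walk.cons h W))) S).Adj _ _ :=
      ⟨h.1, h.2.1, h.2.2.choose, ind_eq_true.2 ((mem_wE _).2 (by simp))⟩
    refine h1.reachable.trans ?_; refine (Cn.mono (ω' := ind (wE (SimpleGraph.Walk.cons h W))) Subset.rfl (fun e he => ?_) ⟨h.2.1, ih h.2.1⟩).2
    rw [ind_eq_true, mem_wE] at he ⊢; simp [he]

lemma finW_cn (S) (x y : V d) : finW (cn S x y) = cn S x y := by
  refine (finW_subset (incr_cn S x y)).antisymm fun ω h => ?_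
  obtain ⟨W⟩ := h.2
  exact ⟨wE W, fun e he => open_of_mem_wE W he, ind_wE_mem W h.1⟩

lemma meas_cn (S) (x y : V d) : MeasurableSet (cn S x y) := by
  rw [← finW_cn]; exact meas_finW _

lemma meas_cl_eq (S) (v : V d) (D) : MeasurableSet {ω | cl S ω v = D} := by
  have : {ω | cl S ω v = D} = ⋂ y, {ω | ω ∈ cn S v y ↔ y ∈ D} := by
    ext ω; simp [Set.ext_iff]; rfl
  rw [this]
  refine MeasurableSet.iInter fun y => ?_
  by_cases h : y ∈ D
  · simpa [h] using meas_cn S v y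
  · have : {ω | ω ∈ cn S v y ↔ y ∈ D} = (cn S v y)ᶜ := by aesop
    rw [this]; exact (meas_cn S v y).compl

lemma cl_eq_of_agree (hω : ∀ a b, ∀ h : Adjacent a b, a ∈ D → a ∈ S → b ∈ S → ω (mkE h) = ω' (mkE h))
    (h : cl S ω v = D) : cl S ω' v = D := by
  subst h
  ext y
  constructor
  · intro hy; refine Cn.induct (Cn.refl hy.1) (fun a b _ ha haS hb hab => ?_) hy; obtain ⟨h1, h2⟩ := openAdj_iff.1 hab
    refine Cn.trans ha (Cn.step haS hb (openAdj_iff.2 ⟨h1, ?_⟩)); simp_all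
  · intro hy; refine Cn.induct (Cn.refl hy.1) (fun a b ha ha' haS hb hab => ?_) hy; obtain ⟨h1, h2⟩ := openAdj_iff.1 hab
    refine Cn.trans ha' (Cn.step haS hb (openAdj_iff.2 ⟨h1, ?_⟩)); rw [← hω a b h1 ha haS hb]; exact h2

lemma depOn_cl_eq (S) (v : V d) (D) : DepOn {ω | cl S ω v = D} (edgesAt D ∩ edgesIn S) := fun _ _ hω h =>
  cl_eq_of_agree (fun _ _ h' ha haS hb => hω _ ⟨(mkE_mem_edgesAt h').2 (.inl ha), (mkE_mem_edgesIn h').2 ⟨haS, hb⟩⟩) h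

lemma Cn.diff_cl (h : Cn S ω z x) (hz : z ∉ cl S ω v) : Cn (S \ cl S ω v) ω z x := by
  refine (Cn.induct (Cn.refl ⟨h.1, hz⟩) (fun a b _ ha haS hb hab => ?_) h)
  refine ha.trans (Cn.step ha.right ⟨hb, fun hb' => ha.right.2 ?_⟩ hab)
  exact Cn.trans hb' (Cn.step hb haS hab.symm)

lemma disjoint_edgesAt_edgesIn_diff (D) : Disjoint (edgesAt D) (edgesIn (R \ D)) := by
  rw [disjoint_left]
  rintro e ⟨a, ha, haD⟩ h
  exact (h a ha).2 haD

/-! ### Two-point function basics -/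

lemma tau_le_one (p) : tau p S x y ≤ 1 := prob_le_one
lemma tau_ne_top (p) : tau p S x y ≠ ⊤ := measure_ne_top _ _

lemma tau_symm (p) : tau p S x y = tau p S y x := by
  unfold tau; congr 1; ext ω; exact ⟨Cn.symm, Cn.symm⟩

lemma tau_mono_set (p) (h : S ⊆ R) : tau p S x y ≤ tau p R x y := measure_mono fun _ hω => Cn.mono_set h hω

lemma tau_self (p) (h : x ∈ S) : tau p S x x = 1 := by
  rw [tau, (show cn S x x = univ from eq_univ_of_forall fun ω => Cn.refl h)]; simp

lemma tau_eq_zero_left (p) (h : x ∉ S) : tau p S x y = 0 := by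
  rw [tau, (show cn S x y = ∅ from eq_empty_of_forall_notMem fun ω hω => h (Cn.left hω))]; simp

lemma tau_eq_zero_right (p) (h : y ∉ S) : tau p S x y = 0 := by rw [tau_symm, tau_eq_zero_left p h]

lemma exists_walk_first {G : SimpleGraph (V d)} (T : Set (V d)) (Q : G.Walk w v) (hv : v ∈ T) :
    ∃ u ∈ T, ∃ Q' : G.Walk w u, ∀ e ∈ Q'.edges, ∃ a ∈ e, a ∉ T := by
  induction Q with
  | nil => exact ⟨_, hv, .nil, by simp⟩
  | @cons a b c h Q ih =>
    by_cases ha : a ∈ T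
    · exact ⟨a, ha, .nil, by simp⟩
    · obtain ⟨u, hu, Q', hQ'⟩ := ih hv; refine ⟨u, hu, .cons h Q', ?_⟩; simp_all

lemma split_subset_sq (W : (og ω S).Walk x y) (hW : W.IsPath) (hx : x ∈ S) (hu : u ∈ W.support) :
    ∃ I J : Finset (Edge d), Disjoint I J ∧ I ∪ J ⊆ wE W ∧ ind I ∈ cn S x u ∧ ind J ∈ cn S u y := by
  have hsplit := congrArg SimpleGraph.Walk.edges (W.take_spec hu)
  rw [SimpleGraph.Walk.edges_append] at hsplit
  have hnd := hW.isTrail.edges_nodup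
  rw [← hsplit, List.nodup_append] at hnd
  refine ⟨wE (W.takeUntil u hu), wE (W.dropUntil u hu), ?_, ?_, ind_wE_mem _ hx, ind_wE_mem _ (Cn.right ⟨hx, (W.takeUntil u hu).reachable⟩)⟩
  · rw [Finset.disjoint_left]; intro e h1 h2; exact hnd.2.2 _ ((mem_wE _).1 h1) _ ((mem_wE _).1 h2) rfl
  · intro e he; rw [Finset.mem_union, mem_wE, mem_wE] at he; rw [mem_wE, ← hsplit, List.mem_append]; exact he

lemma cn_inter_cn_subset : cn S v y ∩ cn R v w ⊆ ⋃ u, sq (sq (cn S v u) (cn S u y)) (cn R u w) := by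
  rintro ω ⟨⟨hv, h1⟩, h2⟩
  obtain ⟨W, hW⟩ := h1.exists_isPath
  obtain ⟨Q⟩ := h2.symm.2
  obtain ⟨u, hu, Q', hQ'⟩ := exists_walk_first {a | a ∈ W.support} Q W.start_mem_support
  obtain ⟨I, J, hIJ, hs, hI, hJ⟩ := split_subset_sq W hW hv hu
  refine mem_iUnion.2 ⟨u, I ∪ J, wE Q', ?_, fun e he => open_of_mem_wE W (hs he), fun e he => open_of_mem_wE Q' he, ?_, ?_⟩
  · rw [Finset.disjoint_left]; intro e he he'; obtain ⟨a, ha, haT⟩ := hQ' _ ((mem_wE _).1 he'); obtain ⟨e, hedge⟩ := e; refine haT ?_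
    induction e with | _ b c =>
    have hbc := (mem_wE W).1 (hs he); rcases Sym2.mem_iff.1 ha with rfl | rfl
    exacts [W.fst_mem_support_of_mem_edges hbc, W.snd_mem_support_of_mem_edges hbc]
  · exact ⟨I, J, hIJ, fun e he => ind_eq_true.2 (Finset.mem_union_left _ he),
      fun e he => ind_eq_true.2 (Finset.mem_union_right _ he), hI, hJ⟩
  · exact Cn.symm (ind_wE_mem Q' h2.right)

lemma mu_cn_inter_cn_le (p) :
    mu p (cn S v y ∩ cn R v w) ≤ ∑' u, tau p S v u * tau p S u y * tau p R u w := by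
  refine (measure_mono cn_inter_cn_subset).trans ((measure_iUnion_le _).trans (tsum_le_tsum fun u => ?_))
  refine (bk p (incr_sq _ _) (incr_cn _ _ _)).trans ?_
  gcongr
  exacts [bk p (incr_cn _ _ _) (incr_cn _ _ _), le_rfl]

open Classical in
lemma tau_le_through (p) (D) :
    tau p R z x ≤ tau p (R \ D) z x + ∑' w, (if w ∈ D then tau p R z w * tau p R w x else 0) := by
  have hs : cn R z x ⊆ cn (R \ D) z x ∪ ⋃ w, (if w ∈ D then sq (cn R z w) (cn R w x) else ∅) := by
    rintro ω ⟨hz, h⟩; obtain ⟨W, hW⟩ := h.exists_isPath; by_cases hD : ∃ u ∈ W.support, u ∈ D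
    · obtain ⟨u, hu, huD⟩ := hD; obtain ⟨I, J, hIJ, hs, hI, hJ⟩ := split_subset_sq W hW hz hu; right; refine mem_iUnion.2 ⟨u, ?_⟩; rw [if_pos huD]
      exact ⟨I, J, hIJ, fun e he => open_of_mem_wE W (hs (Finset.mem_union_left _ he)),
        fun e he => open_of_mem_wE W (hs (Finset.mem_union_right _ he)), hI, hJ⟩
    · left; push Not at hD; clear hW h; induction W with
      | nil => exact Cn.refl ⟨hz, hD _ (by simp)⟩
      | cons h W ih =>
        have := ih h.2.1 (fun u hu => hD u (by simp [hu])); exact Cn.trans (Cn.step ⟨hz, hD _ (by simp)⟩ (Cn.left this) h.2.2) this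
  refine (measure_mono hs).trans ((measure_union_le _ _).trans ?_)
  refine add_le_add le_rfl ((measure_iUnion_le _).trans (tsum_le_tsum fun w => ?_))
  split_ifs
  exacts [bk p (incr_cn _ _ _) (incr_cn _ _ _), by simp]

end

noncomputable section

variable {d : ℕ}
variable {S R : Set (V d)} {ω ω' : Config d} {x y z v w : V d}

lemma meas_cl_finite (S) (v : V d) : MeasurableSet {ω | (cl S ω v).Finite} := by
  have : {ω | (cl S ω v).Finite} = ⋃ D : Finset (V d), {ω | cl S ω v = D} := by
    ext ω; simp [mem_ofPred_eq]; exact ⟨fun h => ⟨h.toFinset, by simp⟩, fun ⟨D, h⟩ => h ▸ D.finite_toSet⟩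
  rw [this]
  exact MeasurableSet.iUnion fun D => meas_cl_eq _ _ _

/-- The cluster of `v` in `S` is almost surely finite. -/
def AF (p : ℝ) (S : Set (V d)) (v : V d) : Prop := mu p {ω | ¬ (cl S ω v).Finite} = 0

lemma AF.of_finite (p) (hS : S.Finite) (v) : AF p S v := by
  have : {ω | ¬ (cl S ω v).Finite} = ∅ :=
    eq_empty_of_forall_notMem fun ω h => h (hS.subset fun y hy => Cn.right hy)
  rw [AF, this]; simp

lemma tsum_mu_cl_inter (h : AF p S v) (hF : MeasurableSet F) :
    ∑' D : Finset (V d), mu p ({ω | cl S ω v = D} ∩ F) = mu p F := by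
  rw [← measure_iUnion]
  · refine measure_congr ?_
    have h' : ∀ᵐ ω ∂(mu p : Measure (Config d)), (cl S ω v).Finite := by
      tauto
    rw [eventuallyEq_set]; filter_upwards [h'] with ω hω; simp only [mem_iUnion]
    exact ⟨fun ⟨_, _, h⟩ => h, fun h => ⟨hω.toFinset, by simp, h⟩⟩
  · intro D D' hne; grind
  · exact fun D => (meas_cl_eq _ _ _).inter hF

open Classical in
/-- The one-step kernel: `p` times the adjacency indicator. -/
def J (p : ℝ) (y z : V d) : ENNReal := if Adjacent y z then wt p true else 0

open Classical in
/-- The exit kernel of `S`. -/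
def Q (p : ℝ) (S : Set (V d)) (v z : V d) : ENNReal :=
  if z ∈ S then 0 else ∑' y, tau p S v y * J p y z

lemma mu_openAdj (p) (y z : V d) : mu p {ω | OpenAdj ω y z} = J p y z := by
  by_cases h : Adjacent y z
  · have : {ω | OpenAdj ω y z} = {ω | ω (mkE h) = true} := by
      ext ω; simp [openAdj_iff]; simp_all
    rw [this, mu_coord, J, if_pos h]
  · have : {ω | OpenAdj ω y z} = ∅ := eq_empty_of_forall_notMem fun ω hω => h (openAdj_iff.1 hω).1; rw [this, J, if_neg h]; simp

lemma meas_openAdj (y z) : MeasurableSet {ω : Config d | OpenAdj ω y z} := by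
  by_cases h : Adjacent y z
  · have : {ω | OpenAdj ω y z} = {ω | ω (mkE h) = true} := by
      ext ω; simp [openAdj_iff]; simp_all
    rw [this]; exact meas_coord _ _
  · have : {ω | OpenAdj ω y z} = ∅ := eq_empty_of_forall_notMem fun ω hω => h (openAdj_iff.1 hω).1; simp_all

lemma depOn_openAdj (y z) : DepOn {ω : Config d | OpenAdj ω y z} {e | e.val = s(y, z)} := by
  rintro ω ω' h ⟨h1, h2⟩
  exact ⟨h1, by rw [← h _ rfl]; exact h2⟩

lemma Cn.last_exit (D) (h : Cn R ω v x) (hv : v ∈ D) (hx : x ∉ D) :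
    ∃ y ∈ D, ∃ z, z ∈ R \ D ∧ OpenAdj ω y z ∧ Cn (R \ D) ω z x := by
  refine (Cn.induct (P := fun x => x ∉ D → ∃ y ∈ D, ∃ z, z ∈ R \ D ∧ OpenAdj ω y z ∧ Cn (R \ D) ω z x)
    (fun h => absurd hv h) (fun a b _ ha haR hb hab hbD => ?_) h) hx
  by_cases haD : a ∈ D
  · exact ⟨a, haD, b, ⟨hb, hbD⟩, hab, Cn.refl ⟨hb, hbD⟩⟩
  · obtain ⟨y, hy, z, hz, hyz, hza⟩ := ha haD; exact ⟨y, hy, z, hz, hyz, hza.trans (Cn.step ⟨haR, haD⟩ ⟨hb, hbD⟩ hab)⟩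

lemma cl_mu_le_tau (p) (S) (v y : V d) :
    ∑' D : Finset (V d), (mu p ({ω | cl S ω v = D} ∩ {_ω | y ∈ D})) ≤ tau p S v y := by
  rw [tau, ← measure_iUnion]
  · refine measure_mono ?_; intro ω hω; obtain ⟨D, h1, h2⟩ := mem_iUnion.1 hω; have h2 : y ∈ (D : Set (V d)) := h2
    rw [← show cl S ω v = D from h1] at h2; exact h2
  · intro D D' hne; grind
  · exact fun D => (meas_cl_eq _ _ _).inter (MeasurableSet.const _)

/-- The event that `v` is connected inside `S` to some vertex of `A`. -/
def cnS (S : Set (V d)) (v : V d) (A : Set (V d)) : Set (Config d) := {ω | ∃ x ∈ A, Cn S ω v x}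

lemma cnS_eq_iUnion (S) (v : V d) (A) : cnS S v A = ⋃ x ∈ A, cn S v x := by
  ext ω; simp [cnS, cn]

lemma meas_cnS (S) (v : V d) (A) : MeasurableSet (cnS S v A) := by
  rw [cnS_eq_iUnion]; exact MeasurableSet.biUnion (to_countable _) fun x _ => meas_cn _ _ _

lemma depOn_cnS (S) (v : V d) (A) : DepOn (cnS S v A) (edgesIn S) := by
  rw [cnS_eq_iUnion]; exact DepOn.iUnion fun x => DepOn.iUnion fun _ => depOn_cn _ _ _

lemma incr_cnS (S) (v : V d) (A) : Incr (cnS S v A) :=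
  fun _ _ hω ⟨x, hx, h⟩ => ⟨x, hx, Cn.mono Subset.rfl hω h⟩

lemma simon_set (A) (hv : v ∈ S) (hAF : AF p S v) :
    mu p (cnS R v A) ≤ mu p (cnS S v A) + ∑' z, Q p S v z * mu p (cnS R z A) := by
  classical
  have hsub : cnS R v A ⊆ cnS S v A ∪ (cnS S v A)ᶜ ∩ cnS R v A := by
    grind
  refine (measure_mono hsub).trans ((measure_union_le _ _).trans (add_le_add le_rfl ?_))
  rw [← tsum_mu_cl_inter hAF ((meas_cnS S v A).compl.inter (meas_cnS R v A))]
  have hD : ∀ D : Finset (V d), mu p ({ω | cl S ω v = D} ∩ ((cnS S v A)ᶜ ∩ cnS R v A)) ≤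
      ∑' z, ∑' y, (mu p ({ω | cl S ω v = D} ∩ {_ω | y ∈ D})) * (if z ∈ S then 0 else J p y z * mu p (cnS R z A)) := by
    intro D
    have h1 : {ω | cl S ω v = D} ∩ ((cnS S v A)ᶜ ∩ cnS R v A) ⊆
        ⋃ z, ⋃ y, if z ∈ S then ∅ else ({ω | cl S ω v = D} ∩ {_ω | y ∈ D}) ∩ ({ω | OpenAdj ω y z} ∩ cnS (R \ D) z A) := by
      rintro ω ⟨h1, h2, x, hxA, h3⟩
      obtain ⟨y, hy, z, hz, hyz, hzx⟩ := Cn.last_exit D h3 (by rw [← h1]; exact Cn.refl hv)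
        (by rw [← h1]; exact fun h => h2 ⟨x, hxA, h⟩)
      refine mem_iUnion.2 ⟨z, mem_iUnion.2 ⟨y, ?_⟩⟩
      have hzS : z ∉ S := by
        intro hzS; apply hz.2; rw [← h1]; have hy' : y ∈ cl S ω v := by rw [h1]; exact hy
        exact Cn.trans hy' (Cn.step (Cn.right hy') hzS hyz)
      rw [if_neg hzS]; exact ⟨⟨h1, hy⟩, hyz, x, hxA, hzx⟩
    refine (measure_mono h1).trans ((measure_iUnion_le _).trans (tsum_le_tsum fun z =>
      (measure_iUnion_le _).trans (tsum_le_tsum fun y => ?_)))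
    split_ifs with hzS
    · simp
    · by_cases hyD : y ∈ D
      · rw [mu_inter_of_depOn p]
        · gcongr
          rw [mu_inter_of_depOn p (meas_openAdj _ _)
            (meas_cnS _ _ _) (depOn_openAdj _ _) (depOn_cnS _ _ _), mu_openAdj]
          · gcongr; rintro ω ⟨x, hx, h⟩; exact ⟨x, hx, h.mono_set sdiff_subset⟩
          · rw [disjoint_left]; rintro e he he'; exact (he' y (by rw [he]; simp)).2 hyD
        · exact (meas_cl_eq _ _ _).inter (MeasurableSet.const _)
        · exact (meas_openAdj _ _).inter (meas_cnS _ _ _)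
        · exact (depOn_cl_eq _ _ _).inter fun _ _ _ h => h
        · exact ((depOn_openAdj _ _).mono subset_union_left).inter ((depOn_cnS _ _ _).mono subset_union_right)
        · rw [disjoint_left]; rintro e ⟨h1, h2⟩ (h3 | h3)
          · exact hzS (h2 z (by rw [h3]; simp))
          · exact disjoint_left.1 (disjoint_edgesAt_edgesIn_diff (D : Set (V d))) h1 h3
      · have : {ω | cl S ω v = D} ∩ {_ω | y ∈ D} ∩ ({ω | OpenAdj ω y z} ∩ cnS (R \ D) z A) = ∅ :=
          eq_empty_of_forall_notMem fun ω h => hyD h.1.2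
        rw [this]; simp
  refine (tsum_le_tsum hD).trans ?_
  rw [tsum_comm]
  refine tsum_le_tsum fun z => ?_
  rw [tsum_comm, Q]
  split_ifs
  · simp
  · rw [← tsum_mul_right]; refine tsum_le_tsum fun y => ?_; rw [tsum_mul_right, mul_assoc]; gcongr; exact cl_mu_le_tau p S v y

lemma simon (hv : v ∈ S) (hAF : AF p S v) :
    tau p R v x ≤ tau p S v x + ∑' z, Q p S v z * tau p R z x := by
  have h : ∀ S v, cnS S v {x} = cn S v x := fun S v => by ext; simp [cnS, cn]
  simpa only [h, tau] using simon_set {x} hv hAF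

/-- First-exit event through the edge `(y,z)` used in the reversed Simon inequality. -/
def revEv (S R : Set (V d)) (v x y z : V d) : Set (Config d) :=
  {ω | ∃ h : Adjacent y z, z ∈ R \ S ∧ ω (mkE h) = true ∧
    setAt (mkE h) false ω ∈ cn S v y ∩ {ω | Cn (R \ cl R ω v) ω z x}}

lemma setAt_false_le (e : Edge d) (ω) : ∀ e', setAt e false ω e' = true → ω e' = true := by
  intro e' h
  by_cases he : e' = e
  · simp_all
  · rwa [setAt_ne he] at h

lemma Cn.setAt (he : e ∉ edgesIn S) (h : Cn S ω x y) : Cn S (setAt e b ω) x y :=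
  h.congr_edges fun a c hac ha hc => by
    rw [setAt_ne]; rintro rfl; exact he ((mkE_mem_edgesIn hac).2 ⟨ha, hc⟩)

lemma Cn.of_setAt (he : e ∉ edgesIn S) (h : Cn S (Perc.setAt e b ω) x y) : Cn S ω x y :=
  h.congr_edges fun a c hac ha hc => by
    rw [setAt_ne]; rintro rfl; exact he ((mkE_mem_edgesIn hac).2 ⟨ha, hc⟩)

lemma revEv_subset (hSR : S ⊆ R) : revEv S R v x y z ⊆ cn R v x := by
  rintro ω ⟨h, hz, hω, h1, h2⟩
  have h1 : Cn R ω v y := Cn.mono hSR (setAt_false_le _ ω) h1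
  exact (h1.trans (Cn.step h1.right hz.1 (openAdj_iff.2 ⟨h, hω⟩))).trans (Cn.mono sdiff_subset (setAt_false_le _ ω) h2)

lemma revEv_disjoint_cn (hSR : S ⊆ R) : Disjoint (cn S v x) (revEv S R v x y z) := by
  rw [disjoint_left]
  rintro ω h0 ⟨h, hz, hω, h1, h2⟩
  exact (Cn.right h2).2 ((Cn.setAt (fun h' => hz.2 ((mkE_mem_edgesIn h).1 h').2) h0).mono_set hSR)

lemma revEv_disjoint (hSR : S ⊆ R) (hne : (y, z) ≠ (y', z')) :
    Disjoint (revEv S R v x y z) (revEv S R v x y' z') := by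
  rw [disjoint_left]
  rintro ω ⟨h, hz, hω, h1, h2⟩ ⟨h', hz', hω', h1', h2'⟩
  have he : mkE h ∉ edgesIn S := fun h'' => hz.2 ((mkE_mem_edgesIn h).1 h'').2
  have he' : mkE h' ∉ edgesIn S := fun h'' => hz'.2 ((mkE_mem_edgesIn h').1 h'').2
  have hne' : mkE h ≠ mkE h' := by
    intro heq; rcases Sym2.eq_iff.1 (congrArg Subtype.val heq) with ⟨rfl, rfl⟩ | ⟨rfl, rfl⟩; exacts [hne rfl, hz.2 (Cn.right h1')]
  have hy' : y' ∈ cl R (setAt (mkE h) false ω) v := (Cn.setAt he (Cn.of_setAt he' h1')).mono_set hSR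
  have hzx : Cn R (setAt (mkE h') false ω) z x := by
    refine (Cn.mono (S := R \ cl R (setAt (mkE h) false ω) v) sdiff_subset (fun _ h => h) ?_)
    refine Cn.congr_edges (fun a c hac ha hc => ?_) (Cn.mono Subset.rfl (setAt_false_le _ ω) h2); rw [setAt_ne]; intro heq
    rcases Sym2.eq_iff.1 (congrArg Subtype.val heq) with ⟨rfl, rfl⟩ | ⟨rfl, rfl⟩; exacts [ha.2 hy', hc.2 hy']
  have hvy : Cn R (setAt (mkE h') false ω) v y := (Cn.setAt he' (Cn.of_setAt he h1)).mono_set hSR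
  refine (Cn.right h2').2 ((hvy.trans (Cn.step hvy.right hz.1 (openAdj_iff.2 ⟨h, ?_⟩))).trans hzx)
  rw [setAt_ne hne']; exact hω

lemma meas_cn_diff_cl (R) (v z x : V d) :
    MeasurableSet {ω | Cn (R \ cl R ω v) ω z x} := by
  have : {ω | Cn (R \ cl R ω v) ω z x} = cn R z x \ cn R v z := by
    ext ω; constructor
    · intro h; exact ⟨Cn.mono_set sdiff_subset h, h.left.2⟩
    · rintro ⟨h1, h2⟩; exact Cn.diff_cl h1 h2
  rw [this]; exact (meas_cn _ _ _).diff (meas_cn _ _ _)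

lemma meas_revEv : MeasurableSet (revEv S R v x y z) := by
  by_cases h : Adjacent y z
  · have : revEv S R v x y z = {_ω | z ∈ R \ S} ∩ ({ω | ω (mkE h) = true} ∩
        setAt (mkE h) false ⁻¹' (cn S v y ∩ {ω | Cn (R \ cl R ω v) ω z x})) := by
      ext ω; simp [revEv, h, exists_true_left]
    rw [this]
    exact (MeasurableSet.const _).inter ((meas_coord _ _).inter (measurable_setAt _ _
      ((meas_cn _ _ _).inter (meas_cn_diff_cl _ _ _ _))))
  · have : revEv S R v x y z = ∅ := eq_empty_of_forall_notMem fun ω ⟨h', _⟩ => h h'; simp_all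

lemma le_mu_revEv (hAF : AF p R v) (hz : z ∈ R \ S) (hSR : S ⊆ R) :
    tau p S v y * J p y z * tau p R z x ≤ mu p (revEv S R v x y z) +
      J p y z * ∑' w, (∑' u, tau p S v u * tau p S u y * tau p R u w) * (tau p R z w * tau p R w x) := by
  by_cases h : Adjacent y z
  swap
  · simp [J, h]
  set b := mkE h with hb
  have hbS : b ∉ edgesIn S := fun h' => hz.2 ((mkE_mem_edgesIn h).1 h').2
  set f : Config d → Config d := setAt b false with hf
  have hfm : Measurable f := measurable_setAt _ _
  set G : Set (Config d) := cn S v y ∩ {ω | Cn (R \ cl R ω v) ω z x} with hG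
  have hGm : MeasurableSet G := (meas_cn _ _ _).inter (meas_cn_diff_cl _ _ _ _)
  have hrev : mu p (revEv S R v x y z) = J p y z * mu p (f ⁻¹' G) := by
    have : revEv S R v x y z = {ω | ω b = true} ∩ f ⁻¹' G := by
      ext ω; simp [revEv, h, hz, hG, hf, hb]
    rw [this, mu_inter_of_depOn p (meas_coord _ _) (hfm hGm), mu_coord, J, if_pos h]
    · intro ω ω' h; simp [h b rfl]
    · intro ω ω' h hω
      have : f ω' = f ω := by
        ext e'; by_cases he : e' = b
        · subst he; simp [hf]
        · rw [hf, setAt_ne he, setAt_ne he, h e' he]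
      rw [mem_preimage, this]; exact hω
    · exact disjoint_compl_right
  rw [hrev, mul_comm (tau p S v y), mul_assoc, ← mul_add]
  gcongr
  -- decompose according to the cluster of `v` after closing `b`
  have hdec : ∀ F, MeasurableSet F →
      ∑' D : Finset (V d), mu p (f ⁻¹' {ω | cl R ω v = D} ∩ F) = mu p F := by
    intro F hF; rw [← measure_iUnion]
    · refine measure_congr ?_
      have h' : ∀ᵐ ω ∂(mu p : Measure (Config d)), (cl R ω v).Finite := by
        rw [ae_iff]; exact hAF
      rw [eventuallyEq_set]; filter_upwards [h'] with ω hω; simp only [mem_iUnion]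
      exact ⟨fun ⟨_, _, h⟩ => h, fun h => ⟨(show (cl R (f ω) v).Finite from hω.subset fun y hy => Cn.mono Subset.rfl (setAt_false_le _ ω) hy).toFinset, by simp, h⟩⟩
    · intro D D' hne; rw [Function.onFun, disjoint_left]; rintro ω ⟨h1, _⟩ ⟨h2, _⟩; simp at h1 h2
      exact hne (by rw [h1] at h2; exact_mod_cast h2)
    · exact fun D => (hfm (meas_cl_eq _ _ _)).inter hF
  have hD : ∀ D : Finset (V d), mu p (f ⁻¹' {ω | cl R ω v = D} ∩ cn S v y) * tau p R z x ≤
      mu p (f ⁻¹' {ω | cl R ω v = D} ∩ f ⁻¹' G) +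
      ∑' w, mu p (f ⁻¹' {ω | cl R ω v = D} ∩ (cn S v y ∩ {_ω | w ∈ D})) * (tau p R z w * tau p R w x) := by
    intro D; by_cases hyD : y ∈ D; swap
    · have : f ⁻¹' {ω | cl R ω v = D} ∩ cn S v y = ∅ := by
        refine eq_empty_of_forall_notMem fun ω ⟨h1, h2⟩ => hyD ?_; have : y ∈ cl R (f ω) v := (Cn.setAt hbS h2).mono_set hSR
        rw [h1] at this; exact this
      rw [this]; simp
    calc _ ≤ mu p (f ⁻¹' {ω | cl R ω v = D} ∩ cn S v y) * (tau p (R \ D) z x +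
          ∑' w, (if w ∈ (D : Set (V d)) then tau p R z w * tau p R w x else 0)) := by
          refine mul_le_mul' le_rfl ((tau_le_through p D).trans_eq ?_); congr!
      _ ≤ _ := by
        rw [mul_add]; refine add_le_add ?_ ?_
        · rw [tau, ← mu_inter_of_depOn p]
          · refine measure_mono ?_; rintro ω ⟨⟨h1, h2⟩, h3⟩; have h1' : cl R (f ω) v = D := h1; refine ⟨h1, Cn.setAt hbS h2, ?_⟩
            change Cn (R \ cl R (f ω) v) (f ω) z x; rw [h1']; exact Cn.setAt (fun h' => (((mkE_mem_edgesIn h).1 h').1.2 hyD)) h3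
          · exact (hfm (meas_cl_eq _ _ _)).inter (meas_cn _ _ _)
          · exact meas_cn _ _ _
          · rintro ω ω' hag ⟨h1, h2⟩; have h1' : cl R (f ω) v = D := h1
            have hag' : ∀ a c, ∀ h : Adjacent a c, a ∈ D → ω (mkE h) = ω' (mkE h) := fun a c h ha =>
              hag _ ((mkE_mem_edgesAt h).2 (.inl ha))
            have hD' : cl R (f ω') v = D := by
              refine cl_eq_of_agree (fun a c hac ha _ _ => ?_) h1'; by_cases hbe : mkE hac = b
              · rw [hbe]; simp [hf]
              · rw [hf, setAt_ne hbe, setAt_ne hbe, hag' a c hac ha]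
            refine ⟨hD', ?_⟩
            have h3 : Cn (S ∩ D) ω v y := by
              refine Cn.induct (Cn.refl ⟨Cn.left h2, ?_⟩) (fun a c ha ha' haS hcS hac => ?_) h2
              · rw [← h1']; exact Cn.refl (hSR (Cn.left h2))
              · refine ha'.trans (Cn.step ha'.right ⟨hcS, ?_⟩ hac); rw [← h1']; exact (Cn.setAt hbS (ha.trans (Cn.step haS hcS hac))).mono_set hSR
            exact (Cn.congr_edges (fun a c hac ha _ => hag' a c hac ha.2) h3).mono_set inter_subset_left
          exacts [depOn_cn _ _ _, disjoint_edgesAt_edgesIn_diff _]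
        · rw [← tsum_mul_left]; refine tsum_le_tsum fun w => ?_; by_cases hw : w ∈ (D : Set (V d))
          · rw [if_pos hw]; gcongr; exact fun ω h => ⟨h, hw⟩
          · rw [if_neg hw]; simp
  rw [tau, ← hdec _ (meas_cn S v y), ← tsum_mul_right]
  refine (tsum_le_tsum hD).trans ?_
  rw [tsum_add, hdec _ (hfm hGm)]
  gcongr
  rw [tsum_comm]
  refine tsum_le_tsum fun w => ?_
  rw [tsum_mul_right]
  gcongr
  refine le_trans ?_ (mu_cn_inter_cn_le p)
  rw [← hdec _ ((meas_cn S v y).inter (meas_cn R v w))]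
  refine tsum_le_tsum fun D => measure_mono ?_
  rintro ω ⟨h1, h2, h3⟩
  refine ⟨h1, h2, ?_⟩
  have h3 : w ∈ (D : Set (V d)) := h3
  rw [← show cl R (f ω) v = D from h1] at h3
  exact Cn.mono Subset.rfl (setAt_false_le _ ω) h3

open Classical in
lemma simon_rev (hSR : S ⊆ R) (hAF : AF p R v) :
    tau p S v x + ∑' z, Q p S v z * tau p R z x ≤ tau p R v x +
      ∑' z, ∑' y, (if z ∈ R \ S then J p y z * ∑' w, (∑' u, tau p S v u * tau p S u y * tau p R u w) *
        (tau p R z w * tau p R w x) else 0) := by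
  have h1 : tau p S v x + ∑' z, ∑' y, mu p (revEv S R v x y z) ≤ tau p R v x := by
    rw [tsum_comm, ← tsum_prod,
      ← measure_iUnion, tau, tau, ← measure_union]
    · exact measure_mono (union_subset (fun ω h => Cn.mono_set hSR h) (iUnion_subset fun b => revEv_subset hSR))
    · exact disjoint_iUnion_right.2 fun b => revEv_disjoint_cn hSR
    · exact MeasurableSet.iUnion fun b => meas_revEv
    · intro b b' hne; exact revEv_disjoint hSR hne
    · exact fun b => meas_revEv
  refine le_trans ?_ (add_le_add_left h1 _)
  rw [add_assoc]
  refine add_le_add le_rfl ?_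
  rw [← tsum_add]
  refine tsum_le_tsum fun z => ?_
  rw [Q, ← tsum_add]
  by_cases hzR : z ∈ R
  swap
  · rw [tau_eq_zero_left p hzR]; simp
  by_cases hzS : z ∈ S
  · simp [hzS]
  rw [if_neg hzS, ← tsum_mul_right]
  refine tsum_le_tsum fun y => ?_
  rw [if_pos ⟨hzR, hzS⟩]
  exact le_mu_revEv hAF ⟨hzR, hzS⟩ hSR

end

noncomputable section

variable {d : ℕ}
variable {S T R : Set (V d)} {ω ω' : Config d} {x y z v w : V d}

/-! ### Lattice automorphisms -/

/-- Lattice automorphisms. -/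
structure Aut (d : ℕ) where
  e : V d ≃ V d
  adj : ∀ x y, Adjacent (e x) (e y) ↔ Adjacent x y

/-- The action on edges. -/
def Aut.edge (σ : Aut d) (e : Edge d) : Edge d := ⟨e.val.map σ.e, by
  obtain ⟨e, he⟩ := e
  induction e with | _ a b =>
  exact isEdge_iff.2 ((σ.adj a b).2 (isEdge_iff.1 he))⟩

lemma Aut.edge_injective (σ : Aut d) : Function.Injective σ.edge := fun _ _ h =>
  Subtype.ext (Sym2.map.injective σ.e.injective (congrArg Subtype.val h))

/-- The action on configurations. -/
def Aut.conf (σ : Aut d) (ω : Config d) : Config d := fun e => ω (σ.edge e)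

lemma Aut.measurable_conf (σ : Aut d) : Measurable σ.conf := measurable_pi_iff.2 fun _ => measurable_pi_apply _

lemma Aut.map_conf (σ : Aut d) (p) : (mu p).map σ.conf = mu p := by
  have : IsProbabilityMeasure ((mu p : Measure (Config d)).map σ.conf) :=
    Measure.isProbabilityMeasure_map σ.measurable_conf.aemeasurable
  refine eq_mu_of_cyl p true _ fun t => ?_
  rw [Measure.map_apply σ.measurable_conf (meas_cyl _ _)]
  have : σ.conf ⁻¹' (cyl t fun _ => true) = cyl (t.image σ.edge) fun _ => true := by
    ext ω; simp only [cyl, Aut.conf, mem_preimage, mem_ofPred_eq, Finset.forall_mem_image]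
  rw [this, mu_cyl]
  simp [Finset.card_image_of_injective _ σ.edge_injective]

lemma Aut.mu_preimage (σ : Aut d) (p) (hF : MeasurableSet F) : mu p (σ.conf ⁻¹' F) = mu p F := by
  conv_rhs => rw [← σ.map_conf p]
  rw [Measure.map_apply σ.measurable_conf hF]

lemma Aut.openAdj (σ : Aut d) : OpenAdj (σ.conf ω) x y ↔ OpenAdj ω (σ.e x) (σ.e y) := by
  rw [openAdj_iff, openAdj_iff]
  exact ⟨fun ⟨h, h'⟩ => ⟨(σ.adj x y).2 h, h'⟩, fun ⟨h, h'⟩ => ⟨(σ.adj x y).1 h, h'⟩⟩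

lemma Aut.cn (σ : Aut d) (hST : ∀ x, σ.e x ∈ T ↔ x ∈ S) : Cn S (σ.conf ω) x y ↔ Cn T ω (σ.e x) (σ.e y) := by
  constructor
  · intro h
    exact h.induct (P := fun y => Cn T ω (σ.e x) (σ.e y)) (Cn.refl ((hST x).2 h.left)) fun a b _ ha haS hb hab => ha.trans (Cn.step ((hST a).2 haS) ((hST b).2 hb) (σ.openAdj.1 hab))
  · intro h
    have := h.induct (P := fun y => Cn S (σ.conf ω) x (σ.e.symm y)) (by simpa using Cn.refl ((hST x).1 h.left))
      fun a b _ ha haS hb hab => ?_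
    · simp_all
    · refine ha.trans (Cn.step ((hST _).1 (by simp_all)) ((hST _).1 (by simp_all)) (σ.openAdj.2 (by simp_all)))

lemma Aut.tau (σ : Aut d) (p) (hST : ∀ x, σ.e x ∈ T ↔ x ∈ S) (x y) : tau p T (σ.e x) (σ.e y) = tau p S x y := by
  unfold Perc.tau
  rw [← σ.mu_preimage p (meas_cn S x y)]
  congr 1; ext ω
  exact (σ.cn hST).symm

lemma Aut.J (σ : Aut d) (p) (x y) : J p (σ.e x) (σ.e y) = J p x y := by
  classical unfold Perc.J; exact if_congr (σ.adj x y) rfl rfl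

lemma Aut.Q (σ : Aut d) (p) (hST : ∀ x, σ.e x ∈ T ↔ x ∈ S) (v z) : Q p T (σ.e v) (σ.e z) = Q p S v z := by
  classical
  refine if_congr (hST z) rfl ?_
  rw [← σ.e.tsum_eq]
  refine tsum_congr fun y => ?_
  rw [σ.tau p hST, σ.J]

/-- Translation by `a`. -/
def shift (a : V d) : Aut d := ⟨Equiv.addRight a, fun x y => by simp [Adjacent]⟩

@[simp] lemma shift_apply (a x : V d) : (shift a).e x = x + a := rfl

/-- Reflection of coordinate `l` about `c / 2`. -/
def refl (l : Fin d) (c : ℤ) : Aut d where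
  e := { toFun := fun x => Function.update x l (c - x l)
         invFun := fun x => Function.update x l (c - x l)
         left_inv := fun x => by simp
         right_inv := fun x => by simp }
  adj := fun x y => by
    unfold Adjacent
    suffices h : ∀ i, |(Function.update x l (c - x l)) i - (Function.update y l (c - y l)) i| = |x i - y i| by
      simp only [Equiv.coe_fn_mk, h]
    intro i
    by_cases h : i = l
    · subst h; simp [abs_sub_comm]
    · simp [h]

@[simp] lemma refl_apply_same (l : Fin d) (c : ℤ) (x : V d) : (refl l c).e x l = c - x l := by simp [refl]
lemma refl_apply_ne (h : i ≠ l) (c) (x) : (refl l c).e x i = x i := by simp [refl, h]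

/-- Permutation of coordinates. -/
def permC (π : Equiv.Perm (Fin d)) : Aut d where
  e := Equiv.arrowCongr π (Equiv.refl ℤ)
  adj := fun x y => by
    unfold Adjacent
    rw [← Equiv.sum_comp π]
    simp [Equiv.arrowCongr]

@[simp] lemma permC_apply (π : Equiv.Perm (Fin d)) (x : V d) (i : Fin d) : (permC π).e x i = x (π.symm i) := rfl

/-! ### Unit steps -/

/-- The unit steps of the lattice. -/
def st (s : Fin d × Bool) : V d := Pi.single s.1 (if s.2 then 1 else -1)

lemma st_same (s : Fin d × Bool) : st s s.1 = if s.2 then 1 else -1 := by simp [st]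
lemma st_ne (h : i ≠ s.1) : st s i = 0 := by simp [st, h]

lemma st_injective : Function.Injective (st : Fin d × Bool → V d) := by
  rintro ⟨l, b⟩ ⟨l', b'⟩ h
  have hl : l = l' := by
    by_contra hne; have := congrFun h l; rw [st_same, st_ne hne] at this; omega
  subst hl
  have := congrFun h l
  rw [st_same, st_same] at this
  grind

lemma adjacent_add_st (x : V d) (s) : Adjacent x (x + st s) := by
  unfold Adjacent
  rw [Finset.sum_eq_single s.1]
  · rw [Pi.add_apply, st_same]; rcases s with ⟨l, _ | _⟩ <;> simp
  · intro i _ h; simp [st_ne h]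
  · simp

lemma adjacent_iff : Adjacent x y ↔ ∃ s, y = x + st s := by
  refine ⟨fun h => ?_, fun ⟨s, h⟩ => h ▸ adjacent_add_st x s⟩
  unfold Adjacent at h
  have hne : ∃ l, x l - y l ≠ 0 := by
    by_contra hc; push Not at hc; simp_all
  obtain ⟨l, hl⟩ := hne
  have h1 : |x l - y l| + ∑ i ∈ Finset.univ.erase l, |x i - y i| = 1 := by
    simp_all
  have h2 : 1 ≤ |x l - y l| := Int.one_le_abs hl
  have h3 : 0 ≤ ∑ i ∈ Finset.univ.erase l, |x i - y i| := Finset.sum_nonneg fun _ _ => abs_nonneg _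
  have h5 : |x l - y l| = 1 := by omega
  have h6 : ∀ i, i ≠ l → y i = x i := fun i hi => by
    have := (Finset.sum_eq_zero_iff_of_nonneg (fun _ _ => abs_nonneg _)).1 (show ∑ i ∈ Finset.univ.erase l, |x i - y i| = 0 by omega) i (by simp [hi])
    grind
  rcases (abs_eq zero_le_one).1 h5 with h7 | h7
  · refine ⟨(l, false), funext fun i => ?_⟩; by_cases hi : i = l
    · subst hi; simp [st]; omega
    · rw [h6 i hi, Pi.add_apply, st_ne hi]; simp
  · refine ⟨(l, true), funext fun i => ?_⟩; by_cases hi : i = l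
    · subst hi; simp [st]; omega
    · rw [h6 i hi, Pi.add_apply, st_ne hi]; simp

lemma tsum_J (p) (y) (f : Fn d) : ∑' z, J p y z * f z = ∑ s, wt p true * f (y + st s) := by
  rw [tsum_eq_sum, sum_image]
  · refine sum_congr rfl fun s _ => ?_; rw [J, if_pos (adjacent_add_st y s)]
  · intro a _ b _ h; exact st_injective (add_left_cancel h)
  · intro z hz; rw [J, if_neg, zero_mul]; intro h; obtain ⟨s, rfl⟩ := adjacent_iff.1 h; simp_all

lemma J_symm (p) (y z : V d) : J p y z = J p z y := by
  classical unfold J; exact if_congr ⟨adjacent_symm, adjacent_symm⟩ rfl rfl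

/-! ### The full-space two-point function -/

/-- Two-point function as a function of the displacement. -/
def tt (p : ℝ) (x : V d) : ENNReal := tau p univ 0 x

/-- Susceptibility of percolation restricted to `S`. -/
def X (p : ℝ) (S : Set (V d)) (v : V d) : ENNReal := ∑' x, tau p S v x

/-- Susceptibility. -/
def chi (d : ℕ) (p : ℝ) : ENNReal := ∑' x : V d, tt p x

/-- Total exit mass of `S` started from `v`. -/
def phi (p : ℝ) (S : Set (V d)) (v : V d) : ENNReal := ∑' z, Q p S v z

lemma tau_shift (p) (a) (hST : ∀ x, x + a ∈ T ↔ x ∈ S) : tau p T (x + a) (y + a) = tau p S x y :=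
  (shift a).tau p hST x y

lemma tau_univ (p) (x y : V d) : tau p univ x y = tt p (y - x) := by
  have := tau_shift (S := univ) (T := univ) (x := 0) (y := y - x) p x (by simp)
  aesop

lemma tau_le_tt (p) (S) (x y : V d) : tau p S x y ≤ tt p (y - x) := by
  rw [← tau_univ]; exact tau_mono_set p (subset_univ _)

lemma tt_neg (p) (x : V d) : tt p (-x) = tt p x := by
  rw [← zero_sub x, ← tau_univ, tau_symm, tau_univ]; simp

lemma tt_zero (p) : tt p (0 : V d) = 1 := tau_self p (mem_univ _)

lemma tt_le_one (p) (x : V d) : tt p x ≤ 1 := tau_le_one p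

lemma tsum_sub_left (f : Fn d) (x) : ∑' y, f (y - x) = ∑' y, f y := (Equiv.subRight x).tsum_eq f
lemma tsum_sub_right (f : Fn d) (x) : ∑' y, f (x - y) = ∑' y, f y := (Equiv.subLeft x).tsum_eq f

lemma X_univ (p) (v : V d) : X p univ v = chi d p := by
  unfold X chi; simp [tau_univ]; exact tsum_sub_left _ v

lemma X_mono (p) (h : S ⊆ T) (v) : X p S v ≤ X p T v := tsum_le_tsum fun _ => tau_mono_set p h

lemma X_le_chi (p) (S) (v : V d) : X p S v ≤ chi d p := by
  rw [← X_univ p v]; exact X_mono p (subset_univ _) v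

lemma phi_shift (p) (a) (hST : ∀ x, x + a ∈ T ↔ x ∈ S) (v) : phi p T (v + a) = phi p S v := by
  unfold phi
  rw [← (shift a).e.tsum_eq]
  exact tsum_congr fun z => (shift a).Q p hST v z

lemma X_shift (p) (a) (hST : ∀ x, x + a ∈ T ↔ x ∈ S) (v) : X p T (v + a) = X p S v := by
  unfold X
  rw [← (shift a).e.tsum_eq]
  exact tsum_congr fun z => (shift a).tau p hST v z

lemma AF.of_chi (h : chi d p ≠ ⊤) (S) (v : V d) : AF p S v := by
  have := ae_finite_setOfPred_mem (μ := (mu p : Measure (Config d))) (ne_top_of_le_ne_top h (X_le_chi p S v))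
  tauto

lemma X_simon (hv : v ∈ S) (hAF : AF p S v) : X p R v ≤ X p S v + ∑' z, Q p S v z * X p R z := by
  unfold X
  refine (tsum_le_tsum fun x => simon hv hAF).trans ?_
  rw [tsum_add, tsum_comm]
  simp [tsum_mul_left]

lemma X_eq_zero (p) (h : v ∉ S) : X p S v = 0 := by
  unfold X; simp [tau_eq_zero_left p h]

/-- The two-step open bubble. -/
def bub (p : ℝ) (x : V d) : ENNReal := ∑' w, tt p w * tt p (x - w)

open Classical in
/-- The error term in the reversed Simon inequality. -/
def err (p : ℝ) (S : Set (V d)) (v : V d) : ENNReal :=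
  ∑' z, ∑' y, if z ∈ S then 0 else J p y z * ∑' u, tau p S v u * tau p S u y * bub p (z - u)

lemma X_simon_rev (hSR : S ⊆ R) (hAF : AF p R v) (hM : ∀ w, X p R w ≤ M) :
    X p S v + ∑' z, Q p S v z * X p R z ≤ X p R v + err p S v * M := by
  have h := tsum_le_tsum fun x => simon_rev (x := x) hSR hAF
  rw [tsum_add, tsum_add, tsum_comm] at h
  simp only [tsum_mul_left] at h
  refine h.trans (add_le_add le_rfl ?_)
  rw [err, ← tsum_mul_right, tsum_comm]
  refine tsum_le_tsum fun z => ?_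
  rw [← tsum_mul_right, tsum_comm]
  refine tsum_le_tsum fun y => ?_
  by_cases hzR : z ∈ R \ S
  swap
  · simp [hzR]
  simp only [if_pos hzR, if_neg hzR.2, tsum_mul_left, mul_assoc]
  gcongr
  calc ∑' x, ∑' w, (∑' u, tau p S v u * (tau p S u y * tau p R u w)) * (tau p R z w * tau p R w x)
      = ∑' w, (∑' u, tau p S v u * (tau p S u y * tau p R u w)) * (tau p R z w * X p R w) := by
        rw [tsum_comm]; simp [tsum_mul_left]; rfl
    _ ≤ ∑' w, (∑' u, tau p S v u * (tau p S u y * tt p (w - u))) * (tt p (z - w) * M) := by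
        refine tsum_le_tsum fun w => ?_; gcongr with u
        · exact tau_le_tt p R u w
        · rw [tau_symm]; exact tau_le_tt p R w z
        · exact hM w
    _ = (∑' u, tau p S v u * (tau p S u y * bub p (z - u))) * M := by
        simp [← tsum_mul_right]; rw [tsum_comm]; refine tsum_congr fun u => ?_
        have : bub p (z - u) = ∑' w, tt p (w - u) * tt p (z - w) := by
          rw [bub, ← tsum_sub_left _ u]; refine tsum_congr fun w => ?_; congr 2; abel
        rw [this, ← tsum_mul_left, ← tsum_mul_left, ← tsum_mul_right]; exact tsum_congr fun w => by ring

lemma phi_le_one_add_err (hchi : chi d p ≠ ⊤) (S) (v : V d) : phi p S v ≤ 1 + err p S v := by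
  have h := X_simon_rev (S := S) (v := v) (subset_univ _) (AF.of_chi hchi _ _) (fun w => (X_univ p w).le)
  simp [X_univ] at h
  rw [tsum_mul_right] at h
  have h0 : chi d p ≠ 0 := by
    intro h0; have := ENNReal.tsum_eq_zero.1 h0 0; rw [tt_zero] at this; exact one_ne_zero this
  have h1 : phi p S v * chi d p ≤ (1 + err p S v) * chi d p := by
    rw [add_mul, one_mul]; exact le_trans le_add_self h
  exact (ENNReal.mul_le_mul_iff_left h0 hchi).1 h1

end

noncomputable section

variable {d : ℕ}
variable {S T R : Set (V d)} {ω ω' : Config d} {x y z v w : V d}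

/-- Weighted susceptibility. -/
def Xf (p : ℝ) (f : Fn d) (S : Set (V d)) (v : V d) : ENNReal := ∑' u, f u * tau p S v u

lemma Xf_simon (f) (hv : v ∈ S) (hAF : AF p S v) :
    Xf p f R v ≤ Xf p f S v + ∑' z, Q p S v z * Xf p f R z := by
  unfold Xf
  calc ∑' u, f u * tau p R v u ≤ ∑' u, f u * (tau p S v u + ∑' z, Q p S v z * tau p R z u) :=
        tsum_le_tsum fun x => by gcongr; exact simon hv hAF
    _ = ∑' u, f u * tau p S v u + ∑' u, ∑' z, Q p S v z * (f u * tau p R z u) := by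
        rw [← tsum_add]; refine tsum_congr fun u => ?_; rw [mul_add, ← tsum_mul_left]; grind
    _ ≤ _ := by
        rw [tsum_comm]; simp [tsum_mul_left]

lemma Xf_eq_zero (p) (f) (h : v ∉ S) : Xf p f S v = 0 := by
  unfold Xf; simp [tau_eq_zero_left p h]

lemma Xf_le_X (p) (hf : ∀ x, f x ≤ 1) (S) (v) : Xf p f S v ≤ X p S v :=
  tsum_le_tsum fun x => mul_le_of_le_one_left' (hf x)

lemma Aut.Xf (σ : Aut d) (p) (hST : ∀ x, σ.e x ∈ T ↔ x ∈ S) (hfg : ∀ x, f (σ.e x) = g x) (v) :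
    Xf p f T (σ.e v) = Xf p g S v := by
  unfold Perc.Xf
  rw [← σ.e.tsum_eq]
  exact tsum_congr fun z => by rw [hfg, σ.tau p hST]

lemma Aut.X (σ : Aut d) (p) (hST : ∀ x, σ.e x ∈ T ↔ x ∈ S) (v) : X p T (σ.e v) = X p S v := by
  unfold Perc.X
  rw [← σ.e.tsum_eq]
  exact tsum_congr fun z => σ.tau p hST v z

open Classical in
lemma phi_eq (p) (S) (v : V d) :
    phi p S v = ∑ s, wt p true * ∑' y, if y + st s ∈ S then 0 else tau p S v y := by
  have : phi p S v = ∑' y, ∑' z, J p y z * (if z ∈ S then 0 else tau p S v y) := by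
    rw [tsum_comm]; refine tsum_congr fun z => ?_; unfold Q; split_ifs
    · simp
    · grind
  rw [this]
  simp only [tsum_J, ← tsum_mul_left]
  rw [Summable.tsum_finsetSum fun _ _ => ENNReal.summable]

/-- Product sets. -/
def bx (I : Fin d → Set ℤ) : Set (V d) := {x | ∀ i, x i ∈ I i}

/-- All exit masses of product-of-interval sets are at most `β`. -/
def PhiLe (d : ℕ) (p β : ℝ) : Prop :=
  ∀ I : Fin d → Set ℤ, (∀ i, (I i).OrdConnected) → ∀ v, phi p (bx I) v ≤ ofReal β

/-- The slab of points with `l`-th coordinate in `K`. -/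
def sl (l : Fin d) (K : Set ℤ) : Set (V d) := {x | x l ∈ K}

lemma mem_sl : x ∈ sl l K ↔ x l ∈ K := Iff.rfl

lemma sl_eq_bx (l : Fin d) (K) : sl l K = bx (Function.update (fun _ => univ) l K) := by
  ext x
  simp [sl, bx, mem_ofPred_eq]
  grind

lemma PhiLe.slab (h : PhiLe d p β) (l) (hK : K.OrdConnected) (v : V d) :
    phi p (sl l K) v ≤ ofReal β := by
  rw [sl_eq_bx]
  refine h _ (fun i => ?_) v
  by_cases hi : i = l
  · simp_all
  · simp [hi, Function.update_of_ne]; exact ordConnected_univ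

lemma Q_sl_ne_zero (h : Q p (sl l K) v z ≠ 0) :
    z l ∉ K ∧ (z l - 1 ∈ K ∨ z l + 1 ∈ K) := by
  unfold Q at h
  split_ifs at h with hz
  · simp_all
  · refine ⟨hz, ?_⟩; obtain ⟨y, hy⟩ := ENNReal.tsum_eq_zero.not.1 h |> not_forall.1
    have h1 : y ∈ sl l K := by
      by_contra hc; exact hy (by rw [tau_eq_zero_right p hc, zero_mul])
    have h2 : Adjacent y z := by
      by_contra hc; exact hy (by rw [J, if_neg hc, mul_zero])
    obtain ⟨s, rfl⟩ := adjacent_iff.1 h2; by_cases hl : l = s.1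
    · subst hl; rw [Pi.add_apply, st_same]; aesop
    · exact absurd h1 (by have := hz; rw [mem_sl, Pi.add_apply, st_ne hl, add_zero] at this; exact this)

/-- Susceptibility of the slab of half-width `s`. -/
def xs (p : ℝ) (l : Fin d) (s : ℤ) : ENNReal := X p (sl l (Icc (-s) s)) 0

lemma X_slab_center (p) (l) (s c) (hv : v l = c) : X p (sl l (Icc (c - s) (c + s))) v = xs p l s := by
  have := X_shift (S := sl l (Icc (-s) s)) (T := sl l (Icc (c - s) (c + s))) p v (fun x => by
    simp [mem_sl, mem_Icc]; constructor <;> rintro ⟨_, _⟩ <;> constructor <;> linarith) 0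
  aesop

lemma X_sl_congr (p) (l) (K) (h : v l = w l) : X p (sl l K) v = X p (sl l K) w := by
  have := X_shift (S := sl l K) (T := sl l K) p (v - w) (fun x => by simp [mem_sl, h]) w
  simp_all

lemma xs_mono (p) (l : Fin d) (h : s ≤ t) : xs p l s ≤ xs p l t :=
  X_mono p (fun x hx =>
    (⟨by have := hx.1; linarith, by have := hx.2; linarith⟩ : x l ∈ Icc (-t) t)) _

lemma xs_le_chi (p) (l : Fin d) (s) : xs p l s ≤ chi d p := X_le_chi _ _ _

open Classical in
lemma slab_exit_symm (p) (l) (s c) (hv : v l = c) :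
    ∑' z, (if z l = c + s + 1 then Q p (sl l (Icc (c - s) (c + s))) v z else 0) =
    ∑' z, (if z l = c - s - 1 then Q p (sl l (Icc (c - s) (c + s))) v z else 0) := by
  rw [← (refl l (2 * c)).e.tsum_eq]
  refine tsum_congr fun z => ?_
  have hvv : (refl l (2 * c)).e v = v := by
    ext i; by_cases hi : i = l
    · subst hi; simp [hv]; ring
    · rw [refl_apply_ne hi]
  refine if_congr (by rw [refl_apply_same]; constructor <;> intro h <;> linarith) ?_ rfl
  conv_lhs => rw [← hvv]
  refine (refl l (2 * c)).Q p (fun x => ?_) v z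
  simp [mem_sl, mem_Icc]
  omega

open Classical in
lemma slab_exit_half (p) (l) (s c) (hs : 0 ≤ s) (hv : v l = c) :
    2 * ∑' z, (if z l = c + s + 1 then Q p (sl l (Icc (c - s) (c + s))) v z else 0) ≤ phi p (sl l (Icc (c - s) (c + s))) v ∧
    2 * ∑' z, (if z l = c - s - 1 then Q p (sl l (Icc (c - s) (c + s))) v z else 0) ≤ phi p (sl l (Icc (c - s) (c + s))) v := by
  have h := slab_exit_symm p l s c hv
  have h2 : ∑' z, (if z l = c + s + 1 then Q p (sl l (Icc (c - s) (c + s))) v z else 0) +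
    ∑' z, (if z l = c - s - 1 then Q p (sl l (Icc (c - s) (c + s))) v z else 0) ≤ phi p (sl l (Icc (c - s) (c + s))) v := by
    rw [← tsum_add]; refine tsum_le_tsum fun z => ?_; split_ifs with h1 h2
    · omega
    · simp
    · simp
    · simp
  constructor
  · rw [two_mul]; nth_rw 2 [h]; exact h2
  · rw [two_mul]; nth_rw 1 [← h]; exact h2

open Classical in
lemma slab_exit_sum_le (l) (s c) (hs : 0 ≤ s) (hv : v l = c) {g : Fn d}
    (hb : phi p (sl l (Icc (c - s) (c + s))) v ≤ b)
    (hg : (∀ z, z l = c + s + 1 → g z = 0) ∧ (∀ z, z l = c - s - 1 → g z ≤ M) ∨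
      (∀ z, z l = c - s - 1 → g z = 0) ∧ (∀ z, z l = c + s + 1 → g z ≤ M)) :
    2 * ∑' z, Q p (sl l (Icc (c - s) (c + s))) v z * g z ≤ b * M := by
  have hne : ∀ z, Q p (sl l (Icc (c - s) (c + s))) v z ≠ 0 → z l = c + s + 1 ∨ z l = c - s - 1 := by
    intro z hz; obtain ⟨h1, h2⟩ := Q_sl_ne_zero hz; grind
  obtain ⟨hu, hl⟩ := slab_exit_half p l s c hs hv
  rcases hg with ⟨h0, hM⟩ | ⟨h0, hM⟩
  · calc _ ≤ 2 * ∑' z, (if z l = c - s - 1 then Q p (sl l (Icc (c - s) (c + s))) v z else 0) * M := by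
          refine mul_le_mul' le_rfl (tsum_le_tsum fun z => ?_); by_cases hz : Q p (sl l (Icc (c - s) (c + s))) v z = 0
          · simp [hz]
          · rcases hne z hz with h | h
            · simp [h0 z h]
            · rw [if_pos h]; gcongr; exact hM z h
      _ ≤ _ := by
          rw [tsum_mul_right, ← mul_assoc]; gcongr; exact hl.trans hb
  · calc _ ≤ 2 * ∑' z, (if z l = c + s + 1 then Q p (sl l (Icc (c - s) (c + s))) v z else 0) * M := by
          refine mul_le_mul' le_rfl (tsum_le_tsum fun z => ?_); by_cases hz : Q p (sl l (Icc (c - s) (c + s))) v z = 0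
          · simp [hz]
          · rcases hne z hz with h | h
            · rw [if_pos h]; gcongr; exact hM z h
            · simp [h0 z h]
      _ ≤ _ := by
          rw [tsum_mul_right, ← mul_assoc]; gcongr; exact hu.trans hb

lemma exit_sum_le {g : Fn d} (hb : phi p S v ≤ b) (hg : ∀ z, Q p S v z ≠ 0 → g z ≤ M) :
    ∑' z, Q p S v z * g z ≤ b * M := by
  calc _ ≤ ∑' z, Q p S v z * M := by
        refine tsum_le_tsum fun z => ?_; by_cases hz : Q p S v z = 0
        · simp [hz]
        · gcongr; exact hg z hz
    _ ≤ _ := by rw [tsum_mul_right]; gcongr; exact hb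

lemma xs_rec (hchi : chi d p ≠ ⊤) (hβ : PhiLe d p β) (l : Fin d) (hs : 0 ≤ s) :
    2 * xs p l (2 * s + 1) ≤ 2 * xs p l s + ofReal β * (2 * xs p l s + ofReal β * xs p l (2 * s + 1)) := by
  set b := ofReal β
  set R := sl l (Icc (-(2 * s + 1)) (2 * s + 1)) with hR
  have hz1 : ∀ z, z l = s + 1 → 2 * X p R z ≤ 2 * xs p l s + b * xs p l (2 * s + 1) := by
    intro z hz
    have h1 := X_simon (S := sl l (Icc (s + 1 - s) (s + 1 + s))) (R := R) (v := z)
      (by rw [mem_sl, hz]; constructor <;> linarith) (AF.of_chi hchi _ _)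
    rw [X_slab_center p l s (s + 1) hz] at h1
    calc 2 * X p R z ≤ 2 * (xs p l s + ∑' z', Q p (sl l (Icc (s + 1 - s) (s + 1 + s))) z z' * X p R z') := by gcongr
      _ = 2 * xs p l s + 2 * ∑' z', Q p (sl l (Icc (s + 1 - s) (s + 1 + s))) z z' * X p R z' := by ring
      _ ≤ _ := by
        refine add_le_add le_rfl ?_; refine slab_exit_sum_le l s (s + 1) hs hz (hβ.slab l ordConnected_Icc z) (.inl ⟨?_, ?_⟩)
        · intro z' hz'; refine X_eq_zero p ?_; rw [hR, mem_sl, hz']; simp; omega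
        · intro z' hz'; rw [xs, X_sl_congr p l _]; rw [hz']; simp
  have hz2 : ∀ z, z l = -(s + 1) → 2 * X p R z ≤ 2 * xs p l s + b * xs p l (2 * s + 1) := by
    intro z hz; rw [← (refl l 0).X p]
    · exact hz1 _ (by rw [refl_apply_same, hz]; ring)
    · intro x; simp [hR, mem_sl, mem_Icc]; constructor <;> rintro ⟨_, _⟩ <;> constructor <;> linarith
  have h1 := X_simon (S := sl l (Icc (-s) s)) (R := R) (v := 0)
      (by rw [mem_sl]; constructor <;> simpa using hs) (AF.of_chi hchi _ _)
  calc 2 * xs p l (2 * s + 1) ≤ 2 * (xs p l s + ∑' z, Q p (sl l (Icc (-s) s)) 0 z * X p R z) := by gcongr; exact h1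
    _ = 2 * xs p l s + ∑' z, Q p (sl l (Icc (-s) s)) 0 z * (2 * X p R z) := by
        rw [mul_add, ← tsum_mul_left]; congr 1; exact tsum_congr fun z => by ring
    _ ≤ _ := by
        gcongr; refine exit_sum_le (hβ.slab l ordConnected_Icc 0) fun z hz => ?_; obtain ⟨h1, h2⟩ := Q_sl_ne_zero hz; simp at h1 h2
        rcases (by omega : z l = s + 1 ∨ z l = -(s + 1)) with h | h; exacts [hz1 z h, hz2 z h]

lemma xs_double (hchi : chi d p ≠ ⊤) (hβ : PhiLe d p β) (h0 : 0 ≤ β) (h1 : β ≤ 1.04) (l : Fin d) (hs : 0 ≤ s) :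
    xs p l (2 * s + 1) ≤ 5 * xs p l s := by
  have h := xs_rec hchi hβ l hs
  have f2 : xs p l s ≠ ⊤ := ne_top_of_le_ne_top hchi (xs_le_chi _ _ _)
  lift xs p l (2 * s + 1) to NNReal using (ne_top_of_le_ne_top hchi (xs_le_chi _ _ _)) with a
  lift xs p l s to NNReal using f2 with c
  rw [ofReal] at h
  norm_cast at h ⊢
  rw [← NNReal.coe_le_coe] at h ⊢
  push_cast [coe_toNNReal _ h0] at h ⊢
  have hc : (0:ℝ) ≤ c := c.2
  nlinarith [mul_le_mul_of_nonneg_right (mul_le_mul h1 h1 h0 (by norm_num)) (show (0:ℝ) ≤ a from a.2), mul_le_mul_of_nonneg_right h1 hc]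

lemma xs_pow (hchi : chi d p ≠ ⊤) (hβ : PhiLe d p β) (h0 : 0 ≤ β) (h1 : β ≤ 1.04) (l : Fin d) (k) :
    xs p l (2 ^ k - 1) ≤ 5 ^ k * xs p l 0 := by
  induction k with
  | zero => simp
  | succ k ih =>
    have := xs_double hchi hβ h0 h1 l (show (0:ℤ) ≤ 2 ^ k - 1 by have : (1:ℤ) ≤ 2 ^ k := one_le_pow₀ (by norm_num); linarith)
    rw [show (2:ℤ) * (2 ^ k - 1) + 1 = 2 ^ (k + 1) - 1 by ring] at this
    calc _ ≤ _ := this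
      _ ≤ 5 * (5 ^ k * xs p l 0) := by gcongr
      _ = _ := by ring

lemma xs_zero_le (hβ : PhiLe d p β) (l : Fin d) : 2 * (wt p true * xs p l 0) ≤ ofReal β := by
  classical
  refine le_trans ?_ (hβ.slab l (ordConnected_Icc (a := -0) (b := 0)) 0)
  rw [phi_eq]
  have h : ∀ b, wt p true * xs p l 0 = wt p true * ∑' y, (if y + st (l, b) ∈ sl l (Icc (-0) 0) then 0 else tau p (sl l (Icc (-0) 0)) 0 y) := by
    intro b; congr 1; refine tsum_congr fun y => ?_; split_ifs with hy
    · refine tau_eq_zero_right p fun hy' => ?_; rw [mem_sl, Pi.add_apply, show st (l, b) l = if b then 1 else -1 from st_same (l, b)] at hy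
      rw [mem_sl] at hy'; aesop
    · rfl
  rw [Fintype.sum_prod_type]
  calc _ = ∑ b, wt p true * ∑' y, (if y + st (l, b) ∈ sl l (Icc (-0) 0) then 0 else tau p (sl l (Icc (-0) 0)) 0 y) := by
        simp only [← h]; simp
    _ ≤ _ := single_le_sum (f := fun l' => ∑ b, wt p true * ∑' y, (if y + st (l', b) ∈ sl l (Icc (-0) 0) then 0 else tau p (sl l (Icc (-0) 0)) 0 y)) (fun _ _ => zero_le) (Finset.mem_univ l)

lemma wt_xs_le (hchi : chi d p ≠ ⊤) (hβ : PhiLe d p β) (h0 : 0 ≤ β) (h1 : β ≤ 1.04) (l : Fin d) {r : ℕ} (hr : 1 ≤ r) :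
    2 * (wt p true * xs p l r) ≤ 8 * r ^ 3 * ofReal β := by
  have h2 : r < 2 ^ r.size := Nat.lt_size_self r
  have h3 : 2 ^ r.size ≤ 2 * r := by
    have : 2 ^ (r.size - 1) ≤ r := Nat.lt_size.1 (by grind)
    calc 2 ^ r.size = 2 * 2 ^ (r.size - 1) := by rw [← pow_succ']; congr 1; have := Nat.size_pos.2 hr; omega
      _ ≤ _ := by omega
  have h4 : xs p l r ≤ 5 ^ r.size * xs p l 0 :=
    (xs_mono p l (by have : (r:ℤ) < 2 ^ r.size := by exact_mod_cast h2
                     linarith)).trans (xs_pow hchi hβ h0 h1 l r.size)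
  have h5 : 5 ^ r.size ≤ 8 * r ^ 3 := by
    calc 5 ^ r.size ≤ 8 ^ r.size := pow_le_pow_left (by norm_num) _
      _ = (2 ^ r.size) ^ 3 := by rw [← pow_mul, mul_comm, pow_mul]; norm_num
      _ ≤ (2 * r) ^ 3 := pow_le_pow_left h3 3
      _ = _ := by ring
  calc 2 * (wt p true * xs p l r) ≤ 2 * (wt p true * (5 ^ r.size * xs p l 0)) := by gcongr
    _ = 5 ^ r.size * (2 * (wt p true * xs p l 0)) := by ring
    _ ≤ (8 * r ^ 3) * ofReal β := by
        gcongr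
        · exact_mod_cast h5
        · exact xs_zero_le hβ l

end

noncomputable section

variable {d : ℕ}
variable {S T R : Set (V d)} {ω ω' : Config d} {x y z v w : V d}

open Classical in
/-- Indicator of the hyperplane at height `c` in direction `l`. -/
def pl (l : Fin d) (c : ℤ) (x : V d) : ENNReal := if x l = c then 1 else 0

lemma pl_le_one (l) (c) (x : V d) : pl l c x ≤ 1 := by unfold pl; split_ifs <;> simp

lemma Xf_pl_congr (p) (l) (c) (K) (h : v l = w l) :
    Xf p (pl l c) (sl l K) v = Xf p (pl l c) (sl l K) w := by
  have := (shift (v - w)).Xf p (S := sl l K) (T := sl l K) (f := pl l c) (g := pl l c)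
    (fun x => by simp [mem_sl, h]) (fun x => by simp [pl, h]) w
  simp_all

lemma Xf_pl_eq_zero (p) (h : c ∉ K) (v) : Xf p (pl l c) (sl l K) v = 0 := by
  refine ENNReal.tsum_eq_zero.2 fun u => ?_
  unfold pl
  split_ifs
  · rw [tau_eq_zero_right p (by aesop), mul_zero]
  · simp

lemma halfspace_visits_le (hchi : chi d p ≠ ⊤) (hβ : PhiLe d p β) (h0 : 1 ≤ β) (h1 : β ≤ 1.04) (l)
    (h : ℤ) (r : ℕ) (v : V d) : Xf p (pl l (h - r)) (sl l (Iic h)) v ≤ ofReal 2.3 * xs p l r := by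
  set b := ofReal β with hb
  set c : ℤ := h - r with hc
  set H := sl l (Iic h) with hH
  set o : V d := Pi.single l c with ho
  have hol : o l = c := by simp [ho]
  set U := Xf p (pl l c) H o
  have hUt : U ≠ ⊤ := ne_top_of_le_ne_top hchi ((Xf_le_X p (pl_le_one l c) _ _).trans (X_le_chi _ _ _))
  have hplane : ∀ z, z l = c → Xf p (pl l c) H z = U := fun z hz => Xf_pl_congr p l c _ (by omega)
  have hout : ∀ z, h < z l → Xf p (pl l c) H z = 0 := fun z hz => Xf_eq_zero p _ (by rw [hH, mem_sl]; simp [hz])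
  have hgen : ∀ z, Xf p (pl l c) H z ≤ b * U := by
    intro z; rcases lt_trichotomy (z l) c with hz | hz | hz
    · have := Xf_simon (S := sl l (Iio c)) (R := H) (pl l c) hz (AF.of_chi hchi _ _); rw [Xf_pl_eq_zero p (K := Iio c) (by simp), zero_add] at this
      refine this.trans (exit_sum_le (hβ.slab l ordConnected_Iio z) fun z' hz' => ?_); obtain ⟨h1, h2⟩ := Q_sl_ne_zero hz'; simp at h1 h2
      exact (hplane z' (by omega)).le
    · rw [hplane z hz]; exact le_mul_of_one_le_left' (by simp_all)
    · rcases lt_or_ge h (z l) with hz2 | hz2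
      · rw [hout z hz2]; exact zero_le
      · have := Xf_simon (S := sl l (Ioc c h)) (R := H) (pl l c) ⟨hz, hz2⟩ (AF.of_chi hchi _ _)
        rw [Xf_pl_eq_zero p (K := Ioc c h) (by simp), zero_add] at this
        refine this.trans (exit_sum_le (hβ.slab l ordConnected_Ioc z) fun z' hz' => ?_); obtain ⟨h1, h2⟩ := Q_sl_ne_zero hz'; simp at h1 h2
        rcases (by omega : z' l = c ∨ h < z' l) with h3 | h3
        · exact (hplane z' h3).le
        · rw [hout z' h3]; exact zero_le
  have hrec : 2 * U ≤ 2 * xs p l r + b * (b * U) := by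
    have := Xf_simon (S := sl l (Icc (c - r) (c + r))) (R := H) (pl l c) (v := o)
      (by rw [mem_sl, hol]; constructor <;> simp) (AF.of_chi hchi _ _)
    calc 2 * U ≤ 2 * (xs p l r + ∑' z, Q p (sl l (Icc (c - r) (c + r))) o z * Xf p (pl l c) H z) := by
          refine mul_le_mul' le_rfl (this.trans (add_le_add ?_ le_rfl)); rw [← X_slab_center p l r c hol]; exact Xf_le_X p (pl_le_one l c) _ _
      _ = 2 * xs p l r + 2 * ∑' z, Q p (sl l (Icc (c - r) (c + r))) o z * Xf p (pl l c) H z := by ring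
      _ ≤ _ := by
          refine add_le_add le_rfl ?_; refine slab_exit_sum_le l r c (by positivity) hol (hβ.slab l ordConnected_Icc o) (.inl ⟨?_, ?_⟩)
          · intro z hz; exact hout z (by rw [hz, hc]; omega)
          · intro z _; exact hgen z
  have hfin : b * U ≤ ofReal 2.3 * xs p l r := by
    clear_value U
    lift U to NNReal using hUt; lift xs p l r to NNReal using (ne_top_of_le_ne_top hchi (xs_le_chi _ _ _)) with a; rw [hb, ofReal] at hrec ⊢
    rw [ofReal]; norm_cast at hrec ⊢; rw [← NNReal.coe_le_coe] at hrec ⊢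
    push_cast [coe_toNNReal _ (zero_le_one.trans h0), coe_toNNReal (2.3:ℝ) (by norm_num)] at hrec ⊢; nlinarith [mul_le_mul_of_nonneg_right h1 U.2]
  exact (hgen v).trans hfin

/-- Signed coordinate of `x` in the direction of the step `s`. -/
def sc (s : Fin d × Bool) (x : V d) : ℤ := if s.2 then x s.1 else - x s.1

lemma visits_le (hchi : chi d p ≠ ⊤) (hβ : PhiLe d p β) (h0 : 1 ≤ β) (h1 : β ≤ 1.04) (s)
    (h : ℤ) (r : ℕ) (hS : ∀ x ∈ S, sc s x ≤ h) (v) :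
    Xf p (fun x => if sc s x = h - r then 1 else 0) S v ≤ ofReal 2.3 * xs p s.1 r := by
  obtain ⟨l, b⟩ := s
  cases b
  · have hle : Xf p (fun x => if sc (l, false) x = h - r then 1 else 0) S v ≤
        Xf p (fun x => if sc (l, false) x = h - r then 1 else 0) (sl l (Ici (-h))) v := by
      refine tsum_le_tsum fun u => mul_le_mul' le_rfl (tau_mono_set p fun x hx => ?_); have := hS x hx; simp [sc] at this
      rw [mem_sl, mem_Ici]; linarith
    refine hle.trans ?_; rw [← (refl l 0).Xf p (S := sl l (Ici (-h)))]
    · exact halfspace_visits_le hchi hβ h0 h1 l h r _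
    · intro x; simp [mem_sl, mem_Ici]; constructor <;> intro h <;> linarith
    · intro x; simp [pl, sc]
  · have hle : Xf p (fun x => if sc (l, true) x = h - r then 1 else 0) S v ≤ Xf p (pl l (h - r)) (sl l (Iic h)) v := by
      refine tsum_le_tsum fun u => mul_le_mul' (by tauto) (tau_mono_set p fun x hx => ?_); tauto
    exact hle.trans (halfspace_visits_le hchi hβ h0 h1 l h r _)

/-- The triangle diagram at a neighbour of the origin. -/
def tri (p : ℝ) (s : Fin d × Bool) : ENNReal := ∑' y, tt p y * bub p (y + st s)

/-- The triangle diagram restricted to height `r` in direction `s`. -/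
def triH (p : ℝ) (s : Fin d × Bool) (r : ℕ) : ENNReal :=
  ∑' y, if sc s y = r then tt p y * bub p (y + st s) else 0

/-- The triangle diagram weighted by the cube of the height. -/
def triW (p : ℝ) (s : Fin d × Bool) : ENNReal := ∑' r : ℕ, r ^ 3 * triH p s r

lemma triH_le_tri (p) (s : Fin d × Bool) (r) : triH p s r ≤ tri p s :=
  tsum_le_tsum fun y => by aesop

lemma sc_sub (s) (x y : V d) : sc s (x - y) = sc s x - sc s y := by
  unfold sc; split_ifs <;> simp; ring

lemma sc_add_st (s) (x : V d) : sc s (x + st s) = sc s x + 1 := by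
  unfold sc; rw [Pi.add_apply, st_same]; rcases s with ⟨l, _ | _⟩ <;> simp; ring

lemma bx_face (hI : ∀ i, (I i).OrdConnected) (hy : y ∈ bx I) (hys : y + st s ∉ bx I) :
    ∀ x ∈ bx I, sc s x ≤ sc s y := by
  intro x hx
  by_contra hlt
  push Not at hlt
  apply hys
  intro i
  by_cases hi : i = s.1
  · subst hi; refine (hI s.1).out (hy s.1) (hx s.1) |> fun h => ?_; have h' := (hI s.1).out (hx s.1) (hy s.1); rw [Pi.add_apply, st_same]
    rcases s with ⟨l, _ | _⟩
    · simp [sc] at *; exact h' ⟨by linarith, by linarith⟩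
    · simp [sc] at *; exact h ⟨by linarith, by linarith⟩
  · rw [Pi.add_apply, st_ne hi, add_zero]; exact hy i

open Classical in
lemma err_eq (p) (S) (v : V d) :
    err p S v = ∑ s, wt p true * ∑' y, if y + st s ∈ S then 0 else
      ∑' u, tau p S v u * tau p S u y * bub p (y + st s - u) := by
  have : err p S v = ∑' y, ∑' z, J p y z * (if z ∈ S then 0 else ∑' u, tau p S v u * tau p S u y * bub p (z - u)) := by
    rw [tsum_comm, err]; simp
  rw [this]
  simp only [tsum_J, ← tsum_mul_left]
  rw [Summable.tsum_finsetSum fun _ _ => ENNReal.summable]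

open Classical in
lemma err_face_le (hchi : chi d p ≠ ⊤) (hβ : PhiLe d p β) (h0 : 1 ≤ β) (h1 : β ≤ 1.04)
    (hI : ∀ i, (I i).OrdConnected) (v : V d) (s) :
    wt p true * (∑' y, if y + st s ∈ bx I then 0 else ∑' u, tau p (bx I) v u * tau p (bx I) u y * bub p (y + st s - u)) ≤
    tri p s * (wt p true * ∑' y, if y + st s ∈ bx I then 0 else tau p (bx I) v y) + 10 * triW p s := by
  set S := bx I
  by_cases hex : ∃ y ∈ S, y + st s ∉ S
  swap
  · push Not at hex
    have : (∑' y, if y + st s ∈ S then 0 else ∑' u, tau p S v u * tau p S u y * bub p (y + st s - u)) = 0 := by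
      refine ENNReal.tsum_eq_zero.2 fun y => ?_; split_ifs with hy
      · rfl
      · refine ENNReal.tsum_eq_zero.2 fun u => ?_; rw [tau_eq_zero_right p (fun h => hy (hex y h))]; simp
    rw [this]; simp
  obtain ⟨y₀, hy₀, hy₀'⟩ := hex
  have htop := bx_face hI hy₀ hy₀'
  set h := sc s y₀
  have hface : ∀ y ∈ S, (y + st s ∉ S ↔ sc s y = h) := by
    intro y hy; constructor
    · intro hy'; exact le_antisymm (htop y hy) (bx_face hI hy hy' y₀ hy₀)
    · intro hy' hy2; have := htop _ hy2; rw [sc_add_st] at this; linarith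
  -- reorganise by the depth of the branching vertex
  have key : (∑' y, if y + st s ∈ S then 0 else ∑' u, tau p S v u * tau p S u y * bub p (y + st s - u)) ≤
      ∑' r, triH p s r * Xf p (fun x => if sc s x = h - r then 1 else 0) S v := by
    calc _ ≤ ∑' y, ∑' u, tau p S v u * (if sc s y = h then tt p (y - u) * bub p (y - u + st s) else 0) := by
          refine tsum_le_tsum fun y => ?_; split_ifs with hy hy2
          · exact zero_le
          · exact zero_le
          · refine tsum_le_tsum fun u => ?_; rw [mul_assoc, show y + st s - u = y - u + st s by abel]; gcongr; exact tau_le_tt p S u y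
          · refine le_of_eq ?_; rw [ENNReal.tsum_eq_zero.2, ENNReal.tsum_eq_zero.2]
            · intro u; simp
            · intro u
              have : y ∉ S := fun hyS => by
                have := (hface y hyS).1 hy; contradiction
              rw [tau_eq_zero_right p this]; simp
      _ = ∑' u, tau p S v u * ∑' y, (if sc s y = h - sc s u then tt p y * bub p (y + st s) else 0) := by
          rw [tsum_comm]; refine tsum_congr fun u => ?_
          rw [tsum_mul_left, ← tsum_sub_left (fun y => if sc s y = h - sc s u then tt p y * bub p (y + st s) else 0) u]; congr 1
          refine tsum_congr fun y => if_congr ?_ rfl rfl; rw [sc_sub]; constructor <;> intro h <;> linarith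
      _ ≤ ∑' u, tau p S v u * ∑' r : ℕ, (if sc s u = h - r then 1 else 0) * triH p s r := by
          refine tsum_le_tsum fun u => ?_; by_cases huS : u ∈ S; swap
          · rw [tau_eq_zero_right p huS]; simp
          gcongr; have hu := htop u huS; refine le_trans ?_ (le_tsum (h - sc s u).toNat)
          have h2 : ((h - sc s u).toNat : ℤ) = h - sc s u := Int.toNat_of_nonneg (by linarith); rw [if_pos (by linarith), one_mul, triH, h2]
      _ = _ := by
          simp [← tsum_mul_left, Xf]; rw [tsum_comm]; exact tsum_congr fun r => tsum_congr fun u => by ring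
  have hX0 : wt p true * Xf p (fun x => if sc s x = h - (0:ℕ) then 1 else 0) S v ≤
      wt p true * ∑' y, if y + st s ∈ S then 0 else tau p S v y := by
    refine mul_le_mul' le_rfl (tsum_le_tsum fun y => ?_); by_cases hy : y ∈ S
    · by_cases hy2 : sc s y = h
      · rw [if_neg ((hface y hy).2 hy2)]; simp [hy2]
      · simp [hy2]
    · rw [tau_eq_zero_right p hy]; simp
  have hXr : ∀ r : ℕ, 1 ≤ r → wt p true * Xf p (fun x => if sc s x = h - r then 1 else 0) S v ≤ 10 * r ^ 3 := by
    intro r hr; have e2 := wt_xs_le hchi hβ (zero_le_one.trans h0) h1 s.1 hr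
    calc _ ≤ wt p true * (ofReal 2.3 * xs p s.1 r) := mul_le_mul' le_rfl (visits_le hchi hβ h0 h1 s h r htop v)
      _ = ofReal 1.15 * (2 * (wt p true * xs p s.1 r)) := by
          rw [show (2.3:ℝ) = 1.15 * 2 by norm_num, ofReal_mul (by norm_num), ofReal_ofNat]; ring
      _ ≤ ofReal 1.15 * (8 * r ^ 3 * ofReal 1.04) := by
          exact mul_le_mul' le_rfl (e2.trans (mul_le_mul' le_rfl (ofReal_le_ofReal h1)))
      _ = (ofReal 1.15 * ofReal 8 * ofReal 1.04) * r ^ 3 := by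
          rw [ofReal_ofNat]; ring
      _ ≤ _ := by
          gcongr; rw [← ofReal_mul (by norm_num), ← ofReal_mul (by norm_num), ← ofReal_ofNat 10]; exact ofReal_le_ofReal (by norm_num)
  calc _ ≤ wt p true * ∑' r, triH p s r * Xf p (fun x => if sc s x = h - r then 1 else 0) S v := by gcongr
    _ = ∑' r, triH p s r * (wt p true * Xf p (fun x => if sc s x = h - r then 1 else 0) S v) := by
        rw [← tsum_mul_left]; exact tsum_congr fun r => by ring
    _ = triH p s 0 * (wt p true * Xf p (fun x => if sc s x = h - (0:ℕ) then 1 else 0) S v) +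
        ∑' r, triH p s (r+1) * (wt p true * Xf p (fun x => if sc s x = h - ((r+1:ℕ):ℤ) then 1 else 0) S v) := by
        rw [ENNReal.tsum_eq_add_tsum_ite 0, tsum_eq_zero_add' ENNReal.summable]; simp
    _ ≤ _ := by
        refine add_le_add (mul_le_mul' (triH_le_tri p s 0) hX0) ?_
        have hW : triW p s = ∑' r, ((r + 1 : ℕ) : ENNReal) ^ 3 * triH p s (r + 1) := by
          rw [triW, tsum_eq_zero_add' ENNReal.summable]; simp
        rw [hW, ← tsum_mul_left]; refine tsum_le_tsum fun r => ?_
        calc _ ≤ triH p s (r + 1) * (10 * ((r + 1 : ℕ) : ENNReal) ^ 3) := mul_le_mul' le_rfl (hXr (r + 1) (by omega))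
          _ = _ := by ring

lemma err_le (hchi : chi d p ≠ ⊤) (hβ : PhiLe d p β) (h0 : 1 ≤ β) (h1 : β ≤ 1.04)
    (hN₀ : ∀ s : Fin d × Bool, tri p s ≤ N₀) (hN₁ : ∀ s : Fin d × Bool, triW p s ≤ N₁)
    (hI : ∀ i, (I i).OrdConnected) (v : V d) :
    err p (bx I) v ≤ N₀ * ofReal β + 20 * d * N₁ := by
  rw [err_eq]
  refine (sum_le_sum fun s _ => err_face_le hchi hβ h0 h1 hI v s).trans ?_
  rw [sum_add_distrib]
  refine add_le_add ?_ ?_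
  · refine le_trans ?_ (mul_le_mul' le_rfl (hβ I hI v)); rw [phi_eq, mul_sum]; refine sum_le_sum fun s _ => ?_; gcongr; exact hN₀ s
  · refine (sum_le_sum fun s _ => mul_le_mul' le_rfl (hN₁ s)).trans (le_of_eq ?_); simp [nsmul_eq_mul]; ring

end

noncomputable section

variable {d : ℕ}
variable {S T R : Set (V d)} {x y z v w : V d}

/-! ### Convolutions -/

/-- Convolution of nonnegative functions on the lattice. -/
def conv (f g : Fn d) (x : V d) : ENNReal := ∑' y, f y * g (x - y)

/-- Unit mass at the origin. -/
def dl : Fn d := Pi.single 0 1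

/-- Convolution powers. -/
def cpow (f : Fn d) : ℕ → Fn d
  | 0 => dl
  | n + 1 => conv f (cpow f n)

/-- Total mass. -/
def mass (f : Fn d) : ENNReal := ∑' x, f x

lemma conv_comm (f g : Fn d) : conv f g = conv g f := by
  ext x
  unfold conv
  rw [← tsum_sub_right (fun y => g y * f (x - y)) x]
  exact tsum_congr fun y => by rw [sub_sub_cancel, mul_comm]

lemma conv_assoc (f g h : Fn d) : conv (conv f g) h = conv f (conv g h) := by
  ext x
  unfold conv
  simp [← tsum_mul_right, ← tsum_mul_left]
  rw [tsum_comm]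
  refine tsum_congr fun y => ?_
  rw [← tsum_sub_left (fun z => f y * (g z * h (x - y - z))) y]
  refine tsum_congr fun z => ?_
  rw [mul_assoc]; congr 3; abel

lemma conv_left_comm (f g h : Fn d) : conv f (conv g h) = conv g (conv f h) := by
  rw [← conv_assoc, conv_comm f g, conv_assoc]

lemma dl_conv (f : Fn d) : conv dl f = f := by
  ext x
  unfold conv dl
  rw [tsum_eq_single 0]
  · simp
  · simp_all

lemma conv_dl (f : Fn d) : conv f dl = f := by rw [conv_comm, dl_conv]

lemma conv_mono (hf : ∀ x, f x ≤ f' x) (hg : ∀ x, g x ≤ g' x) (x) : conv f g x ≤ conv f' g' x :=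
  tsum_le_tsum fun y => mul_le_mul' (hf y) (hg _)

lemma conv_add (f g h : Fn d) : conv f (fun x => g x + h x) = fun x => conv f g x + conv f h x := by
  ext x; unfold conv; rw [← tsum_add]; exact tsum_congr fun y => mul_add _ _ _

lemma add_conv (f g h : Fn d) : conv (fun x => f x + g x) h = fun x => conv f h x + conv g h x := by
  rw [conv_comm, conv_add, conv_comm h f, conv_comm h g]

lemma tsum_conv (f : ι → Fn d) (g) (x) :
    conv (fun x => ∑' i, f i x) g x = ∑' i, conv (f i) g x := by
  unfold conv; simp [← tsum_mul_right]; rw [tsum_comm]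

lemma sum_conv (s) (f : ι → Fn d) (g) (x) :
    conv (fun x => ∑ i ∈ s, f i x) g x = ∑ i ∈ s, conv (f i) g x := by
  unfold conv; simp [sum_mul]; rw [Summable.tsum_finsetSum fun _ _ => ENNReal.summable]

lemma mass_conv (f g : Fn d) : mass (conv f g) = mass f * mass g := by
  unfold mass conv
  rw [tsum_comm, ← tsum_mul_right]
  refine tsum_congr fun y => ?_
  rw [tsum_mul_left, tsum_sub_left]

lemma mass_dl : mass (dl : Fn d) = 1 := by unfold mass dl; rw [tsum_pi_single]

lemma mass_cpow (f : Fn d) (n) : mass (cpow f n) = mass f ^ n := by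
  induction n with
  | zero => simp [cpow, mass_dl]
  | succ n ih => rw [cpow, mass_conv, ih, pow_succ']

lemma mass_mono (h : ∀ x, f x ≤ g x) : mass f ≤ mass g := tsum_le_tsum h

lemma conv_le_mass_mul (hg : ∀ x, g x ≤ a) (x) : conv f g x ≤ mass f * a := by
  unfold conv mass; rw [← tsum_mul_right]; exact tsum_le_tsum fun y => mul_le_mul' le_rfl (hg _)

lemma conv_le_mul_mass (hf : ∀ x, f x ≤ a) (x) : conv f g x ≤ a * mass g := by
  rw [conv_comm, mul_comm]; exact conv_le_mass_mul hf x

lemma cpow_add (f : Fn d) (m n) : cpow f (m + n) = conv (cpow f m) (cpow f n) := by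
  induction m with
  | zero => rw [zero_add, cpow, dl_conv]
  | succ m ih => rw [Nat.succ_add, cpow, ih, cpow, conv_assoc]

/-- `f` vanishes outside the cube of radius `ρ`. -/
def Rng (ρ : ℕ) (f : Fn d) : Prop := ∀ x, f x ≠ 0 → ∀ l, |x l| ≤ ρ

lemma Rng.mono (h : Rng ρ f) (hρ : ρ ≤ ρ') : Rng ρ' f := fun x hx l =>
  (h x hx l).trans (by omega)

lemma rng_dl : Rng 0 (dl : Fn d) := by
  intro x hx l
  simp [(show x = 0 by by_contra hc; exact hx (by simp [dl, hc]))]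

lemma conv_ne_zero (h : conv f g x ≠ 0) : ∃ y, f y ≠ 0 ∧ g (x - y) ≠ 0 := by
  obtain ⟨y, hy⟩ := not_forall.1 (ENNReal.tsum_eq_zero.not.1 h)
  grind

lemma Rng.conv (hf : Rng ρ f) (hg : Rng ρ' g) : Rng (ρ + ρ') (conv f g) := by
  intro x hx l
  obtain ⟨y, h1, h2⟩ := conv_ne_zero hx
  have h3 := hf y h1 l
  have h4 := hg _ h2 l
  rw [Pi.sub_apply] at h4
  grind

lemma Rng.cpow (hf : Rng ρ f) (n) : Rng (n * ρ) (cpow f n) := by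
  induction n with
  | zero => rw [zero_mul]; exact rng_dl
  | succ n ih => rw [Perc.cpow]; exact (hf.conv ih).mono (by linarith)

/-! ### Cubes -/

/-- The open cube of radius `N`. -/
def cb (d N : ℕ) : Set (V d) := bx fun _ => Ioo (-(N:ℤ)) N

lemma mem_cb : x ∈ cb d N ↔ ∀ i, |x i| < N := by
  simp [cb, bx, abs_lt]

/-- Exit kernel of the cube. -/
def qk (p : ℝ) (N : ℕ) (z : V d) : ENNReal := Q p (cb d N) 0 z

/-- Two-point function of the cube. -/
def gk (p : ℝ) (N : ℕ) (z : V d) : ENNReal := tau p (cb d N) 0 z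

lemma tt_le_cube (hchi : chi d p ≠ ⊤) (hN : 0 < N) (x : V d) : tt p x ≤ gk p N x + conv (qk p N) (tt p) x := by
  have := simon (S := cb d N) (R := univ) (v := 0) (x := x) (by rw [mem_cb]; simp [hN]) (AF.of_chi hchi _ _)
  simp [tau_univ, sub_zero] at this
  exact this

lemma qk_mass (hβ : PhiLe d p β) (N) : mass (qk p N : Fn d) ≤ ofReal β :=
  hβ _ (fun _ => ordConnected_Ioo) 0

lemma qk_ne_zero (h : qk p N z ≠ 0) : ∃ l, |z l| = N ∧ ∀ i, i ≠ l → |z i| < N := by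
  unfold qk Q at h
  split_ifs at h with hz
  · simp_all
  obtain ⟨y, hy⟩ := not_forall.1 (ENNReal.tsum_eq_zero.not.1 h)
  have h1 : y ∈ cb d N := by
    by_contra hc; exact hy (by rw [tau_eq_zero_right p hc, zero_mul])
  have h2 : Adjacent y z := by
    by_contra hc; exact hy (by rw [J, if_neg hc, mul_zero])
  obtain ⟨s, rfl⟩ := adjacent_iff.1 h2
  rw [mem_cb] at h1
  have hi : ∀ i, i ≠ s.1 → |(y + st s) i| < N := fun i hi => by rw [Pi.add_apply, st_ne hi, add_zero]; exact h1 i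
  refine ⟨s.1, ?_, hi⟩
  by_contra hc
  apply hz
  rw [mem_cb]
  intro i
  by_cases hi' : i = s.1
  · subst hi'; have h3 := h1 s.1
    have h4 : |(y + st s) s.1| ≤ |y s.1| + 1 := by
      refine (abs_add_le _ _).trans (add_le_add le_rfl ?_); rw [st_same]; split_ifs <;> simp
    omega
  · exact hi i hi'

lemma rng_qk (p) (N) : Rng N (qk p N : Fn d) := by
  intro x hx l
  obtain ⟨l', h1, h2⟩ := qk_ne_zero hx
  grind

lemma rng_gk (p) (N) : Rng N (gk p N : Fn d) := by
  intro x hx l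
  exact (mem_cb.1 (by by_contra hc; exact hx (tau_eq_zero_right p hc)) l).le

lemma gk_mass_le (p) (l : Fin d) : mass (gk p N : Fn d) ≤ xs p l (N - 1) := by
  refine X_mono p (fun x hx => ?_) 0
  have := mem_cb.1 hx l
  rw [mem_sl, mem_Icc]
  grind

open Classical in
/-- The part of the exit kernel on the two faces orthogonal to `l`. -/
def qf (p : ℝ) (N : ℕ) (l : Fin d) (z : V d) : ENNReal := if |z l| = N then qk p N z else 0

lemma qk_eq_sum (p) (N) (z : V d) : qk p N z = ∑ l, qf p N l z := by
  by_cases h : qk p N z = 0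
  · rw [h]; symm; exact Finset.sum_eq_zero fun l _ => by simp [qf, h]
  · obtain ⟨l, h1, h2⟩ := qk_ne_zero h; rw [Finset.sum_eq_single l]
    · simp [qf, h1]
    · intro i _ hi; rw [qf, if_neg (h2 i hi).ne]
    · simp

lemma qk_perm (p) (N) (π) (z : V d) : qk p N ((permC π).e z) = qk p N z := by
  unfold qk
  conv_lhs => rw [← (show (permC π).e 0 = 0 from rfl)]
  refine (permC π).Q p (fun x => ?_) 0 z
  constructor
  · intro h i; simpa using h (π i)
  · intro h i; exact h _

lemma qk_refl (p) (N) (l) (z : V d) : qk p N ((refl l 0).e z) = qk p N z := by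
  have h0 : (refl l 0).e 0 = 0 := by
    ext i; by_cases h : i = l
    · simp_all
    · rw [refl_apply_ne h]
  unfold qk
  conv_lhs => rw [← h0]
  refine (refl l 0).Q p (fun x => ?_) 0 z
  rw [mem_cb, mem_cb]
  refine forall_congr' fun i => ?_
  by_cases h : i = l
  · subst h; simp
  · rw [refl_apply_ne h]

lemma qf_mass_eq (p) (N) (l l' : Fin d) : mass (qf p N l) = mass (qf p N l') := by
  unfold mass
  rw [← (permC (Equiv.swap l l')).e.tsum_eq]
  refine tsum_congr fun z => ?_
  unfold qf
  rw [qk_perm]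
  simp

lemma qf_mass_le (hβ : PhiLe d p β) (N) (l : Fin d) : d * mass (qf p N l) ≤ ofReal β := by
  refine le_trans (le_of_eq ?_) (qk_mass hβ N)
  have : mass (qk p N : Fn d) = ∑ l' : Fin d, mass (qf p N l') := by
    unfold mass; simp [qk_eq_sum]; rw [Summable.tsum_finsetSum fun _ _ => ENNReal.summable]
  rw [this, sum_congr rfl fun l' _ => qf_mass_eq p N l' l]
  simp

/-- Symmetric two-point jump `± N` in direction `l`. -/
def sgk (N : ℕ) (l : Fin d) (z : V d) : ENNReal :=
  2⁻¹ * dl (z - Pi.single l (N:ℤ)) + 2⁻¹ * dl (z + Pi.single l (N:ℤ))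

lemma sgk_conv (N) (l) (f) (x : V d) :
    conv (sgk N l) f x = 2⁻¹ * f (x - Pi.single l (N:ℤ)) + 2⁻¹ * f (x + Pi.single l (N:ℤ)) := by
  have h1 : ∀ a, conv (fun z => 2⁻¹ * dl (z - a)) f x = 2⁻¹ * f (x - a) := by
    intro a; unfold conv
    rw [tsum_eq_single a]
    · simp [dl]
    · intro y hy; simp [dl, sub_eq_zero, hy]
  unfold sgk
  rw [add_conv]
  simp only
  have := h1 (-Pi.single l (N:ℤ))
  simp_all

open Classical in
/-- Transversal part of the face kernel. -/
def mk' (p : ℝ) (N : ℕ) (l : Fin d) (z : V d) : ENNReal :=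
  if z l = 0 then 2 * qk p N (z + Pi.single l (N:ℤ)) else 0

lemma qf_eq_conv (p) (hN : 0 < N) (l : Fin d) : qf p N l = conv (sgk N l) (mk' p N l) := by
  ext x
  rw [sgk_conv]
  unfold mk' qf
  have h2 : (2:ENNReal)⁻¹ * 2 = 1 := ENNReal.inv_mul_cancel (by simp) (by simp)
  simp only [Pi.sub_apply, Pi.add_apply, Pi.single_eq_same, sub_add_cancel]
  by_cases h1 : x l = N
  · have : ¬ (x l + N = 0) := by omega
    rw [if_pos (by simp_all), if_pos (by omega), if_neg this, ← mul_assoc, h2]; simp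
  · by_cases h3 : x l = -N
    · rw [if_pos (by simp_all), if_neg (by omega), if_pos (by omega), ← mul_assoc, h2, mul_zero, zero_add, one_mul,
        ← qk_refl p N l]
      congr 1; ext i; by_cases hi : i = l
      · simp_all
      · rw [refl_apply_ne hi]; simp [hi]
    · rw [if_neg, if_neg (by omega), if_neg (by omega)]
      · simp
      · intro h; rcases (abs_eq (by positivity)).1 h with h | h <;> contradiction

lemma sgk_mass (N) (l) : mass (sgk N l : Fn d) = 1 := by
  have h : ∀ a, ∑' z : V d, dl (z + a) = 1 := fun a => by
    have := tsum_sub_left dl (-a); simp at this; rw [this]; exact mass_dl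
  unfold mass sgk
  rw [tsum_add, tsum_mul_left, tsum_mul_left, h, fun a => (tsum_sub_left dl a).trans mass_dl, mul_one, inv_two_add_inv_two]

lemma mk'_mass (p) (hN : 0 < N) (l : Fin d) : mass (mk' p N l) = mass (qf p N l) := by
  rw [qf_eq_conv p hN, mass_conv, sgk_mass, one_mul]

/-- Support condition relative to a set `H` of already used directions. -/
def SuppH (N : ℕ) (H : Finset (Fin d)) (s : Fn d) : Prop :=
  ∀ x, s x ≠ 0 → ∀ l, |x l| < (if l ∈ H then 2 * N else N : ℕ)

lemma conv_sgk_le (hs : SuppH N H s) (hl : l ∉ H)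
    (ha : ∀ x, s x ≤ a) (x) : conv s (sgk N l) x ≤ 2⁻¹ * a := by
  rw [conv_comm, sgk_conv]
  by_cases h1 : s (x - Pi.single l (N:ℤ)) = 0
  · rw [h1, mul_zero, zero_add]; gcongr; exact ha _
  · by_cases h2 : s (x + Pi.single l (N:ℤ)) = 0
    · rw [h2, mul_zero, add_zero]; gcongr; exact ha _
    · have h3 := hs _ h1 l; have h4 := hs _ h2 l; simp [Pi.single_eq_same] at h3 h4; grind

lemma SuppH.conv_sgk (hs : SuppH N H s) (hl : l ∉ H) :
    SuppH N (insert l H) (conv s (sgk N l)) := by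
  intro x hx i
  rw [conv_comm, sgk_conv] at hx
  have key : ∃ e : ℤ, (e = N ∨ e = -N) ∧ s (x + Pi.single l e) ≠ 0 := by
    by_cases h1 : s (x - Pi.single l (N:ℤ)) = 0
    · simp_all
    · refine ⟨-N, .inr rfl, ?_⟩; rw [Pi.single_neg, ← sub_eq_add_neg]; exact h1
  obtain ⟨e, he, hse⟩ := key
  have h3 := hs _ hse i
  by_cases hi : i = l
  · subst hi; simp [hl, Pi.single_eq_same] at h3 ⊢; rw [abs_lt] at h3 ⊢; omega
  · simpa [hi] using h3

/-- Convolving functions supported in the cube of radius `M` with `K` multiplies sup bounds by `B`. -/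
def Contr (M : ℕ) (K : Fn d) (B : ENNReal) : Prop :=
  ∀ s : Fn d, SuppH M ∅ s → ∀ a, (∀ x, s x ≤ a) → ∀ x, conv s K x ≤ a * B

lemma contr_step (hβ : PhiLe d p β) (hN : 0 < N) (hK : Contr (2 * N) K B)
    (m) : ∀ H, 2 * (H.card + m) ≤ d → ∀ s : Fn d, SuppH N H s → ∀ a, (∀ x, s x ≤ a) →
      ∀ x, conv s (conv (cpow (qk p N) m) K) x ≤ a * (B * (ofReal (3 / 4 * β)) ^ m) := by
  induction m with
  | zero =>
    intro H _ s hs a ha x; rw [cpow, dl_conv, pow_zero, mul_one]; refine hK s (fun x hx l => ?_) a ha x; have := hs x hx l; grind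
  | succ m ih =>
    intro H hH s hs a ha x; set K' := conv (cpow (qk p N) m) K
    set B' := B * (ofReal (3 / 4 * β)) ^ m with hB'
    have e1 : conv s (conv (cpow (qk p N) (m + 1)) K) = conv (qk p N) (conv s K') := by
      rw [cpow, conv_assoc, conv_left_comm]
    have e2 : conv (qk p N) (conv s K') x = ∑ l, conv (qf p N l) (conv s K') x := by
      rw [← sum_conv]; congr 1; ext z; exact qk_eq_sum p N z
    have hl : ∀ l, conv (qf p N l) (conv s K') x ≤ mass (qf p N l) * ((if l ∈ H then 1 else 2⁻¹) * (a * B')) := by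
      intro l; split_ifs with hlH
      · rw [one_mul]; exact conv_le_mass_mul (ih H (by omega) s hs a ha) x
      · rw [qf_eq_conv p hN, conv_comm (sgk N l), conv_assoc, ← conv_assoc (sgk N l), conv_comm (sgk N l), ← mul_assoc 2⁻¹,
          mass_conv, sgk_mass, mul_one]
        refine conv_le_mass_mul (ih (insert l H) ?_ _ (hs.conv_sgk hlH) _ (conv_sgk_le hs hlH ha)) x
        rw [Finset.card_insert_of_notMem hlH]; omega
    rw [e1, e2]; refine (sum_le_sum fun l _ => hl l).trans ?_; rcases Nat.eq_zero_or_pos d with rfl | hd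
    · simp
    set c := mass (qf p N (⟨0, hd⟩ : Fin d)); have hdc : d * c ≤ ofReal β := qf_mass_le hβ N _
    have hsum : ∑ l, (if l ∈ H then (1:ENNReal) else 2⁻¹) ≤ d * ofReal (3 / 4) := by
      have : ∀ l, (if l ∈ H then (1:ENNReal) else 2⁻¹) = 2⁻¹ + if l ∈ H then 2⁻¹ else 0 := by
        intro l; split_ifs
        · rw [inv_two_add_inv_two]
        · simp
      simp [this]; rw [sum_add_distrib, Finset.sum_ite_mem, Finset.univ_inter, sum_const, sum_const]; simp [nsmul_eq_mul]
      have h2 : (2:ENNReal)⁻¹ = ofReal (1/2) := by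
        rw [one_div, ofReal_inv_of_pos (by norm_num)]; simp
      rw [h2, ← ofReal_natCast, ← ofReal_natCast, ← ofReal_mul (by positivity), ← ofReal_mul (by positivity),
        ← ofReal_mul (by positivity), ← ofReal_add (by positivity) (by positivity)]
      refine ofReal_le_ofReal ?_; have : (2:ℝ) * H.card ≤ d := by exact_mod_cast (by omega : 2 * H.card ≤ d)
      linarith
    calc ∑ l, mass (qf p N l) * ((if l ∈ H then 1 else 2⁻¹) * (a * B'))
        = c * (a * B') * ∑ l, (if l ∈ H then (1:ENNReal) else 2⁻¹) := by
          rw [mul_sum]; refine sum_congr rfl fun l _ => ?_; rw [fun l => qf_mass_eq p N l _]; ring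
      _ ≤ c * (a * B') * (d * ofReal (3 / 4)) := by gcongr
      _ = a * (B' * (ofReal (3/4) * (d * c))) := by ring
      _ ≤ a * (B' * (ofReal (3/4) * ofReal β)) := by gcongr
      _ = _ := by rw [hB', pow_succ, ← ofReal_mul (by norm_num)]; ring

/-- Product of the dyadic exit kernels at scales `i, …, i + k - 1`, each with multiplicity `n`. -/
def Pk (d : ℕ) (p : ℝ) (n : ℕ) : ℕ → ℕ → Fn d
  | _, 0 => dl
  | i, k + 1 => conv (cpow (qk p (2 ^ i)) n) (Pk d p n (i + 1) k)

lemma contr_Pk (hβ : PhiLe d p β) (hn : 2 * n ≤ d) (k) :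
    ∀ i, Contr (2 ^ i) (Pk d p n i k) ((ofReal (3 / 4 * β)) ^ (n * k)) := by
  induction k with
  | zero =>
    intro i s _ a ha x; rw [Pk, conv_dl]; simpa using ha x
  | succ k ih =>
    intro i s hs a ha x; have := contr_step hβ (by simp) (by rw [← pow_succ']; exact ih (i + 1)) n ∅ (by simp_all) s hs a ha x
    refine this.trans (le_of_eq ?_); rw [← pow_add]; ring_nf

lemma Pk_sup (hβ : PhiLe d p β) (hn : 2 * n ≤ d) (k) (x) :
    Pk d p n 0 k x ≤ (ofReal (3 / 4 * β)) ^ (n * k) := by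
  have := contr_Pk hβ hn k 0 dl (fun x hx l => ?_) 1 (fun x => ?_) x
  · rwa [dl_conv, one_mul] at this
  · have := rng_dl x hx l; simp_all
  · unfold dl; by_cases h : x = 0
    · simp_all
    · simp [h]

end

noncomputable section

variable {d : ℕ}
variable {x y z v w : V d}

/-! ### Counting nearest-neighbour walks -/

/-- Number of nearest-neighbour walks of length `n` from `0` to `x`. -/
def wc (d : ℕ) : ℕ → V d → ℕ
  | 0, x => if x = 0 then 1 else 0
  | n + 1, x => ∑ s : Fin d × Bool, wc d n (x - st s)

/-- The reversed step. -/
def flip (s : Fin d × Bool) : Fin d × Bool := (s.1, !s.2)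

lemma st_flip (s : Fin d × Bool) : st (flip s) = - st s := by
  rcases s with ⟨l, _ | _⟩ <;> simp [st, flip, ← Pi.single_neg]

lemma sc_st (s t : Fin d × Bool) : sc s (st t) = if t = s then 1 else if t = flip s then -1 else 0 := by
  rcases s with ⟨l, b⟩; rcases t with ⟨l', b'⟩
  by_cases h : l' = l
  · subst h; cases b <;> cases b' <;> simp [sc, st, flip]
  · have h' : l ≠ l' := fun h2 => h h2.symm; cases b <;> cases b' <;> simp [sc, st, flip, h, h']

lemma sum_sc_st (s) (f : Fin d × Bool → ℤ) : ∑ t, sc s (st t) * f t = f s - f (flip s) := by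
  have hne : s ≠ flip s := by rcases s with ⟨l, _ | _⟩ <;> simp [flip]
  have : ∀ t, sc s (st t) * f t = (if t = s then f s else 0) - (if t = flip s then f (flip s) else 0) := by
    intro t; rw [sc_st]; grind
  simp only [this]
  simp

lemma wc_identity (s) (n) : ∀ y : V d,
    sc s y * wc d n y = n * ((wc d (n - 1) (y - st s) : ℤ) - wc d (n - 1) (y + st s)) := by
  induction n with
  | zero =>
    intro y; by_cases h : y = 0
    · subst h; simp [sc]
    · simp [wc, h]
  | succ n ih =>
    intro y; rw [wc, Nat.add_sub_cancel]; push_cast; rw [mul_sum]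
    have h1 : ∀ t, sc s y * (wc d n (y - st t) : ℤ) =
        n * ((wc d (n - 1) (y - st s - st t) : ℤ) - wc d (n - 1) (y + st s - st t)) + sc s (st t) * wc d n (y - st t) := by
      intro t; have h2 := ih (y - st t); rw [sc_sub] at h2
      rw [show y - st s - st t = y - st t - st s by abel, show y + st s - st t = y - st t + st s by abel]; linarith
    rw [sum_congr rfl fun t _ => h1 t, sum_add_distrib, sum_sc_st s fun t => (wc d n (y - st t) : ℤ),
      ← mul_sum, Finset.sum_sub_distrib, st_flip, sub_neg_eq_add]
    rcases Nat.eq_zero_or_pos n with rfl | hn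
    · simp
    · obtain ⟨m, rfl⟩ : ∃ m, n = m + 1 := ⟨n - 1, by omega⟩; simp
      have e1 : ∀ z, ∑ t, (wc d m (z - st t) : ℤ) = wc d (m + 1) z := fun z => by rw [wc]; push_cast; rfl
      rw [e1, e1]; ring

lemma wc_le_of_height (h : sc s y = 1) : wc d (n + 1) y ≤ (n + 1) * wc d n (y - st s) := by
  have := wc_identity s (n + 1) y
  grind

lemma wc_support : ∀ x, wc d n x ≠ 0 → ∑ i, |x i| ≤ n := by
  induction n with
  | zero => intro x hx; have : x = 0 := by by_contra h; simp [wc, h] at hx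
            simp [this]
  | succ n ih =>
    intro x hx; obtain ⟨s, _, hs⟩ := Finset.exists_ne_zero_of_sum_ne_zero hx; have h1 := ih _ hs
    have h2 : Adjacent (x - st s) x := by
      have := adjacent_add_st (x - st s) s; simp_all
    unfold Adjacent at h2
    have h3 : ∑ i, |x i| ≤ ∑ i, |(x - st s) i| + ∑ i, |(x - st s) i - x i| := by
      rw [← sum_add_distrib]; refine sum_le_sum fun i _ => ?_
      calc |x i| = |(x - st s) i - ((x - st s) i - x i)| := by congr 1; ring
        _ ≤ _ := abs_sub _ _
    push_cast; linarith

/-- Constants in the walk-count bounds. -/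
def KK : ℕ → ℕ
  | 0 => 1
  | 1 => 1
  | n + 2 => 2 * (n + 2) * KK (n + 1) + 2 * (n + 1) * KK n

lemma wc_le (hd : 0 < d) (n) : ∀ x, wc d n x ≤ KK n * d ^ (n / 2) := by
  induction n using Nat.strong_induction_on with
  | _ n ih =>
  match n with
  | 0 => intro x; simp [wc, KK]; split_ifs <;> simp
  | 1 =>
    intro x; simp only [wc, KK, Nat.reduceDiv, pow_zero, mul_one]
    rw [Finset.sum_ite, Finset.sum_const_zero, add_zero, sum_const, smul_eq_mul, mul_one, Finset.card_le_one]; intro a ha b hb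
    simp only [mem_filter, Finset.mem_univ, true_and, sub_eq_zero] at ha hb; exact st_injective (ha.symm.trans hb)
  | n + 2 =>
    intro x; by_cases hx : wc d (n + 2) x = 0
    · omega
    have hsupp := wc_support x hx; set Z : Finset (Fin d) := Finset.univ.filter fun i => x i ≠ 0
    have hZ : Z.card ≤ n + 2 := by
      have : (Z.card : ℤ) ≤ ∑ i, |x i| := by
        calc (Z.card : ℤ) = ∑ i ∈ Z, 1 := by simp
          _ ≤ ∑ i ∈ Z, |x i| := sum_le_sum fun i hi => Int.one_le_abs (Finset.mem_filter.1 hi).2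
          _ ≤ _ := Finset.sum_le_sum_of_subset_of_nonneg (Finset.subset_univ _) fun _ _ _ => abs_nonneg _
      omega
    have hterm : ∀ s, wc d (n + 1) (x - st s) ≤
        (if s.1 ∈ Z then KK (n + 1) * d ^ ((n + 1) / 2) else 0) + (n + 1) * (KK n * d ^ (n / 2)) := by
      intro s; split_ifs with hs
      · grind
      · have hs' : x s.1 = 0 := by by_contra h; exact hs (by simp [Z, h])
        have h1 : sc (flip s) (x - st s) = 1 := by
          rcases s with ⟨l, _ | _⟩ <;> simp_all [sc, flip, st]
        have := wc_le_of_height (n := n) h1; rw [st_flip, sub_neg_eq_add, sub_add_cancel] at this; rw [zero_add]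
        exact this.trans (Nat.mul_le_mul_left _ (ih n (by omega) x))
    refine (sum_le_sum fun s _ => hterm s).trans ?_; rw [sum_add_distrib, sum_const, Fintype.sum_prod_type_right]
    simp only [Finset.sum_ite_mem, Finset.univ_inter, sum_const, card_univ, Fintype.card_bool,
      Fintype.card_prod, Fintype.card_fin, smul_eq_mul]
    have e2 : d ^ ((n + 1) / 2) ≤ d ^ (n / 2 + 1) := pow_le_pow_right hd (by omega)
    calc _ ≤ 2 * ((n + 2) * (KK (n + 1) * d ^ (n / 2 + 1))) + d * 2 * ((n + 1) * (KK n * d ^ (n / 2))) := by gcongr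
      _ = KK (n + 2) * d ^ (n / 2 + 1) := by rw [KK, pow_succ]; ring
      _ = _ := by rw [(show (n + 2) / 2 = n / 2 + 1 by omega)]

lemma cb_one : cb d 1 = {0} := by
  ext x
  rw [mem_cb, mem_singleton_iff]
  aesop

lemma gk_one (p) : (gk p 1 : Fn d) = dl := by
  ext x
  unfold gk
  rw [cb_one]
  by_cases h : x = 0
  · subst h; rw [tau_self p (mem_singleton _)]; simp [dl]
  · rw [tau_eq_zero_right p (by simp_all)]; simp [dl, h]

lemma qk_one (p) (z : V d) : qk p 1 z = J p 0 z := by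
  unfold qk Q
  split_ifs with h
  · rw [cb_one] at h; rw [mem_singleton_iff.1 h, J, if_neg (not_adjacent_self 0)]
  · rw [tsum_eq_single 0]
    · rw [tau_self p (by tauto), one_mul]
    · intro y hy; rw [tau_eq_zero_right p (by rw [cb_one]; simpa using hy), zero_mul]

lemma conv_qk_one (p) (f) (x : V d) : conv (qk p 1) f x = ∑ s, wt p true * f (x - st s) := by
  unfold conv
  simp [qk_one]
  rw [tsum_J p 0 fun y => f (x - y)]
  simp

lemma cpow_qk_one (p) (n) : ∀ x, cpow (qk p 1) n x = wt p true ^ n * wc d n x := by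
  induction n with
  | zero => intro x; by_cases h : x = 0
            · subst h; simp [cpow, dl, wc]
            · simp [cpow, dl, wc, h]
  | succ n ih =>
    intro x; rw [cpow, conv_qk_one, wc]; push_cast; rw [mul_sum]; refine sum_congr rfl fun s _ => ?_; rw [ih, pow_succ]; ring

lemma mass_qk_one (p) : mass (qk p 1 : Fn d) = 2 * d * wt p true := by
  unfold mass
  have := tsum_J p (0 : V d) fun _ => 1
  simp only [mul_one] at this
  simp only [qk_one, this, sum_const, card_univ, Fintype.card_prod, Fintype.card_fin, Fintype.card_bool, nsmul_eq_mul]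
  grind

lemma wt_le_inv (hβ : PhiLe d p β) (h1 : β ≤ 1.04) (hd : 0 < d) : wt p true ≤ ofReal (1 / d) := by
  have hd' : (0:ℝ) < d := by positivity
  have h2 : (2 * d : ENNReal) * wt p true ≤ (2 * d : ENNReal) * ofReal (1 / d) := by
    refine ((mass_qk_one p).symm.le.trans (qk_mass hβ 1)).trans ?_
    rw [show (2 * d : ENNReal) = ofReal (2 * d) by rw [ofReal_mul (by norm_num)]; simp, ← ofReal_mul (by simp)]; refine ofReal_le_ofReal (h1.trans ?_)
    grind
  exact (ENNReal.mul_le_mul_iff_right (by positivity) (mul_ne_top (by simp) (by simp))).1 h2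

lemma cpow_qk_one_le (hβ : PhiLe d p β) (h1 : β ≤ 1.04) (hd : 0 < d) (n) (x : V d) :
    cpow (qk p 1) n x ≤ ofReal (KK n / (d:ℝ) ^ ((n + 1) / 2)) := by
  rw [cpow_qk_one]
  calc _ ≤ ofReal (1 / d) ^ n * ((KK n * d ^ (n / 2) : ℕ) : ENNReal) := by
        gcongr; exacts [wt_le_inv hβ h1 hd, wc_le hd n x]
    _ = ofReal ((1 / d) ^ n * (KK n * d ^ (n / 2) : ℕ)) := by
        rw [ofReal_mul (by simp), ofReal_pow (by simp), ofReal_natCast]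
    _ ≤ _ := by
        refine ofReal_le_ofReal (le_of_eq ?_); push_cast
        rw [one_div, inv_pow, (show (d:ℝ) ^ n = d ^ (n / 2) * d ^ ((n + 1) / 2) by rw [← pow_add]; congr 1; omega)]; field_simp

end

noncomputable section

variable {d : ℕ}
variable {x y z v w : V d}

lemma tt_le_iter (hchi : chi d p ≠ ⊤) (hN : 0 < N) (m) (x : V d) :
    tt p x ≤ conv (fun x => ∑ t ∈ Finset.range m, cpow (qk p N) t x) (gk p N) x + conv (cpow (qk p N) m) (tt p) x := by
  induction m generalizing x with
  | zero => simp [cpow, dl_conv]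
  | succ m ih =>
    refine (ih x).trans ?_
    have h1 : conv (cpow (qk p N) m) (tt p) x ≤
        conv (cpow (qk p N) m) (gk p N) x + conv (cpow (qk p N) (m + 1)) (tt p) x := by
      refine (conv_mono (fun _ => le_rfl) (tt_le_cube hchi hN) x).trans (le_of_eq ?_); rw [conv_add, cpow, conv_assoc, conv_left_comm]
    refine (add_le_add le_rfl h1).trans (le_of_eq ?_); rw [← add_assoc, sum_conv, sum_conv, Finset.sum_range_succ]

lemma Pk_succ_right (p) (n k) : ∀ i, Pk d p n i (k + 1) = conv (Pk d p n i k) (cpow (qk p (2 ^ (i + k))) n) := by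
  induction k with
  | zero => intro i; simp [Pk, conv_dl, dl_conv, add_zero]
  | succ k ih =>
    intro i; rw [Pk, ih (i + 1), ← conv_assoc, ← Pk, show i + 1 + k = i + (k + 1) by ring]

/-- Walk-plus-cubes kernel preceding level `j`. -/
def Rk (d : ℕ) (p : ℝ) (T n j : ℕ) : Fn d := conv (cpow (qk p 1) T) (Pk d p n 0 j)

/-- Multiscale decomposition of the two-point function. -/
def lev (d : ℕ) (p : ℝ) (T n : ℕ) : ℕ → Fn d
  | 0 => fun x => ∑ t ∈ Finset.range T, cpow (qk p 1) t x
  | j + 1 => conv (Rk d p T n j) (conv (fun x => ∑ t ∈ Finset.range n, cpow (qk p (2 ^ j)) t x) (gk p (2 ^ j)))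

/-- The decomposition at the scales used in dimension `d`. -/
abbrev lv (d : ℕ) (p : ℝ) := lev d p 26 (d / 2)

lemma tt_le_levs (hchi : chi d p ≠ ⊤) (T n k) (x) :
    tt p x ≤ ∑ j ∈ Finset.range (k + 1), lev d p T n j x + conv (Rk d p T n k) (tt p) x := by
  induction k generalizing x with
  | zero =>
    have := tt_le_iter hchi one_pos T x; rw [gk_one, conv_dl] at this; simpa [lev, Rk, Pk, conv_dl] using this
  | succ k ih =>
    refine (ih x).trans ?_; rw [Finset.sum_range_succ _ (k + 1), add_assoc]; refine add_le_add le_rfl ?_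
    refine (conv_mono (fun _ => le_rfl) (tt_le_iter hchi (N := 2 ^ k) (by simp) n) x).trans (le_of_eq ?_)
    rw [conv_add, lev, Rk, Rk, Pk_succ_right, zero_add]; simp [conv_assoc]

lemma Rk_sup (hβ : PhiLe d p β) (T) (hn : 2 * n ≤ d) (k) (x) :
    Rk d p T n k x ≤ ofReal β ^ T * (ofReal (3 / 4 * β)) ^ (n * k) := by
  refine (conv_le_mass_mul (Pk_sup hβ hn k) x).trans ?_
  gcongr
  rw [mass_cpow]; gcongr; exact qk_mass hβ 1

lemma tt_le_tsum_lev (hchi : chi d p ≠ ⊤) (hβ : PhiLe d p β) (h1 : β ≤ 1.04) (T) (hn : 2 * n ≤ d)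
    (hn0 : 0 < n) (x) : tt p x ≤ ∑' j, lev d p T n j x := by
  have h : ∀ k, tt p x ≤ ∑' j, lev d p T n j x + ofReal β ^ T * chi d p * (ofReal (3/4 * β)) ^ k := by
    intro k; refine (tt_le_levs hchi T n k x).trans (add_le_add (sum_le_tsum _) ?_); refine (conv_le_mul_mass (Rk_sup hβ T hn k) x).trans ?_
    have h2 : (ofReal (3 / 4 * β)) ^ (n * k) ≤ (ofReal (3 / 4 * β)) ^ k := by
      refine pow_le_pow_of_le_one (zero_le) ?_ (Nat.le_mul_of_pos_left k hn0); rw [← ofReal_one]; exact ofReal_le_ofReal (by linarith)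
    calc _ ≤ ofReal β ^ T * (ofReal (3 / 4 * β)) ^ k * chi d p := by gcongr; exact le_rfl
      _ = _ := by ring
  have hlim : Tendsto (fun k => ∑' j, lev d p T n j x + ofReal β ^ T * chi d p * (ofReal (3/4 * β)) ^ k)
      atTop (nhds (∑' j, lev d p T n j x + ofReal β ^ T * chi d p * 0)) := by
    refine Filter.Tendsto.const_add _ (ENNReal.Tendsto.const_mul ?_ (.inr ?_))
    · refine ENNReal.tendsto_pow_atTop_nhds_zero_of_lt_one ?_; rw [← ofReal_one]; exact (ENNReal.ofReal_lt_ofReal_iff one_pos).2 (by linarith)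
    · exact mul_ne_top (pow_ne_top ofReal_ne_top) hchi
  rw [mul_zero, add_zero] at hlim
  exact ge_of_tendsto' hlim h

lemma chi_le_of_small (hchi : chi d p ≠ ⊤) (h : 2 * d * wt p true ≤ ofReal (1 / 4)) : chi d p ≤ 2 := by
  have h1 : chi d p ≤ 1 + 2 * d * wt p true * chi d p := by
    have := mass_mono (tt_le_cube hchi one_pos); rw [gk_one] at this
    have e : mass (fun x : V d => dl x + conv (qk p 1) (tt p) x) = 1 + 2 * d * wt p true * chi d p := by
      unfold mass; rw [tsum_add]; change mass dl + mass (conv (qk p 1) (tt p)) = _; rw [mass_dl, mass_conv, mass_qk_one]; rfl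
    aesop
  have h2 : chi d p ≤ 1 + ofReal (1 / 4) * chi d p := h1.trans (by gcongr)
  lift chi d p to NNReal using hchi with c
  rw [ofReal] at h2
  norm_cast at h2 ⊢
  rw [← NNReal.coe_le_coe] at h2 ⊢
  push_cast [coe_toNNReal (1/4:ℝ) (by norm_num)] at h2 ⊢
  linarith

lemma xs_zero_le_five (hchi : chi d p ≠ ⊤) (hβ : PhiLe d p β) (h1 : β ≤ 1.04) (l : Fin d) : xs p l 0 ≤ 5 * d := by
  have hd : 0 < d := Fin.pos l
  rcases le_total (2 * d * wt p true) (ofReal (1 / 4)) with h | h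
  · refine (xs_le_chi p l 0).trans ((chi_le_of_small hchi h).trans ?_); exact_mod_cast by omega
  · have h2 := (xs_zero_le hβ l).trans (ofReal_le_ofReal h1); have hw := wt_ne_top p true
    lift xs p l 0 to NNReal using (ne_top_of_le_ne_top hchi (xs_le_chi _ _ _)) with a; lift wt p true to NNReal using hw with b; rw [ofReal] at h h2
    norm_cast at h h2 ⊢; rw [← NNReal.coe_le_coe] at h h2 ⊢
    push_cast [coe_toNNReal (1/4:ℝ) (by norm_num), coe_toNNReal (1.04:ℝ) (by norm_num)] at h h2 ⊢; nlinarith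

/-- Standing assumptions for the multiscale estimates. -/
structure Std (d : ℕ) (p β G : ℝ) : Prop where
  chi : chi d p ≠ ⊤
  phi : PhiLe d p β
  one : 1 ≤ β
  le : β ≤ 1.04
  G1 : 1 ≤ G
  pow : β ^ d ≤ G
  d26 : 26 ≤ d

variable {p β G : ℝ}

lemma Std.pow_le (h : Std d p β G) (hk : k ≤ d) : β ^ k ≤ G := (pow_le_pow_right₀ h.one hk).trans h.pow

lemma Std.mass_cpow (h : Std d p β G) (N) (hk : k ≤ d) : mass (cpow (qk p N : Fn d) k) ≤ ofReal G := by
  rw [Perc.mass_cpow]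
  calc _ ≤ ofReal β ^ k := by gcongr; exact qk_mass h.phi N
    _ = ofReal (β ^ k) := (ofReal_pow (zero_le_one.trans h.one) k).symm
    _ ≤ _ := ofReal_le_ofReal (h.pow_le hk)

lemma Std.mass_sum (h : Std d p β G) (N) (hn : n ≤ d) :
    mass (fun x : V d => ∑ t ∈ Finset.range n, cpow (qk p N) t x) ≤ ofReal (d * G) := by
  unfold mass
  rw [Summable.tsum_finsetSum fun _ _ => ENNReal.summable]
  calc _ ≤ ∑ t ∈ Finset.range n, ofReal G := sum_le_sum fun t ht => h.mass_cpow N (by grind)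
    _ = n * ofReal G := by simp
    _ ≤ d * ofReal G := by gcongr
    _ = _ := by simp

lemma Std.mass_Pk (h : Std d p β G) (hn : n ≤ d) (k) : ∀ i, mass (Pk d p n i k) ≤ ofReal (G ^ k) := by
  have hG := h.G1
  induction k with
  | zero => intro i; simp [Pk, mass_dl]
  | succ k ih =>
    intro i; rw [Pk, mass_conv, pow_succ', ofReal_mul (by linarith)]; exact mul_le_mul' (h.mass_cpow _ hn) (ih _)

lemma Std.mass_gk (h : Std d p β G) (j) : mass (gk p (2 ^ j) : Fn d) ≤ ofReal (5 ^ j * (5 * d)) := by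
  have h1 := gk_mass_le p (⟨0, by have := h.d26; omega⟩ : Fin d) (N := 2 ^ j)
  refine h1.trans ((xs_pow h.chi h.phi (zero_le_one.trans h.one) h.le _ j).trans ?_)
  simp [ofReal_natCast]
  gcongr
  exact xs_zero_le_five h.chi h.phi h.le _

/-- Mass bounds of the levels. -/
def mu' (d : ℕ) (G : ℝ) (m : ℕ) : ℝ := 5 * d ^ 2 * G ^ 2 * (5 * G) ^ m

lemma mu'_mono (hG : 1 ≤ G) (h : i ≤ j) : mu' d G i ≤ mu' d G j := by
  unfold mu'; gcongr; linarith

lemma Std.tail_mass (h : Std d p β G) (hn : n ≤ d) (j) :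
    mass (conv (fun x : V d => ∑ t ∈ Finset.range n, cpow (qk p (2 ^ j)) t x) (gk p (2 ^ j))) ≤
      ofReal (5 * G * d ^ 2 * 5 ^ j) := by
  have hG := h.G1
  rw [mass_conv, show (5 * G * d ^ 2 * 5 ^ j : ℝ) = (d * G) * (5 ^ j * (5 * d)) by ring, ofReal_mul (by positivity)]
  exact mul_le_mul' (h.mass_sum _ hn) (h.mass_gk j)

lemma Std.lev_mass (h : Std d p β G) (hn : n ≤ d) (m) : mass (lev d p 26 n m) ≤ ofReal (mu' d G m) := by
  have hG := h.G1
  have hd : (26:ℝ) ≤ d := by exact_mod_cast h.d26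
  cases m with
  | zero =>
    refine (h.mass_sum 1 h.d26).trans (ofReal_le_ofReal ?_); unfold mu'
    calc (d:ℝ) * G ≤ (d * G) * (5 * d * G) := le_mul_of_one_le_right (by positivity) (by nlinarith)
      _ = _ := by ring
  | succ j =>
    rw [lev, mass_conv, Rk, mass_conv]; refine (mul_le_mul' (mul_le_mul' (h.mass_cpow 1 h.d26) (h.mass_Pk hn j 0)) (h.tail_mass hn j)).trans ?_
    rw [← ofReal_mul (by linarith), ← ofReal_mul (by positivity)]; refine ofReal_le_ofReal ?_; unfold mu'
    calc G * G ^ j * (5 * G * d ^ 2 * 5 ^ j) = (5 * d ^ 2 * G ^ 2 * (5 ^ j * G ^ j)) := by ring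
      _ ≤ (5 * d ^ 2 * G ^ 2 * (5 ^ j * G ^ j)) * (5 * G) := le_mul_of_one_le_right (by positivity) (by linarith)
      _ = _ := by ring

/-- Sup bounds of the levels (from level one on). -/
def si (d : ℕ) (G : ℝ) : ℕ → ℝ
  | 0 => 0
  | 1 => KK 26 / d ^ 13 * (5 * G * d ^ 2)
  | j + 2 => G * (0.78 ^ (d / 2)) ^ (j + 1) * (5 * G * d ^ 2 * 5 ^ (j + 1))

lemma Std.lev_sup (h : Std d p β G) (hm : 1 ≤ m) (x) : lv d p m x ≤ ofReal (si d G m) := by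
  have hG := h.G1
  match m, hm with
  | 1, _ =>
    rw [lv, lev, si, ofReal_mul (by positivity)]
    have h1 : ∀ x, Rk d p 26 (d / 2) 0 x ≤ ofReal (KK 26 / d ^ 13) := by
      intro x; rw [Rk, Pk, conv_dl]; exact cpow_qk_one_le h.phi h.le (by have := h.d26; omega) 26 x
    refine (conv_le_mul_mass h1 x).trans ?_; gcongr; have := h.tail_mass (Nat.div_le_self d 2) 0; simp_all
  | j + 2, _ =>
    rw [lv, lev, si, ofReal_mul (by positivity)]
    have h1 : ∀ x, Rk d p 26 (d / 2) (j + 1) x ≤ ofReal (G * (0.78 ^ (d / 2)) ^ (j + 1)) := by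
      intro x; refine (Rk_sup h.phi 26 (by omega) (j + 1) x).trans ?_; have hβ0 : 0 ≤ β := zero_le_one.trans h.one
      rw [← ofReal_pow hβ0, ← ofReal_pow (by linarith), ← ofReal_mul (by positivity), ← pow_mul]
      exact ofReal_le_ofReal (mul_le_mul (h.pow_le h.d26) (pow_le_pow_left₀ (by linarith) (by linarith [h.le]) _) (by positivity) (by linarith))
    refine (conv_le_mul_mass h1 x).trans ?_; gcongr; exact h.tail_mass (Nat.div_le_self d 2) (j + 1)

lemma rng_Pk (p) (n k) : ∀ i, Rng (n * (2 ^ (i + k) - 2 ^ i)) (Pk d p n i k) := by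
  induction k with
  | zero => intro i; exact rng_dl.mono (Nat.zero_le _)
  | succ k ih =>
    intro i
    refine (((rng_qk p (2 ^ i)).cpow n).conv (ih (i + 1))).mono ?_
    rw [← mul_add]
    refine Nat.mul_le_mul_left _ ?_
    have h1 : 2 ^ (i + 1) ≤ 2 ^ (i + 1 + k) := pow_le_pow_right (by norm_num) (by omega)
    grind

lemma rng_sum (s) {f : ι → Fn d} (h : ∀ i ∈ s, Rng ρ (f i)) : Rng ρ (fun x => ∑ i ∈ s, f i x) := by
  intro x hx l
  aesop

lemma rng_cpow_sum (p) (n N) : Rng (n * N) (fun x : V d => ∑ t ∈ Finset.range n, cpow (qk p N) t x) :=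
  rng_sum _ fun t ht => ((rng_qk p N).cpow t).mono (Nat.mul_le_mul_right _ (Finset.mem_range.1 ht).le)

lemma lev_rng (hd : 26 ≤ d) (p) (m) : Rng (3 * d * 2 ^ m) (lv d p m) := by
  cases m with
  | zero => exact (rng_cpow_sum p 26 1).mono (by omega)
  | succ j =>
    refine ((((rng_qk p 1).cpow 26).conv (rng_Pk p (d / 2) j 0)).conv
      ((rng_cpow_sum p (d / 2) (2 ^ j)).conv (rng_gk p (2 ^ j)))).mono ?_
    have h1 : 1 ≤ 2 ^ j := Nat.one_le_two_pow; have h2 : d / 2 * (2 ^ (0 + j) - 2 ^ 0) ≤ d * 2 ^ j := Nat.mul_le_mul (Nat.div_le_self d 2) (by simp)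
    have h3 : d / 2 * 2 ^ j ≤ d * 2 ^ j := Nat.mul_le_mul_right _ (Nat.div_le_self d 2); rw [pow_succ]; nlinarith

end

noncomputable section

variable {d : ℕ}
variable {x y z v w : V d}
variable {p β G : ℝ}

lemma tsum_half_pow : ∑' i, (2⁻¹ : ENNReal) ^ i = 2 := by
  simp

lemma triple_sum_le {F : ℕ → ℕ → ℕ → ENNReal} (h0 : F 0 0 0 ≤ a)
    (h1 : ∀ i j k m : ℕ, 1 ≤ m → i ≤ m → j ≤ m → k ≤ m → (i = m ∨ j = m ∨ k = m) → F i j k ≤ e * (8⁻¹) ^ m) :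
    ∑' i, ∑' j, ∑' k, F i j k ≤ a + 8 * e := by
  have key : ∀ i j k, F i j k ≤ (if i = 0 then (if j = 0 then (if k = 0 then a else 0) else 0) else 0) +
      e * (2⁻¹ ^ i * (2⁻¹ ^ j * 2⁻¹ ^ k)) := by
    intro i j k; by_cases hz : i = 0 ∧ j = 0 ∧ k = 0
    · obtain ⟨rfl, rfl, rfl⟩ := hz; simpa using h0.trans le_self_add
    · refine le_trans ?_ le_add_self; obtain ⟨m, hm⟩ : ∃ m, m = max i (max j k) := ⟨_, rfl⟩
      have := h1 i j k m (by omega) (by omega) (by omega) (by omega) (by omega); refine this.trans ?_; rw [← pow_add, ← pow_add]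
      refine mul_le_mul' le_rfl ?_; rw [(show (8:ENNReal)⁻¹ = 2⁻¹ ^ 3 by rw [← ENNReal.inv_pow]; norm_num), ← pow_mul]
      exact pow_le_pow_of_le_one (zero_le) (ENNReal.inv_le_one.2 (by norm_num)) (by omega)
  refine (tsum_le_tsum fun i => tsum_le_tsum fun j => tsum_le_tsum fun k => key i j k).trans (le_of_eq ?_)
  simp [tsum_add, tsum_mul_left, tsum_mul_right]
  congr 1
  · rw [tsum_eq_single 0 (fun i hi => by simp [hi]), tsum_eq_single 0 (fun i hi => by simp [hi]), tsum_eq_single 0 (fun i hi => by simp [hi])]; simp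
  · rw [mul_comm e]; norm_num

/-- Numerical smallness of the higher levels. -/
def NumOK (d : ℕ) (G : ℝ) : Prop :=
  ∀ m, 1 ≤ m → (3 * d * 2 ^ m : ℝ) ^ 3 * (si d G m * mu' d G m ^ 2) ≤ 1 / d ^ 3 * (8⁻¹) ^ m

lemma si_nonneg (hG : 1 ≤ G) : ∀ m, 0 ≤ si d G m
  | 0 => le_rfl
  | 1 => by unfold si; positivity
  | j + 2 => by unfold si; positivity

lemma numOK_of (hG : 1 ≤ G) (h1 : 675 * 1600 * 8 * 5 * KK 26 * G ^ 7 ≤ d) (h2 : 8000 * 8 * G ^ 2 * 0.78 ^ (d / 2) ≤ (1:ℝ))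
    (h3 : 100000000 * d ^ 12 * G ^ 8 * (8000 * 8 * G ^ 2 * 0.78 ^ (d / 2)) ≤ (1:ℝ)) (hd : 0 < d) : NumOK d G := by
  intro m hm
  have hr : ∀ m, (3 * d * 2 ^ m : ℝ) ^ 3 * mu' d G m ^ 2 * 8 ^ m = 675 * d ^ 7 * G ^ 4 * (1600 * G ^ 2) ^ m := by
    intro m; unfold mu'
    have : (1600 * G ^ 2) ^ m = ((2:ℝ) ^ m) ^ 3 * ((5 * G) ^ m) ^ 2 * 8 ^ m := by
      rw [show (1600 * G ^ 2 : ℝ) = 2 ^ 3 * (5 * G) ^ 2 * 8 by ring, mul_pow, mul_pow, pow_right_comm, pow_right_comm (5 * G)]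
    grind
  rw [(show ∀ m, ((8:ℝ)⁻¹) ^ m = 1 / 8 ^ m from fun m => by simp), div_mul_div_comm, one_mul, le_div_iff₀ (by positivity)]
  have : (3 * d * 2 ^ m : ℝ) ^ 3 * (si d G m * mu' d G m ^ 2) * (d ^ 3 * 8 ^ m) =
      (675 * d ^ 7 * G ^ 4 * (1600 * G ^ 2) ^ m) * si d G m * d ^ 3 := by grind
  rw [this]
  match m, hm with
  | 1, _ =>
    unfold si; rw [pow_one]
    have : 675 * (d:ℝ) ^ 7 * G ^ 4 * (1600 * G ^ 2) * (KK 26 / d ^ 13 * (5 * G * d ^ 2)) * d ^ 3 = (675 * 1600 * 5 * KK 26 * G ^ 7) / d := by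
      field_simp
    rw [this, div_le_one (by positivity)]; nlinarith
  | j + 2, _ =>
    unfold si; set r := (0.78 : ℝ) ^ (d / 2)
    have : 675 * (d:ℝ) ^ 7 * G ^ 4 * (1600 * G ^ 2) ^ (j + 2) * (G * r ^ (j + 1) * (5 * G * d ^ 2 * 5 ^ (j + 1))) * d ^ 3 =
       (5400000 * d ^ 12 * G ^ 8 * (8000 * G ^ 2 * r)) * (8000 * G ^ 2 * r) ^ j := by
      rw [pow_succ (1600 * G ^ 2) (j + 1), pow_succ (1600 * G ^ 2) j, pow_succ r, pow_succ 5,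
        show (8000 * G ^ 2 * r) ^ j = (1600 * G ^ 2) ^ j * r ^ j * 5 ^ j by rw [← mul_pow, ← mul_pow]; ring]
      ring
    rw [this]; have ha : (8000 * G ^ 2 * r) ^ j ≤ 1 := pow_le_one₀ (by positivity) (by nlinarith)
    have hb : 5400000 * (d:ℝ) ^ 12 * G ^ 8 * (8000 * G ^ 2 * r) ≤ 1 := by
      nlinarith
    exact mul_le_one₀ hb (by positivity) ha

/-- Triangle diagram with a weight on the first vertex. -/
def Dg (w f g h : Fn d) (e : V d) : ENNReal := ∑' y, w y * (f y * conv g h (y + e))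

lemma conv_mono_levs (h : ∀ x, tt p x ≤ ∑' j, lv d p j x) (z) :
    conv (tt p) (tt p) z ≤ ∑' j, ∑' k, conv (lv d p j) (lv d p k) z := by
  refine (conv_mono h h z).trans (le_of_eq ?_)
  rw [tsum_conv]
  refine tsum_congr fun j => ?_
  rw [conv_comm, tsum_conv]
  exact tsum_congr fun k => by rw [conv_comm]

lemma Dg_le_levs (h : ∀ x, tt p x ≤ ∑' j, lv d p j x) (w) (e) :
    Dg w (tt p) (tt p) (tt p) e ≤
      ∑' i, ∑' j, ∑' k, Dg w (lv d p i) (lv d p j) (lv d p k) e := by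
  have : Dg w (tt p) (tt p) (tt p) e ≤ ∑' y, ∑' i, ∑' j, ∑' k, w y * (lv d p i y * conv (lv d p j) (lv d p k) (y + e)) := by
    refine tsum_le_tsum fun y => ?_; refine (mul_le_mul' le_rfl (mul_le_mul' (h y) (conv_mono_levs h (y + e)))).trans (le_of_eq ?_)
    simp [tsum_mul_left, tsum_mul_right]
  refine this.trans (le_of_eq ?_)
  rw [tsum_comm]
  refine tsum_congr fun i => ?_
  rw [tsum_comm]
  refine tsum_congr fun j => ?_
  rw [tsum_comm]
  rfl

lemma Std.lev_mass' (h : Std d p β G) (hi : i ≤ m) : mass (lv d p i) ≤ ofReal (mu' d G m) :=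
  (h.lev_mass (Nat.div_le_self d 2) i).trans (ofReal_le_ofReal (mu'_mono h.G1 hi))

lemma Std.lev_triple (h : Std d p β G) (hm : 1 ≤ m) (hi : i ≤ m) (hj : j ≤ m) (hk : k ≤ m) (hor : i = m ∨ j = m ∨ k = m) (e) :
    ∑' y, lv d p i y * conv (lv d p j) (lv d p k) (y + e) ≤ ofReal (si d G m * mu' d G m ^ 2) := by
  have hG := h.G1
  rw [ofReal_mul (si_nonneg hG m), pow_two, ofReal_mul (by unfold mu'; positivity)]
  set s := ofReal (si d G m)
  set M := ofReal (mu' d G m)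
  have hsh : ∑' y, conv (lv d p j) (lv d p k) (y + e) = mass (conv (lv d p j) (lv d p k)) :=
    (Equiv.addRight e).tsum_eq (conv (lv d p j) (lv d p k))
  rcases hor with rfl | hor
  · calc _ ≤ ∑' y, s * conv (lv d p j) (lv d p k) (y + e) :=
          tsum_le_tsum fun y => mul_le_mul' (h.lev_sup hm y) le_rfl
      _ = s * (mass (lv d p j) * mass (lv d p k)) := by rw [tsum_mul_left, hsh, mass_conv]
      _ ≤ _ := mul_le_mul' le_rfl (mul_le_mul' (h.lev_mass' hj) (h.lev_mass' hk))
  · have hb : ∀ x, conv (lv d p j) (lv d p k) x ≤ s * M := by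
      intro x; rcases hor with rfl | rfl
      · exact (conv_le_mul_mass (h.lev_sup hm) x).trans (mul_le_mul' le_rfl (h.lev_mass' hk))
      · rw [mul_comm]; exact (conv_le_mass_mul (h.lev_sup hm) x).trans (mul_le_mul' (h.lev_mass' hj) le_rfl)
    calc _ ≤ ∑' y, lv d p i y * (s * M) := tsum_le_tsum fun y => mul_le_mul' le_rfl (hb _)
      _ = mass (lv d p i) * (s * M) := by rw [tsum_mul_right]; rfl
      _ ≤ M * (s * M) := mul_le_mul' (h.lev_mass' hi) le_rfl
      _ = _ := by ring

lemma Std.pos (h : Std d p β G) : (0:ℝ) < d := by have := h.d26; exact_mod_cast (by omega)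

lemma ofReal_eighth (a) (m) (ha : 0 ≤ a) : ofReal (a * (8⁻¹) ^ m) = ofReal a * (8⁻¹) ^ m := by
  rw [ofReal_mul ha, ofReal_pow (by norm_num), ofReal_inv_of_pos (by norm_num)]; simp

lemma Std.lev_num (_h : Std d p β G) (hN : NumOK d G) (hm : 1 ≤ m) (hW : W ≤ ((3 * d * 2 ^ m : ℕ) : ENNReal) ^ 3)
    (hT : T ≤ ofReal (si d G m * mu' d G m ^ 2)) : W * T ≤ ofReal (1 / d ^ 3) * (8⁻¹) ^ m := by
  rw [← ofReal_eighth _ _ (by simp)]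
  refine (mul_le_mul' hW hT).trans ?_
  rw [← ofReal_natCast, ← ofReal_pow (by simp), ← ofReal_mul (by positivity)]
  refine ofReal_le_ofReal ?_
  push_cast
  tauto

lemma Std.tt_levs (h : Std d p β G) (x) : tt p x ≤ ∑' j, lv d p j x :=
  tt_le_tsum_lev h.chi h.phi h.le 26 (by omega) (by have := h.d26; omega) x

lemma Std.Dg_le (h : Std d p β G) (hN : NumOK d G) {w : Fn d} (hw : ∀ ρ : ℕ, 1 ≤ ρ → ∀ y : V d, (∀ l, |y l| ≤ ρ) → w y ≤ (ρ : ENNReal) ^ 3)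
    (h0 : Dg w (lv d p 0) (lv d p 0) (lv d p 0) e ≤ a) :
    Dg w (tt p) (tt p) (tt p) e ≤ a + 8 * ofReal (1 / d ^ 3) := by
  refine (Dg_le_levs h.tt_levs w e).trans (triple_sum_le h0 fun i j k m hm hi hj hk hor => ?_)
  refine le_trans ?_ (h.lev_num hN hm le_rfl (h.lev_triple hm hi hj hk hor e))
  rw [← tsum_mul_left]
  refine tsum_le_tsum fun y => ?_
  by_cases hy : lv d p i y = 0
  · simp [hy]
  · refine mul_le_mul' (hw _ ?_ y fun l => ((lev_rng h.d26 p i).mono ?_) y hy l) le_rfl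
    · have := h.d26; have : 1 ≤ 2 ^ m := Nat.one_le_two_pow; nlinarith [this]
    · exact Nat.mul_le_mul_left _ (pow_le_pow_right (by norm_num) hi)

lemma wc_neg (n) : ∀ x, wc d n (-x) = wc d n x := by
  induction n with
  | zero => intro x; simp [wc]
  | succ n ih =>
    intro x; simp [wc]; rw [← Equiv.sum_comp (show Function.Involutive flip from fun s => by simp [flip]).toPerm]; refine sum_congr rfl fun s _ => ?_
    change wc d n (-x - st (flip s)) = _; rw [st_flip, ← ih]; congr 1; ring

lemma cpow_qk_neg (p) (n) (x : V d) : cpow (qk p 1) n (-x) = cpow (qk p 1) n x := by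
  rw [cpow_qk_one, cpow_qk_one, wc_neg]

lemma Dg_walk (p) (a b c) (e : V d) :
    ∑' y, cpow (qk p 1) a y * conv (cpow (qk p 1) b) (cpow (qk p 1) c) (y + e) = cpow (qk p 1) (a + (b + c)) e := by
  rw [cpow_add, cpow_add]
  rw [← (Equiv.neg (V d)).tsum_eq]
  refine tsum_congr fun y => ?_
  rw [Equiv.neg_apply, cpow_qk_neg, neg_add_eq_sub]

/-- Constant dominating walk counts up to the relevant length. -/
def Kx : ℕ := ∑ n ∈ Finset.range 78, KK n

lemma KK_le_Kx (h : n < 78) : KK n ≤ Kx := single_le_sum (fun _ _ => Nat.zero_le _) (Finset.mem_range.2 h)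

lemma Dg_sum (w) (f : ℕ → Fn d) (T) (e) :
    Dg w (fun x => ∑ t ∈ Finset.range T, f t x) (fun x => ∑ t ∈ Finset.range T, f t x) (fun x => ∑ t ∈ Finset.range T, f t x) e =
      ∑ a ∈ Finset.range T, ∑ b ∈ Finset.range T, ∑ c ∈ Finset.range T, Dg w (f a) (f b) (f c) e := by
  unfold Dg
  have hc : ∀ z, conv (fun x => ∑ t ∈ Finset.range T, f t x) (fun x => ∑ t ∈ Finset.range T, f t x) z =
      ∑ b ∈ Finset.range T, ∑ c ∈ Finset.range T, conv (f b) (f c) z := by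
    intro z; rw [sum_conv]; refine sum_congr rfl fun j _ => ?_; rw [conv_comm, sum_conv]; exact sum_congr rfl fun k _ => by rw [conv_comm]
  have hs : ∀ y, w y * ((∑ t ∈ Finset.range T, f t y) * ∑ b ∈ Finset.range T, ∑ c ∈ Finset.range T, conv (f b) (f c) (y + e)) =
      ∑ a ∈ Finset.range T, ∑ b ∈ Finset.range T, ∑ c ∈ Finset.range T, w y * (f a y * conv (f b) (f c) (y + e)) := by
    intro y; rw [sum_mul, mul_sum]; refine sum_congr rfl fun a _ => ?_; rw [mul_sum, mul_sum]; refine sum_congr rfl fun b _ => ?_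
    rw [mul_sum, mul_sum]
  simp [hc, hs]
  rw [Summable.tsum_finsetSum fun _ _ => ENNReal.summable]
  refine sum_congr rfl fun a _ => ?_
  rw [Summable.tsum_finsetSum fun _ _ => ENNReal.summable]
  refine sum_congr rfl fun b _ => ?_
  rw [Summable.tsum_finsetSum fun _ _ => ENNReal.summable]

lemma sum_range_triple_le {F : ℕ → ℕ → ℕ → ENNReal} (h : ∀ i < T, ∀ j < T, ∀ k < T, F i j k ≤ c) :
    ∑ i ∈ Finset.range T, ∑ j ∈ Finset.range T, ∑ k ∈ Finset.range T, F i j k ≤ T ^ 3 * c := by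
  calc _ ≤ ∑ i ∈ Finset.range T, ∑ j ∈ Finset.range T, ∑ k ∈ Finset.range T, c :=
        sum_le_sum fun i hi => sum_le_sum fun j hj => sum_le_sum fun k hk =>
          h i (Finset.mem_range.1 hi) j (Finset.mem_range.1 hj) k (Finset.mem_range.1 hk)
    _ = _ := by simp; ring

lemma Std.walk_le (h : Std d p β G) (hn : n < 78) (hk : k ≤ (n + 1) / 2) (x : V d) :
    cpow (qk p 1) n x ≤ ofReal (Kx / d ^ k) := by
  have hd := h.pos
  have hd1 : (1:ℝ) ≤ d := by aesop
  refine (cpow_qk_one_le h.phi h.le (by simp_all) n x).trans (ofReal_le_ofReal ?_)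
  have : (KK n : ℝ) ≤ Kx := by exact_mod_cast KK_le_Kx hn
  gcongr

lemma st_ne_zero (s : Fin d × Bool) : st s ≠ 0 := fun h => by
  have := congrFun h s.1
  rw [st_same] at this
  aesop

lemma tri_eq (p) (s : Fin d × Bool) : tri p s = Dg (fun _ => 1) (tt p) (tt p) (tt p) (st s) := by
  unfold tri Dg; simp; rfl

lemma Std.tri_le (h : Std d p β G) (hN : NumOK d G) (s : Fin d × Bool) : tri p s ≤ ofReal ((26 ^ 3 * Kx + 8) / d) := by
  have hd := h.pos
  rw [tri_eq]
  have h0 : Dg (fun _ => 1) (lv d p 0) (lv d p 0) (lv d p 0) (st s) ≤ (26:ℕ) ^ 3 * ofReal (Kx / d ^ 1) := by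
    simp only [lev]; rw [Dg_sum]; refine sum_range_triple_le fun a ha b hb c hc => ?_; unfold Dg; simp only [one_mul]; rw [Dg_walk]
    rcases Nat.eq_zero_or_pos (a + (b + c)) with hz | hz
    · rw [hz, cpow, dl, Pi.single_eq_of_ne (st_ne_zero s)]; exact zero_le
    · exact h.walk_le (by omega) (by omega) _
  refine (h.Dg_le hN (fun ρ hρ y _ => one_le_pow₀ (by simp_all)) h0).trans ?_
  rw [show (8:ENNReal) = ofReal 8 by simp, ← ofReal_natCast, ← ofReal_pow (by simp),
    ← ofReal_mul (by simp), ← ofReal_mul (by simp), ← ofReal_add (by positivity) (by simp)]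
  refine ofReal_le_ofReal ?_
  rw [add_div, pow_one, mul_div_assoc]
  refine add_le_add (le_of_eq (by simp)) ?_
  rw [mul_one_div]
  exact div_le_div_of_nonneg_left (by norm_num) hd (le_self_pow₀ (by aesop) (by norm_num))

lemma triW_eq (p) (s : Fin d × Bool) : triW p s = Dg (fun y => ((sc s y).toNat : ENNReal) ^ 3) (tt p) (tt p) (tt p) (st s) := by
  unfold triW triH Dg
  simp only [← tsum_mul_left]
  rw [tsum_comm]
  refine tsum_congr fun y => ?_
  rw [tsum_eq_single (sc s y).toNat]
  · split_ifs
    · rfl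
    · rw [Int.toNat_of_nonpos (by omega)]; simp
  · grind

lemma sc_abs (s : Fin d × Bool) (y : V d) {ρ : ℕ} (h : ∀ l, |y l| ≤ ρ) : (sc s y).toNat ≤ ρ := by
  have := abs_le.1 (h s.1)
  unfold sc; split_ifs <;> omega

lemma Std.triW_le (h : Std d p β G) (hN : NumOK d G) (s : Fin d × Bool) : triW p s ≤ ofReal ((26 ^ 6 * Kx + 8) / d ^ 2) := by
  have hd := h.pos
  rw [triW_eq]
  have h0 : Dg (fun y => ((sc s y).toNat : ENNReal) ^ 3) (lv d p 0) (lv d p 0) (lv d p 0) (st s) ≤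
      (26:ℕ) ^ 3 * ((26:ℕ) ^ 3 * ofReal (Kx / d ^ 2)) := by
    simp only [lev]; rw [Dg_sum]; refine sum_range_triple_le fun a ha b hb c hc => ?_
    have hterm : ∀ y, ((sc s y).toNat : ENNReal) ^ 3 * (cpow (qk p 1) a y * conv (cpow (qk p 1) b) (cpow (qk p 1) c) (y + st s)) ≠ 0 → 3 ≤ a + (b + c) := by
      intro y hy; have h1 : (sc s y).toNat ≠ 0 := fun h => hy (by simp [h]); have h2 : cpow (qk p 1) a y ≠ 0 := fun h => hy (by simp [h])
      have h3 : conv (cpow (qk p 1) b) (cpow (qk p 1) c) (y + st s) ≠ 0 := fun h => hy (by simp [h])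
      have r2 := sc_abs s y (((rng_qk p 1).cpow a) y h2); have r3 := sc_abs s (y + st s) ((((rng_qk p 1).cpow b).conv ((rng_qk p 1).cpow c)) _ h3)
      have h4 : sc s (y + st s) = sc s y + 1 := by
        have := sc_sub s (y + st s) (st s); rw [add_sub_cancel_right, sc_st, if_pos rfl] at this; linarith
      omega
    by_cases h3 : 3 ≤ a + (b + c)
    · refine le_trans ?_ (mul_le_mul' le_rfl (h.walk_le (n := a + (b + c)) (by omega) (by omega) (st s))); rw [← Dg_walk, ← tsum_mul_left]
      refine tsum_le_tsum fun y => ?_; by_cases h2 : cpow (qk p 1) a y = 0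
      · simp [h2]
      · exact mul_le_mul' (pow_le_pow_left' (Nat.cast_le.2 ((sc_abs s y (((rng_qk p 1).cpow a) y h2)).trans (by omega))) 3) le_rfl
    · unfold Dg; rw [ENNReal.tsum_eq_zero.2 fun y => by_contra fun hne => h3 (hterm y hne)]; exact zero_le
  refine (h.Dg_le hN (fun ρ hρ y hy => by gcongr; exact sc_abs s y hy) h0).trans ?_
  rw [show (8:ENNReal) = ofReal 8 by simp, ← ofReal_natCast, ← ofReal_pow (by positivity),
    ← ofReal_mul (by positivity), ← ofReal_mul (by positivity), ← ofReal_mul (by positivity), ← ofReal_add (by positivity) (by positivity)]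
  refine ofReal_le_ofReal ?_
  rw [add_div]
  refine add_le_add (le_of_eq (by push_cast; ring)) ?_
  rw [mul_one_div]
  exact div_le_div_of_nonneg_left (by norm_num) (by positivity) (pow_le_pow_right₀ (by aesop) (by norm_num))

lemma emb_injective (hd : 2 ≤ d) : Function.Injective (emb d) := by
  intro u v h
  have h0 := congrFun h ⟨0, by omega⟩
  have h1 := congrFun h ⟨1, by omega⟩
  simp [emb] at h0 h1
  grind

lemma plane_sum_le (hd : 2 ≤ d) (hρ : Rng ρ f) (hf : ∀ x, f x ≤ a) :
    ∑' u, f (emb d u) ≤ ((2 * ρ + 1) ^ 2 : ℕ) * a := by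
  have hsupp : ∀ u ∉ (Finset.Icc (-(ρ:ℤ)) ρ ×ˢ Finset.Icc (-(ρ:ℤ)) ρ), f (emb d u) = 0 := by
    intro u hu; by_contra hne; apply hu; have h0 := hρ _ hne ⟨0, by omega⟩; have h1 := hρ _ hne ⟨1, by omega⟩; simp [emb] at h0 h1; grind
  rw [tsum_eq_sum hsupp]
  refine (sum_le_card_nsmul _ _ a fun u _ => hf _).trans (le_of_eq ?_)
  rw [nsmul_eq_mul, Finset.card_product, Int.card_Icc, ← pow_two]
  congr 3
  omega

/-- The triple convolution of the two-point function. -/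
def ttt (p : ℝ) : Fn d := conv (tt p) (conv (tt p) (tt p))

lemma Std.plane (h : Std d p β G) (hN : NumOK d G) :
    ∑' u, ttt p (emb d u) ≤ ofReal (mu' d G 0) ^ 3 + 8 * (49 * ofReal (1 / d ^ 3)) := by
  have hd2 : 2 ≤ d := by have := h.d26; omega
  have h1 : ∑' u, ttt p (emb d u) ≤ ∑' i, ∑' j, ∑' k, ∑' u, conv (lv d p i) (conv (lv d p j) (lv d p k)) (emb d u) := by
    have : ∀ x, ttt p x ≤ ∑' i, ∑' j, ∑' k, conv (lv d p i) (conv (lv d p j) (lv d p k)) x := by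
      intro x; refine (conv_mono h.tt_levs (conv_mono_levs h.tt_levs) x).trans (le_of_eq ?_); rw [tsum_conv]; refine tsum_congr fun i => ?_
      rw [conv_comm, tsum_conv]; refine tsum_congr fun j => ?_; rw [tsum_conv]; exact tsum_congr fun k => by rw [conv_comm]
    refine (tsum_le_tsum fun u => this (emb d u)).trans (le_of_eq ?_); rw [tsum_comm]; refine tsum_congr fun i => ?_; rw [tsum_comm]
    refine tsum_congr fun j => ?_; rw [tsum_comm]
  refine h1.trans (triple_sum_le ?_ fun i j k m hm hi hj hk hor => ?_)
  · refine (ENNReal.tsum_comp_le_tsum_of_injective (emb_injective hd2) _).trans ?_; change mass _ ≤ _; rw [mass_conv, mass_conv, pow_three]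
    exact mul_le_mul' (h.lev_mass' le_rfl) (mul_le_mul' (h.lev_mass' le_rfl) (h.lev_mass' le_rfl))
  · set ρ := 3 * d * 2 ^ m with hρ
    have hr : ∀ {i}, i ≤ m → Rng ρ (lv d p i) := fun hi =>
      (lev_rng h.d26 p _).mono (Nat.mul_le_mul_left _ (pow_le_pow_right (by norm_num) hi))
    have hsup : ∀ x, conv (lv d p i) (conv (lv d p j) (lv d p k)) x ≤ ofReal (si d G m * mu' d G m ^ 2) := by
      intro x; have hG := h.G1; rw [ofReal_mul (si_nonneg hG m), pow_two, ofReal_mul (by unfold mu'; positivity)]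
      have key : ∀ i j k, i = m → j ≤ m → k ≤ m → conv (lv d p i) (conv (lv d p j) (lv d p k)) x ≤
          ofReal (si d G m) * (ofReal (mu' d G m) * ofReal (mu' d G m)) := by
        rintro i j k rfl hj hk; refine (conv_le_mul_mass (h.lev_sup hm) x).trans ?_; rw [mass_conv]
        exact mul_le_mul' le_rfl (mul_le_mul' (h.lev_mass' hj) (h.lev_mass' hk))
      rcases hor with h | h | h
      · exact key i j k h hj hk
      · rw [conv_left_comm]; exact key j i k h hi hk
      · rw [conv_comm (lv d p j), conv_left_comm]; exact key k i j h hi hj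
    refine (plane_sum_le hd2 ((hr hi).conv ((hr hj).conv (hr hk))) hsup).trans ?_; rw [mul_assoc]
    refine le_trans ?_ (mul_le_mul' le_rfl (h.lev_num hN hm le_rfl le_rfl)); rw [← mul_assoc]; refine mul_le_mul' ?_ le_rfl
    have h1 : 1 ≤ ρ := by have := h.d26; have : 1 ≤ 2 ^ m := Nat.one_le_two_pow; rw [hρ]; nlinarith
    have : (2 * (ρ + (ρ + ρ)) + 1) ^ 2 ≤ 49 * ρ ^ 3 := by
      calc (2 * (ρ + (ρ + ρ)) + 1) ^ 2 ≤ (7 * ρ) ^ 2 := pow_le_pow_left (by omega) 2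
        _ = 49 * ρ ^ 2 := by ring
        _ ≤ 49 * ρ ^ 3 := Nat.mul_le_mul_left _ (pow_le_pow_right h1 (by norm_num))
    exact_mod_cast this

end

noncomputable section

section Product
variable {E : Type*}

/-- The event `F` on pairs is determined by the coordinates in `A` of the first and `A'` of the second configuration. -/
def DepOn₂ (F : Set (Pr E)) (A A' : Set E) : Prop :=
  ∀ x y : Pr E, (∀ e ∈ A, x.1 e = y.1 e) → (∀ e ∈ A', x.2 e = y.2 e) → x ∈ F → y ∈ F

lemma DepOn₂.mono (h : DepOn₂ F A A') (hA : A ⊆ B) (hA' : A' ⊆ B') :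
    DepOn₂ F B B' := fun x y h1 h2 => h x y (fun e he => h1 e (hA he)) fun e he => h2 e (hA' he)

lemma DepOn₂.inter (h : DepOn₂ F A A') (h' : DepOn₂ G A A') :
    DepOn₂ (F ∩ G) A A' := fun x y h1 h2 h3 => ⟨h x y h1 h2 h3.1, h' x y h1 h2 h3.2⟩

lemma DepOn.fst (h : DepOn F A) : DepOn₂ {x | x.1 ∈ F} A ∅ :=
  fun _ _ h1 _ => h _ _ h1

lemma DepOn.snd (h : DepOn F A) : DepOn₂ {x | x.2 ∈ F} ∅ A :=
  fun _ _ _ h2 => h _ _ h2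

lemma DepOn.orc (h : DepOn F A) : DepOn₂ {x | orc x.1 x.2 ∈ F} A A :=
  fun _ _ h1 h2 => h _ _ fun e he => by simp [Perc.orc, h1 e he, h2 e he]

lemma map_mix₂ (p s) (A A' : Set E) :
    (((mu p).prod (mu s)).prod ((mu p).prod (mu s))).map
      (fun x => (mix A x.1.1 x.2.1, mix A' x.1.2 x.2.2)) = (mu p).prod (mu s) := by
  classical
  have hm1 : Measurable fun x : (Pr E) × (Pr E) => mix A x.1.1 x.2.1 :=
    (measurable_mix A).comp (measurable_fst.fst.prodMk measurable_snd.fst)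
  have hm2 : Measurable fun x : (Pr E) × (Pr E) => mix A' x.1.2 x.2.2 :=
    (measurable_mix A').comp (measurable_fst.snd.prodMk measurable_snd.snd)
  have hcyl : ∀ A t (ω ω' : E → Bool), mix A ω ω' ∈ (cyl t fun _ => true) ↔
      ω ∈ (cyl (t.filter (· ∈ A)) fun _ => true) ∧ ω' ∈ (cyl (t.filter (¬ · ∈ A)) fun _ => true) := by
    intro A t ω ω'; simp only [cyl, mem_filter]; constructor
    · intro h
      exact ⟨fun e he => by have := h e he.1; rwa [mix_mem he.2] at this,
        fun e he => by have := h e he.1; rwa [mix_not_mem he.2] at this⟩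
    · rintro ⟨h1, h2⟩ e he; by_cases hA : e ∈ A
      · rw [mix_mem hA]; exact h1 e ⟨he, hA⟩
      · rw [mix_not_mem hA]; exact h2 e ⟨he, hA⟩
  refine (eq_mu_prod p s true true _ fun t u => ?_).symm
  rw [Measure.map_apply (hm1.prodMk hm2) ((meas_cyl _ _).prod (meas_cyl _ _))]
  have : (fun x => (mix A x.1.1 x.2.1, mix A' x.1.2 x.2.2)) ⁻¹'
      ((cyl t fun _ => true) ×ˢ (cyl u fun _ => true)) =
      ((cyl (t.filter (· ∈ A)) fun _ => true) ×ˢ (cyl (u.filter (· ∈ A')) fun _ => true)) ×ˢ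
      ((cyl (t.filter (¬ · ∈ A)) fun _ => true) ×ˢ (cyl (u.filter (¬ · ∈ A')) fun _ => true)) := by
    grind
  rw [this]
  simp [mu_cyl, prod_const]
  rw [← Finset.card_filter_add_card_filter_not (s := t) (· ∈ A), ← Finset.card_filter_add_card_filter_not (s := u) (· ∈ A'), pow_add, pow_add]
  ring

lemma prod_inter_of_depOn (p s) {F G : Set (Pr E)} (hF : MeasurableSet F) (hG : MeasurableSet G)
    (hFA : DepOn₂ F A A') (hGB : DepOn₂ G B B') (hAB : Disjoint A B) (hAB' : Disjoint A' B') :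
    ((mu p).prod (mu s)) (F ∩ G) = ((mu p).prod (mu s)) F * ((mu p).prod (mu s)) G := by
  have hm1 : Measurable fun x : (Pr E) × (Pr E) => mix A x.1.1 x.2.1 :=
    (measurable_mix A).comp (measurable_fst.fst.prodMk measurable_snd.fst)
  have hm2 : Measurable fun x : (Pr E) × (Pr E) => mix A' x.1.2 x.2.2 :=
    (measurable_mix A').comp (measurable_fst.snd.prodMk measurable_snd.snd)
  rw [← Measure.prod_prod]
  conv_lhs => rw [← map_mix₂ p s A A']
  rw [Measure.map_apply (hm1.prodMk hm2) (hF.inter hG)]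
  congr 1
  ext x
  refine and_congr ⟨hFA _ _ (fun e he => mix_mem he) fun e he => mix_mem he, hFA _ _ (fun e he => (mix_mem he).symm) fun e he => (mix_mem he).symm⟩ ?_
  have h1 : ∀ e ∈ B, e ∉ A := fun e he h => disjoint_left.1 hAB h he
  have h2 : ∀ e ∈ B', e ∉ A' := fun e he h => disjoint_left.1 hAB' h he
  exact ⟨hGB _ _ (fun e he => mix_not_mem (h1 e he)) fun e he => mix_not_mem (h2 e he),
    hGB _ _ (fun e he => (mix_not_mem (h1 e he)).symm) fun e he => (mix_not_mem (h2 e he)).symm⟩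

lemma prod_fst (p s) (F) : ((mu p).prod (mu s)) {x : Pr E | x.1 ∈ F} = mu p F := by
  have : {x : Pr E | x.1 ∈ F} = F ×ˢ univ := by ext; simp
  simp_all

lemma prod_snd (p s) (F) : ((mu p).prod (mu s)) {x : Pr E | x.2 ∈ F} = mu s F := by
  have : {x : Pr E | x.2 ∈ F} = univ ×ˢ F := by ext; simp
  simp_all

end Product

variable {d : ℕ}
variable {S R : Set (V d)} {x y z v w : V d}

lemma tau_uni_le (hp : p ∈ 𝕀) (hs : s ∈ 𝕀) (hv : v ∈ S) (hAF : AF p S v) :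
    tau (uni p s) S v x ≤ tau p S v x + ∑' z, ∑' y, tau p S v y * (J s y z * tau (uni p s) S z x) := by
  set P := (mu p : Measure (Config d)).prod (mu s) with hP
  set Ev : Finset (V d) → V d → V d → Set (Pr (Edge d)) := fun D z y =>
    {q | q.1 ∈ {ω | cl S ω v = D} ∩ {_ω | y ∈ D}} ∩ ({q | q.2 ∈ {ξ | OpenAdj ξ y z}} ∩ {q | orc q.1 q.2 ∈ cn (S \ D) z x}) with hEv
  have hsub : {q | orc q.1 q.2 ∈ cn S v x} ⊆
      {q | q.1 ∈ cn S v x} ∪ ({q | q.1 ∈ {ω | ¬ (cl S ω v).Finite}} ∪ ⋃ D, ⋃ z, ⋃ y, Ev D z y) := by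
    intro q hq
    by_cases h1 : q.1 ∈ cn S v x
    · simp_all
    by_cases h2 : (cl S q.1 v).Finite
    swap
    · simp_all
    refine .inr (.inr ?_)
    obtain ⟨y, hy, z, hz, hyz, hzx⟩ := Cn.last_exit (cl S q.1 v) hq (Cn.refl hv) h1
    have hyz' : OpenAdj q.2 y z := by
      obtain ⟨h, ho⟩ := openAdj_iff.1 hyz
      refine openAdj_iff.2 ⟨h, ?_⟩
      rcases Bool.or_eq_true_iff.1 ho with ho | ho
      · exact absurd (Cn.trans hy (Cn.step (Cn.right hy) hz.1 (openAdj_iff.2 ⟨h, ho⟩))) hz.2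
      · exact ho
    refine mem_iUnion.2 ⟨h2.toFinset, mem_iUnion.2 ⟨z, mem_iUnion.2 ⟨y, ⟨?_, ?_⟩, hyz', ?_⟩⟩⟩
    · simp
    · simpa using hy
    · change Cn (S \ _) _ z x; simpa using hzx
  have hE : ∀ D z y, P (Ev D z y) ≤ mu p ({ω | cl S ω v = D} ∩ {_ω | y ∈ D}) * (J s y z * tau (uni p s) S z x) := by
    intro D z y
    by_cases hy : y ∈ D
    swap
    · have : Ev D z y = ∅ := eq_empty_of_forall_notMem fun q h => hy h.1.2
      rw [this]; simp
    have m1 : MeasurableSet {q : Pr (Edge d) | q.1 ∈ {ω | cl S ω v = D} ∩ {_ω | y ∈ D}} :=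
      measurable_fst ((meas_cl_eq _ _ _).inter (MeasurableSet.const _))
    have m2 : MeasurableSet {q : Pr (Edge d) | q.2 ∈ {ξ | OpenAdj ξ y z}} := measurable_snd (meas_openAdj _ _)
    have m3 : MeasurableSet {q : Pr (Edge d) | orc q.1 q.2 ∈ cn (S \ D) z x} := measurable_orc (meas_cn _ _ _)
    have hdisj : Disjoint {e | e.val = s(y, z)} (edgesIn (S \ D)) := by
      rw [disjoint_left]; intro e he he'
      exact (he' y (by rw [he]; simp)).2 hy
    rw [hEv, hP, prod_inter_of_depOn p s (A := edgesAt D) (A' := ∅) (B := edgesIn (S \ D)) (B' := {e | e.val = s(y, z)} ∪ edgesIn (S \ D))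
      m1 (m2.inter m3), prod_inter_of_depOn p s (A := ∅) (A' := {e | e.val = s(y, z)}) (B := edgesIn (S \ D)) (B' := edgesIn (S \ D)) m2 m3
      (depOn_openAdj _ _).snd (depOn_cn _ _ _).orc (empty_disjoint _) hdisj, prod_fst, prod_snd, mu_openAdj, ← mu_uni hp hs (meas_cn _ _ _)]
    · exact mul_le_mul' le_rfl (mul_le_mul' le_rfl (tau_mono_set _ sdiff_subset))
    · exact (((depOn_cl_eq _ _ _).mono inter_subset_left).inter fun _ _ _ h => h).fst
    · exact ((depOn_openAdj _ _).snd.mono (empty_subset _) subset_union_left).inter ((depOn_cn _ _ _).orc.mono Subset.rfl subset_union_right)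
    · exact disjoint_edgesAt_edgesIn_diff _
    · exact empty_disjoint _
  rw [tau, mu_uni hp hs (meas_cn _ _ _)]
  refine (measure_mono hsub).trans ((measure_union_le _ _).trans (add_le_add (prod_fst p s _).le ?_))
  refine (measure_union_le _ _).trans ?_
  rw [prod_fst, show mu p {ω | ¬ (cl S ω v).Finite} = 0 from hAF, zero_add]
  refine (measure_iUnion_le _).trans ((tsum_le_tsum fun D => (measure_iUnion_le _).trans
    (tsum_le_tsum fun z => (measure_iUnion_le _).trans (tsum_le_tsum fun y => hE D z y))).trans ?_)
  rw [tsum_comm]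
  refine tsum_le_tsum fun z => ?_
  rw [tsum_comm]
  refine tsum_le_tsum fun y => ?_
  rw [tsum_mul_right]
  exact mul_le_mul' (cl_mu_le_tau p S v y) le_rfl

lemma tau_mono (hp : 0 ≤ p) (hpq : p ≤ q) (hq : q ≤ 1) (S) (x y : V d) : tau p S x y ≤ tau q S x y :=
  mu_mono hp hpq hq (meas_cn _ _ _) (incr_cn _ _ _)

lemma chi_mono (hp : 0 ≤ p) (hpq : p ≤ q) (hq : q ≤ 1) : chi d p ≤ chi d q :=
  tsum_le_tsum fun _ => tau_mono hp hpq hq _ _ _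

lemma J_eq_mul (hs : s ∈ 𝕀) (y z : V d) : J s y z = ofReal s * J 1 y z := by
  unfold J; split_ifs
  · rw [wt_true hs, wt_true (by simp)]; simp
  · simp

lemma tsum_J_one (y : V d) : ∑' z, J 1 y z = 2 * d := by
  have := tsum_J 1 y fun _ => 1
  simp at this
  rw [this, wt_true (by simp)]; simp [mul_comm]

/-- Kernel controlling the increments of the two-point function below `q`. -/
def gg (q : ℝ) : Fn d := conv (tt q) (conv (qk 1 1) (tt q))

lemma mass_gg (q) : mass (gg q : Fn d) = chi d q * (2 * d * chi d q) := by
  rw [gg, mass_conv, mass_conv, mass_qk_one, wt_true (by simp)]; simp [mass, chi]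

lemma gg_eq (q) (v x : V d) : gg q (x - v) = ∑' y, tt q (y - v) * ∑' z, J 1 y z * tt q (x - z) := by
  rw [gg, conv, ← tsum_sub_left _ v]
  refine tsum_congr fun y => ?_
  rw [conv_qk_one, tsum_J]
  congr 1
  refine sum_congr rfl fun s _ => ?_
  congr 2; abel

section Lip
variable {p s q : ℝ}

lemma tau_uni_le_gg (hp : p ∈ 𝕀) (hs : s ∈ 𝕀) (hpq : p ≤ q) (hq' : uni p s ≤ q) (hq : q ≤ 1) (hchi : chi d q ≠ ⊤)
    (hv : v ∈ S) (x) : tau (uni p s) S v x ≤ tau p S v x + ofReal s * gg q (x - v) := by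
  refine (tau_uni_le hp hs hv (AF.of_chi (ne_top_of_le_ne_top hchi (chi_mono hp.1 hpq hq)) _ _)).trans (add_le_add le_rfl ?_)
  rw [gg_eq, tsum_comm, ← tsum_mul_left]
  refine tsum_le_tsum fun y => ?_
  rw [← tsum_mul_left, ← tsum_mul_left]
  refine tsum_le_tsum fun z => ?_
  rw [J_eq_mul hs]
  calc _ ≤ tt q (y - v) * (ofReal s * J 1 y z * tt q (x - z)) := by
        exact mul_le_mul' ((tau_mono hp.1 hpq hq S v y).trans (tau_le_tt _ _ _ _)) (mul_le_mul' le_rfl ((tau_mono (uni_mem hp hs).1 hq' hq S z x).trans (tau_le_tt _ _ _ _)))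
    _ = _ := by ring

lemma tt_uni_le_gg (hp : p ∈ 𝕀) (hs : s ∈ 𝕀) (hpq : p ≤ q) (hq' : uni p s ≤ q) (hq : q ≤ 1) (hchi : chi d q ≠ ⊤)
    (x : V d) : tt (uni p s) x ≤ tt p x + ofReal s * gg q x := by
  have := tau_uni_le_gg hp hs hpq hq' hq hchi (mem_univ 0) x
  aesop

lemma phi_uni_le (hp : p ∈ 𝕀) (hs : s ∈ 𝕀) (hpq : p ≤ q) (hq' : uni p s ≤ q) (hq : q ≤ 1) (hchi : chi d q ≠ ⊤)
    (S) (v : V d) : phi (uni p s) S v ≤ phi p S v + ofReal s * (2 * d * (mass (gg q : Fn d) + chi d q)) := by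
  by_cases hv : v ∈ S
  swap
  · have : phi (uni p s) S v = 0 := by
      unfold phi Q; simp [tau_eq_zero_left _ hv]
    simp_all
  have hu := uni_mem hp hs
  have hJ : ∀ y z : V d, J (uni p s) y z ≤ J p y z + ofReal s * J 1 y z := by
    intro y z; rw [J_eq_mul hu, J_eq_mul hp, ← add_mul, ← ofReal_add hp.1 hs.1]; refine mul_le_mul' (ofReal_le_ofReal ?_) le_rfl
    unfold uni; nlinarith [mul_nonneg hp.1 hs.1]
  have hJ1 : ∀ y z : V d, J (uni p s) y z ≤ J 1 y z := by
    intro y z; rw [J_eq_mul hu]; refine (mul_le_mul' (ofReal_le_ofReal hu.2) le_rfl).trans (by simp)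
  have key : ∀ z, Q (uni p s) S v z ≤ Q p S v z + ∑' y, ofReal s * ((gg q (y - v) + tt q (y - v)) * J 1 y z) := by
    intro z; unfold Q; split_ifs
    · simp
    rw [← tsum_add]; refine tsum_le_tsum fun y => ?_
    calc _ ≤ (tau p S v y + ofReal s * gg q (y - v)) * J (uni p s) y z :=
          mul_le_mul' (tau_uni_le_gg hp hs hpq hq' hq hchi hv y) le_rfl
      _ = tau p S v y * J (uni p s) y z + ofReal s * gg q (y - v) * J (uni p s) y z := by ring
      _ ≤ tau p S v y * (J p y z + ofReal s * J 1 y z) + ofReal s * gg q (y - v) * J 1 y z :=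
          add_le_add (mul_le_mul' le_rfl (hJ y z)) (mul_le_mul' le_rfl (hJ1 y z))
      _ ≤ tau p S v y * J p y z + tt q (y - v) * (ofReal s * J 1 y z) + ofReal s * gg q (y - v) * J 1 y z := by
          rw [mul_add]; exact add_le_add (add_le_add le_rfl (mul_le_mul' ((tau_mono hp.1 hpq hq S v y).trans (tau_le_tt _ _ _ _)) le_rfl)) le_rfl
      _ = _ := by ring
  refine (tsum_le_tsum key).trans (le_of_eq ?_)
  rw [tsum_add, tsum_comm]
  simp [tsum_mul_left, tsum_J_one, tsum_mul_right, tsum_add]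
  rw [tsum_sub_left (gg q) v, tsum_sub_left (tt q) v, mul_comm (∑' y, gg q y + ∑' y, tt q y)]
  rfl

lemma Dg_uni_le (hp : p ∈ 𝕀) (hs : s ∈ 𝕀) (hpq : p ≤ q) (hq' : uni p s ≤ q) (hq : q ≤ 1) (hchi : chi d q ≠ ⊤)
    (W) (e : V d) : Dg W (tt (uni p s)) (tt (uni p s)) (tt (uni p s)) e ≤ Dg W (tt p) (tt p) (tt p) e +
      ofReal s * ((∑' y, W y * tt q y) * (2 * mass (gg q : Fn d)) + (∑' y, W y * gg q y) * chi d q) := by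
  set t := tt (uni p s)
  set a := ofReal s
  have h1 : ∀ x, t x ≤ tt p x + a * gg q x := tt_uni_le_gg hp hs hpq hq' hq hchi
  have hpt : ∀ x : V d, tt p x ≤ tt q x := fun x => tau_mono hp.1 hpq hq _ _ _
  have hB : ∀ x, conv t t x ≤ chi d q := fun x =>
    (conv_le_mul_mass (fun x => tt_le_one _ x) x).trans (by rw [one_mul]; exact mass_mono fun x => tau_mono (uni_mem hp hs).1 hq' hq _ _ _)
  have hsc : ∀ f (x : V d), (∀ y, f y ≤ 1) → conv f (fun y => a * gg q y) x ≤ a * mass (gg q : Fn d) := by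
    intro f x hf; refine (conv_le_mul_mass hf x).trans (le_of_eq ?_); rw [one_mul]; unfold mass; rw [tsum_mul_left]
  have hBB : ∀ x, conv t t x ≤ conv (tt p) (tt p) x + a * (2 * mass (gg q : Fn d)) := by
    intro x
    calc conv t t x ≤ conv t (fun y => tt p y + a * gg q y) x := conv_mono (fun _ => le_rfl) h1 x
      _ = conv (tt p) t x + conv t (fun y => a * gg q y) x := by rw [conv_add, conv_comm t (tt p)]
      _ ≤ conv (tt p) (fun y => tt p y + a * gg q y) x + conv t (fun y => a * gg q y) x := add_le_add (conv_mono (fun _ => le_rfl) h1 x) le_rfl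
      _ = conv (tt p) (tt p) x + conv (tt p) (fun y => a * gg q y) x + conv t (fun y => a * gg q y) x := by rw [conv_add]
      _ ≤ conv (tt p) (tt p) x + a * mass (gg q : Fn d) + a * mass (gg q : Fn d) :=
          add_le_add (add_le_add le_rfl (hsc _ x fun y => tt_le_one _ y)) (hsc _ x fun y => tt_le_one _ y)
      _ = _ := by ring
  unfold Dg
  have key : ∀ y, W y * (t y * conv t t (y + e)) ≤ W y * (tt p y * conv (tt p) (tt p) (y + e)) +
      (a * ((W y * tt q y) * (2 * mass (gg q : Fn d))) + a * ((W y * gg q y) * chi d q)) := by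
    intro y
    calc _ ≤ W y * ((tt p y + a * gg q y) * conv t t (y + e)) := mul_le_mul' le_rfl (mul_le_mul' (h1 y) le_rfl)
      _ = W y * (tt p y * conv t t (y + e)) + a * ((W y * gg q y) * conv t t (y + e)) := by ring
      _ ≤ W y * (tt p y * (conv (tt p) (tt p) (y + e) + a * (2 * mass (gg q : Fn d)))) + a * ((W y * gg q y) * chi d q) :=
          add_le_add (mul_le_mul' le_rfl (mul_le_mul' le_rfl (hBB _))) (mul_le_mul' le_rfl (mul_le_mul' le_rfl (hB _)))
      _ = W y * (tt p y * conv (tt p) (tt p) (y + e)) + a * ((W y * tt p y) * (2 * mass (gg q : Fn d))) + a * ((W y * gg q y) * chi d q) := by ring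
      _ ≤ _ := by
          rw [add_assoc]; exact add_le_add le_rfl (add_le_add (mul_le_mul' le_rfl (mul_le_mul' (mul_le_mul' le_rfl (hpt y)) le_rfl)) le_rfl)
  refine (tsum_le_tsum key).trans (le_of_eq ?_)
  simp [tsum_add, tsum_mul_left, tsum_mul_right]
  ring

end Lip

/-! ### Moments of the subcritical two-point function -/

lemma tsum_le_of_unique [Countable ι] {f : ι → ENNReal} (h : ∀ i, f i ≤ c) (hu : ∀ i j, f i ≠ 0 → f j ≠ 0 → i = j) :
    ∑' i, f i ≤ c := by
  by_cases he : ∃ i, f i ≠ 0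
  · obtain ⟨i, hi⟩ := he; rw [tsum_eq_single i fun j hj => by_contra fun hne => hj (hu j i hne hi)]; exact h i
  · simp_all

lemma exists_cube_phi_lt_one (hchi : chi d q ≠ ⊤) : ∃ N, 0 < N ∧ mass (qk q N : Fn d) < 1 := by
  have h1 : ∑' N, mass (qk q (N + 1) : Fn d) ≠ ⊤ := by
    have : ∑' N, mass (qk q (N + 1) : Fn d) ≤ chi d q * (2 * d) := by
      unfold mass; rw [tsum_comm]
      calc _ ≤ ∑' z, ∑' y, tt q y * J 1 y z := by
            refine tsum_le_tsum fun z => tsum_le_of_unique (fun N => ?_) fun i j hi hj => ?_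
            · unfold qk Q; split_ifs
              · simp
              · refine tsum_le_tsum fun y => mul_le_mul' ?_ ?_
                · have := tau_le_tt q (cb d (N + 1)) 0 y; rwa [sub_zero] at this
                · unfold J; split_ifs
                  · rw [wt_true (p := 1) (by simp), ofReal_one]; exact wt_le_one _ _
                  · exact le_rfl
            · obtain ⟨l, hl, hl'⟩ := qk_ne_zero hi; obtain ⟨m, hm, hm'⟩ := qk_ne_zero hj; grind
        _ = _ := by
            rw [tsum_comm]; simp [tsum_mul_left, tsum_J_one, tsum_mul_right]; rfl
    exact ne_top_of_le_ne_top (mul_ne_top hchi (mul_ne_top (by simp) (by simp))) this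
  obtain ⟨N, hN⟩ := ((ENNReal.tendsto_atTop_zero_of_tsum_ne_top h1).eventually (gt_mem_nhds zero_lt_one)).exists
  grind

lemma tt_le_tsum_iter (hchi : chi d q ≠ ⊤) (hN : 0 < N) (hφ : mass (qk q N : Fn d) < 1) (x : V d) :
    tt q x ≤ ∑' t, conv (cpow (qk q N) t) (gk q N) x := by
  set r := mass (qk q N : Fn d)
  have h : ∀ k, tt q x ≤ ∑' t, conv (cpow (qk q N) t) (gk q N) x + r ^ k := by
    intro k; refine (tt_le_iter hchi hN k x).trans (add_le_add ?_ ?_)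
    · rw [sum_conv]; exact sum_le_tsum _
    · refine (conv_le_mass_mul (tt_le_one q) x).trans ?_; rw [mass_cpow, mul_one]
  have hlim := (ENNReal.tendsto_pow_atTop_nhds_zero_of_lt_one hφ).const_add (∑' t, conv (cpow (qk q N) t) (gk q N) x)
  rw [add_zero] at hlim
  exact ge_of_tendsto' hlim h

/-- Cubic weight in direction `s`. -/
def uw (s : Fin d × Bool) (y : V d) : ENNReal := ((1 + (sc s y).natAbs : ℕ) : ENNReal) ^ 3

lemma uw_add (s) (x y : V d) : uw s (x + y) ≤ uw s x * uw s y := by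
  unfold uw
  rw [← mul_pow]
  refine pow_le_pow_left' ?_ 3
  have h := sc_sub s (x + y) y
  rw [add_sub_cancel_right] at h
  have : 1 + (sc s (x + y)).natAbs ≤ (1 + (sc s x).natAbs) * (1 + (sc s y).natAbs) := by
    grind
  exact_mod_cast this

lemma uw_le (s) (y : V d) {ρ : ℕ} (h : ∀ l, |y l| ≤ ρ) : uw s y ≤ ((1 + ρ : ℕ) : ENNReal) ^ 3 := by
  refine pow_le_pow_left' (Nat.cast_le.2 ?_) 3
  have := abs_le.1 (h s.1)
  unfold sc; split_ifs <;> omega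

lemma tsum_uw_conv (s) (f g : Fn d) : ∑' x, uw s x * conv f g x ≤ (∑' x, uw s x * f x) * ∑' x, uw s x * g x := by
  have : mass (conv (fun x => uw s x * f x) (fun x => uw s x * g x)) = (∑' x, uw s x * f x) * ∑' x, uw s x * g x := mass_conv _ _
  rw [← this]
  refine tsum_le_tsum fun x => ?_
  unfold conv
  rw [← tsum_mul_left]
  refine tsum_le_tsum fun y => ?_
  calc _ ≤ (uw s y * uw s (x - y)) * (f y * g (x - y)) := mul_le_mul' (by have := uw_add s y (x - y); rwa [add_sub_cancel] at this) le_rfl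
    _ = _ := by ring

lemma tsum_uw_rng (s) (h : Rng ρ f) : ∑' x, uw s x * f x ≤ ((1 + ρ : ℕ) : ENNReal) ^ 3 * mass f := by
  unfold mass
  rw [← tsum_mul_left]
  refine tsum_le_tsum fun x => ?_
  by_cases hx : f x = 0
  · simp [hx]
  · exact mul_le_mul' (uw_le s x (h x hx)) le_rfl

lemma tsum_cube_geometric (hr : r < 1) : ∑' t, ((t + 1 : ℕ) : ENNReal) ^ 3 * r ^ t ≠ ⊤ := by
  lift r to NNReal using hr.ne_top
  have h1 : Summable fun t : ℕ => ((t:ℝ)) ^ 3 * (r:ℝ) ^ t := by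
    refine summable_pow_mul_geometric_of_norm_lt_one 3 ?_; simp_all
  have h2 : Summable fun t => ((t + 1 : ℕ) : NNReal) ^ 3 * r ^ t := by
    rw [← NNReal.summable_coe]
    refine Summable.of_nonneg_of_le (fun t => by linarith) (fun t => ?_) ((h1.mul_left 4).add ((show Summable fun t => (r:ℝ) ^ t from summable_geometric_of_lt_one r.2 (by simp_all)).mul_left 4))
    push_cast; rw [← mul_assoc, ← add_mul]; refine mul_le_mul_of_nonneg_right ?_ (by simp); have ht : (0:ℝ) ≤ t := by simp
    nlinarith [mul_nonneg ht (sq_nonneg ((t:ℝ) - 1)), sq_nonneg ((t:ℝ) - 1), mul_nonneg ht ht]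
  have := ENNReal.tsum_coe_ne_top_iff_summable.2 h2
  simp_all

lemma tsum_uw_tt (hchi : chi d q ≠ ⊤) (s : Fin d × Bool) : ∑' x, uw s x * tt q x ≠ ⊤ := by
  obtain ⟨N, hN, hφ⟩ := exists_cube_phi_lt_one hchi
  set r := mass (qk q N : Fn d)
  have hb : ∑' x, uw s x * tt q x ≤ ∑' t, ((N + 1 : ℕ) : ENNReal) ^ 3 * (((t + 1 : ℕ) : ENNReal) ^ 3 * r ^ t) * mass (gk q N : Fn d) := by
    calc _ ≤ ∑' x, ∑' t, uw s x * conv (cpow (qk q N) t) (gk q N) x := by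
          refine tsum_le_tsum fun x => ?_; rw [tsum_mul_left]; exact mul_le_mul' le_rfl (tt_le_tsum_iter hchi hN hφ x)
      _ = ∑' t, ∑' x, uw s x * conv (cpow (qk q N) t) (gk q N) x := tsum_comm
      _ ≤ _ := by
          refine tsum_le_tsum fun t => ?_; refine (tsum_uw_rng s (((rng_qk q N).cpow t).conv (rng_gk q N))).trans ?_
          rw [mass_conv, mass_cpow, ← mul_assoc, ← mul_assoc, ← mul_pow]; refine mul_le_mul' (mul_le_mul' (pow_le_pow_left' ?_ 3) le_rfl) le_rfl
          have : 1 + (t * N + N) ≤ (N + 1) * (t + 1) := by nlinarith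
          exact_mod_cast this
  refine ne_top_of_le_ne_top ?_ hb
  rw [tsum_mul_right, tsum_mul_left]
  refine mul_ne_top (mul_ne_top (by simp) (tsum_cube_geometric hφ)) (ne_top_of_le_ne_top hchi ?_)
  exact tsum_le_tsum fun x => by have := tau_le_tt q (cb d N) 0 x; rwa [sub_zero] at this

lemma tsum_uw_gg (hchi : chi d q ≠ ⊤) (s : Fin d × Bool) : ∑' x, uw s x * gg q x ≠ ⊤ := by
  refine ne_top_of_le_ne_top ?_ (tsum_uw_conv s _ _)
  refine mul_ne_top (tsum_uw_tt hchi s) (ne_top_of_le_ne_top ?_ (tsum_uw_conv s _ _))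
  refine mul_ne_top (ne_top_of_le_ne_top ?_ (tsum_uw_rng s (rng_qk 1 1))) (tsum_uw_tt hchi s)
  rw [mass_qk_one]
  tauto

end

noncomputable section

variable {d : ℕ}

/-- Constant for the triangle diagram. -/
def K₁ : ℝ := 26 ^ 3 * Kx + 8
/-- Constant for the weighted triangle diagram. -/
def K₂ : ℝ := 26 ^ 6 * Kx + 8
/-- Constant in the bound on exit masses. -/
def C₀ : ℝ := 2 * (K₁ + 1) + 20 * (K₂ + 1)

lemma K₁_pos : 0 < K₁ := by unfold K₁; positivity
lemma K₂_pos : 0 < K₂ := by unfold K₂; positivity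
lemma C₀_pos : 0 < C₀ := by unfold C₀; have := K₁_pos; have := K₂_pos; positivity

/-- The dimension is large enough. -/
structure Big (d : ℕ) : Prop where
  d26 : 26 ≤ d
  C : 100000 * C₀ ≤ d
  num : NumOK d (exp C₀)

lemma eventually_big : ∀ᶠ d : ℕ in atTop, Big d := by
  set G := exp C₀
  have hc : Tendsto (fun d : ℕ => (d : ℝ)) atTop atTop := tendsto_natCast_atTop_atTop
  have hhalf : Tendsto (fun d => d / 2) atTop atTop := Nat.tendsto_div_const_atTop (by norm_num)
  have hgeo : Tendsto (fun d => 8000 * 8 * G ^ 2 * (0.78:ℝ) ^ (d / 2)) atTop (nhds (8000 * 8 * G ^ 2 * 0)) :=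
    ((tendsto_pow_atTop_nhds_zero_of_lt_one (by norm_num) (by norm_num)).comp hhalf).const_mul _
  have hpoly : Tendsto (fun n : ℕ => (n:ℝ) ^ 12 * (0.78:ℝ) ^ n) atTop (nhds 0) :=
    tendsto_pow_const_mul_const_pow_of_abs_lt_one 12 (by linarith)
  have hpoly2 : Tendsto (fun d => 100000000 * 3 ^ 12 * G ^ 8 * (8000 * 8 * G ^ 2) * (((d / 2 : ℕ):ℝ) ^ 12 * (0.78:ℝ) ^ (d / 2)))
      atTop (nhds (100000000 * 3 ^ 12 * G ^ 8 * (8000 * 8 * G ^ 2) * 0)) := (hpoly.comp hhalf).const_mul _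
  rw [mul_zero] at hgeo hpoly2
  filter_upwards [eventually_ge_atTop 26, hc.eventually_ge_atTop (100000 * C₀), hc.eventually_ge_atTop (675 * 1600 * 8 * 5 * KK 26 * G ^ 7),
    hgeo.eventually (gt_mem_nhds one_pos), hpoly2.eventually (gt_mem_nhds one_pos)] with d h1 h2 h3 h4 h5
  refine ⟨h1, h2, numOK_of (Real.one_le_exp C₀_pos.le) h3 h4.le ?_ (by omega)⟩
  refine le_trans ?_ h5.le
  have : (d:ℝ) ^ 12 ≤ (3 * ((d / 2 : ℕ):ℝ)) ^ 12 := pow_le_pow_left₀ (by positivity) (by exact_mod_cast (by omega : d ≤ 3 * (d / 2))) 12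
  calc _ = 100000000 * G ^ 8 * (8000 * 8 * G ^ 2 * (0.78:ℝ) ^ (d / 2)) * (d:ℝ) ^ 12 := by ring
    _ ≤ 100000000 * G ^ 8 * (8000 * 8 * G ^ 2 * (0.78:ℝ) ^ (d / 2)) * (3 * ((d / 2 : ℕ):ℝ)) ^ 12 := by gcongr
    _ = _ := by ring

namespace Big

lemma pos (h : Big d) : (0:ℝ) < d := by have := h.d26; exact_mod_cast (by omega)

lemma std (h : Big d) {p : ℝ} (hchi : chi d p ≠ ⊤) (hφ : PhiLe d p (1 + C₀ / d)) : Std d p (1 + C₀ / d) (exp C₀) where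
  chi := hchi
  phi := hφ
  one := by have := h.pos; have := C₀_pos; simp; positivity
  le := by
    have h1 := h.pos; have : C₀ / d ≤ 0.04 := by rw [div_le_iff₀ h1]; have := h.C; linarith [C₀_pos]
    linarith
  G1 := Real.one_le_exp C₀_pos.le
  pow := by
    have h1 := h.pos
    calc (1 + C₀ / d) ^ d ≤ (exp (C₀ / d)) ^ d := by
          refine pow_le_pow_left₀ (by have := C₀_pos; positivity) ?_ d; rw [add_comm]; exact add_one_le_exp _
      _ = exp C₀ := by rw [← exp_nat_mul]; congr 1; field_simp
  d26 := h.d26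

lemma phiLe_of_weak (h : Big d) (hchi : chi d p ≠ ⊤) (hφ : PhiLe d p 1.04)
    (h1 : ∀ s : Fin d × Bool, tri p s ≤ ofReal ((K₁ + 1) / d)) (h2 : ∀ s : Fin d × Bool, triW p s ≤ ofReal ((K₂ + 1) / d ^ 2)) :
    PhiLe d p (1 + C₀ / d) := by
  intro I hI v
  have k1 := K₁_pos
  have k2 := K₂_pos
  refine (phi_le_one_add_err hchi _ v).trans ?_
  rw [ofReal_add zero_le_one (by have := C₀_pos; positivity), ofReal_one]
  refine add_le_add le_rfl ((err_le hchi hφ (by norm_num) le_rfl h1 h2 hI v).trans ?_)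
  rw [← ofReal_natCast d, show (20:ENNReal) = ofReal 20 by simp, ← ofReal_mul (by positivity),
    ← ofReal_mul (by simp), ← ofReal_mul (by simp), ← ofReal_add (by positivity) (by positivity)]
  refine ofReal_le_ofReal ?_
  rw [(show (K₁ + 1) / d * 1.04 + 20 * d * ((K₂ + 1) / d ^ 2) = (1.04 * (K₁ + 1) + 20 * (K₂ + 1)) / d by grind)]
  refine div_le_div_of_nonneg_right ?_ h.pos.le
  unfold C₀; linarith

lemma phiLe_zero (β) : PhiLe d 0 β := by
  intro I _ v
  have : phi 0 (bx I) v = 0 := by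
    unfold phi Q; refine ENNReal.tsum_eq_zero.2 fun z => ?_; split_ifs
    · rfl
    · refine ENNReal.tsum_eq_zero.2 fun y => ?_; unfold J; rw [wt_true (by simp)]; simp
  simp_all

lemma exists_step (hq : q ≤ 1) (hchi : chi d q ≠ ⊤) (hδ : 0 < δ) : ∃ h > 0, ∀ p s : ℝ, p ∈ 𝕀 → s ∈ 𝕀 → p ≤ q → uni p s ≤ q → s ≤ h →
    (∀ (S : Set (V d)) (v : V d), phi (uni p s) S v ≤ phi p S v + ofReal δ) ∧ (∀ t : Fin d × Bool, tri (uni p s) t ≤ tri p t + ofReal δ) ∧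
    (∀ t : Fin d × Bool, triW (uni p s) t ≤ triW p t + ofReal δ) := by
  set M₁ := 2 * d * (mass (gg q : Fn d) + chi d q)
  have hg : mass (gg q : Fn d) ≠ ⊤ := by
    rw [mass_gg]; exact mul_ne_top hchi (mul_ne_top (mul_ne_top (by simp) (by simp)) hchi)
  set MW : Fin d × Bool → ENNReal := fun t => (∑' y, uw t y * tt q y) * (2 * mass (gg q : Fn d)) + (∑' y, uw t y * gg q y) * chi d q
  set M := M₁ + ∑ t, MW t + 1
  have hM : M ≠ ⊤ := ENNReal.add_ne_top.2 ⟨ENNReal.add_ne_top.2 ⟨mul_ne_top (mul_ne_top (by simp) (by simp)) (ENNReal.add_ne_top.2 ⟨hg, hchi⟩), ENNReal.sum_ne_top.2 fun t _ => (fun t => ENNReal.add_ne_top.2 ⟨mul_ne_top (tsum_uw_tt hchi t) (mul_ne_top (by simp) hg), mul_ne_top (tsum_uw_gg hchi t) hchi⟩) t⟩, by simp⟩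
  have hM0 : 0 < M.toReal := ENNReal.toReal_pos (by simp [M]) hM
  refine ⟨δ / M.toReal, by positivity, fun p s hp hs hpq hu hsh => ?_⟩
  have hsM : ∀ m ≤ M, ofReal s * m ≤ ofReal δ := by
    intro m hm; refine (mul_le_mul' (ofReal_le_ofReal hsh) hm).trans ?_
    rw [← ofReal_toReal hM, ← ofReal_mul (by positivity), ENNReal.toReal_ofReal hM0.le, div_mul_cancel₀ _ hM0.ne']
  have hWM : ∀ t, MW t ≤ M := fun t => le_add_right (le_add_left (single_le_sum (fun _ _ => zero_le) (Finset.mem_univ t)))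
  have hone : ∀ t (y : V d), (1:ENNReal) ≤ uw t y := fun t y => by
    unfold uw; exact one_le_pow₀ (by exact_mod_cast Nat.le_add_right 1 _)
  have hle : ∀ (W : Fn d) t, (∀ y, W y ≤ uw t y) →
      (∑' y, W y * tt q y) * (2 * mass (gg q : Fn d)) + (∑' y, W y * gg q y) * chi d q ≤ MW t := fun W t hW =>
    add_le_add (mul_le_mul' (tsum_le_tsum fun y => mul_le_mul' (hW y) le_rfl) le_rfl)
      (mul_le_mul' (tsum_le_tsum fun y => mul_le_mul' (hW y) le_rfl) le_rfl)
  refine ⟨fun S v => ?_, fun t => ?_, fun t => ?_⟩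
  · exact (phi_uni_le hp hs hpq hu hq hchi S v).trans (add_le_add le_rfl (hsM _ (le_add_right (le_add_right le_rfl))))
  · rw [tri_eq, tri_eq]; exact (Dg_uni_le hp hs hpq hu hq hchi _ _).trans (add_le_add le_rfl (hsM _ ((hle _ t (hone t)).trans (hWM t))))
  · rw [triW_eq, triW_eq]; refine (Dg_uni_le hp hs hpq hu hq hchi _ _).trans (add_le_add le_rfl (hsM _ ((hle _ t fun y => ?_).trans (hWM t))))
    exact pow_le_pow_left' (Nat.cast_le.2 (by omega)) 3

lemma ofReal_add_le (ha : 0 ≤ a) (hb : 0 ≤ b) (h : a + b ≤ c) (hu : u ≤ ofReal a) : u + ofReal b ≤ ofReal c :=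
  (add_le_add hu le_rfl).trans (by rw [← ofReal_add ha hb]; exact ofReal_le_ofReal h)

theorem phiLe (h : Big d) (hq0 : 0 ≤ q) (hq : q ≤ 1) (hchi : chi d q ≠ ⊤) : PhiLe d q (1 + C₀ / d) := by
  have hd := h.pos
  have hd26 : (26:ℝ) ≤ d := by exact_mod_cast h.d26
  have hC := C₀_pos
  obtain ⟨η, hη, hstep⟩ := exists_step hq hchi (δ := 1 / d ^ 2) (by positivity)
  have key : ∀ n : ℕ, ∀ p, 0 ≤ p → p ≤ q → p ≤ n * (η / 2) → PhiLe d p (1 + C₀ / d) := by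
    intro n; induction n with
    | zero =>
      intro p h0 _ h1; have : p = 0 := le_antisymm (by simpa using h1) h0; rw [this]; exact phiLe_zero _
    | succ n ih =>
      intro p h0 hpq h1; set p₀ := max 0 (p - η / 2); have hp0 : p₀ ≤ p := max_le h0 (by linarith)
      have hg := ih p₀ (le_max_left _ _) (hp0.trans hpq) (max_le (by positivity) (by push_cast at h1; linarith))
      have hchip : chi d p ≠ ⊤ := ne_top_of_le_ne_top hchi (chi_mono h0 hpq hq)
      have hS := h.std (ne_top_of_le_ne_top hchi (chi_mono (le_max_left _ _) (hp0.trans hpq) hq)) hg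
      have hp01 : p₀ ∈ 𝕀 := ⟨le_max_left _ _, (hp0.trans hpq).trans hq⟩; obtain ⟨s, hs, hu, hse⟩ := exists_uni hp0 (hpq.trans hq)
      have hp0h : p₀ ≤ 1 / 2 := by
        have := wt_le_inv hS.phi hS.le (by have := h.d26; omega); rw [wt_true hp01] at this; have := (ofReal_le_ofReal_iff (by positivity)).1 this
        exact this.trans (one_div_le_one_div_of_le (by norm_num) (by linarith))
      have hsh : s ≤ η := by
        have : p - η / 2 ≤ p₀ := le_max_right _ _; nlinarith [hs.1]
      obtain ⟨e1, e2, e3⟩ := hstep p₀ s hp01 hs (hp0.trans hpq) (hu ▸ hpq) hsh; rw [hu] at e1 e2 e3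
      refine h.phiLe_of_weak hchip ?_ (fun t => (e2 t).trans ?_) fun t => (e3 t).trans ?_
      · intro I hI v; refine (e1 _ v).trans (ofReal_add_le (by positivity) (by positivity) ?_ (hg I hI v))
        have : C₀ / d ≤ 0.00001 := by rw [div_le_iff₀ hd]; have := h.C; linarith
        have : 1 / (d:ℝ) ^ 2 ≤ 0.02 := by rw [div_le_iff₀ (by positivity)]; nlinarith
        linarith
      · exact ofReal_add_le (by positivity) (by positivity) (by rw [add_div K₁]; exact add_le_add le_rfl (one_div_le_one_div_of_le hd (by nlinarith))) (hS.tri_le h.num t)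
      · exact ofReal_add_le (by positivity) (by positivity) (by rw [add_div K₂]; exact le_rfl) (hS.triW_le h.num t)
  obtain ⟨n, hn⟩ := exists_nat_ge (q / (η / 2))
  exact key n q hq0 le_rfl (by rw [div_le_iff₀ (by positivity)] at hn; exact hn)

variable {p : ℝ}

lemma std' (h : Big d) (hp0 : 0 ≤ p) (hp : p ≤ 1) (hchi : Perc.chi d p ≠ ⊤) : Std d p (1 + C₀ / d) (exp C₀) :=
  h.std hchi (h.phiLe hp0 hp hchi)

lemma C_div_le (h : Big d) : C₀ / d ≤ 0.00001 := by rw [div_le_iff₀ h.pos]; have := h.C; linarith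

lemma tri_le (h : Big d) (hp0 : 0 ≤ p) (hp : p ≤ 1) (hchi : Perc.chi d p ≠ ⊤) (s : Fin d × Bool) : tri p s ≤ ofReal 0.00001 := by
  refine ((h.std' hp0 hp hchi).tri_le h.num s).trans (ofReal_le_ofReal (le_trans ?_ h.C_div_le))
  refine div_le_div_of_nonneg_right ?_ h.pos.le
  rw [(show (26 ^ 3 * Kx + 8 : ℝ) = K₁ from rfl)]; unfold C₀; have := K₁_pos; have := K₂_pos; linarith

lemma err_le (h : Big d) (hp0 : 0 ≤ p) (hp : p ≤ 1) (hchi : Perc.chi d p ≠ ⊤) (hI : ∀ i, (I i).OrdConnected) (v : V d) :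
    err p (bx I) v ≤ ofReal 0.00001 := by
  have hS := h.std' hp0 hp hchi
  have k1 := K₁_pos
  refine (Perc.err_le hchi hS.phi hS.one hS.le (hS.tri_le h.num) (hS.triW_le h.num) hI v).trans ?_
  rw [← ofReal_natCast d, show (20:ENNReal) = ofReal 20 by simp, ← ofReal_mul (by positivity),
    ← ofReal_mul (by simp), ← ofReal_mul (by simp), ← ofReal_add (by have := C₀_pos; positivity) (by positivity)]
  refine ofReal_le_ofReal (le_trans ?_ h.C_div_le)
  change K₁ / d * (1 + C₀ / d) + 20 * d * (K₂ / d ^ 2) ≤ C₀ / d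
  rw [(show K₁ / d * (1 + C₀ / d) + 20 * d * (K₂ / d ^ 2) = (K₁ * (1 + C₀ / d) + 20 * K₂) / d by grind)]
  refine div_le_div_of_nonneg_right ?_ h.pos.le
  unfold C₀ at *
  have := hS.le
  nlinarith

end Big
end

noncomputable section

variable {d : ℕ}
variable {x y z v w : V d} {p s : ℝ}

/-- Close the edge `b` in both configurations. -/
def cl₂ (b : Edge d) (q : Pr (Edge d)) : Pr (Edge d) := (setAt b false q.1, setAt b false q.2)

lemma measurable_cl₂ (b : Edge d) : Measurable (cl₂ b) :=
  ((measurable_setAt b false).comp measurable_fst).prodMk ((measurable_setAt b false).comp measurable_snd)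

lemma orc_cl₂ (b : Edge d) (q) : orc (cl₂ b q).1 (cl₂ b q).2 = setAt b false (orc q.1 q.2) := by
  ext e
  by_cases h : e = b
  · subst h; simp [orc, cl₂]
  · simp [orc, cl₂, setAt_ne h]

lemma le_orc (ω ξ : Config d) : ∀ e, ω e = true → orc ω ξ e = true := fun e h => by simp [orc, h]

/-- `v` reaches `y` in the base configuration while `z` reaches `x` off the cluster of `v` in the union. -/
def spG (v x y z : V d) : Set (Pr (Edge d)) :=
  {q | q.1 ∈ cn univ v y} ∩ {q | orc q.1 q.2 ∈ {ω | Cn (univ \ cl univ ω v) ω z x}}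

lemma meas_spG : MeasurableSet (spG v x y z) :=
  (measurable_fst (meas_cn _ _ _)).inter (measurable_orc (meas_cn_diff_cl _ _ _ _))

/-- The sprinkled edge `(y, z)` is the last link from the base cluster of `v` to `x`. -/
def spEv (v x y z : V d) : Set (Pr (Edge d)) :=
  {q | ∃ h : Adjacent y z, q.1 (mkE h) = false ∧ q.2 (mkE h) = true ∧ cl₂ (mkE h) q ∈ spG v x y z}

lemma spEv_eq (h : Adjacent y z) : spEv v x y z =
    {q | q.1 ∈ {ω | ω (mkE h) = false}} ∩ ({q | q.2 ∈ {ω | ω (mkE h) = true}} ∩ cl₂ (mkE h) ⁻¹' spG v x y z) := by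
  ext q; simp [spEv, h, mem_preimage]

lemma meas_spEv : MeasurableSet (spEv v x y z) := by
  by_cases h : Adjacent y z
  · rw [spEv_eq h]
    exact (measurable_fst (meas_coord _ _)).inter ((measurable_snd (meas_coord _ _)).inter (measurable_cl₂ _ meas_spG))
  · have : spEv v x y z = ∅ := eq_empty_of_forall_notMem fun q ⟨h', _⟩ => h h'; simp_all

lemma depOn₂_cl₂ (b : Edge d) (F) : DepOn₂ (cl₂ b ⁻¹' F) {b}ᶜ {b}ᶜ := by
  intro q q' h1 h2 hq
  have : cl₂ b q' = cl₂ b q := by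
    refine Prod.ext ?_ ?_ <;> ext e <;> by_cases he : e = b
    · subst he; simp [cl₂]
    · simp [cl₂, setAt_ne he]; exact (h1 e he).symm
    · subst he; simp [cl₂]
    · simp [cl₂, setAt_ne he]; exact (h2 e he).symm
  simp_all

lemma measure_spEv (h : Adjacent y z) : ((mu p).prod (mu s)) (spEv v x y z) =
    wt p false * wt s true * ((mu p).prod (mu s)) (cl₂ (mkE h) ⁻¹' spG v x y z) := by
  have hd : ∀ b, DepOn {ω | ω (mkE h) = b} {mkE h} := fun b ω ω' h' => by simp_all
  have m2 : MeasurableSet {q : Pr (Edge d) | q.2 ∈ {ω | ω (mkE h) = true}} := measurable_snd (meas_coord _ _)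
  rw [spEv_eq h, prod_inter_of_depOn p s (B' := univ) (show MeasurableSet {q | q.1 ∈ {ω | ω (mkE h) = false}} from measurable_fst (meas_coord _ _))
      (m2.inter (measurable_cl₂ _ meas_spG)) (hd _).fst ?_ disjoint_compl_right (empty_disjoint _),
    prod_inter_of_depOn p s m2
      (measurable_cl₂ _ meas_spG) (hd _).snd (depOn₂_cl₂ _ _) (empty_disjoint _) disjoint_compl_right, prod_fst, prod_snd, mu_coord, mu_coord, mul_assoc]
  exact ((hd _).snd.mono (empty_subset _) (subset_univ _)).inter ((depOn₂_cl₂ _ _).mono Subset.rfl (subset_univ _))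

lemma spEv_subset : spEv v x y z ⊆ {q | orc q.1 q.2 ∈ cn univ v x} := by
  rintro q ⟨h, -, h2, h3, h4⟩
  have h4 : Cn _ (orc (cl₂ (mkE h) q).1 (cl₂ (mkE h) q).2) z x := h4
  rw [orc_cl₂] at h4
  have h6 : Cn univ (orc q.1 q.2) v y := Cn.mono Subset.rfl (fun e he => le_orc _ _ e (setAt_false_le _ _ e he)) h3
  exact (h6.trans (Cn.step trivial trivial (openAdj_iff.2 ⟨h, by simp [orc, h2]⟩))).trans (Cn.mono (subset_univ _) (setAt_false_le _ _) h4)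

lemma setAt_eq_self (h : ω e = b) : setAt e b ω = ω := by rw [← h]; simp [setAt]

lemma spEv_disjoint_cn : Disjoint {q | q.1 ∈ cn univ v x} (spEv v x y z) := by
  rw [disjoint_left]
  rintro q h0 ⟨h, h1, h2, h3, h4⟩
  refine (Cn.right h4).2 (Cn.mono Subset.rfl (le_orc _ _) ?_)
  change Cn univ (setAt (mkE h) false q.1) v x
  rw [setAt_eq_self h1]; exact h0

lemma spEv_disjoint (hne : (y, z) ≠ (y', z')) : Disjoint (spEv v x y z) (spEv v x y' z') := by
  rw [disjoint_left]
  rintro q ⟨h, h1, h2, i3, i4⟩ ⟨h', h1', h2', i3', i4'⟩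
  have h3 : Cn univ (setAt (mkE h) false q.1) v y := i3
  have h3' : Cn univ (setAt (mkE h') false q.1) v y' := i3'
  have h4 : Cn (univ \ cl univ (orc (cl₂ (mkE h) q).1 (cl₂ (mkE h) q).2) v) (orc (cl₂ (mkE h) q).1 (cl₂ (mkE h) q).2) z x := i4
  have h4' : Cn (univ \ cl univ (orc (cl₂ (mkE h') q).1 (cl₂ (mkE h') q).2) v) (orc (cl₂ (mkE h') q).1 (cl₂ (mkE h') q).2) z' x := i4'
  rw [orc_cl₂] at h4 h4'
  rw [setAt_eq_self h1] at h3
  rw [setAt_eq_self h1'] at h3'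
  set o := orc q.1 q.2
  have hin : ∀ e u, q.1 e = false → Cn univ q.1 v u → u ∈ cl univ (setAt e false o) v := by
    intro e u he hu; rw [← setAt_eq_self he] at hu; refine Cn.mono Subset.rfl (fun e' he' => ?_) hu; by_cases hee : e' = e
    · simp_all
    · rw [setAt_ne hee] at he' ⊢; exact le_orc _ _ _ he'
  have hne' : mkE h ≠ mkE h' := by
    intro heq; rcases Sym2.eq_iff.1 (congrArg Subtype.val heq) with ⟨rfl, rfl⟩ | ⟨rfl, rfl⟩
    · simp_all
    · exact h4.left.2 (hin _ _ h1 h3')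
  have hzx : Cn univ (setAt (mkE h') false o) z x := by
    refine (Cn.mono (S := univ \ cl univ (setAt (mkE h) false o) v) (subset_univ _) (fun _ h => h) ?_)
    refine Cn.congr_edges (fun a c hac ha hc => ?_) (Cn.mono Subset.rfl (setAt_false_le _ _) h4); rw [setAt_ne]; intro heq
    rcases Sym2.eq_iff.1 (congrArg Subtype.val heq) with ⟨rfl, rfl⟩ | ⟨rfl, rfl⟩; exacts [ha.2 (hin _ _ h1 h3'), hc.2 (hin _ _ h1 h3')]
  refine (Cn.right h4').2 (((hin _ _ h1' h3).trans (Cn.step trivial trivial (openAdj_iff.2 ⟨h, ?_⟩))).trans hzx)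
  rw [setAt_ne hne']; simp [o, orc, h2]

lemma le_measure_spG (hp : p ∈ 𝕀) (hs : s ∈ 𝕀) (hAF : AF (uni p s) univ v) (h : Adjacent y z) :
    mu p (setAt (mkE h) false ⁻¹' cn univ v y) * tau (uni p s) univ z x ≤ ((mu p).prod (mu s)) (cl₂ (mkE h) ⁻¹' spG v x y z) +
      ∑' w, (∑' u, tau (uni p s) univ v u * tau (uni p s) univ u y * tau (uni p s) univ u w) * (tau (uni p s) univ z w * tau (uni p s) univ w x) := by
  set b := mkE h
  set P := (mu p : Measure (Config d)).prod (mu s) with hP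
  set p' := uni p s with hp'
  set A : Set (Pr (Edge d)) := {q | setAt b false q.1 ∈ cn univ v y}
  have hAm : MeasurableSet A := measurable_fst (measurable_setAt b false (meas_cn _ _ _))
  set CD : Finset (V d) → Set (Pr (Edge d)) := fun D => {q | setAt b false (orc q.1 q.2) ∈ {ω | cl univ ω v = D}} with hCD
  have hCDm : ∀ D, MeasurableSet (CD D) := fun D => measurable_orc (measurable_setAt b false (meas_cl_eq _ _ _))
  have hdec : ∀ F, MeasurableSet F → ∑' D, P (CD D ∩ F) = P F := by
    intro F hF; rw [← measure_iUnion]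
    · refine measure_congr ?_
      have h' : ∀ᵐ q ∂P, (cl univ (orc q.1 q.2) v).Finite := by
        rw [ae_iff, ← hAF]; exact (mu_uni hp hs (meas_cl_finite univ v).compl).symm
      rw [eventuallyEq_set]; filter_upwards [h'] with q hq; simp only [mem_iUnion, mem_inter_iff]
      exact ⟨fun ⟨_, _, h⟩ => h, fun h => ⟨(show (cl univ (setAt b false (orc q.1 q.2)) v).Finite from hq.subset fun y hy => Cn.mono Subset.rfl (setAt_false_le _ _) hy).toFinset, by simp [hCD], h⟩⟩
    · intro D D' hne; rw [Function.onFun, disjoint_left]; rintro q ⟨h1, _⟩ ⟨h2, _⟩; have h2 : cl univ (setAt b false (orc q.1 q.2)) v = D' := h2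
      exact hne (by rw [h1] at h2; exact_mod_cast h2)
    · exact fun D => (hCDm D).inter hF
  have hAsub : ∀ (q : Pr (Edge d)) u, Cn univ (setAt b false q.1) v u → u ∈ cl univ (setAt b false (orc q.1 q.2)) v := by
    intro q u hu; refine Cn.mono Subset.rfl (fun e' he' => ?_) hu; by_cases hee : e' = b
    · subst hee; simp at he'
    · rw [setAt_ne hee] at he' ⊢; exact le_orc _ _ _ he'
  have hD : ∀ D, P (CD D ∩ A) * tau p' univ z x ≤ P (CD D ∩ cl₂ b ⁻¹' spG v x y z) +
      ∑' w, P (CD D ∩ (A ∩ {_q | w ∈ D})) * (tau p' univ z w * tau p' univ w x) := by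
    intro D; by_cases hyD : y ∈ D; swap
    · have : CD D ∩ A = ∅ := by
        refine eq_empty_of_forall_notMem fun q ⟨h1, h2⟩ => hyD ?_; have := hAsub q y h2; rw [h1] at this; exact this
      rw [this]; simp
    calc _ ≤ P (CD D ∩ A) * (tau p' (univ \ D) z x + ∑' w, (if w ∈ (D : Set (V d)) then tau p' univ z w * tau p' univ w x else 0)) := by
          refine mul_le_mul' le_rfl ((tau_le_through p' D).trans_eq ?_); congr!
      _ ≤ _ := by
        rw [mul_add]; refine add_le_add ?_ ?_
        · rw [tau, hp', mu_uni hp hs (meas_cn _ _ _), ← prod_inter_of_depOn p s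
           ]
          · refine measure_mono ?_; rintro q ⟨⟨h1, h2⟩, h3⟩; have h1' : cl univ (setAt b false (orc q.1 q.2)) v = D := h1; refine ⟨h1, h2, ?_⟩
            change Cn (univ \ cl univ (orc (cl₂ b q).1 (cl₂ b q).2) v) (orc (cl₂ b q).1 (cl₂ b q).2) z x; rw [orc_cl₂, h1']
            exact Cn.setAt (fun h' => ((mkE_mem_edgesIn h).1 h').1.2 hyD) h3
          · exact (hCDm D).inter hAm
          · exact measurable_orc (meas_cn _ _ _)
          · rintro q q' hag hag' ⟨h1, h2⟩; have h1' : cl univ (setAt b false (orc q.1 q.2)) v = D := h1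
            have hag1 : ∀ a c, ∀ h : Adjacent a c, a ∈ D → q.1 (mkE h) = q'.1 (mkE h) := fun a c h ha =>
              hag _ ((mkE_mem_edgesAt h).2 (.inl ha))
            have hs1 : ∀ (ω ω' : Config d) (a c : V d) (hac : Adjacent a c), ω (mkE hac) = ω' (mkE hac) → setAt b false ω (mkE hac) = setAt b false ω' (mkE hac) := by
              intro ω ω' a c hac he; by_cases hbe : mkE hac = b
              · rw [hbe]; simp
              · rw [setAt_ne hbe, setAt_ne hbe, he]
            refine ⟨cl_eq_of_agree (fun a c hac ha _ _ => hs1 _ _ a c hac (by simp [orc, hag1 a c hac ha, (fun a c h ha => hag' _ ((mkE_mem_edgesAt h).2 (.inl ha))) a c hac ha])) h1', ?_⟩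
            have h3 : Cn D (setAt b false q.1) v y := by
              have hin : ∀ u, Cn univ (setAt b false q.1) v u → u ∈ (D : Set (V d)) := fun u hu => h1' ▸ hAsub q u hu
              exact Cn.induct (P := fun y => Cn (D : Set (V d)) (setAt b false q.1) v y) (Cn.refl (hin v (Cn.refl trivial))) (fun a c ha ha' _ _ hac => (ha'.trans (Cn.step ha'.right (hin c (ha.trans (Cn.step trivial trivial hac))) hac))) h2
            exact (Cn.congr_edges (fun a c hac ha _ => hs1 _ _ a c hac (hag1 a c hac ha)) h3).mono_set (subset_univ _)
          exacts [(depOn_cn _ _ _).orc, disjoint_edgesAt_edgesIn_diff _, disjoint_edgesAt_edgesIn_diff _]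
        · rw [← tsum_mul_left]; refine tsum_le_tsum fun w => ?_; by_cases hw : w ∈ (D : Set (V d))
          · rw [if_pos hw]; exact mul_le_mul' (measure_mono fun q h => ⟨h.1, h.2, hw⟩) le_rfl
          · rw [if_neg hw]; simp
  rw [(show mu p (setAt b false ⁻¹' cn univ v y) = P A from (prod_fst p s (setAt b false ⁻¹' cn univ v y)).symm), ← hdec _ hAm, ← tsum_mul_right]
  refine (tsum_le_tsum hD).trans ?_
  rw [tsum_add, hdec _ (measurable_cl₂ b meas_spG), tsum_comm]
  refine add_le_add le_rfl (tsum_le_tsum fun w => ?_)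
  rw [tsum_mul_right]
  refine mul_le_mul' (le_trans ?_ (mu_cn_inter_cn_le p')) le_rfl
  rw [hp', mu_uni hp hs ((meas_cn _ _ _).inter (meas_cn _ _ _)), ← hP, ← hdec {q | orc q.1 q.2 ∈ cn univ v y ∩ cn univ v w} (measurable_orc ((meas_cn univ v y).inter (meas_cn univ v w)))]
  refine tsum_le_tsum fun D => measure_mono ?_
  rintro q ⟨h1, h2, h3⟩
  refine ⟨h1, Cn.mono Subset.rfl (fun e he => le_orc _ _ e (setAt_false_le _ _ e he)) h2, ?_⟩
  have h3 : w ∈ (D : Set (V d)) := h3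
  rw [← show cl univ (setAt b false (orc q.1 q.2)) v = D from h1] at h3
  exact Cn.mono Subset.rfl (setAt_false_le _ _) h3

lemma tau_le_closed (p) (h : Adjacent y z) (v) :
    tau p univ v y ≤ mu p (setAt (mkE h) false ⁻¹' cn univ v y) + wt p true * tau p univ v z := by
  have hsub : setAt (mkE h) true ⁻¹' cn univ v y ⊆ setAt (mkE h) false ⁻¹' cn univ v y ∪ setAt (mkE h) false ⁻¹' cn univ v z := by
    intro ω hω
    have : ∀ u, Cn univ (setAt (mkE h) true ω) v u → (Cn univ (setAt (mkE h) false ω) v u ∨ Cn univ (setAt (mkE h) false ω) v y ∨ Cn univ (setAt (mkE h) false ω) v z) := by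
      intro u hu
      refine Cn.induct (P := fun u => Cn univ (setAt (mkE h) false ω) v u ∨ Cn univ (setAt (mkE h) false ω) v y ∨ Cn univ (setAt (mkE h) false ω) v z)
        (.inl (Cn.refl trivial)) (fun a c _ ha _ _ hac => ?_) hu
      rcases ha with ha | ha; swap
      · simp_all
      obtain ⟨h1, h2⟩ := openAdj_iff.1 hac; by_cases he : mkE h1 = mkE h
      · rcases Sym2.eq_iff.1 (congrArg Subtype.val he) with ⟨rfl, rfl⟩ | ⟨rfl, rfl⟩
        · simp_all
        · simp_all
      · refine .inl (ha.trans (Cn.step trivial trivial (openAdj_iff.2 ⟨h1, ?_⟩))); rwa [setAt_ne he] at h2 ⊢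
    rcases this y hω with h' | h' | h'
    · tauto
    · tauto
    · tauto
  calc tau p univ v y = wt p true * mu p (setAt (mkE h) true ⁻¹' cn univ v y) + wt p false * mu p (setAt (mkE h) false ⁻¹' cn univ v y) :=
        mu_eq_resample p (mkE h) (meas_cn univ v y)
    _ ≤ wt p true * (mu p (setAt (mkE h) false ⁻¹' cn univ v y) + tau p univ v z) + wt p false * mu p (setAt (mkE h) false ⁻¹' cn univ v y) := by
        exact add_le_add (mul_le_mul' le_rfl ((measure_mono hsub).trans ((measure_union_le _ _).trans (add_le_add le_rfl (measure_mono fun ω hω => Cn.mono Subset.rfl (setAt_false_le _ _) hω))))) le_rfl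
    _ = (wt p true + wt p false) * mu p (setAt (mkE h) false ⁻¹' cn univ v y) + wt p true * tau p univ v z := by ring
    _ = _ := by rw [wt_add, one_mul]

lemma chi_uni_ge (hp : p ∈ 𝕀) (hs : s ∈ 𝕀) (hchi : chi d (uni p s) ≠ ⊤) (hN : ∀ t : Fin d × Bool, tri (uni p s) t ≤ N) :
    chi d p + wt p false * wt s true * (2 * d * (chi d p * chi d (uni p s))) ≤ chi d (uni p s) +
      wt p false * wt s true * (2 * d * (N * chi d (uni p s) ^ 2 + wt p true * chi d p * chi d (uni p s))) := by
  set p' := uni p s with hp'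
  set a := wt p false * wt s true
  set Er : V d → V d → Fn d := fun x y z =>
    ∑' w, (∑' u, tau p' univ 0 u * tau p' univ u y * tau p' univ u w) * (tau p' univ z w * tau p' univ w x) with hEr
  have h1 : ∀ x : V d, tau p univ 0 x + ∑' y, ∑' z, ((mu p).prod (mu s)) (spEv 0 x y z) ≤ tau p' univ 0 x := by
    intro x
    rw [← tsum_prod (f := fun y z => ((mu p).prod (mu s)) (spEv 0 x y z)),
      ← measure_iUnion, tau, tau, hp', mu_uni hp hs (meas_cn _ _ _), ← prod_fst p s, ← measure_union]
    · exact measure_mono (union_subset (fun q h => Cn.mono Subset.rfl (le_orc _ _) h) (iUnion_subset fun b => spEv_subset))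
    · exact disjoint_iUnion_right.2 fun b => spEv_disjoint_cn
    · exact MeasurableSet.iUnion fun b => meas_spEv
    · intro b b' hne; exact spEv_disjoint hne
    · exact fun b => meas_spEv
  have h2 : ∀ x y z : V d, a * (J 1 y z * (tau p univ 0 y * tau p' univ z x)) ≤ ((mu p).prod (mu s)) (spEv 0 x y z) +
      a * (J 1 y z * (Er x y z + wt p true * tau p univ 0 z * tau p' univ z x)) := by
    intro x y z; by_cases h : Adjacent y z; swap
    · simp [J, h]
    rw [measure_spEv h, J, if_pos h, wt_true (by simp), ofReal_one, one_mul, one_mul, ← mul_add, ← add_assoc]; refine mul_le_mul' le_rfl ?_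
    refine (mul_le_mul' (tau_le_closed p h 0) le_rfl).trans ?_; rw [add_mul]; exact add_le_add (le_measure_spG hp hs (AF.of_chi hchi _ _) h) le_rfl
  have h3 : ∀ x, tau p univ 0 x + ∑' y, ∑' z, a * (J 1 y z * (tau p univ 0 y * tau p' univ z x)) ≤
      tau p' univ 0 x + ∑' y, ∑' z, a * (J 1 y z * (Er x y z + wt p true * tau p univ 0 z * tau p' univ z x)) := by
    intro x
    calc _ ≤ tau p univ 0 x + ∑' y, ∑' z, (((mu p).prod (mu s)) (spEv 0 x y z) +
          a * (J 1 y z * (Er x y z + wt p true * tau p univ 0 z * tau p' univ z x))) :=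
          add_le_add le_rfl (tsum_le_tsum fun y => tsum_le_tsum fun z => h2 x y z)
      _ ≤ _ := by
          simp [tsum_add]; rw [← add_assoc]; exact add_le_add (h1 x) le_rfl
  have h4 := tsum_le_tsum h3
  have hX : ∀ z, ∑' x, tau p' univ z x = chi d p' := fun z => X_univ p' z
  have swap3 : ∀ f : V d → V d → Fn d, ∑' x, ∑' y, ∑' z, f x y z = ∑' y, ∑' z, ∑' x, f x y z := fun f => by
    rw [tsum_comm]; exact tsum_congr fun y => tsum_comm
  rw [tsum_add, tsum_add, swap3 (fun x y z => a * (J 1 y z * (tau p univ 0 y * tau p' univ z x))),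
    swap3 (fun x y z => a * (J 1 y z * (Er x y z + wt p true * tau p univ 0 z * tau p' univ z x)))] at h4
  have e1 : ∑' x : V d, tau p univ 0 x = chi d p := X_univ p 0
  have e2 : ∑' y : V d, ∑' z : V d, ∑' x : V d, a * (J 1 y z * (tau p univ 0 y * tau p' univ z x)) = a * (2 * d * (chi d p * chi d p')) := by
    simp [tsum_mul_left, hX, tsum_mul_right, tsum_J_one, e1]
  have e3 : ∑' y : V d, ∑' z : V d, ∑' x : V d, a * (J 1 y z * (Er x y z + wt p true * tau p univ 0 z * tau p' univ z x)) ≤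
      a * (2 * d * (N * chi d p' ^ 2 + wt p true * chi d p * chi d p')) := by
    simp [tsum_mul_left, tsum_add, hX]; refine mul_le_mul' le_rfl ?_
    have hEsum : ∀ y z : V d, ∑' x, Er x y z = (∑' u, tt p' u * (tt p' (y - u) * bub p' (z - u))) * chi d p' := by
      intro y z; rw [hEr]; rw [tsum_comm]; simp [tsum_mul_left, hX, ← mul_assoc]; rw [tsum_mul_right]; congr 1; simp [← tsum_mul_right]
      rw [tsum_comm]; refine tsum_congr fun u => ?_; simp [tau_univ, sub_zero]
      have : bub p' (z - u) = ∑' w, tt p' (w - u) * tt p' (z - w) := by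
        rw [bub, ← tsum_sub_left _ u]; refine tsum_congr fun w => ?_; congr 2; abel
      rw [this, ← tsum_mul_left]; refine tsum_congr fun w => ?_; rw [← tt_neg p' (w - z), neg_sub]; ring
    simp [hEsum, mul_add, tsum_add]; refine add_le_add ?_ (le_of_eq ?_)
    · have : ∀ y : V d, ∑' z, J 1 y z * ((∑' u, tt p' u * (tt p' (y - u) * bub p' (z - u))) * chi d p') =
          ∑ t : Fin d × Bool, (∑' u, tt p' u * (tt p' (y - u) * bub p' (y - u + st t))) * chi d p' := by
        intro y; rw [tsum_J, wt_true (by simp), ofReal_one]; refine sum_congr rfl fun t _ => ?_; rw [one_mul]; congr 1; refine tsum_congr fun u => ?_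
        rw [show y + st t - u = y - u + st t by abel]
      simp [this]; rw [Summable.tsum_finsetSum fun _ _ => ENNReal.summable]
      calc _ ≤ ∑ t : Fin d × Bool, N * chi d p' ^ 2 := by
            refine sum_le_sum fun t _ => ?_; rw [tsum_mul_right, tsum_comm]; simp [tsum_mul_left]
            have : ∀ u : V d, ∑' y, tt p' (y - u) * bub p' (y - u + st t) = tri p' t := fun u =>
              tsum_sub_left (fun y => tt p' y * bub p' (y + st t)) u
            simp [this, tsum_mul_right]
            calc _ ≤ chi d p' * N * chi d p' := mul_le_mul' (mul_le_mul' le_rfl (hN t)) le_rfl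
              _ = _ := by ring
        _ = _ := by simp; ring
    · rw [tsum_comm]
      have : ∀ z : V d, ∑' y, J 1 y z * (wt p true * tau p univ 0 z * chi d p') = 2 * d * (wt p true * tau p univ 0 z * chi d p') := by
        intro z; rw [tsum_mul_right]; congr 1; rw [← tsum_J_one z]; exact tsum_congr fun y => J_symm _ _ _
      simp [this, tsum_mul_left, tsum_mul_right, e1]
  rw [e2] at h4
  exact h4.trans (add_le_add le_rfl e3)

end

noncomputable section

variable {d : ℕ}
variable {x y z v w : V d} {p q : ℝ}

/-- The threshold for finite susceptibility. -/
def pT (d : ℕ) : ℝ := sSup {p | p ∈ 𝕀 ∧ chi d p ≠ ⊤}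

lemma chi_zero_ne_top (d) : chi d 0 ≠ ⊤ := by
  have h : ∀ x : V d, x ≠ 0 → tt 0 x = 0 := by
    intro x hx
    have hsub : cn univ 0 x ⊆ ⋃ e, {ω | ω e = true} := by
      intro ω hω; by_contra hc
      have : x = 0 := Cn.induct (P := fun y => y = 0) rfl (fun a b _ _ _ _ hab => by
        obtain ⟨h1, h2⟩ := openAdj_iff.1 hab; rw [(show ∀ e, ω e = false from fun e => by simp_all)] at h2; simp at h2) hω
      simp_all
    refine le_antisymm ((measure_mono hsub).trans ((measure_iUnion_le _).trans ?_)) zero_le; simp [mu_coord, wt_true (p := 0) (by simp)]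
  rw [chi, tsum_eq_single 0 h, tt_zero]; simp

lemma bddAbove_pT (d) : BddAbove {p | p ∈ 𝕀 ∧ chi d p ≠ ⊤} := ⟨1, fun _ h => h.1.2⟩

lemma pT_nonneg (d) : 0 ≤ pT d := le_csSup (bddAbove_pT d) ⟨by simp, chi_zero_ne_top d⟩

lemma nonempty_pT (d) : {p | p ∈ 𝕀 ∧ chi d p ≠ ⊤}.Nonempty := ⟨0, by simp, chi_zero_ne_top d⟩

lemma pT_le_one (d) : pT d ≤ 1 := csSup_le (nonempty_pT d) fun _ h => h.1.2

lemma chi_ne_top_of_lt (hp : 0 ≤ p) (h : p < pT d) : chi d p ≠ ⊤ := by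
  obtain ⟨q, hq, hpq⟩ := exists_lt_of_lt_csSup (nonempty_pT d) h
  exact ne_top_of_le_ne_top hq.2 (chi_mono hp hpq.le hq.1.2)

lemma chi_eq_top_of_gt (hp : p ∈ 𝕀) (h : pT d < p) : chi d p = ⊤ := by
  by_contra hc
  exact absurd (le_csSup (bddAbove_pT d) ⟨hp, hc⟩) (not_le.2 h)

lemma one_le_chi (p) : 1 ≤ chi d p := by
  rw [← tt_zero p]; exact le_tsum 0

namespace Big

lemma p_le (h : Big d) (hp : p ∈ 𝕀) (hchi : Perc.chi d p ≠ ⊤) : p ≤ 1 / 26 := by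
  have hS := h.std' hp.1 hp.2 hchi
  have := wt_le_inv hS.phi hS.le (by have := h.d26; omega)
  rw [wt_true hp] at this
  exact ((ofReal_le_ofReal_iff (by simp)).1 this).trans (one_div_le_one_div_of_le (by norm_num) (by exact_mod_cast h.d26))

lemma pT_le (h : Big d) : pT d ≤ 1 / 26 := csSup_le (nonempty_pT d) fun _ hp => h.p_le hp.1 hp.2

lemma inv_chi_step (h : Big d) (hp : p ∈ 𝕀) (hs : s ∈ 𝕀) (hchi : Perc.chi d (uni p s) ≠ ⊤)
    (h2 : Perc.chi d (uni p s) ≤ 2 * Perc.chi d p) : d * (uni p s - p) ≤ 1 / (Perc.chi d p).toReal - 1 / (Perc.chi d (uni p s)).toReal := by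
  have hu := uni_mem hp hs
  have hpu : p ≤ uni p s := by unfold uni; nlinarith [hp.2, hs.1]
  have hchi0 : Perc.chi d p ≠ ⊤ := ne_top_of_le_ne_top hchi (chi_mono hp.1 hpu hu.2)
  have key := chi_uni_ge hp hs hchi (h.tri_le hu.1 hu.2 hchi)
  have o1 := one_le_chi (d := d) p
  have hp26 := h.p_le hp hchi0
  rw [wt_false hp, wt_true hs, wt_true hp] at key
  lift Perc.chi d p to NNReal using hchi0 with c
  lift Perc.chi d (uni p s) to NNReal using hchi with c'
  have o1 : (1:ℝ) ≤ c := by simp_all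
  simp [ofReal] at key
  norm_cast at key
  rw [← NNReal.coe_le_coe] at key
  push_cast [coe_toNNReal _ (sub_nonneg.2 hp.2), coe_toNNReal _ hs.1, coe_toNNReal _ hp.1, coe_toNNReal (0.00001:ℝ) (by norm_num)] at key
  rw [← (show uni p s - p = (1 - p) * s by unfold uni; ring)] at key
  set a := uni p s - p
  have hm : (0:ℝ) ≤ a * d * (c * c') := by positivity
  have t1 : a * (2 * d * (0.00001 * (c':ℝ) ^ 2)) ≤ 0.00004 * (a * d * (c * c')) := by
    have : a * d * c' * c' ≤ a * d * c' * (2 * c) := mul_le_mul_of_nonneg_left (by exact_mod_cast h2) (by positivity); nlinarith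
  have hle : a * d * (c * c') ≤ c' - c := by nlinarith
  simp only [ENNReal.coe_toReal]
  rw [div_sub_div _ _ (by linarith) (by linarith), le_div_iff₀ (by nlinarith)]
  linarith

lemma inv_chi_diff (h : Big d) (hp : 0 ≤ p) (hpq : p ≤ q) (hq : q ≤ 1) (hchi : Perc.chi d q ≠ ⊤) :
    d * (q - p) ≤ 1 / (Perc.chi d p).toReal - 1 / (Perc.chi d q).toReal := by
  have hg : mass (gg q : Fn d) ≠ ⊤ := by
    rw [mass_gg]; exact mul_ne_top hchi (mul_ne_top (mul_ne_top (by simp) (by simp)) hchi)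
  obtain ⟨η, hη, hηg⟩ : ∃ η, 0 < η ∧ ofReal (2 * η) * mass (gg q : Fn d) ≤ 1 := by
    refine ⟨1 / (2 * ((mass (gg q : Fn d)).toReal + 1)), by positivity, ?_⟩
    rw [← ofReal_toReal hg, ← ofReal_mul (by positivity), ENNReal.toReal_ofReal toReal_nonneg, ← ofReal_one]; refine ofReal_le_ofReal ?_; field_simp
    linarith
  have key : ∀ n : ℕ, ∀ p, 0 ≤ p → p ≤ q → q - p ≤ n * η → d * (q - p) ≤ 1 / (Perc.chi d p).toReal - 1 / (Perc.chi d q).toReal := by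
    intro n; induction n with
    | zero =>
      grind
    | succ n ih =>
      intro p hp hpq h1; set p' := min q (p + η); have hpp : p ≤ p' := le_min hpq (by linarith); have hp'q : p' ≤ q := min_le_left _ _
      have hp1 : p ∈ 𝕀 := ⟨hp, hpq.trans hq⟩; obtain ⟨s, hs, hu, hse⟩ := exists_uni hpp (hp'q.trans hq)
      have hchip' : Perc.chi d p' ≠ ⊤ := ne_top_of_le_ne_top hchi (chi_mono (hp.trans hpp) hp'q hq)
      have hp26 := h.p_le hp1 (ne_top_of_le_ne_top hchi (chi_mono hp hpq hq))
      have hs2 : s ≤ 2 * η := by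
        have : p' ≤ p + η := min_le_right _ _; nlinarith [hs.1]
      have hdbl : Perc.chi d (uni p s) ≤ 2 * Perc.chi d p := by
        have : Perc.chi d (uni p s) ≤ Perc.chi d p + ofReal s * mass (gg q : Fn d) := by
          unfold Perc.chi mass; rw [← tsum_mul_left, ← tsum_add]; exact tsum_le_tsum fun x => tt_uni_le_gg hp1 hs hpq (hu ▸ hp'q) hq hchi x
        refine this.trans ?_; rw [two_mul]; exact add_le_add le_rfl (((mul_le_mul' (ofReal_le_ofReal hs2) le_rfl).trans hηg).trans (one_le_chi p))
      have a1 := h.inv_chi_step hp1 hs (hu ▸ hchip') hdbl; rw [hu] at a1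
      have a2 := ih p' (hp.trans hpp) hp'q (by
        rcases min_choice q (p + η) with he | he
        · rw [show p' = q from he]; simp; positivity
        · rw [show p' = p + η from he]; push_cast at h1; linarith)
      linarith
  obtain ⟨n, hn⟩ := exists_nat_ge ((q - p) / η)
  exact key n p hp hpq (by rwa [div_le_iff₀ hη] at hn)

lemma chi_le (h : Big d) (hp : 0 ≤ p) (hpT : p < pT d) : Perc.chi d p ≤ ofReal (1 / (pT d - p)) := by
  have hchi := chi_ne_top_of_lt hp hpT
  have o1 : (1:ℝ) ≤ (Perc.chi d p).toReal := by
    rw [← ENNReal.toReal_one]; exact ENNReal.toReal_mono hchi (one_le_chi p)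
  have hd1 : (1:ℝ) ≤ d := by exact_mod_cast (by have := h.d26; omega : 1 ≤ d)
  have key : ∀ q, p < q → q < pT d → q - p ≤ 1 / (Perc.chi d p).toReal := by
    intro q hpq hq; have := h.inv_chi_diff hp hpq.le (hq.le.trans (pT_le_one d)) (chi_ne_top_of_lt (hp.trans hpq.le) hq)
    have h0 : 0 ≤ 1 / (Perc.chi d q).toReal := by simp
    nlinarith
  have : pT d - p ≤ 1 / (Perc.chi d p).toReal := by
    refine le_of_forall_lt fun c hc => ?_; by_contra hcon; push Not at hcon
    have h1 := key ((max (c + p) p + pT d) / 2) (by have := le_max_right (c + p) p; linarith)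
      (by have : max (c + p) p < pT d := max_lt (by linarith) hpT
          linarith)
    have h2 : c + p < (max (c + p) p + pT d) / 2 := by
      have h3 := le_max_left (c + p) p; linarith
    linarith
  rw [← ofReal_toReal hchi]
  refine ofReal_le_ofReal ?_
  rw [le_div_iff₀ (by linarith)] at this ⊢
  linarith

end Big

/-! ### Growth of slab susceptibilities -/

lemma sl_Icc_mono (h1 : a' ≤ a) (h2 : b ≤ b') : sl l (Icc a b) ⊆ sl l (Icc a' b') :=
  fun x hx => (Icc_subset_Icc h1 h2 hx : x l ∈ Icc a' b')

open Classical in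
lemma phi_slab_eq (p) (l) (s c) (hs : 0 ≤ s) (hv : v l = c) :
    phi p (sl l (Icc (c - s) (c + s))) v = 2 * ∑' z, (if z l = c - s - 1 then Q p (sl l (Icc (c - s) (c + s))) v z else 0) := by
  rw [two_mul]
  nth_rw 1 [← slab_exit_symm p l s c hv]
  rw [← tsum_add]
  refine tsum_congr fun z => ?_
  by_cases hz : Q p (sl l (Icc (c - s) (c + s))) v z = 0
  · simp [hz]
  · obtain ⟨h1, h2⟩ := Q_sl_ne_zero hz; simp only [mem_Icc] at h1 h2
    rcases (by omega : z l = c + s + 1 ∧ z l ≠ c - s - 1 ∨ z l = c - s - 1 ∧ z l ≠ c + s + 1) with ⟨a, b⟩ | ⟨a, b⟩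
    · simp_all
    · simp_all

lemma phi_slab_center (p) (l) (s c) (hv : v l = c) : phi p (sl l (Icc (c - s) (c + s))) v = phi p (sl l (Icc (-s) s)) 0 := by
  have := phi_shift (S := sl l (Icc (-s) s)) (T := sl l (Icc (c - s) (c + s))) p v (fun x => by
    simp [mem_sl, mem_Icc]; constructor <;> rintro ⟨_, _⟩ <;> constructor <;> linarith) 0
  simp_all

lemma Big.xs_growth (h : Big d) (hp0 : 0 ≤ p) (hp : p ≤ 1) (hchi : chi d p ≠ ⊤) (l : Fin d) (hs : 0 ≤ s)
    (hφ : ofReal 0.97 ≤ phi p (sl l (Icc (-s) s)) 0) : ofReal 3.5 * xs p l s ≤ xs p l (2 * s + 1) := by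
  have hS := h.std' hp0 hp hchi
  set R := sl l (Icc (-(2 * s + 1)) (2 * s + 1)) with hR
  have hβ0 : 0 ≤ 1 + C₀ / d := zero_le_one.trans hS.one
  have hM : ∀ w, X p R w ≤ 25 * xs p l s := by
    intro w
    by_cases hw : w ∈ R
    swap
    · rw [X_eq_zero p hw]; exact zero_le
    have hw' : w l ∈ Icc (-(2 * s + 1)) (2 * s + 1) := hw
    calc X p R w ≤ X p (sl l (Icc (w l - (2 * (2 * s + 1) + 1)) (w l + (2 * (2 * s + 1) + 1)))) w :=
          X_mono p (sl_Icc_mono (by grind) (by grind)) w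
      _ = xs p l (2 * (2 * s + 1) + 1) := X_slab_center p l _ _ rfl
      _ ≤ 5 * xs p l (2 * s + 1) := xs_double hchi hS.phi hβ0 hS.le l (by linarith)
      _ ≤ 5 * (5 * xs p l s) := by gcongr; exact xs_double hchi hS.phi hβ0 hS.le l hs
      _ = _ := by ring
  have herr : ∀ {K : Set ℤ} (_ : K.OrdConnected) (v : V d), err p (sl l K) v ≤ ofReal 0.00001 := by
    intro K hK v
    rw [sl_eq_bx]
    refine h.err_le hp0 hp hchi (fun i => ?_) v
    by_cases hi : i = l
    · subst hi; simpa using hK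
    · simp [ne_eq, hi, not_false_eq_true, Function.update_of_ne]; exact ordConnected_univ
  set f := phi p (sl l (Icc (-s) s)) (0 : V d) with hf
  set eM := ofReal 0.00001 * (25 * xs p l s) with heM
  obtain ⟨z₀, hz₀⟩ : ∃ z₀, z₀ l = s + 1 := ⟨fun _ => s + 1, rfl⟩
  set Y := X p R z₀ with hY
  have hYeq : ∀ z, z l = s + 1 ∨ z l = -(s + 1) → X p R z = Y := by
    rintro z (hz | hz)
    · exact X_sl_congr p l _ (by rw [hz, hz₀])
    · rw [← (refl l 0).X p (S := R) (T := R)]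
      · exact X_sl_congr p l _ (by rw [refl_apply_same, hz, hz₀]; ring)
      · intro x; simp only [hR, mem_sl, refl_apply_same, mem_Icc]; constructor <;> rintro ⟨_, _⟩ <;> constructor <;> linarith
  have hA : xs p l s + f * Y ≤ xs p l (2 * s + 1) + eM := by
    have h1 := X_simon_rev (S := sl l (Icc (-s) s)) (R := R) (v := 0) (p := p)
      (sl_Icc_mono (by linarith) (by linarith)) (AF.of_chi hchi _ _) hM
    have h2 : ∑' z, Q p (sl l (Icc (-s) s)) 0 z * X p R z = f * Y := by
      rw [hf, phi, ← tsum_mul_right]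
      refine tsum_congr fun z => ?_
      by_cases hz : Q p (sl l (Icc (-s) s)) 0 z = 0
      · simp [hz]
      · obtain ⟨h1, h2⟩ := Q_sl_ne_zero hz
        simp [mem_Icc] at h1 h2
        rw [hYeq z (by omega)]
    rw [h2] at h1
    exact h1.trans (add_le_add le_rfl (mul_le_mul' (herr ordConnected_Icc _) le_rfl))
  have hB : 2 * xs p l s + f * xs p l (2 * s + 1) ≤ 2 * Y + 2 * eM := by
    have h1 := X_simon_rev (S := sl l (Icc (s + 1 - s) (s + 1 + s))) (R := R) (v := z₀) (p := p)
      (sl_Icc_mono (by linarith) (by linarith)) (AF.of_chi hchi _ _) hM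
    rw [X_slab_center p l s (s + 1) hz₀] at h1
    have h2 : f * xs p l (2 * s + 1) ≤ 2 * ∑' z, Q p (sl l (Icc (s + 1 - s) (s + 1 + s))) z₀ z * X p R z := by
      rw [hf, ← phi_slab_center p l s (s + 1) hz₀, phi_slab_eq p l s (s + 1) hs hz₀, mul_assoc, ← tsum_mul_right]
      refine mul_le_mul' le_rfl (tsum_le_tsum fun z => ?_)
      split_ifs with hz
      · refine mul_le_mul' le_rfl (le_of_eq ?_)
        rw [xs, X_sl_congr p l _ (w := z)]
        rw [hz]; simp
      · simp
    calc _ ≤ 2 * xs p l s + 2 * ∑' z, Q p (sl l (Icc (s + 1 - s) (s + 1 + s))) z₀ z * X p R z := add_le_add le_rfl h2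
      _ = 2 * (xs p l s + ∑' z, Q p (sl l (Icc (s + 1 - s) (s + 1 + s))) z₀ z * X p R z) := by ring
      _ ≤ 2 * (Y + eM) := mul_le_mul' le_rfl (h1.trans (add_le_add le_rfl (mul_le_mul' (herr ordConnected_Icc _) le_rfl)))
      _ = _ := by ring
  have hA' := (add_le_add (le_refl (xs p l s)) (mul_le_mul' hφ (le_refl Y))).trans hA
  have hB' := (add_le_add (le_refl (2 * xs p l s)) (mul_le_mul' hφ (le_refl (xs p l (2 * s + 1))))).trans hB
  have f2 : xs p l s ≠ ⊤ := ne_top_of_le_ne_top hchi (xs_le_chi _ _ _)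
  have f3 : Y ≠ ⊤ := ne_top_of_le_ne_top hchi (X_le_chi _ _ _)
  clear_value Y
  rw [heM] at hA' hB'
  lift xs p l (2 * s + 1) to NNReal using (show xs p l (2 * s + 1) ≠ ⊤ from ne_top_of_le_ne_top hchi (xs_le_chi _ _ _)) with a
  lift xs p l s to NNReal using f2 with c
  lift Y to NNReal using f3 with y
  simp only [ofReal] at hA' hB' ⊢
  norm_cast at hA' hB' ⊢
  rw [← NNReal.coe_le_coe] at hA' hB' ⊢
  push_cast [coe_toNNReal (0.97:ℝ) (by norm_num), coe_toNNReal (3.5:ℝ) (by norm_num), coe_toNNReal (0.00001:ℝ) (by norm_num)] at hA' hB' ⊢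
  linarith

/-- Points at distance at least `r` in direction `l`. -/
def farL (l : Fin d) (r : ℕ) (v : V d) : Set (V d) := {x | (r:ℤ) ≤ |x l - v l|}

lemma Big.exists_scale (h : Big d) (hp0 : 0 ≤ p) (hp : p ≤ 1) (hchi : chi d p ≠ ⊤) (l : Fin d) :
    ∃ i, ofReal (3.5 ^ i) ≤ chi d p ∧ phi p (sl l (Icc (-(2 ^ i - 1)) (2 ^ i - 1))) 0 ≤ ofReal 0.97 := by
  have hgrow : ∀ n, (∀ i < n, ofReal 0.97 ≤ phi p (sl l (Icc (-(2 ^ i - 1)) (2 ^ i - 1))) 0) →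
      ofReal (3.5 ^ n) ≤ xs p l (2 ^ n - 1) := by
    intro n; induction n with
    | zero =>
      simp [ofReal_one]; rw [← tau_self p (S := sl l (Icc (-0) 0)) (x := (0 : V d)) (by tauto)]; exact le_tsum 0
    | succ n ih =>
      intro hi; have := h.xs_growth hp0 hp hchi l (by have : (1:ℤ) ≤ 2 ^ n := one_le_pow₀ (by norm_num); linarith) (hi n (Nat.lt_succ_self n))
      rw [show (2:ℤ) * (2 ^ n - 1) + 1 = 2 ^ (n + 1) - 1 by ring] at this; refine le_trans ?_ this; rw [pow_succ', ofReal_mul (by norm_num)]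
      exact mul_le_mul' le_rfl (ih fun i hin => hi i (hin.trans (Nat.lt_succ_self n)))
  have hex : ∃ i, phi p (sl l (Icc (-(2 ^ i - 1)) (2 ^ i - 1))) 0 ≤ ofReal 0.97 := by
    by_contra hc; push Not at hc; obtain ⟨n, hn⟩ := pow_unbounded_of_one_lt (chi d p).toReal (by norm_num : (1:ℝ) < 3.5)
    have := (hgrow n fun i _ => (hc i).le).trans (xs_le_chi p l _); rw [← ofReal_toReal hchi] at this
    exact absurd ((ofReal_le_ofReal_iff toReal_nonneg).1 this) (not_le.2 hn)
  exact ⟨Nat.find hex, (hgrow _ fun i hi => (not_le.1 (Nat.find_min hex hi)).le).trans (xs_le_chi p l _), Nat.find_spec hex⟩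

lemma mu_farL_le (hchi : chi d p ≠ ⊤) (l)
    (hφ : phi p (sl l (Icc (-(2 ^ i - 1)) (2 ^ i - 1))) 0 ≤ b) (m) :
    ∀ v : V d, mu p (cnS univ v (farL l (m * 2 ^ i) v)) ≤ b ^ m := by
  induction m with
  | zero => intro v; rw [pow_zero]; exact prob_le_one
  | succ m ih =>
    intro v; have h1 : (1:ℤ) ≤ 2 ^ i := one_le_pow₀ (by norm_num); set S := sl l (Icc (v l - (2 ^ i - 1)) (v l + (2 ^ i - 1))) with hS
    refine (simon_set (farL l ((m + 1) * 2 ^ i) v) (show v ∈ S by rw [hS, mem_sl]; constructor <;> linarith) (AF.of_chi hchi _ _)).trans ?_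
    have h0 : cnS S v (farL l ((m + 1) * 2 ^ i) v) = ∅ := by
      refine eq_empty_of_forall_notMem ?_; rintro ω ⟨x, hx, hc⟩; have hxS : x l ∈ Icc _ _ := hc.right
      have hx : (((m + 1) * 2 ^ i : ℕ) : ℤ) ≤ |x l - v l| := hx; have : |x l - v l| ≤ 2 ^ i - 1 := abs_le.2 ⟨by linarith [hxS.1], by linarith [hxS.2]⟩
      push_cast at hx; nlinarith
    rw [h0, measure_empty, zero_add, pow_succ']; refine exit_sum_le (by rw [hS, phi_slab_center p l _ _ rfl]; exact hφ) fun z hz => ?_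
    refine le_trans (measure_mono ?_) (ih z); rintro ω ⟨x, hx, hc⟩; refine ⟨x, ?_, hc⟩; obtain ⟨g1, g2⟩ := Q_sl_ne_zero hz; simp [mem_Icc] at g1 g2
    have hx : (((m + 1) * 2 ^ i : ℕ) : ℤ) ≤ |x l - v l| := hx; change ((m * 2 ^ i : ℕ) : ℤ) ≤ |x l - z l|
    have hzv : |z l - v l| ≤ 2 ^ i := abs_le.2 ⟨by omega, by omega⟩; have := abs_sub_le (x l) (z l) (v l); push_cast at hx ⊢; linarith

end

noncomputable section

variable {d : ℕ}
variable {S : Set (V d)} {x y z v w : V d} {p q : ℝ}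

lemma finite_edgesIn (hS : S.Finite) : (edgesIn S).Finite := by
  refine ((show ((fun a => s(a.1, a.2)) '' (S ×ˢ S)).Finite from (hS.prod hS).image _).preimage Subtype.val_injective.injOn).subset ?_
  rintro ⟨_, a, b, hab, rfl⟩ hin
  exact ⟨(a, b), ⟨hin a (by simp), hin b (by simp)⟩, rfl⟩

lemma finite_edgesAt (D : Finset (V d)) : ∃ T : Finset (Edge d), edgesAt (D : Set (V d)) ⊆ T ∧ T.card ≤ 2 * d * D.card := by
  refine ⟨(D ×ˢ (Finset.univ : Finset (Fin d × Bool))).image fun a => mkE (adjacent_add_st a.1 a.2), ?_, ?_⟩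
  · rintro ⟨e, he⟩ ⟨x, hx, hxD⟩; obtain ⟨a, b, hab, rfl⟩ := he; rw [mem_coe, Finset.mem_image]; rcases Sym2.mem_iff.1 hx with rfl | rfl
    · obtain ⟨s, rfl⟩ := adjacent_iff.1 hab; exact ⟨(x, s), by simpa using hxD, rfl⟩
    · obtain ⟨s, rfl⟩ := adjacent_iff.1 (adjacent_symm hab); exact ⟨(x, s), by simpa using hxD, Subtype.ext Sym2.eq_swap⟩
  · refine Finset.card_image_le.trans (le_of_eq ?_); simp; ring

lemma tau_uni_le_finite (hp : p ∈ 𝕀) (hs : s ∈ 𝕀) (hS : S.Finite) (v y) :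
    tau (uni p s) S v y ≤ tau p S v y + (finite_edgesIn hS).toFinset.card * ofReal s :=
  mu_uni_le hp hs (meas_cn _ _ _) _ (by rw [Finite.coe_toFinset]; exact depOn_cn S v y)

lemma phi_uni_le_finite (hp : p ∈ 𝕀) (hs : s ∈ 𝕀) (hS : S.Finite) (v) :
    phi (uni p s) S v ≤ phi p S v + ofReal s * (((finite_edgesIn hS).toFinset.card + 1) * (hS.toFinset.card * (2 * d))) := by
  classical
  have hu := uni_mem hp hs
  set K : ENNReal := (((finite_edgesIn hS).toFinset.card : ℕ) : ENNReal)
  have hJ : ∀ y z : V d, J (uni p s) y z ≤ J p y z + ofReal s * J 1 y z := by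
    intro y z; rw [J_eq_mul hu, J_eq_mul hp, ← add_mul, ← ofReal_add hp.1 hs.1]; refine mul_le_mul' (ofReal_le_ofReal ?_) le_rfl
    unfold uni; nlinarith [mul_nonneg hp.1 hs.1]
  have hJ1 : ∀ y z : V d, J (uni p s) y z ≤ J 1 y z := by
    intro y z; rw [J_eq_mul hu]; refine (mul_le_mul' (ofReal_le_ofReal hu.2) le_rfl).trans (by simp)
  have key : ∀ z, Q (uni p s) S v z ≤ Q p S v z + ∑' y, (if y ∈ S then ofReal s * (K + 1) * J 1 y z else 0) := by
    intro z; unfold Q; split_ifs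
    · simp
    rw [← tsum_add]; refine tsum_le_tsum fun y => ?_; by_cases hy : y ∈ S; swap
    · rw [tau_eq_zero_right _ hy]; simp
    rw [if_pos hy]
    calc _ ≤ (tau p S v y + K * ofReal s) * J (uni p s) y z := mul_le_mul' (tau_uni_le_finite hp hs hS v y) le_rfl
      _ = tau p S v y * J (uni p s) y z + K * ofReal s * J (uni p s) y z := by ring
      _ ≤ tau p S v y * (J p y z + ofReal s * J 1 y z) + K * ofReal s * J 1 y z :=
          add_le_add (mul_le_mul' le_rfl (hJ y z)) (mul_le_mul' le_rfl (hJ1 y z))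
      _ ≤ tau p S v y * J p y z + 1 * (ofReal s * J 1 y z) + K * ofReal s * J 1 y z := by
          rw [mul_add]; exact add_le_add (add_le_add le_rfl (mul_le_mul' (tau_le_one p) le_rfl)) le_rfl
      _ = _ := by ring
  refine (tsum_le_tsum key).trans (le_of_eq ?_)
  rw [tsum_add, tsum_comm]
  congr 1
  rw [tsum_eq_sum]
  · rw [sum_congr rfl (g := fun _ => ofReal s * (K + 1) * (2 * d))]
    · simp [nsmul_eq_mul]; ring
    · intro y hy; simp [if_pos ((Finite.mem_toFinset _).1 hy)]; rw [tsum_mul_left, tsum_J_one]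
  · intro y hy; simp [(show y ∉ S from fun h => hy ((Finite.mem_toFinset _).2 h))]

lemma finite_box (v : V d) (n) : (box v n).Finite := by
  refine (Set.Finite.pi (t := fun i => Icc (v i - n) (v i + n)) fun i => finite_Icc _ _).subset fun x hx i _ => ?_
  have := abs_le.1 (hx i)
  grind

lemma box_mono (h : m ≤ n) : box v m ⊆ box v n := fun _ hx i => (hx i).trans (by omega)

lemma exists_box (x : V d) : ∃ n, x ∈ box 0 n := by
  refine ⟨∑ i, (x i).natAbs, fun i => ?_⟩
  simp only [Pi.zero_apply, sub_zero]
  rw [Int.abs_eq_natAbs]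
  exact_mod_cast single_le_sum (f := fun i => (x i).natAbs) (fun _ _ => Nat.zero_le _) (Finset.mem_univ i)

lemma Cn.exists_box (h : Cn univ ω x y) : ∃ n, Cn (box 0 n) ω x y := by
  refine Cn.induct (P := fun y => ∃ n, Cn (box 0 n) ω x y) ?_ (fun a b _ ⟨n, ha⟩ _ _ hab => ?_) h
  · obtain ⟨n, hn⟩ := Perc.exists_box x; exact ⟨n, Cn.refl hn⟩
  · obtain ⟨m, hm⟩ := Perc.exists_box b; have h1 := ha.mono_set (box_mono (le_max_left n m))
    exact ⟨max n m, h1.trans (Cn.step h1.right (box_mono (le_max_right n m) hm) hab)⟩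

lemma tendsto_tau_box (p) (x y : V d) : Tendsto (fun n => tau p (box 0 n) x y) atTop (nhds (tau p univ x y)) := by
  have h : cn univ x y = ⋃ n, cn (box 0 n) x y := by
    ext ω; simp; exact ⟨fun h => Cn.exists_box h, fun ⟨n, h⟩ => Cn.mono_set (subset_univ _) h⟩
  unfold tau
  rw [h]
  exact tendsto_measure_iUnion_atTop fun m n hmn ω hω => Cn.mono_set (box_mono hmn) hω

lemma chi_ne_top_of_phi_lt_one (hS : S.Finite) (h0 : (0 : V d) ∈ S) (hφ : phi p S 0 < 1) : chi d p ≠ ⊤ := by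
  set c : ENNReal := ((hS.toFinset.card : ℕ) : ENNReal)
  set f := phi p S 0
  have hbd : ∀ n (v : V d), X p (box 0 n) v ≤ c / (1 - f) := by
    intro n; set R := box 0 n; have hR := finite_box (0 : V d) n; set M := ⨆ v, X p R v
    have hMt : M ≠ ⊤ := by
      refine ne_top_of_le_ne_top (b := (hR.toFinset.card : ENNReal)) (by simp) (iSup_le fun v => ?_); unfold X
      rw [tsum_eq_sum (s := hR.toFinset) fun x hx => tau_eq_zero_right p fun h => hx ((Finite.mem_toFinset _).2 h)]
      exact (sum_le_card_nsmul _ _ 1 fun x _ => tau_le_one p).trans (by simp)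
    have h1 : ∀ v, X p R v ≤ c + f * M := by
      intro v; set T := (fun x => x + v) '' S with hT; have hTf : T.Finite := hS.image _
      refine (X_simon (show v ∈ T from ⟨0, h0, by simp⟩) (AF.of_finite p hTf v)).trans (add_le_add ?_ ?_)
      · unfold X; rw [tsum_eq_sum (s := hTf.toFinset) fun x hx => tau_eq_zero_right p fun h => hx ((Finite.mem_toFinset _).2 h)]
        refine (sum_le_card_nsmul _ _ 1 fun x _ => tau_le_one p).trans ?_; rw [nsmul_eq_mul, mul_one]; refine Nat.cast_le.2 ?_
        rw [← ncard_eq_toFinset_card _ hTf, ← ncard_eq_toFinset_card _ hS]; exact ncard_image_le hS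
      · refine exit_sum_le (le_of_eq ?_) fun z _ => le_iSup (X p R) z
        have := phi_shift p v (show ∀ x, x + v ∈ T ↔ x ∈ S from fun x => by simp [hT]) 0; rwa [zero_add] at this
    intro v; refine (le_iSup (X p R) v).trans ?_
    rw [ENNReal.le_div_iff_mul_le (.inl (tsub_pos_of_lt hφ).ne') (.inl (by simp)), mul_comm, ENNReal.sub_mul (fun _ _ => hMt), one_mul]
    exact tsub_le_iff_right.2 (iSup_le h1)
  have hfin : chi d p ≤ c / (1 - f) := by
    unfold chi; rw [ENNReal.tsum_eq_iSup_sum]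
    exact iSup_le fun F => le_of_tendsto' (tendsto_finsetSum F fun x _ => tendsto_tau_box p 0 x) fun n => (sum_le_tsum F).trans (hbd n 0)
  refine ne_top_of_le_ne_top (ENNReal.div_ne_top (by simp [c]) (tsub_pos_of_lt hφ).ne') hfin

lemma one_le_phi_pT (h : Big d) (hS : S.Finite) (h0 : (0 : V d) ∈ S) : 1 ≤ phi (pT d) S 0 := by
  by_contra hc
  push Not at hc
  have hT : pT d ∈ 𝕀 := ⟨pT_nonneg d, pT_le_one d⟩
  set K : ENNReal := (((finite_edgesIn hS).toFinset.card + 1) * (hS.toFinset.card * (2 * d)) : ENNReal)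
  have hlim : Tendsto (fun n : ℕ => phi (pT d) S 0 + ofReal (1 / ((n:ℝ) + 1)) * K) atTop (nhds (phi (pT d) S 0 + ofReal 0 * K)) :=
    (ENNReal.Tendsto.mul_const (ENNReal.tendsto_ofReal tendsto_one_div_add_atTop_nhds_zero_nat) (.inr (mul_ne_top (by simp) (mul_ne_top (by simp) (mul_ne_top (by simp) (by simp)))))).const_add _
  rw [ofReal_zero, zero_mul, add_zero] at hlim
  obtain ⟨n, hn⟩ := (hlim.eventually (gt_mem_nhds hc)).exists
  set s : ℝ := 1 / ((n:ℝ) + 1)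
  have hs0 : 0 < s := by positivity
  have hs : s ∈ 𝕀 := ⟨hs0.le, by rw [div_le_one (by positivity)]; linarith [n.cast_nonneg (α := ℝ)]⟩
  refine (chi_ne_top_of_phi_lt_one hS h0 ((phi_uni_le_finite hT hs hS 0).trans_lt hn)) (chi_eq_top_of_gt (uni_mem hT hs) ?_)
  have := h.pT_le
  unfold uni; nlinarith

lemma pT_pos (h : Big d) : 0 < pT d := by
  refine lt_of_le_of_ne (pT_nonneg d) fun h0 => ?_
  have := one_le_phi_pT h (finite_singleton _) rfl
  have hz : phi 0 {(0 : V d)} 0 = 0 := by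
    unfold phi Q; refine ENNReal.tsum_eq_zero.2 fun z => ?_; split_ifs
    · rfl
    · refine ENNReal.tsum_eq_zero.2 fun y => ?_; unfold J; rw [wt_true (by simp)]; simp
  simp_all

/-! ### Comparison of densities along explored clusters -/

/-- Real edge weights. -/
def wr (q : ℝ) (b : Bool) : ℝ := if b then q else 1 - q

lemma wr_nonneg (hq : q ∈ 𝕀) (b) : 0 ≤ wr q b := by
  unfold wr; split_ifs <;> linarith [hq.1, hq.2]

lemma wt_eq_wr (hq : q ∈ 𝕀) (b) : wt q b = ofReal (wr q b) := by
  cases b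
  · simp [wt_false hq, wr]
  · simp [wt_true hq, wr]

section
open Classical

lemma eq_iUnion_cyl {F : Set (E → Bool)} {T : Finset E} (hT : DepOn F T) :
    F = ⋃ I ∈ T.powerset.filter (fun I => ind I ∈ F), cyl T (ind I) := by
  ext ω
  simp [exists_prop]
  constructor
  · intro hω
    have hag : ∀ e ∈ T, ω e = ind (T.filter fun e => ω e = true) e := by
      intro e he; cases h : ω e <;> simp [ind, h, he]
    exact ⟨T.filter fun e => ω e = true, ⟨Finset.filter_subset _ _, hT _ _ hag hω⟩, hag⟩
  · rintro ⟨I, ⟨_, hI⟩, hag⟩; exact hT _ _ (fun e he => (hag e he).symm) hI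

lemma meas_of_depOn {F : Set (E → Bool)} (hTf : T.Finite) (hT : DepOn F T) : MeasurableSet F := by
  rw [eq_iUnion_cyl (F := F) (T := hTf.toFinset) (by simp_all)]
  exact measurableSet_biUnion _ fun I _ => meas_cyl _ _

lemma mu_eq_sum_cyl (hq : q ∈ 𝕀) {F : Set (E → Bool)} {T : Finset E} (hT : DepOn F T) :
    mu q F = ∑ I ∈ T.powerset.filter (fun I => ind I ∈ F), ofReal (∏ e ∈ T, wr q (ind I e)) := by
  conv_lhs => rw [eq_iUnion_cyl hT]
  rw [measure_biUnion_finset]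
  · refine sum_congr rfl fun I _ => ?_; rw [mu_cyl, ENNReal.ofReal_prod_of_nonneg fun e _ => wr_nonneg hq _]
    exact Finset.prod_congr rfl fun e _ => wt_eq_wr hq _
  · intro I hI I' hI' hne; rw [Function.onFun, disjoint_left]; intro ω h h'; refine hne ?_
    have sub : ∀ I ∈ T.powerset.filter (fun I => ind I ∈ F), I ⊆ T := fun I hI => Finset.mem_powerset.1 (Finset.mem_filter.1 hI).1; ext e
    by_cases he : e ∈ T
    · have := (h e he).symm.trans (h' e he); simpa [ind] using this
    · exact ⟨fun h => absurd (sub I hI h) he, fun h => absurd (sub I' hI' h) he⟩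
  · exact fun I _ => meas_cyl _ _

end

lemma three_mul_le {t a b : ℝ} (ha : 0 ≤ a) (hb : 0 ≤ b) (h : t ^ 3 = a ^ 2 * b) : 3 * t ≤ 2 * a + b := by
  by_contra hc
  push Not at hc
  have h1 : (2 * a + b) ^ 3 < (3 * t) ^ 3 := pow_lt_pow_left₀ hc (by linarith) (by norm_num)
  nlinarith [mul_nonneg (sq_nonneg (a - b)) (by linarith)]

lemma mu_compare (hp : p ∈ 𝕀) (hq : q ∈ 𝕀) (hr : r ∈ 𝕀) (hl : 0 ≤ l) (hθ : 0 < θ)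
    (hrel : ∀ b, wr q b ^ 3 = wr p b ^ 2 * (l * wr r b)) {F : Set (E → Bool)} {T : Finset E} (hT : DepOn F T) :
    3 * mu q F ≤ ofReal (2 * θ) * mu p F + ofReal (l ^ T.card / θ ^ 2) * mu r F := by
  rw [mu_eq_sum_cyl hp hT, mu_eq_sum_cyl hq hT, mu_eq_sum_cyl hr hT, mul_sum, mul_sum, mul_sum, ← sum_add_distrib]
  refine sum_le_sum fun I _ => ?_
  have n1 : 0 ≤ ∏ e ∈ T, wr p (ind I e) := Finset.prod_nonneg fun e _ => wr_nonneg hp _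
  have n3 : 0 ≤ ∏ e ∈ T, wr r (ind I e) := Finset.prod_nonneg fun e _ => wr_nonneg hr _
  rw [show (3:ENNReal) = ofReal 3 by simp, ← ofReal_mul (by norm_num), ← ofReal_mul (by linarith),
    ← ofReal_mul (by positivity), ← ofReal_add (by positivity) (by positivity)]
  refine ofReal_le_ofReal ?_
  rw [mul_assoc 2 θ]
  refine three_mul_le (by positivity) (by positivity) ?_
  rw [← Finset.prod_pow, Finset.prod_congr rfl fun e _ => hrel (ind I e), Finset.prod_mul_distrib, Finset.prod_mul_distrib, prod_const, Finset.prod_pow]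
  field_simp

/-- The event that the cluster of `v` in `S` belongs to a given family. -/
def clIn (S : Set (V d)) (v : V d) (𝒟 : Set (Finset (V d))) : Set (Config d) := {ω | ∃ D ∈ 𝒟, cl S ω v = (D : Set (V d))}

lemma mu_clIn (p) (S) (v) (𝒟) :
    mu p (clIn S v 𝒟) = ∑' D : 𝒟, mu p {ω | cl S ω v = ((D : Finset (V d)) : Set (V d))} := by
  rw [(show clIn S v 𝒟 = ⋃ D : 𝒟, {ω | cl S ω v = (D : Set (V d))} by aesop), measure_iUnion]
  · intro D D' hne; grind
  · exact fun D => meas_cl_eq _ _ _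

lemma mu_clIn_compare (hp : p ∈ 𝕀) (hq : q ∈ 𝕀) (hr : r ∈ 𝕀) (hl : 0 ≤ l) (hlL : l ≤ L) (hL : 1 ≤ L) (hθ : 0 < θ)
    (hrel : ∀ b, wr q b ^ 3 = wr p b ^ 2 * (l * wr r b)) (S) (v : V d)
    (hK : ∀ D ∈ 𝒟, 2 * d * D.card ≤ K) :
    3 * mu q (clIn S v 𝒟) ≤ ofReal (2 * θ) * mu p (clIn S v 𝒟) + ofReal (L ^ K / θ ^ 2) := by
  have h1 : 3 * mu q (clIn S v 𝒟) ≤ ofReal (2 * θ) * mu p (clIn S v 𝒟) + ofReal (L ^ K / θ ^ 2) * mu r (clIn S v 𝒟) := by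
    rw [mu_clIn, mu_clIn, mu_clIn, ← tsum_mul_left, ← tsum_mul_left, ← tsum_mul_left, ← tsum_add]; refine tsum_le_tsum fun D => ?_
    obtain ⟨T, hT, hc⟩ := finite_edgesAt (D : Finset (V d))
    refine (mu_compare hp hq hr hl hθ hrel (((depOn_cl_eq S v D).mono inter_subset_left).mono hT)).trans ?_
    exact add_le_add le_rfl (mul_le_mul' (ofReal_le_ofReal (div_le_div_of_nonneg_right ((pow_le_pow_left₀ hl hlL _).trans (pow_le_pow_right₀ hL (hc.trans (hK D D.2)))) (by positivity))) le_rfl)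
  exact h1.trans (add_le_add le_rfl ((mul_le_mul' le_rfl prob_le_one).trans (by simp)))

lemma mu_clIn_card_le (p) (S) (v : V d) (hN : ∀ D ∈ 𝒟, N ≤ D.card) :
    N * mu p (clIn S v 𝒟) ≤ chi d p := by
  rw [mu_clIn, ← tsum_mul_left]
  calc _ ≤ ∑' D : 𝒟, ((D : Finset (V d)).card : ENNReal) * mu p {ω | cl S ω v = (D : Set (V d))} :=
        tsum_le_tsum fun D => mul_le_mul' (hN D D.2) le_rfl
    _ ≤ ∑' D : Finset (V d), (D.card : ENNReal) * mu p {ω | cl S ω v = D} :=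
        ENNReal.tsum_comp_le_tsum_of_injective Subtype.val_injective (fun D : Finset (V d) => (D.card : ENNReal) * mu p {ω | cl S ω v = D})
    _ = ∑' D : Finset (V d), ∑' x, mu p ({ω | cl S ω v = D} ∩ {_ω | x ∈ D}) := by
        refine tsum_congr fun D => ?_; rw [tsum_eq_sum (s := D)]
        · simp_all
        · simp_all
    _ ≤ chi d p := by
        rw [tsum_comm]; exact (tsum_le_tsum fun x => cl_mu_le_tau p S v x).trans (X_le_chi p S v)

/-- The constant produced by the comparison with subcritical densities. -/
def e₀ (d : ℕ) : ℝ := exp (14 / pT d * (128 * d))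

lemma compare_pT (h : Big d) (hθ : 0 < θ) (hθT : 1 / θ ^ 3 ≤ pT d / 2) (S) (v : V d)
    (hD : ∀ D ∈ 𝒟, (D.card : ℝ) ≤ 64 * θ ^ 6) :
    3 * mu (pT d) (clIn S v 𝒟) ≤ ofReal (2 * θ) * mu (pT d - 1 / θ ^ 3) (clIn S v 𝒟) + ofReal (e₀ d / θ ^ 2) := by
  have hT := pT_pos h
  have hT2 := h.pT_le
  set q := pT d with hq
  set δ := 1 / θ ^ 3 with hδ
  have hδ0 : 0 < δ := by positivity
  set p := q - δ with hp
  have hp0 : q / 2 ≤ p := by linarith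
  have hpp : 0 < p := by linarith
  have h1p : 0 < 1 - p := by linarith
  set l := q ^ 3 / p ^ 2 + (1 - q) ^ 3 / (1 - p) ^ 2 with hl
  have h1q : 0 < 1 - q := by linarith
  have hl0 : 0 < l := by positivity
  set r := (q ^ 3 / p ^ 2) / l with hr
  have hr01 : r ∈ 𝕀 := by
    refine ⟨by positivity, ?_⟩; rw [hr, div_le_one hl0, hl]; have : 0 ≤ (1 - q) ^ 3 / (1 - p) ^ 2 := by positivity
    linarith
  have hlr : l * r = q ^ 3 / p ^ 2 := by rw [hr]; field_simp
  have hrel : ∀ b, wr q b ^ 3 = wr p b ^ 2 * (l * wr r b) := by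
    intro b; cases b
    · simp [wr]; rw [mul_sub, hlr, mul_one, hl, add_sub_cancel_left]; field_simp
    · simp [wr]; rw [hlr]; field_simp
  have hlL : l ≤ 1 + 14 / q * δ ^ 2 := by
    have hqp : q = p + δ := by rw [hp]; ring
    have e2 : (1 - q) ^ 3 / (1 - p) ^ 2 = (1 - p) - 3 * δ + 3 * δ ^ 2 / (1 - p) - δ ^ 3 / (1 - p) ^ 2 := by rw [hqp]; field_simp; ring
    have e3 : 3 * δ ^ 2 / p ≤ 3 * δ ^ 2 / (q / 2) := div_le_div_of_nonneg_left (by positivity) (by positivity) hp0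
    have e4 : δ ^ 3 / p ^ 2 ≤ δ ^ 2 / (q / 2) := by
      rw [div_le_div_iff₀ (by positivity) (by positivity)]; have : δ * (q / 2) ≤ p * p := mul_le_mul (by linarith) hp0 (by positivity) hpp.le
      nlinarith [sq_nonneg δ]
    have e5 : 3 * δ ^ 2 / (1 - p) ≤ 6 * δ ^ 2 := by
      rw [div_le_iff₀ h1p]; nlinarith [sq_nonneg δ]
    have e6 : 0 ≤ δ ^ 3 / (1 - p) ^ 2 := by positivity
    have e7 : 6 * δ ^ 2 ≤ 6 * δ ^ 2 / q := by
      rw [le_div_iff₀ hT]; nlinarith [sq_nonneg δ]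
    have e8 : 14 / q * δ ^ 2 = 3 * δ ^ 2 / (q / 2) + δ ^ 2 / (q / 2) + 6 * δ ^ 2 / q := by field_simp; ring
    rw [hl, (show q ^ 3 / p ^ 2 = p + 3 * δ + 3 * δ ^ 2 / p + δ ^ 3 / p ^ 2 by rw [hqp]; field_simp; ring), e2, e8]; linarith
  have hc0 : 0 ≤ 14 / q * δ ^ 2 := by positivity
  set K := ⌊128 * d * θ ^ 6⌋₊ with hK
  have hKD : ∀ D ∈ 𝒟, 2 * d * D.card ≤ K := by
    intro D hDD; refine Nat.le_floor ?_; push_cast; have := hD D hDD; have hd := h.pos; nlinarith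
  refine (mu_clIn_compare ⟨hpp.le, by linarith⟩ ⟨hT.le, by linarith⟩ hr01 hl0.le hlL (by linarith) hθ hrel S v hKD).trans ?_
  refine add_le_add le_rfl (ofReal_le_ofReal (div_le_div_of_nonneg_right ?_ (by positivity)))
  calc (1 + 14 / q * δ ^ 2) ^ K ≤ (exp (14 / q * δ ^ 2)) ^ K := pow_le_pow_left₀ (by positivity) (by rw [add_comm]; exact add_one_le_exp _) _
    _ = exp (K * (14 / q * δ ^ 2)) := (exp_nat_mul _ _).symm
    _ ≤ _ := by
        unfold e₀; rw [← hq]; refine Real.exp_le_exp.2 ?_; have h1 : (K:ℝ) ≤ 128 * d * θ ^ 6 := Nat.floor_le (by positivity)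
        calc (K:ℝ) * (14 / q * δ ^ 2) ≤ (128 * d * θ ^ 6) * (14 / q * δ ^ 2) := mul_le_mul_of_nonneg_right h1 hc0
          _ = _ := by rw [hδ]; field_simp

lemma volume_tail (h : Big d) (hθ : 0 < θ) (hθT : 1 / θ ^ 3 ≤ pT d / 2) (S) (v : V d) :
    mu (pT d) (clIn S v {D | θ ^ 6 ≤ D.card ∧ (D.card : ℝ) ≤ 64 * θ ^ 6}) ≤ ofReal ((2 + e₀ d) / θ ^ 2) := by
  have h1 := compare_pT h hθ hθT S v (𝒟 := {D | θ ^ 6 ≤ D.card ∧ (D.card : ℝ) ≤ 64 * θ ^ 6}) fun D hD => hD.2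
  set F := clIn S v {D | θ ^ 6 ≤ D.card ∧ (D.card : ℝ) ≤ 64 * θ ^ 6}
  have hδ : 0 < 1 / θ ^ 3 := by positivity
  have h3 := h.chi_le (p := pT d - 1 / θ ^ 3) (by linarith) (by linarith)
  rw [sub_sub_cancel, one_div_one_div] at h3
  have h4 : mu (pT d - 1 / θ ^ 3) F ≤ ofReal (1 / θ ^ 3) := by
    have h5 := (mu_clIn_card_le (pT d - 1 / θ ^ 3) S v (𝒟 := {D | θ ^ 6 ≤ D.card ∧ (D.card : ℝ) ≤ 64 * θ ^ 6}) (N := ofReal (θ ^ 6)) fun D hD => by simp_all).trans h3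
    have : ofReal (θ ^ 3) = ofReal (θ ^ 6) * ofReal (1 / θ ^ 3) := by
      rw [← ofReal_mul (by positivity)]; congr 1; field_simp
    rw [this] at h5; exact (ENNReal.mul_le_mul_iff_right (by positivity) ofReal_ne_top).1 h5
  have h6 : mu (pT d) F ≤ 3 * mu (pT d) F := by
    calc mu (pT d) F = 1 * mu (pT d) F := (one_mul _).symm
      _ ≤ _ := mul_le_mul' (by norm_num) le_rfl
  refine h6.trans (h1.trans ((add_le_add (mul_le_mul' le_rfl h4) le_rfl).trans ?_))
  have he : 0 ≤ e₀ d := (exp_pos _).le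
  rw [← ofReal_mul (by positivity), ← ofReal_add (by positivity) (by positivity)]
  refine ofReal_le_ofReal (le_of_eq ?_)
  field_simp

/-- The one-arm event at scale `L`, inside the box. -/
def arm (L : ℕ) (v : V d) : Set (Config d) := cnS (box v L) v (sphere v L)

lemma one_arm (h : Big d) : ∃ C, 0 < C ∧ ∀ᶠ m : ℕ in atTop, mu (pT d) (arm (m ^ 11) (0 : V d)) ≤ ofReal (C / m ^ 12) := by
  have hT := pT_pos h
  have he : 0 < e₀ d := exp_pos _
  refine ⟨2 * (2 + e₀ d) + (1 + e₀ d), by positivity, ?_⟩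
  have hpoly : Tendsto (fun m : ℕ => 2 * (d:ℝ) * ((m:ℝ) ^ 18 * (0.97:ℝ) ^ m)) atTop (nhds (2 * (d:ℝ) * 0)) :=
    (tendsto_pow_const_mul_const_pow_of_abs_lt_one 18 (by linarith)).const_mul _
  rw [mul_zero] at hpoly
  filter_upwards [eventually_ge_atTop 1, hpoly.eventually (gt_mem_nhds one_pos), tendsto_one_div_add_atTop_nhds_zero_nat.eventually (gt_mem_nhds (by positivity : 0 < pT d / 4))] with m hm1 hm2 hm3
  have hm : (1:ℝ) ≤ m := by simp_all
  set S := box 0 (m ^ 11)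
  have hθT : ∀ θ, (m:ℝ) ≤ θ → 1 / θ ^ 3 ≤ pT d / 2 := by
    intro θ hθ; have h1 : θ ≤ θ ^ 3 := le_self_pow₀ (by linarith) (by norm_num)
    calc 1 / θ ^ 3 ≤ 1 / m := one_div_le_one_div_of_le (by linarith) (by linarith)
      _ ≤ 2 * (1 / (m + 1)) := by rw [mul_one_div, div_le_div_iff₀ (by linarith) (by linarith)]; linarith
      _ ≤ _ := by linarith
  have hm6 : (m:ℝ) ≤ (m:ℝ) ^ 6 := le_self_pow₀ hm (by norm_num)
  set 𝒜 : Set (Finset (V d)) := {D | (∃ x ∈ D, x ∈ sphere 0 (m ^ 11)) ∧ (D.card : ℝ) ≤ 64 * ((m:ℝ) ^ 6) ^ 6}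
  have hsub : arm (m ^ 11) 0 ⊆ clIn S 0 𝒜 ∪ ⋃ j, clIn S 0 {D | (2 ^ j * (m:ℝ) ^ 6) ^ 6 ≤ D.card ∧ (D.card : ℝ) ≤ 64 * (2 ^ j * (m:ℝ) ^ 6) ^ 6} := by
    rintro ω ⟨x, hx, hc⟩; set D := (show (cl S ω 0).Finite from (finite_box _ _).subset fun y hy => Cn.right hy).toFinset with hD
    have hcD : cl S ω 0 = D := by simp [hD]
    by_cases hcard : (D.card : ℝ) ≤ 64 * ((m:ℝ) ^ 6) ^ 6
    · exact .inl ⟨D, ⟨⟨x, by rw [hD, Finite.mem_toFinset]; exact hc, hx⟩, hcard⟩, hcD⟩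
    · right; push Not at hcard; have hpos : (0:ℝ) < ((m:ℝ) ^ 6) ^ 6 := by positivity
      obtain ⟨j, hj1, hj2⟩ := exists_nat_pow_near (x := (D.card : ℝ) / ((m:ℝ) ^ 6) ^ 6) (y := 64) (by rw [le_div_iff₀ hpos]; linarith) (by norm_num)
      rw [le_div_iff₀ hpos] at hj1; rw [div_lt_iff₀ hpos] at hj2
      have e : (2 ^ j * (m:ℝ) ^ 6) ^ 6 = 64 ^ j * ((m:ℝ) ^ 6) ^ 6 := by rw [mul_pow, ← pow_mul, mul_comm j, pow_mul]; norm_num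
      refine mem_iUnion.2 ⟨j, D, ⟨by rw [e]; exact hj1, ?_⟩, hcD⟩; rw [e]; rw [pow_succ] at hj2; linarith
  refine (measure_mono hsub).trans ((measure_union_le _ _).trans ?_)
  rw [add_comm, add_div, ofReal_add (by positivity) (by positivity)]
  refine add_le_add ?_ ?_
  · refine (measure_iUnion_le _).trans ?_
    have hj : ∀ j, mu (pT d) (clIn S 0 {D | (2 ^ j * (m:ℝ) ^ 6) ^ 6 ≤ D.card ∧ (D.card : ℝ) ≤ 64 * (2 ^ j * (m:ℝ) ^ 6) ^ 6}) ≤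
        ofReal ((2 + e₀ d) / m ^ 12) * 2⁻¹ ^ j := by
      intro j; have h2j : (1:ℝ) ≤ 2 ^ j := one_le_pow₀ (by norm_num); refine (volume_tail h (by positivity) (hθT _ (by nlinarith)) S 0).trans ?_
      rw [show (2⁻¹ : ENNReal) ^ j = ofReal ((2⁻¹) ^ j) by rw [ofReal_pow (by norm_num), ofReal_inv_of_pos (by norm_num)]; simp,
        ← ofReal_mul (by positivity)]
      refine ofReal_le_ofReal ?_; rw [inv_pow, ← div_eq_mul_inv, div_div]; refine div_le_div_of_nonneg_left (by positivity) (by positivity) ?_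
      rw [mul_pow, ← pow_mul (m:ℝ), mul_comm]; exact mul_le_mul_of_nonneg_right (le_self_pow₀ h2j (by norm_num)) (by positivity)
    refine (tsum_le_tsum hj).trans ?_; rw [tsum_mul_left, tsum_half_pow, mul_comm, mul_div_assoc, ofReal_mul (by norm_num)]; simp
  · have h1 := compare_pT h (by positivity) (hθT _ hm6) S 0 (𝒟 := 𝒜) fun D hD => hD.2; set p := pT d - 1 / ((m:ℝ) ^ 6) ^ 3 with hp
    have hδ : 0 < 1 / ((m:ℝ) ^ 6) ^ 3 := by positivity
    have hp0 : 0 ≤ p := by have := hθT _ hm6; linarith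
    have hpT : p < pT d := by linarith
    have hchi := chi_ne_top_of_lt hp0 hpT; have hchib := h.chi_le hp0 hpT; rw [hp, sub_sub_cancel, one_div_one_div, ← hp] at hchib
    have hF : mu p (clIn S 0 𝒜) ≤ ofReal (d * 0.97 ^ m) := by
      have hs : clIn S 0 𝒜 ⊆ ⋃ l, cnS univ 0 (farL l (m ^ 11) 0) := by
        rintro ω ⟨D, ⟨⟨x, hx, -, l, hl⟩, -⟩, hcD⟩; refine mem_iUnion.2 ⟨l, x, ?_, ?_⟩
        · exact hl.ge
        · have : x ∈ cl S ω 0 := by rw [hcD]; exact hx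
          exact Cn.mono_set (subset_univ _) this
      refine (measure_mono hs).trans ((measure_iUnion_le _).trans ?_); rw [tsum_fintype]
      calc _ ≤ ∑ l, ofReal (0.97 ^ m) := by
            refine sum_le_sum fun l _ => ?_; obtain ⟨i, hi1, hi2⟩ := h.exists_scale hp0 (hpT.le.trans (pT_le_one d)) hchi l
            have hi4 : ((2:ℝ) ^ i) ^ 9 ≤ (m ^ 10) ^ 9 := by
              calc ((2:ℝ) ^ i) ^ 9 = (2 ^ 9) ^ i := by rw [← pow_mul, ← pow_mul, mul_comm]
                _ ≤ (3.5 ^ 5) ^ i := pow_le_pow_left₀ (by norm_num) (by norm_num) i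
                _ = (3.5 ^ i) ^ 5 := by rw [← pow_mul, ← pow_mul, mul_comm]
                _ ≤ (((m:ℝ) ^ 6) ^ 3) ^ 5 := pow_le_pow_left₀ (by positivity) ((ofReal_le_ofReal_iff (by positivity)).1 (hi1.trans hchib)) 5
                _ = _ := by ring
            have hi6 : 2 ^ i ≤ m ^ 10 := by exact_mod_cast le_of_pow_le_pow_left₀ (by norm_num) (by positivity) hi4
            rw [ofReal_pow (by norm_num)]; refine le_trans (measure_mono ?_) (mu_farL_le hchi l hi2 m 0); rintro ω ⟨x, hx, hc⟩; refine ⟨x, ?_, hc⟩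
            refine le_trans ?_ (show ((m ^ 11 : ℕ) : ℤ) ≤ _ from hx)
            have : m * 2 ^ i ≤ m ^ 11 := by
              calc m * 2 ^ i ≤ m * m ^ 10 := Nat.mul_le_mul_left _ hi6
                _ = _ := by ring
            exact_mod_cast this
        _ = _ := by
            rw [sum_const, card_univ, Fintype.card_fin, nsmul_eq_mul, ofReal_mul (by positivity), ofReal_natCast]
    have h6 : mu (pT d) (clIn S 0 𝒜) ≤ 3 * mu (pT d) (clIn S 0 𝒜) := by
      calc mu (pT d) (clIn S 0 𝒜) = 1 * mu (pT d) (clIn S 0 𝒜) := (one_mul _).symm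
        _ ≤ _ := mul_le_mul' (by norm_num) le_rfl
    refine h6.trans (h1.trans ((add_le_add (mul_le_mul' le_rfl hF) le_rfl).trans ?_))
    rw [← ofReal_mul (by positivity), ← ofReal_add (by positivity) (by positivity)]; refine ofReal_le_ofReal ?_; rw [add_div, ← pow_mul (m:ℝ)]
    refine add_le_add ?_ le_rfl; rw [le_div_iff₀ (by positivity)]
    calc _ = 2 * d * ((m:ℝ) ^ 18 * 0.97 ^ m) := by ring
      _ ≤ 1 := hm2.le

end

noncomputable section

variable {d : ℕ}
variable {S R A B D : Set (V d)} {x y z v w : V d} {p q s : ℝ} {ω ω' : Config d}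

/-! ### The plane sum at the transition point -/

lemma tendsto_tt_pT (h : Big d) (x : V d) :
    Tendsto (fun j : ℕ => tt (pT d - pT d * (1 / ((j:ℝ) + 1))) x) atTop (nhds (tt (pT d) x)) := by
  have hT := pT_pos h
  have hT2 := h.pT_le
  have hj : ∀ j : ℕ, 0 < 1 / ((j:ℝ) + 1) ∧ 1 / ((j:ℝ) + 1) ≤ 1 := fun j =>
    ⟨by positivity, by rw [div_le_one (by linarith)]; linarith [j.cast_nonneg (α := ℝ)]⟩
  have hle : ∀ j : ℕ, 0 ≤ pT d - pT d * (1 / ((j:ℝ) + 1)) ∧ pT d - pT d * (1 / ((j:ℝ) + 1)) ≤ pT d := fun j => by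
    constructor <;> nlinarith [hj j]
  refine tendsto_order.2 ⟨fun a ha => ?_, fun a ha => Filter.Eventually.of_forall fun j =>
    (tau_mono (hle j).1 (hle j).2 (pT_le_one d) _ _ _).trans_lt ha⟩
  obtain ⟨n, hn⟩ := ((tendsto_tau_box (pT d) 0 x).eventually (lt_mem_nhds ha)).exists
  set t := tau (pT d) (box 0 n) 0 x
  set K : ENNReal := (((finite_edgesIn (finite_box 0 n)).toFinset.card : ℕ) : ENNReal) with hK
  have hlim : Tendsto (fun j : ℕ => K * ofReal (1 / ((j:ℝ) + 1))) atTop (nhds (K * ofReal 0)) :=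
    ENNReal.Tendsto.const_mul (ENNReal.tendsto_ofReal tendsto_one_div_add_atTop_nhds_zero_nat) (.inr (by simp [hK]))
  rw [ofReal_zero, mul_zero] at hlim
  filter_upwards [hlim.eventually (gt_mem_nhds (tsub_pos_of_lt hn))] with j hjK
  obtain ⟨s, hs, hu, hs1⟩ := exists_uni (hle j).2 (pT_le_one d)
  have h1 := tau_uni_le_finite ⟨(hle j).1, (hle j).2.trans (pT_le_one d)⟩ hs (finite_box 0 n) 0 x
  rw [hu] at h1
  by_contra hc
  push Not at hc
  have h2 : t ≤ a + K * ofReal (1 / ((j:ℝ) + 1)) :=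
    h1.trans (add_le_add ((tau_mono_set _ (subset_univ _)).trans hc) (mul_le_mul' le_rfl (ofReal_le_ofReal (by nlinarith [hj j, hs.1, hle j]))))
  have h3 := ENNReal.add_lt_add_left (ne_top_of_lt hn) hjK
  rw [add_tsub_cancel_of_le hn.le] at h3
  exact absurd (h2.trans_lt h3) (lt_irrefl _)

lemma plane_pT (h : Big d) : ∑' u, ttt (pT d) (emb d u) ≠ ⊤ := by
  set M := ofReal (mu' d (exp C₀) 0) ^ 3 + 8 * (49 * ofReal (1 / d ^ 3))
  have e : ∀ p, ∑' u, ttt p (emb d u) =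
      ∑' r : (ℤ × ℤ) × V d × V d, tt p r.2.1 * (tt p r.2.2 * tt p (emb d r.1 - r.2.1 - r.2.2)) := by
    intro p; rw [tsum_prod (f := fun u (c : V d × V d) => tt p c.1 * (tt p c.2 * tt p (emb d u - c.1 - c.2)))]; refine tsum_congr fun u => ?_
    rw [tsum_prod (f := fun a b : V d => tt p a * (tt p b * tt p (emb d u - a - b)))]; refine tsum_congr fun a => ?_; rw [tsum_mul_left]; rfl
  refine ne_top_of_le_ne_top (show M ≠ ⊤ from ENNReal.add_ne_top.2 ⟨pow_ne_top ofReal_ne_top, mul_ne_top (by simp) (mul_ne_top (by simp) ofReal_ne_top)⟩) ?_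
  rw [e, ENNReal.tsum_eq_iSup_sum]
  refine iSup_le fun F => ?_
  have hl := fun x => tendsto_tt_pT h x
  have ht : ∀ x : V d, tt (pT d) x ≠ ⊤ := fun x => tau_ne_top _
  refine le_of_tendsto' (tendsto_finsetSum F fun r _ => ENNReal.Tendsto.mul (hl r.2.1) (.inr (mul_ne_top (ht _) (ht _)))
    (ENNReal.Tendsto.mul (hl r.2.2) (.inr (ht _)) (hl (emb d r.1 - r.2.1 - r.2.2)) (.inr (ht _))) (.inr (ht _))) fun j => ?_
  refine (sum_le_tsum F).trans ?_
  rw [← e]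
  have hT := pT_pos h
  have hj : 0 < 1 / ((j:ℝ) + 1) ∧ 1 / ((j:ℝ) + 1) ≤ 1 :=
    ⟨by positivity, by rw [div_le_one (by positivity)]; linarith [j.cast_nonneg (α := ℝ)]⟩
  have h0 : 0 ≤ pT d - pT d * (1 / ((j:ℝ) + 1)) := by nlinarith
  have h1 : pT d - pT d * (1 / ((j:ℝ) + 1)) < pT d := by nlinarith
  exact (h.std' h0 (h1.le.trans (pT_le_one d)) (chi_ne_top_of_lt h0 h1)).plane h.num

lemma exists_spacing (h : Big d) : ∃ g : ℕ, 0 < g ∧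
    ∑' u : ℤ × ℤ, (if u = 0 then 0 else 2 * ttt (pT d) (emb d ((g:ℤ) • u))) ≤ 2⁻¹ := by
  obtain ⟨T, hT⟩ := ((ENNReal.tendsto_tsum_compl_atTop_zero (plane_pT h)).eventually (gt_mem_nhds (show 0 < 4⁻¹ by simp))).exists
  obtain ⟨g, hg⟩ : ∃ g : ℕ, ∀ u ∈ T, u.1.natAbs < g ∧ u.2.natAbs < g :=
    ⟨T.sup (fun u => u.1.natAbs + u.2.natAbs) + 1, fun u hu => by
      have := Finset.le_sup (f := fun u : ℤ × ℤ => u.1.natAbs + u.2.natAbs) hu; omega⟩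
  refine ⟨g + 1, by omega, ?_⟩
  set G : ℤ × ℤ → ENNReal := fun v => if v ∈ T then 0 else ttt (pT d) (emb d v)
  have hinj : Function.Injective fun u : ℤ × ℤ => ((g + 1 : ℕ):ℤ) • u := by
    intro u v huv; have hg : ((g + 1 : ℕ):ℤ) ≠ 0 := by positivity
    exact smul_right_injective _ hg huv
  have h1 : ∀ u : ℤ × ℤ, (if u = 0 then 0 else 2 * ttt (pT d) (emb d (((g + 1 : ℕ):ℤ) • u))) ≤ 2 * G (((g + 1 : ℕ):ℤ) • u) := by
    intro u; split_ifs with hu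
    · exact zero_le
    · have : ((g + 1 : ℕ):ℤ) • u ∉ T := by
        intro hm; have h2 := hg _ hm; simp only [Prod.smul_fst, Prod.smul_snd, smul_eq_mul, Int.natAbs_mul, Int.natAbs_natCast] at h2
        refine hu (Prod.ext (Int.natAbs_eq_zero.1 ?_) (Int.natAbs_eq_zero.1 ?_))
        · by_contra h0; nlinarith [h2.1, Nat.pos_of_ne_zero h0]
        · by_contra h0; nlinarith [h2.2, Nat.pos_of_ne_zero h0]
      simp only [G, if_neg this]; exact le_rfl
  refine (tsum_le_tsum h1).trans ?_
  rw [tsum_mul_left]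
  have h3 : ∑' v, G v ≤ 4⁻¹ := by
    refine le_trans (le_of_eq ?_) hT.le; refine Eq.trans (tsum_congr fun v => ?_) (tsum_subtype {x | x ∉ T} fun v => ttt (pT d) (emb d v)).symm
    by_cases hv : v ∈ T <;> simp [G, hv]
  calc _ ≤ 2 * (4⁻¹ : ENNReal) := mul_le_mul' le_rfl ((ENNReal.tsum_comp_le_tsum_of_injective hinj G).trans h3)
    _ = _ := by
      rw [show (4:ENNReal) = 2 * 2 by norm_num, ENNReal.mul_inv (by simp) (by simp), ← mul_assoc, ENNReal.mul_inv_cancel (by simp) (by simp), one_mul]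

lemma tt_le_ttt (p) (x : V d) : tt p x ≤ ttt p x := by
  have h1 : 1 ≤ conv (tt p) (tt p) (0 : V d) := by
    refine le_trans (le_of_eq ?_) (le_tsum 0); simp [tt_zero]
  calc tt p x = tt p x * 1 := (mul_one _).symm
    _ ≤ tt p x * conv (tt p) (tt p) (x - x) := mul_le_mul' le_rfl (by simp_all)
    _ ≤ _ := le_tsum x

lemma J_le_tt (p) (y z : V d) : J p y z ≤ tt p (z - y) := by
  rw [← mu_openAdj, ← tau_univ]
  exact measure_mono fun ω hω => Cn.step (mem_univ _) (mem_univ _) hω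

lemma tsum_tt_J_le (p) (b x : V d) : ∑' z, tt p (z - b) * ∑' y, tt p (y - x) * J p y z ≤ ttt p (x - b) := by
  unfold ttt conv
  rw [← tsum_sub_left (fun a => tt p a * ∑' c, tt p c * tt p (x - b - a - c)) b]
  refine tsum_le_tsum fun z => mul_le_mul' le_rfl ?_
  rw [← tsum_sub_left (fun c => tt p c * tt p (x - b - (z - b) - c)) z]
  refine tsum_le_tsum fun y => ?_
  rw [mul_comm]
  refine mul_le_mul' ((J_le_tt p y z).trans (le_of_eq ?_)) (le_of_eq ?_)
  · rw [← tt_neg, neg_sub]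
  · rw [← tt_neg]; congr 1; abel

/-! ### Clusters of sets -/

/-- The vertices joined to `A` inside `S`. -/
def clS (S A : Set (V d)) (ω : Config d) : Set (V d) := {y | ω ∈ cnS S y A}

lemma clS_subset : clS S A ω ⊆ S := fun _ ⟨_, _, h⟩ => h.left

lemma meas_clS_eq (S A D : Set (V d)) : MeasurableSet {ω | clS S A ω = D} := by
  have : {ω | clS S A ω = D} = ⋂ y, {ω | ω ∈ cnS S y A ↔ y ∈ D} := by
    ext ω; simp [Set.ext_iff]; rfl
  rw [this]
  refine MeasurableSet.iInter fun y => ?_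
  by_cases h : y ∈ D
  · simpa [h] using meas_cnS S y A
  · have : {ω | ω ∈ cnS S y A ↔ y ∈ D} = (cnS S y A)ᶜ := by aesop
    rw [this]; exact (meas_cnS S y A).compl

lemma clS_step (ha : x ∈ clS S A ω) (hy : y ∈ S) (h : OpenAdj ω x y) : y ∈ clS S A ω := by
  obtain ⟨a, haA, hc⟩ := ha
  exact ⟨a, haA, (Cn.step hy hc.left h.symm).trans hc⟩

lemma depOn_clS_eq (S A D : Set (V d)) : DepOn {ω | clS S A ω = D} (edgesAt D ∩ edgesIn S) := by
  intro ω ω' hω h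
  have he : ∀ a b, a ∈ D → a ∈ S → b ∈ S → (OpenAdj ω a b ↔ OpenAdj ω' a b) := by
    intro a b ha haS hb; rw [openAdj_iff, openAdj_iff]; refine exists_congr fun h' => ?_
    rw [hω _ ⟨(mkE_mem_edgesAt h').2 (.inl ha), (mkE_mem_edgesIn h').2 ⟨haS, hb⟩⟩]
  refine Subset.antisymm ?_ ?_
  · rintro y ⟨x, hx, hc⟩; refine Cn.induct ?_ (fun a b _ ha haS hb hab => ?_) hc.symm
    · rw [← h]; exact ⟨x, hx, Cn.refl hc.right⟩
    · have hab := (he a b ha haS hb).2 hab; rw [← h] at ha ⊢; exact clS_step ha hb hab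
  · intro y hy; rw [← h] at hy; obtain ⟨x, hx, hc⟩ := hy
    refine ⟨x, hx, Cn.symm (Cn.induct (Cn.refl hc.right) (fun a b ha ha' haS hb hab => ?_) hc.symm)⟩
    refine ha'.trans (Cn.step haS hb ((he a b ?_ haS hb).1 hab)); rw [← h]; exact ⟨x, hx, ha.symm⟩

lemma tsum_mu_clS_inter (p) (hS : S.Finite) (hF : MeasurableSet F) :
    ∑' D : Finset (V d), mu p ({ω | clS S A ω = D} ∩ F) = mu p F := by
  rw [← measure_iUnion]
  · congr 1; ext ω; simp only [mem_iUnion]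
    exact ⟨fun ⟨_, _, h⟩ => h, fun h => ⟨(hS.subset (clS_subset (A := A) (ω := ω))).toFinset, by simp, h⟩⟩
  · intro D D' hne; grind
  · exact fun D => (meas_clS_eq _ _ _).inter hF

lemma one_le_phi_pT' (h : Big d) (hS : S.Finite) (hx : x ∈ S) : 1 ≤ phi (pT d) S x := by
  set T := (fun y => y + x) ⁻¹' S with hT
  have h1 := phi_shift (pT d) x (S := T) (fun y => Iff.rfl) 0
  rw [zero_add] at h1
  rw [h1]
  refine one_le_phi_pT h (hS.preimage ?_) (by simp_all)
  simp

open Classical in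
/-- The expected number of open exits from the cluster of `A` in `S`. -/
def phiA (p : ℝ) (S A : Set (V d)) : ENNReal := ∑' z, if z ∈ S then 0 else ∑' y, mu p (cnS S y A) * J p y z

/-- The event that `y` is joined to `x` but not to `B`. -/
def newEv (S B : Set (V d)) (x y : V d) : Set (Config d) := cn S x y ∩ (cnS S y B)ᶜ

lemma meas_newEv (S B) (x y : V d) : MeasurableSet (newEv S B x y) :=
  (meas_cn _ _ _).inter (meas_cnS _ _ _).compl

open Classical in
lemma one_le_new_exit (h : Big d) (hS : S.Finite) (hx : x ∈ S) (B : Finset (V d)) :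
    1 ≤ (∑' z, if z ∈ S then 0 else ∑' y, mu (pT d) (newEv S B x y) * J (pT d) y z) + ∑ b ∈ B, 2 * ttt (pT d) (x - b) := by
  set p := pT d
  set K : Fn d := fun z => ∑' y, tt p (y - x) * J p y z
  have hD : ∀ D : Finset (V d), mu p {ω | clS S B ω = D} ≤ mu p ({ω | clS S B ω = D} ∩ cnS S x B) +
      ((∑' z, if z ∈ S then 0 else ∑' y, mu p ({ω | clS S B ω = D} ∩ newEv S B x y) * J p y z) +
        ∑' z, mu p ({ω | clS S B ω = D} ∩ cnS S z B) * K z) := by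
    intro D
    have hin : ∀ z ∈ D, {ω | clS S B ω = D} ∩ cnS S z B = {ω | clS S B ω = D} := fun z hz =>
      inter_eq_left.2 fun ω hω => by
        exact (show z ∈ clS S B ω by simp_all)
    by_cases hxD : x ∈ D
    · rw [hin x hxD]; exact le_self_add
    refine le_add_left ?_; set W := mu p {ω | clS S B ω = D}; rw [← tsum_add]
    calc W = W * 1 := (mul_one _).symm
      _ ≤ W * phi p (S \ D) x := mul_le_mul' le_rfl (one_le_phi_pT' h (hS.subset sdiff_subset) ⟨hx, hxD⟩)
      _ ≤ _ := by
        rw [phi, ← tsum_mul_left]; refine tsum_le_tsum fun z => ?_; unfold Q; by_cases hzD : z ∈ D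
        · rw [if_neg (fun hz => hz.2 hzD), hin z hzD]
          refine le_add_left (mul_le_mul' le_rfl (tsum_le_tsum fun y => mul_le_mul' (tau_le_tt _ _ _ _) le_rfl))
        · by_cases hzS : z ∈ S
          · simp_all
          · rw [if_neg (fun hz => hzS hz.1), if_neg hzS, ← tsum_mul_left]; refine le_add_right (tsum_le_tsum fun y => ?_); rw [← mul_assoc]
            refine mul_le_mul' ?_ le_rfl
            rw [tau, ← mu_inter_of_depOn p (meas_clS_eq _ _ _) (meas_cn _ _ _)
              ((depOn_clS_eq S B D).mono inter_subset_left) (depOn_cn _ _ _) (disjoint_edgesAt_edgesIn_diff _)]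
            refine measure_mono fun ω ⟨h1, h2⟩ => ⟨h1, Cn.mono_set sdiff_subset h2, fun hc => ?_⟩; have hy : y ∈ clS S B ω := hc; rw [h1] at hy
            exact (Cn.right h2).2 hy
  have hsum := tsum_le_tsum hD
  have e1 := tsum_mu_clS_inter (A := B) p hS MeasurableSet.univ
  simp [measure_univ] at e1
  rw [e1, tsum_add, tsum_add, tsum_mu_clS_inter p hS (meas_cnS _ _ _), tsum_comm,
    tsum_comm (f := fun D : Finset (V d) => _)] at hsum
  have e2 : ∀ z, ∑' D : Finset (V d), (if z ∈ S then 0 else ∑' y, mu p ({ω | clS S B ω = D} ∩ newEv S B x y) * J p y z) =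
      if z ∈ S then 0 else ∑' y, mu p (newEv S B x y) * J p y z := by
    intro z; split_ifs
    · simp
    · rw [tsum_comm]; refine tsum_congr fun y => ?_; rw [tsum_mul_right, tsum_mu_clS_inter p hS (meas_newEv _ _ _ _)]
  simp [e2, (show ∀ z, ∑' D : Finset (V d), mu p ({ω | clS S B ω = D} ∩ cnS S z B) * K z = mu p (cnS S z B) * K z from fun z => by rw [tsum_mul_right, tsum_mu_clS_inter p hS (meas_cnS _ _ _)])] at hsum
  have hc : ∀ z, mu p (cnS S z B) ≤ ∑ b ∈ B, tt p (z - b) := by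
    intro z; rw [cnS_eq_iUnion]; refine (measure_biUnion_finset_le B _).trans (sum_le_sum fun b _ => ?_)
    rw [← tt_neg, neg_sub]; exact tau_le_tt p S z b
  refine hsum.trans ?_
  rw [add_left_comm]
  refine add_le_add le_rfl ?_
  calc _ ≤ ∑ b ∈ B, ttt p (x - b) + ∑ b ∈ B, ttt p (x - b) := by
        refine add_le_add ((hc x).trans (sum_le_sum fun b _ => tt_le_ttt _ _)) ?_
        calc _ ≤ ∑' z, ∑ b ∈ B, tt p (z - b) * K z := tsum_le_tsum fun z => by
              rw [← sum_mul]; exact mul_le_mul' (hc z) le_rfl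
          _ = ∑ b ∈ B, ∑' z, tt p (z - b) * K z := Summable.tsum_finsetSum fun _ _ => ENNReal.summable
          _ ≤ _ := sum_le_sum fun b _ => tsum_tt_J_le p b x
    _ = _ := by rw [← two_mul, mul_sum]

open Classical in
lemma card_le_phiA (h : Big d) (hS : S.Finite) (A : Finset (V d)) (hA : (A : Set (V d)) ⊆ S)
    (hs : ∀ x ∈ A, ∑ b ∈ A.erase x, 2 * ttt (pT d) (x - b) ≤ 2⁻¹) : A.card * (2⁻¹ : ENNReal) ≤ phiA (pT d) S A := by
  have h1 : ∀ x ∈ A, 2⁻¹ ≤ ∑' z, if z ∈ S then 0 else ∑' y, mu (pT d) (newEv S (A.erase x : Finset (V d)) x y) * J (pT d) y z := by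
    intro x hx; have h2 := (one_le_new_exit h hS (hA hx) (A.erase x)).trans (add_le_add le_rfl (hs x hx)); rw [← inv_two_add_inv_two] at h2; simp_all
  calc A.card * (2⁻¹ : ENNReal) = ∑ x ∈ A, 2⁻¹ := by rw [sum_const, nsmul_eq_mul]
    _ ≤ _ := sum_le_sum h1
    _ = ∑' z, ∑ x ∈ A, (if z ∈ S then 0 else ∑' y, mu (pT d) (newEv S (A.erase x : Finset (V d)) x y) * J (pT d) y z) :=
        (Summable.tsum_finsetSum fun _ _ => ENNReal.summable).symm
    _ ≤ _ := by
      refine tsum_le_tsum fun z => ?_; split_ifs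
      · simp
      rw [← Summable.tsum_finsetSum fun _ _ => ENNReal.summable]; refine tsum_le_tsum fun y => ?_; rw [← sum_mul]; refine mul_le_mul' ?_ le_rfl
      rw [← measure_biUnion_finset]
      · refine measure_mono (iUnion₂_subset fun x hx ω hω => ⟨x, hx, Cn.symm hω.1⟩)
      · intro x hx x' hx' hne; rw [Function.onFun, disjoint_left]; intro ω h1 h2; exact h2.2 ⟨x, by simpa [hne] using hx, Cn.symm h1.1⟩
      · exact fun x _ => meas_newEv _ _ _ _

end

noncomputable section

variable {d : ℕ}
variable {S R B D : Set (V d)} {x y z v w : V d} {p q s : ℝ} {ω ω' : Config d}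

lemma emb_sub (u v) : emb d u - emb d v = emb d (u - v) := by
  funext i; simp [emb, Prod.snd_sub]; split_ifs <;> simp

open Classical in
lemma exists_grid (h : Big d) : ∃ g, 0 < g ∧ ∀ m, ∃ A : Finset (V d), A.card = m ^ 2 ∧ (A : Set (V d)) ⊆ box 0 (g * m) ∧
    ∀ S, S.Finite → (A : Set (V d)) ⊆ S → (m ^ 2 : ℕ) * (2⁻¹ : ENNReal) ≤ phiA (pT d) S A := by
  obtain ⟨g, hg, hsum⟩ := exists_spacing h
  refine ⟨g, hg, fun m => ?_⟩
  set f : ℕ × ℕ → V d := fun t => emb d ((g:ℤ) • ((t.1:ℤ), (t.2:ℤ))) with hf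
  have hf1 : Function.Injective f := by
    intro t t' ht; have h1 := smul_right_injective _ (by omega) (emb_injective (by have := h.d26; omega) ht); aesop
  refine ⟨(Finset.range m ×ˢ Finset.range m).image f, ?_, ?_, ?_⟩
  · rw [Finset.card_image_of_injective _ hf1]; simp [pow_two]
  · intro x hx; rw [mem_coe, Finset.mem_image] at hx; obtain ⟨t, ht, rfl⟩ := hx; simp [Finset.mem_range] at ht; intro i
    have h2 : g * t.2 ≤ g * m := Nat.mul_le_mul_left _ ht.2.le; simp [hf, emb]; split_ifs
    · rw [abs_of_nonneg (by positivity)]; exact_mod_cast Nat.mul_le_mul_left _ ht.1.le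
    · rw [abs_of_nonneg (by positivity)]; exact_mod_cast h2
    · simp [abs_zero]; positivity
  · intro S hS hA
    have hc : ((Finset.range m ×ˢ Finset.range m).image f).card = m ^ 2 := by
      rw [Finset.card_image_of_injective _ hf1]; simp [pow_two]
    rw [← hc]; refine card_le_phiA h hS _ hA fun x hx => ?_; obtain ⟨t, -, rfl⟩ := Finset.mem_image.1 hx; refine le_trans ?_ hsum
    set G : ℤ × ℤ → ENNReal := fun u => if u = 0 then 0 else 2 * ttt (pT d) (emb d ((g:ℤ) • u))
    have hinj : Function.Injective fun t' : ℕ × ℕ => ((t.1:ℤ) - t'.1, (t.2:ℤ) - t'.2) := by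
      intro a b hab; simp [Prod.mk.injEq] at hab; exact Prod.ext (by omega) (by omega)
    calc _ = ∑ b ∈ (((Finset.range m ×ˢ Finset.range m).erase t).image f), 2 * ttt (pT d) (f t - b) := by
          rw [Finset.image_erase hf1]
      _ = ∑ t' ∈ (Finset.range m ×ˢ Finset.range m).erase t, 2 * ttt (pT d) (f t - f t') :=
          sum_image fun _ _ _ _ h => hf1 h
      _ = ∑ t' ∈ (Finset.range m ×ˢ Finset.range m).erase t, G ((t.1:ℤ) - t'.1, (t.2:ℤ) - t'.2) := by
          refine sum_congr rfl fun t' ht' => ?_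
          have hne : ((t.1:ℤ) - t'.1, (t.2:ℤ) - t'.2) ≠ 0 := by
            intro h0; refine (Finset.mem_erase.1 ht').1 (hinj (?_ : (_, _) = (_, _))); rw [h0, sub_self, sub_self]; rfl
          simp only [G, if_neg hne, hf, emb_sub, ← smul_sub]; rfl
      _ ≤ ∑' t' : ℕ × ℕ, G ((t.1:ℤ) - t'.1, (t.2:ℤ) - t'.2) := sum_le_tsum _
      _ ≤ _ := ENNReal.tsum_comp_le_tsum_of_injective hinj G

lemma sum_measure_le_union [MeasurableSpace Ω] (μ : Measure Ω) (E : ι → Set Ω) (hE : ∀ i, MeasurableSet (E i))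
    (F) (hc : ∀ i ∈ F, ∀ j ∈ F, i ≠ j → μ (E i ∩ E j) ≤ c) : ∑ i ∈ F, μ (E i) ≤ μ (⋃ i ∈ F, E i) + (F.card : ENNReal) ^ 2 * c := by
  classical
  induction F using Finset.induction_on with
  | empty => simp
  | insert a F ha ih =>
    rw [Finset.sum_insert ha, Finset.set_biUnion_insert, Finset.card_insert_of_notMem ha]
    have h1 : μ (E a ∩ ⋃ i ∈ F, E i) ≤ F.card * c := by
      rw [inter_iUnion₂]; refine (measure_biUnion_finset_le F _).trans ?_; rw [← nsmul_eq_mul]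
      exact sum_le_card_nsmul _ _ _ fun i hi => hc a (by simp) i (by simp [hi]) fun h => ha (h ▸ hi)
    calc _ ≤ μ (E a) + (μ (⋃ i ∈ F, E i) + (F.card : ENNReal) ^ 2 * c) := add_le_add le_rfl (ih fun i hi j hj => hc i (by simp [hi]) j (by simp [hj]))
      _ = μ (E a ∪ ⋃ i ∈ F, E i) + μ (E a ∩ ⋃ i ∈ F, E i) + (F.card : ENNReal) ^ 2 * c := by
          rw [measure_union_add_inter _ (F.measurableSet_biUnion fun i _ => hE i), add_assoc]
      _ ≤ μ (E a ∪ ⋃ i ∈ F, E i) + F.card * c + (F.card : ENNReal) ^ 2 * c := add_le_add (add_le_add le_rfl h1) le_rfl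
      _ ≤ _ := by
          rw [add_assoc, ← add_mul]; refine add_le_add le_rfl (mul_le_mul' ?_ le_rfl); norm_cast; nlinarith

/-- The event that no vertex of `A` is joined in the box to its boundary sphere. -/
def noFar (n : ℕ) (A : Set (V d)) : Set (Config d) := {ω | ∀ x ∈ A, ω ∉ cnS (box 0 n) x (sphere 0 n)}

lemma meas_noFar (n) (A : Set (V d)) : MeasurableSet (noFar n A) := by
  rw [(show noFar n A = ⋂ x ∈ A, (cnS (box 0 n) x (sphere 0 n))ᶜ by aesop)]; exact MeasurableSet.biInter (to_countable _) fun x _ => (meas_cnS _ _ _).compl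

lemma mem_sphere_of_adjacent (hy : y ∈ box v n) (hz : z ∉ box v n) (h : Adjacent y z) : y ∈ sphere v n := by
  refine ⟨hy, ?_⟩
  by_contra hc
  push Not at hc
  refine hz fun i => ?_
  obtain ⟨s, rfl⟩ := adjacent_iff.1 h
  have h1 := lt_of_le_of_ne (hy i) (hc i)
  have h2 : |st s i| ≤ 1 := by
    by_cases hi : i = s.1
    · subst hi; rw [st_same]; split_ifs <;> simp
    · rw [st_ne hi]; simp
  rw [Pi.add_apply, add_sub_right_comm]
  exact (abs_add_le _ _).trans (by omega)

open Classical in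
lemma noFar_sprinkle (hp : p ∈ 𝕀) (hs : s ∈ 𝕀) (n) (A) (hAn : A ⊆ box 0 n)
    (ha : ∀ S : Set (V d), S.Finite → A ⊆ S → a ≤ ∑' z, if z ∈ S then 0 else ∑' y, mu p (cnS S y A) * J 1 y z) :
    mu (uni p s) (noFar n A) + ofReal s * a * mu p (noFar n A) ≤
      (1 + (((finite_box (0 : V d) n).toFinset ×ˢ (finite_box (0 : V d) n).toFinset).card : ENNReal) ^ 2 * ofReal s ^ 2) * mu p (noFar n A) := by
  set R := box (0 : V d) n
  set T := sphere 0 n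
  have hRf : R.Finite := finite_box _ _
  set F := hRf.toFinset ×ˢ hRf.toFinset
  set μ := (mu p : Measure (Config d)).prod (mu s) with hμ
  set N := noFar n A
  have hNm : MeasurableSet N := meas_noFar _ _
  have key : ∀ U : Finset (V d), μ {q | (clS R T q.1 = U ∧ q.1 ∈ N) ∧ orc q.1 q.2 ∈ N} + ofReal s * a * mu p ({ω | clS R T ω = U} ∩ N) ≤
      (1 + (F.card : ENNReal) ^ 2 * ofReal s ^ 2) * mu p ({ω | clS R T ω = U} ∩ N) := by
    intro U; rcases ({ω | clS R T ω = U} ∩ N).eq_empty_or_nonempty with h0 | ⟨ω₀, hω₀, hω₀N⟩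
    · have : {q : Pr (Edge d) | (clS R T q.1 = U ∧ q.1 ∈ N) ∧ orc q.1 q.2 ∈ N} = ∅ :=
        eq_empty_of_forall_notMem fun q hq => by
          have : q.1 ∈ ({ω | clS R T ω = U} ∩ N : Set (Config d)) := hq.1; rw [h0] at this; exact this
      rw [h0, this]; simp
    have hω₀ : clS R T ω₀ = U := hω₀; have hTU : T ⊆ U := fun x hx => by rw [← hω₀]; exact ⟨x, hx, Cn.refl hx.1⟩
    have hAU : ∀ x ∈ A, x ∉ U := fun x hx hxU => hω₀N x hx (by
      have : x ∈ clS R T ω₀ := by rw [hω₀]; exact hxU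
      exact this)
    have hWN : ({ω | clS R T ω = U} ∩ N : Set (Config d)) = {ω | clS R T ω = U} := inter_eq_left.2 fun ω hω x hx hc => by
      have : x ∈ clS R T ω := hc; rw [hω] at this; exact hAU x hx this
    rw [hWN]; set W := {ω | clS R T ω = U}; set S := R \ U
    set E : V d × V d → Set (Pr (Edge d)) := fun r => {q | (q.1 ∈ cnS S r.1 A ∧ OpenAdj q.2 r.1 r.2) ∧ r.2 ∈ U} with hE
    have m2 : ∀ y z, MeasurableSet {q : Pr (Edge d) | OpenAdj q.2 y z} := fun y z => measurable_snd (meas_openAdj y z)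
    have hEm : ∀ r, MeasurableSet (E r) := fun r => (((show ∀ y, MeasurableSet {q : Pr (Edge d) | q.1 ∈ cnS S y A} from fun y => measurable_fst (meas_cnS _ _ _)) _).inter (m2 _ _)).inter (MeasurableSet.const _)
    have hEμ : ∀ y z, z ∈ U → μ (E (y, z)) = ofReal s * (mu p (cnS S y A) * J 1 y z) := by
      intro y z hz; have : E (y, z) = (cnS S y A) ×ˢ {ξ | OpenAdj ξ y z} := by ext q; simp [hE, hz]
      rw [this, hμ, Measure.prod_prod, mu_openAdj, J_eq_mul hs, mul_left_comm]
    have hlow : ofReal s * a ≤ ∑ r ∈ F, μ (E r) := by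
      refine (mul_le_mul' le_rfl (ha S (hRf.subset sdiff_subset) fun x hx => ⟨hAn hx, hAU x hx⟩)).trans ?_
      rw [Finset.sum_product_right, ← tsum_mul_left, tsum_eq_sum]
      · refine sum_le_sum fun z hz => ?_; have hzR : z ∈ R := (Finite.mem_toFinset _).1 hz; split_ifs with hzS
        · simp
        rw [← tsum_mul_left, tsum_eq_sum]
        · exact sum_le_sum fun y _ => (hEμ y z (by by_contra hc; exact hzS ⟨hzR, hc⟩)).ge
        · intro y hy; have : cnS S y A = ∅ := eq_empty_of_forall_notMem fun ω ⟨_, _, hc⟩ => hy ((Finite.mem_toFinset _).2 hc.left.1); rw [this]; simp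
      · intro z hz; have hzR : z ∉ R := fun h => hz ((Finite.mem_toFinset _).2 h); rw [if_neg (fun h => hzR h.1), ENNReal.tsum_eq_zero.2, mul_zero]
        intro y; by_cases hyS : y ∈ S
        · have : J 1 y z = 0 := by
            unfold J; rw [if_neg]; exact fun hadj => hyS.2 (hTU (mem_sphere_of_adjacent hyS.1 hzR hadj))
          rw [this, mul_zero]
        · have : cnS S y A = ∅ := eq_empty_of_forall_notMem fun ω ⟨_, _, hc⟩ => hyS hc.left; rw [this]; simp
    have hpair : ∀ r ∈ F, ∀ r' ∈ F, r ≠ r' → μ (E r ∩ E r') ≤ ofReal s ^ 2 := by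
      rintro ⟨y, z⟩ - ⟨y', z'⟩ - hne; by_cases hq : (E (y, z) ∩ E (y', z')).Nonempty; swap
      · rw [not_nonempty_iff_eq_empty.1 hq]; simp
      obtain ⟨q, ⟨⟨⟨_, _, hy⟩, -⟩, hz⟩, ⟨⟨⟨_, _, hy'⟩, -⟩, hz'⟩⟩ := hq
      have hd : Disjoint {e : Edge d | e.val = s(y, z)} {e | e.val = s(y', z')} := by
        rw [disjoint_left]; intro e h1 (h2 : e.val = s(y', z')); rw [h1, Sym2.eq_iff] at h2; rcases h2 with ⟨rfl, rfl⟩ | ⟨rfl, rfl⟩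
        · exact hne rfl
        · exact hy.left.2 hz'
      have hJ : ∀ y z : V d, J s y z ≤ ofReal s := fun y z => by
        unfold J; split_ifs
        · rw [wt_true hs]
        · exact zero_le
      calc _ ≤ μ {q | q.2 ∈ ({ξ | OpenAdj ξ y z} ∩ {ξ | OpenAdj ξ y' z'} : Set (Config d))} :=
            measure_mono fun q hq => ⟨hq.1.1.2, hq.2.1.2⟩
        _ = J s y z * J s y' z' := by
            rw [hμ, prod_snd, mu_inter_of_depOn s (meas_openAdj _ _) (meas_openAdj _ _) (depOn_openAdj _ _) (depOn_openAdj _ _) hd, mu_openAdj, mu_openAdj]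
        _ ≤ _ := by rw [pow_two]; exact mul_le_mul' (hJ _ _) (hJ _ _)
    set H := ⋃ r ∈ F, E r with hH; have hHm : MeasurableSet H := F.measurableSet_biUnion fun r _ => hEm r
    have hHd : DepOn₂ H (edgesIn S) univ := by
      intro q q' h1 h2 hq; simp only [hH, mem_iUnion] at hq ⊢; obtain ⟨r, hr, ⟨hq1, hq2⟩, hq3⟩ := hq
      refine ⟨r, hr, ⟨depOn_cnS _ _ _ _ _ h1 hq1, ?_⟩, hq3⟩; rw [← funext fun e => h2 e trivial]; exact hq2
    have hWd : DepOn₂ {q | q.1 ∈ W} (edgesAt U) ∅ := ((depOn_clS_eq R T U).mono inter_subset_left).fst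
    have hsub : {q | (clS R T q.1 = U ∧ q.1 ∈ N) ∧ orc q.1 q.2 ∈ N} ⊆ {q | q.1 ∈ W} ∩ Hᶜ := by
      rintro q ⟨⟨h1, -⟩, h3⟩; refine ⟨h1, fun hq => ?_⟩; simp only [hH, mem_iUnion] at hq; obtain ⟨⟨y, z⟩, -, ⟨⟨x, hx, hc⟩, ho⟩, hz⟩ := hq
      obtain ⟨t, ht, hzt⟩ := (show z ∈ clS R T q.1 by rw [h1]; exact hz)
      exact h3 x hx ⟨t, ht, ((hc.symm.mono sdiff_subset (le_orc _ _)).trans (Cn.step hc.left.1 hzt.left (ho.mono fun e he => by simp [orc, he]))).trans (hzt.mono Subset.rfl (le_orc _ _))⟩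
    have hle : μ {q | (clS R T q.1 = U ∧ q.1 ∈ N) ∧ orc q.1 q.2 ∈ N} ≤ mu p W * μ Hᶜ := by
      refine (measure_mono hsub).trans (le_of_eq ?_)
      rw [hμ, prod_inter_of_depOn p s (show MeasurableSet {q | q.1 ∈ W} from measurable_fst (meas_clS_eq _ _ _)) hHm.compl hWd (fun q q' h1 h2 hq hq' => hq (hHd q' q (fun e he => (h1 e he).symm) (fun e he => (h2 e he).symm) hq')) (disjoint_edgesAt_edgesIn_diff _) (empty_disjoint _), prod_fst]
    calc _ ≤ mu p W * μ Hᶜ + (μ H + (F.card : ENNReal) ^ 2 * ofReal s ^ 2) * mu p W := add_le_add hle (mul_le_mul' (hlow.trans (sum_measure_le_union μ E hEm F hpair)) le_rfl)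
      _ = (μ H + μ Hᶜ + (F.card : ENNReal) ^ 2 * ofReal s ^ 2) * mu p W := by ring
      _ = _ := by rw [measure_add_measure_compl hHm, measure_univ]
  have h1 : mu (uni p s) N ≤ ∑' U : Finset (V d), μ {q | (clS R T q.1 = U ∧ q.1 ∈ N) ∧ orc q.1 q.2 ∈ N} := by
    rw [mu_uni hp hs hNm]; refine (measure_mono fun q hq => ?_).trans (measure_iUnion_le _)
    refine mem_iUnion.2 ⟨(hRf.subset (clS_subset (A := T) (ω := q.1))).toFinset, ⟨by simp, fun x hx hc => hq x hx ?_⟩, hq⟩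
    exact incr_cnS _ _ _ _ _ (le_orc _ _) hc
  have h2 := tsum_mu_clS_inter (A := T) p hRf hNm
  calc _ ≤ _ := add_le_add h1 (mul_le_mul' le_rfl h2.ge)
    _ = _ := by rw [← tsum_mul_left, ← tsum_add]
    _ ≤ _ := tsum_le_tsum key
    _ = _ := by rw [tsum_mul_left, h2]

lemma noFar_le (hq : pT d < q) (hq1 : q ≤ 1) (n) (A) (hAn : A ⊆ box 0 n) (ha0 : 0 ≤ a)
    (ha : ∀ S : Set (V d), S.Finite → A ⊆ S → ofReal a ≤ phiA (pT d) S A) :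
    mu q (noFar n A) ≤ ofReal (exp (1 - (q - pT d) * a)) := by
  set K : ℕ := ((finite_box 0 n).toFinset ×ˢ (finite_box 0 n).toFinset).card with hK
  set t := q - pT d
  have ht1 : t ≤ 1 := by linarith [pT_nonneg d]
  obtain ⟨m, hm⟩ := exists_nat_ge (t ^ 2 * (K:ℝ) ^ 2 + 1)
  have hm0 : (0:ℝ) < m := by nlinarith
  set s := t / m with hs
  have hs0 : 0 < s := by positivity
  have hms : m * s = t := by grind
  have hs1 : s ≤ 1 := by nlinarith
  have hsI : s ∈ 𝕀 := ⟨hs0.le, hs1⟩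
  have iter : ∀ j : ℕ, ∃ p, pT d ≤ p ∧ p ≤ pT d + j * s ∧ p ≤ 1 ∧ mu p (noFar n A) ≤ ofReal (exp (j * (s ^ 2 * K ^ 2 - s * a))) := by
    intro j; induction j with
    | zero => exact ⟨pT d, le_rfl, by simp, pT_le_one d, by simpa using prob_le_one⟩
    | succ j ih =>
      obtain ⟨p, h1, h2, h3, h4⟩ := ih; have hp : p ∈ 𝕀 := ⟨(pT_nonneg d).trans h1, h3⟩; refine ⟨uni p s, ?_, ?_, (uni_mem hp hsI).2, ?_⟩
      · unfold uni; nlinarith [mul_nonneg hs0.le (sub_nonneg.2 h3)]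
      · unfold uni; push_cast; nlinarith [mul_nonneg hs0.le hp.1]
      have h5 := noFar_sprinkle hp hsI n A hAn fun S hS hAS => by
        refine (ha S hS hAS).trans (tsum_le_tsum fun z => ?_); split_ifs
        · exact le_rfl
        refine tsum_le_tsum fun y => mul_le_mul' (mu_mono (pT_nonneg d) h1 h3 (meas_cnS _ _ _) (incr_cnS _ _ _)) ?_
        rw [J_eq_mul ⟨pT_nonneg d, pT_le_one d⟩]; exact (mul_le_mul' (ENNReal.ofReal_le_one.2 (pT_le_one d)) le_rfl).trans (by rw [one_mul])
      rw [← hK] at h5; have hn2 := measure_ne_top (mu p) (noFar n A)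
      lift mu (uni p s) (noFar n A) to NNReal using (measure_ne_top (mu (uni p s)) (noFar n A)) with G' hG'
      lift mu p (noFar n A) to NNReal using hn2 with G hG
      have h6 : (G':ℝ) + s * a * G ≤ (1 + K ^ 2 * s ^ 2) * G := by
        simp [ofReal] at h5; norm_cast at h5; rw [← NNReal.coe_le_coe] at h5; push_cast [coe_toNNReal _ hs0.le, coe_toNNReal _ ha0] at h5; exact h5
      rw [← ENNReal.ofReal_coe_nnreal] at h4 ⊢; refine ofReal_le_ofReal ?_
      have h8 : (G':ℝ) ≤ exp (s ^ 2 * K ^ 2 - s * a) * G := by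
        have h9 := mul_le_mul_of_nonneg_right (add_one_le_exp (s ^ 2 * K ^ 2 - s * a)) (NNReal.coe_nonneg G); nlinarith
      calc (G':ℝ) ≤ _ := h8
        _ ≤ exp (s ^ 2 * K ^ 2 - s * a) * exp (j * (s ^ 2 * K ^ 2 - s * a)) := mul_le_mul_of_nonneg_left ((ofReal_le_ofReal_iff (exp_pos _).le).1 h4) (exp_pos _).le
        _ = _ := by rw [← Real.exp_add]; congr 1; push_cast; ring
  obtain ⟨p, h1, h2, h3, h4⟩ := iter m
  have h5 : mu q (noFar n A) ≤ mu p (noFar n A) := by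
    rw [← compl_compl (noFar n A), prob_compl_eq_one_sub (meas_noFar _ _).compl, prob_compl_eq_one_sub (meas_noFar _ _).compl]
    refine tsub_le_tsub_left (mu_mono ((pT_nonneg d).trans h1) (by linarith) hq1 (meas_noFar _ _).compl ?_) _; intro ω ω' hω h hc
    exact h fun x hx hx' => hc x hx (incr_cnS _ _ _ _ _ hω hx')
  refine h5.trans (h4.trans (ofReal_le_ofReal (Real.exp_le_exp.2 ?_)))
  have : m * (s ^ 2 * K ^ 2) ≤ 1 := by
    rw [(show m * (s ^ 2 * K ^ 2) = t ^ 2 * K ^ 2 / m by rw [hs]; field_simp), div_le_one hm0]; linarith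
  nlinarith

end

noncomputable section

variable {d : ℕ}
variable {S R D : Set (V d)} {x y z v w : V d} {p q s : ℝ} {ω ω' η ξ : Config d}

/-! ### Geometry of boxes and spheres -/

lemma Cn.first_exit (D) (h : Cn R ω v x) (hv : v ∈ D) (hx : x ∉ D) :
    ∃ y z, Cn (R ∩ D) ω v y ∧ z ∈ R \ D ∧ OpenAdj ω y z := by
  refine ((Cn.induct (P := fun x => Cn (R ∩ D) ω v x ∨ ∃ y z, Cn (R ∩ D) ω v y ∧ z ∈ R \ D ∧ OpenAdj ω y z)
    (.inl (Cn.refl ⟨h.left, hv⟩)) (fun a b _ ha haR hb hab => ?_) h)).resolve_left fun hc => hx hc.right.2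
  rcases ha with ha | ha
  · by_cases hbD : b ∈ D
    · exact .inl (ha.trans (Cn.step ha.right ⟨hb, hbD⟩ hab))
    · grind
  · simp_all

lemma Cn.exit_sphere (h : Cn R ω v x) (hv : v ∈ box c n) (hx : x ∉ box c n) :
    ∃ y ∈ sphere c n, Cn (R ∩ box c n) ω v y := by
  obtain ⟨y, z, h1, h2, h3⟩ := h.first_exit (box c n) hv hx
  exact ⟨y, mem_sphere_of_adjacent h1.right.2 h2.2 (openAdj_iff.1 h3).1, h1⟩

/-- A monotone path from a point of a sphere to its extreme corner. -/
def cornerPath (i : Fin d) (ρ : ℕ) (a : V d) (t : ℕ) : V d :=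
  fun l => if l = i then min (a i + max 0 ((t:ℤ) - 2 * ρ)) ρ else min (a l + t) ρ

lemma cornerPath_mem (hij : j ≠ i) (ha : a ∈ box 0 ρ) (hi : |a i| = ρ) (t) : cornerPath i ρ a t ∈ sphere 0 ρ := by
  have hb : ∀ l, -(ρ:ℤ) ≤ a l ∧ a l ≤ ρ := fun l => by have := abs_le.1 (ha l); simpa using this
  refine ⟨fun l => ?_, ?_⟩
  · have := hb l; have hbi := hb i; simp [cornerPath, abs_le]; split_ifs <;> omega
  · simp [sub_zero]; by_cases ht : (t:ℤ) ≤ 2 * ρ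
    · refine ⟨i, ?_⟩; have := hb i; rw [← hi]; congr 1; simp [cornerPath]; omega
    · refine ⟨j, ?_⟩; have := hb j; rw [(show cornerPath i ρ a t j = ρ by simp [cornerPath, if_neg hij]; omega)]; simp

lemma exists_spot_aux (hd : 2 ≤ d) {Fr P : V d → Prop} {T : V d → V d} (hT : ∀ u ∈ sphere (0 : V d) ρ, T u ∈ box u k ∧ Fr (T u))
    (ha : a ∈ sphere 0 ρ) (hFa : Fr a) (hPa : P a) (hc : ¬ P (T fun _ => (ρ:ℤ))) :
    ∃ u ∈ sphere 0 ρ, ∃ t ∈ box u (k + 1), ∃ t' ∈ box u (k + 1), (Fr t ∧ P t) ∧ Fr t' ∧ ¬ P t' := by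
  obtain ⟨hab, i, hi⟩ := ha
  simp [sub_zero] at hi
  obtain ⟨j, hij⟩ : ∃ j, j ≠ i := by
    have : Nontrivial (Fin d) := Fin.nontrivial_iff_two_le.2 hd; exact exists_ne i
  set γ := cornerPath i ρ a
  have hγ : ∀ t, γ t ∈ sphere 0 ρ := cornerPath_mem hij hab hi
  have hb : ∀ l, -(ρ:ℤ) ≤ a l ∧ a l ≤ ρ := fun l => by have := abs_le.1 (hab l); simpa using this
  have h0 : γ 0 = a := by
    funext l; have := hb l; have := hb i; simp [γ, cornerPath]; split_ifs with h
    · subst h; omega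
    · omega
  have hend : γ (4 * ρ) = fun _ => (ρ:ℤ) := by
    funext l; have := hb l; have := hb i; simp only [γ, cornerPath]; split_ifs <;> omega
  have hstep : ∀ t l, |γ (t + 1) l - γ t l| ≤ 1 := by
    intro t l; simp [γ, cornerPath, abs_le]; split_ifs <;> omega
  by_contra hno
  have hno : ∀ u ∈ sphere 0 ρ, ∀ t ∈ box u (k + 1), ∀ t' ∈ box u (k + 1), Fr t → P t → Fr t' → P t' := by
    intro u hu t ht t' ht' h1 h2 h3; by_contra h4; exact hno ⟨u, hu, t, ht, t', ht', ⟨h1, h2⟩, h3, h4⟩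
  have hall : ∀ t, P (T (γ t)) := by
    intro t; induction t with
    | zero =>
      refine hno (γ 0) (hγ 0) a ?_ _ (box_mono (by omega) (hT _ (hγ 0)).1) hFa hPa (hT _ (hγ 0)).2; rw [h0]; intro l; simp; positivity
    | succ t ih =>
      refine hno (γ t) (hγ t) _ (box_mono (by omega) (hT _ (hγ t)).1) _ ?_ (hT _ (hγ t)).2 ih (hT _ (hγ (t + 1))).2; intro l
      have h1 := (hT _ (hγ (t + 1))).1 l; have h2 := hstep t l; rw [abs_le] at *; push_cast; constructor <;> linarith [h1.1, h1.2, h2.1, h2.2]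
  exact hc (hend ▸ hall (4 * ρ))

lemma exists_spot (hd : 2 ≤ d) {Fr P : V d → Prop} (hT : ∀ u ∈ sphere (0 : V d) ρ, ∃ t ∈ box u k, Fr t)
    (ha : a ∈ sphere 0 ρ) (hb : b ∈ sphere 0 ρ) (hFa : Fr a) (hFb : Fr b) (hPa : P a) (hPb : ¬ P b) :
    ∃ u ∈ sphere 0 ρ, ∃ t ∈ box u (k + 1), ∃ t' ∈ box u (k + 1), (Fr t ∧ P t) ∧ Fr t' ∧ ¬ P t' := by
  choose! T hT using hT
  by_cases hc : P (T fun _ => (ρ:ℤ))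
  · obtain ⟨u, hu, t, ht, t', ht', h1, h2, h3⟩ := exists_spot_aux hd hT (P := fun x => ¬ P x) hb hFb hPb (not_not.2 hc)
    exact ⟨u, hu, t', ht', t, ht, ⟨h2, not_not.1 h3⟩, h1⟩
  · exact exists_spot_aux hd hT ha hFa hPa hc

lemma exists_path (u) (K) : ∀ (m : ℕ) (a b : V d), a ∈ box u K → b ∈ box u K → ∑ i, (a i - b i).natAbs = m →
    ∃ F : Finset (Edge d), (F : Set (Edge d)) ⊆ edgesIn (box u K) ∧ F.card ≤ m ∧ ∀ η, (∀ e ∈ F, η e = true) → Cn (box u K) η a b := by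
  intro m
  induction m with
  | zero =>
    intro a b ha hb h0
    have : a = b := funext fun i => by
      have := (Finset.sum_eq_zero_iff.1 h0) i (Finset.mem_univ i); omega
    subst this; exact ⟨∅, by simp, by simp, fun η _ => Cn.refl ha⟩
  | succ m ih =>
    intro a b ha hb hm
    obtain ⟨i, hi⟩ : ∃ i, a i ≠ b i := by
      by_contra hc; push Not at hc; simp [hc] at hm
    set r : Fin d × Bool := (i, decide (a i < b i)) with hr; set a' := a + st r with ha'
    have hai : a' i = a i + if a i < b i then 1 else -1 := by rw [ha', Pi.add_apply, show i = r.1 from rfl, st_same]; simp [hr]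
    have hal : ∀ l, l ≠ i → a' l = a l := fun l hl => by rw [ha', Pi.add_apply, st_ne hl, add_zero]
    have hbox : a' ∈ box u K := by
      intro l; by_cases hl : l = i
      · subst hl; have h1 := abs_le.1 (ha l); have h2 := abs_le.1 (hb l); rw [hai, abs_le]; split_ifs <;> omega
      · rw [hal l hl]; exact ha l
    have hsum : ∑ l, (a' l - b l).natAbs = m := by
      rw [← Finset.add_sum_erase _ _ (Finset.mem_univ i)] at hm ⊢
      have : ∑ l ∈ Finset.univ.erase i, (a' l - b l).natAbs = ∑ l ∈ Finset.univ.erase i, (a l - b l).natAbs :=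
        sum_congr rfl fun l hl => by rw [hal l (Finset.ne_of_mem_erase hl)]
      omega
    obtain ⟨F, hF1, hF2, hF3⟩ := ih a' b hbox hb hsum; have hadj : Adjacent a a' := adjacent_add_st a r
    refine ⟨insert (mkE hadj) F, ?_, (Finset.card_insert_le _ _).trans (by omega), fun η hη => ?_⟩
    · rw [Finset.coe_insert]; exact insert_subset ((mkE_mem_edgesIn hadj).2 ⟨ha, hbox⟩) hF1
    · exact (Cn.step ha hbox (openAdj_iff.2 ⟨hadj, hη _ (by simp)⟩)).trans (hF3 η fun e he => hη e (by simp [he]))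

lemma exists_path' (ha : a ∈ box u K) (hb : b ∈ box u K) :
    ∃ F : Finset (Edge d), (F : Set (Edge d)) ⊆ edgesIn (box u K) ∧ F.card ≤ d * (2 * K) ∧ ∀ η, (∀ e ∈ F, η e = true) → Cn (box u K) η a b := by
  obtain ⟨F, h1, h2, h3⟩ := exists_path u K _ a b ha hb rfl
  refine ⟨F, h1, h2.trans ?_, h3⟩
  refine (sum_le_card_nsmul _ _ (2 * K) fun i _ => ?_).trans (by simp)
  have h1 := abs_le.1 (ha i)
  have h2 := abs_le.1 (hb i)
  omega

lemma mu_not_all_open (hs : s ∈ 𝕀) (D) (F : ℕ → Finset E) (hF : ∀ i j, i ≠ j → Disjoint (F i) (F j)) (hD : ∀ i, (F i).card ≤ D) (M) :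
    mu s (⋂ i ∈ Finset.range M, (cyl (F i) fun _ => true)ᶜ) ≤ (1 - ofReal s ^ D) ^ M := by
  induction M with
  | zero => simp
  | succ M ih =>
    have hm : ∀ M, MeasurableSet (⋂ i ∈ Finset.range M, (cyl (F i) fun _ => true)ᶜ) := fun M =>
      Finset.measurableSet_biInter _ fun i _ => (meas_cyl _ _).compl
    have hdep : ∀ i, DepOn (cyl (F i) fun _ => true)ᶜ (F i : Set E) := fun i =>
      DepOn.compl fun ω ω' h hω e he => by rw [← h e he]; exact hω e he
    have hd1 : DepOn (⋂ i ∈ Finset.range M, (cyl (F i) fun _ => true)ᶜ) (⋃ i ∈ Finset.range M, (F i : Set E)) :=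
      DepOn.iInter fun i => DepOn.iInter fun hi => (hdep i).mono (subset_biUnion_of_mem (u := fun i => (F i : Set E)) hi)
    rw [Finset.range_add_one, Finset.set_biInter_insert, inter_comm, mu_inter_of_depOn s (hm M) (meas_cyl _ _).compl hd1 (hdep M), pow_succ]
    · refine mul_le_mul' ih ?_
      rw [prob_compl_eq_one_sub (meas_cyl _ _), mu_cyl, prod_const, wt_true hs]
      exact tsub_le_tsub_left (pow_le_pow_right_of_le_one' (ENNReal.ofReal_le_one.2 hs.2) (hD M)) _
    · aesop

lemma mu_uni_compl_le (hp : p ∈ 𝕀) (hs : s ∈ 𝕀) {F G : Set (E → Bool)} (hF : MeasurableSet F) (hG : MeasurableSet G)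
    (h : ∀ ξ ∈ G, mu s {ξ' | orc ξ ξ' ∉ F} ≤ c) : mu (uni p s) Fᶜ ≤ mu p Gᶜ + c := by
  rw [mu_uni hp hs hF.compl]
  refine (measure_mono (show {x : Pr E | orc x.1 x.2 ∈ Fᶜ} ⊆ {x | x.1 ∈ Gᶜ} ∪ {x | x.1 ∈ G ∧ orc x.1 x.2 ∈ Fᶜ} from fun x hx => by grind)).trans ((measure_union_le _ _).trans (add_le_add (prod_fst p s Gᶜ).le ?_))
  rw [Measure.prod_apply (show MeasurableSet {x | x.1 ∈ G ∧ orc x.1 x.2 ∈ Fᶜ} from (measurable_fst hG).inter (measurable_orc hF.compl))]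
  calc _ ≤ ∫⁻ _, c ∂(mu p) := by
        refine lintegral_mono fun ξ => ?_; by_cases hξ : ξ ∈ G
        · simp_all
        · simp_all
    _ = c := by simp

end

noncomputable section

variable {d : ℕ}
variable {S R D : Set (V d)} {x y z v w : V d} {p q s : ℝ} {ω ω' η ξ : Config d}

/-! ### Gluing of far-reaching clusters by sprinkling -/

/-- The vertices of the box of radius `r` that reach the sphere of radius `n`. -/
def far (n r : ℕ) (ω : Config d) : Set (V d) := {x | x ∈ box 0 r ∧ ω ∈ cnS (box 0 n) x (sphere 0 n)}

/-- All boxes of radius `k` reach the sphere of radius `n`. -/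
def Dense (n k : ℕ) (ω : Config d) : Prop := ∀ u ∈ box (0 : V d) n, box u k ⊆ box 0 n → ∃ t ∈ box u k, ω ∈ cnS (box 0 n) t (sphere 0 n)

/-- Every far vertex is joined to all others or has a cluster of size `N`. -/
def Merged (n r N : ℕ) (ω η : Config d) : Prop :=
  ∀ v ∈ far n r ω, (∀ w ∈ far n r ω, Cn (box 0 n) η v w) ∨ N ≤ (cl (box 0 n) η v).ncard

lemma far_mono (h : r ≤ r') : far n r ω ⊆ far n r' ω := fun _ hx => ⟨box_mono h hx.1, hx.2⟩

lemma exists_far_sphere (hr : r ≤ ρ) (hρ : ρ < n) (hv : v ∈ far n r ω) :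
    ∃ a ∈ sphere 0 ρ, a ∈ far n ρ ω ∧ Cn (box 0 n) ω v a := by
  obtain ⟨hvr, x, hx, hc⟩ := hv
  have hxρ : x ∉ box 0 ρ := by
    obtain ⟨i, hi⟩ := hx.2; intro hxb; have := hxb i; omega
  obtain ⟨a, ha, hva⟩ := hc.exit_sphere (box_mono hr hvr) hxρ
  have hva := hva.mono_set inter_subset_left
  exact ⟨a, ha, ⟨ha.1, x, hx, hva.symm.trans hc⟩, hva⟩

/-- The points at sup-distance about `ρ` from the origin. -/
def shell (ρ K : ℕ) : Set (V d) := {x | x ∈ box 0 (ρ + K) ∧ ∃ i, (ρ:ℤ) - K ≤ |x i|}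

lemma box_subset_shell (hu : u ∈ sphere 0 ρ) : box u K ⊆ shell ρ K := by
  intro x hx
  refine ⟨fun i => ?_, ?_⟩
  · have h1 := hx i; have h2 := hu.1 i; grind
  · obtain ⟨i, hi⟩ := hu.2; refine ⟨i, ?_⟩; simp [sub_zero] at hi; have h1 := abs_sub_abs_le_abs_sub (u i) (x i); rw [abs_sub_comm] at h1
    have := hx i; linarith

lemma disjoint_shell (h : ρ + 2 * K < ρ') : Disjoint (shell ρ K : Set (V d)) (shell ρ' K) := by
  rw [disjoint_left]
  rintro x ⟨h1, -⟩ ⟨-, i, hi⟩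
  have := h1 i
  simp [sub_zero] at this
  omega

lemma exists_bridge (hd : 2 ≤ d) (hω : Dense n k ω) (hωη : ∀ e, ω e = true → η e = true) (hr : r ≤ ρ) (hρ : ρ + k < n)
    (hv : v ∈ far n r ω) (hw : w ∈ far n r ω) (hvw : ¬ Cn (box 0 n) η v w) :
    ∃ F : Finset (Edge d), (F : Set (Edge d)) ⊆ edgesIn (shell ρ (k + 1)) ∧ F.card ≤ d * (2 * (k + 1)) ∧
      ∃ t t', Cn (box 0 n) η v t ∧ t' ∈ far n (ρ + k + 1) ω ∧ ¬ Cn (box 0 n) η v t' ∧ ∀ η', (∀ e ∈ F, η' e = true) → Cn (box 0 n) η' t t' := by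
  obtain ⟨a, ha, haf, hva⟩ := exists_far_sphere hr (by omega) hv
  obtain ⟨b, hb, hbf, hwb⟩ := exists_far_sphere hr (by omega) hw
  have hbn : ∀ u ∈ sphere (0 : V d) ρ, box u (k + 1) ⊆ box 0 n := fun u hu x hx => box_mono (by omega) (box_subset_shell hu hx).1
  obtain ⟨u, hu, t, ht, t', ht', ⟨-, hPt⟩, hFt', hPt'⟩ := exists_spot hd
    (fun u hu => hω u (box_mono (by omega) hu.1) ((box_mono (by omega)).trans (hbn u hu)))
    ha hb haf.2 hbf.2 (hva.mono Subset.rfl hωη) fun hc => hvw (hc.trans (hwb.mono Subset.rfl hωη).symm)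
  obtain ⟨F, hF1, hF2, hF3⟩ := exists_path' ht ht'
  exact ⟨F, fun e he x hx => box_subset_shell hu (hF1 he x hx), hF2, t, t', hPt, ⟨(box_subset_shell hu ht').1, hFt'⟩, hPt', fun η' hη' => (hF3 η' hη').mono_set (hbn u hu)⟩

lemma depOn_merged (n r N) (ω : Config d) : DepOn {ξ | Merged n r N ω (orc ω ξ)} (edgesIn (box 0 n)) := by
  intro ξ ξ' h hm
  have hcl : ∀ v w, Cn (box 0 n) (orc ω ξ) v w ↔ Cn (box 0 n) (orc ω ξ') v w := fun v w =>
    (depOn_cn _ v w).iff fun e he => by simp [orc, h e he]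
  have e : ∀ v, cl (box 0 n) (orc ω ξ) v = cl (box 0 n) (orc ω ξ') v := fun v => by ext w; exact hcl v w
  intro v hv
  rw [← e]
  exact (hm v hv).imp_left fun h w hw => (hcl v w).1 (h w hw)

lemma mu_not_merged_le (hd : 2 ≤ d) (hs : s ∈ 𝕀) (hω : Dense n k ω) (hn : r + M * (2 * k + 4) ≤ n)
    (hm : Merged n (r + M * (2 * k + 4)) N ω (orc ω ξ)) :
    mu s {ξ' | ¬ Merged n r (2 * N) ω (orc ω (orc ξ ξ'))} ≤ (finite_box (0 : V d) n).toFinset.card * (1 - ofReal s ^ (d * (2 * (k + 1)))) ^ M := by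
  set η := orc ω ξ with hη
  have hηη : ∀ ξ' e, η e = true → orc ω (orc ξ ξ') e = true := fun ξ' e he => by
    simp [hη, orc, Bool.or_eq_true] at he ⊢; tauto
  have hfin : ∀ η v, (cl (box (0 : V d) n) η v).Finite := fun η v => (finite_box _ _).subset fun y hy => Cn.right hy
  set bad : V d → Prop := fun v => v ∈ far n r ω ∧ ∃ w ∈ far n r ω, ¬ Cn (box 0 n) η v w
  have hex : ∀ v, ∃ F : ℕ → Finset (Edge d), (∀ i j, i ≠ j → Disjoint (F i) (F j)) ∧ (∀ i, (F i).card ≤ d * (2 * (k + 1))) ∧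
      (bad v → ∀ ξ', ξ' ∉ (⋂ i ∈ Finset.range M, (cyl (F i) fun _ => true)ᶜ) → 2 * N ≤ (cl (box 0 n) (orc ω (orc ξ ξ')) v).ncard) := by
    intro v
    by_cases hb : bad v
    swap
    · exact ⟨fun _ => ∅, fun _ _ _ => by simp, by simp, fun h => absurd h hb⟩
    obtain ⟨hv, w, hw, hvw⟩ := hb
    set ρ : ℕ → ℕ := fun i => r + i * (2 * k + 4) + (k + 2) with hρ
    have hb1 : ∀ i, i < M → r + i * (2 * k + 4) + (2 * k + 4) ≤ r + M * (2 * k + 4) := fun i hi => by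
      have := Nat.mul_le_mul_right (2 * k + 4) (Nat.succ_le_of_lt hi)
      rw [succ_mul] at this; omega
    have hbr : ∀ i, i < M → _ := fun i hi => exists_bridge hd (ρ := ρ i) hω (le_orc _ _) (by simp [hρ]; omega) (by have := hb1 i hi; simp [hρ]; omega) hv hw hvw
    choose! F hF1 hF2 t t' ht ht'f ht' hF3 using hbr
    refine ⟨fun i => if i < M then F i else ∅, fun i j hij => ?_, fun i => ?_, fun _ ξ' hξ' => ?_⟩
    · dsimp only
      split_ifs with hi hj <;> try simp
      rw [Finset.disjoint_left]
      intro e he he'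
      obtain ⟨x, hx⟩ : ∃ x, x ∈ e.val := by
        obtain ⟨_, a, b, hab, rfl⟩ := e
        exact ⟨a, by simp⟩
      have h1 := hF1 i hi he x hx
      have h2 := hF1 j hj he' x hx
      rcases lt_or_gt_of_ne hij with h | h
      · refine disjoint_left.1 (disjoint_shell ?_) h1 h2
        have := Nat.mul_le_mul_right (2 * k + 4) (Nat.succ_le_of_lt h)
        rw [succ_mul] at this; simp [hρ]; omega
      · refine disjoint_left.1 (disjoint_shell ?_) h2 h1
        have := Nat.mul_le_mul_right (2 * k + 4) (Nat.succ_le_of_lt h)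
        rw [succ_mul] at this; simp [hρ]; omega
    · dsimp only
      split_ifs with hi
      exacts [hF2 i hi, by simp]
    · simp only [mem_iInter, not_forall, mem_compl_iff, not_not] at hξ'
      obtain ⟨i, hi, hop⟩ := hξ'
      have hi := Finset.mem_range.1 hi
      rw [if_pos hi] at hop
      have hvR := far_mono (Nat.le_add_right r (M * (2 * k + 4))) hv
      have htR := far_mono (show ρ i + k + 1 ≤ r + M * (2 * k + 4) by have := hb1 i hi; simp [hρ]; omega) (ht'f i hi)
      have n1 : N ≤ (cl (box 0 n) η v).ncard := (hm v hvR).resolve_left fun h => hvw (h w (far_mono (Nat.le_add_right r (M * (2 * k + 4))) hw))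
      have n2 : N ≤ (cl (box 0 n) η (t' i)).ncard := (hm _ htR).resolve_left fun h => ht' i hi (h v hvR).symm
      have hdis : Disjoint (cl (box 0 n) η v) (cl (box 0 n) η (t' i)) := by
        rw [disjoint_left]
        intro y h1 h2
        exact ht' i hi (Cn.trans h1 (Cn.symm h2))
      have hvt : Cn (box 0 n) (orc ω (orc ξ ξ')) v (t' i) :=
        ((ht i hi).mono Subset.rfl (hηη ξ')).trans (hF3 i hi _ fun e he => (fun ξ' e he => by simp [orc, he]) ξ' e (hop e he))
      calc 2 * N ≤ (cl (box 0 n) η v ∪ cl (box 0 n) η (t' i)).ncard := by rw [ncard_union_eq hdis (hfin _ _) (hfin _ _)]; omega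
        _ ≤ _ := by
          exact ncard_le_ncard (union_subset (fun y hy => Cn.mono Subset.rfl (hηη ξ') hy) fun y hy => (hvt.trans (Cn.mono Subset.rfl (hηη ξ') hy))) (hfin _ _)
  choose F hF1 hF2 hF3 using hex
  have hsub : {ξ' | ¬ Merged n r (2 * N) ω (orc ω (orc ξ ξ'))} ⊆ ⋃ v ∈ (finite_box 0 n).toFinset, ⋂ i ∈ Finset.range M, (cyl (F v i) fun _ => true)ᶜ := by
    intro ξ' hξ'
    unfold Merged at hξ'
    push Not at hξ'
    obtain ⟨v, hv, ⟨w, hw, hvw⟩, hN⟩ := hξ'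
    refine mem_iUnion₂.2 ⟨v, (Finite.mem_toFinset _).2 (box_mono (by omega) hv.1), ?_⟩
    by_contra hc
    exact absurd (hF3 v ⟨hv, w, hw, fun h => hvw (h.mono Subset.rfl (hηη ξ'))⟩ ξ' hc) (by omega)
  refine (measure_mono hsub).trans ((measure_biUnion_finset_le _ _).trans ?_)
  rw [← nsmul_eq_mul]
  exact sum_le_card_nsmul _ _ _ fun v _ => mu_not_all_open hs _ _ (hF1 v) (hF2 v) M

/-- All far vertices of the inner box are joined. -/
def Glued (n r : ℕ) (ω η : Config d) : Prop := ∀ v ∈ far n r ω, ∀ w ∈ far n r ω, Cn (box 0 n) η v w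

lemma mu_not_glued_le (hd : 2 ≤ d) {n r k M J : ℕ} (hs : s ∈ 𝕀) (hJ : J * s ≤ q) (hq : q ≤ 1) (hω : Dense n k ω) (hn : r + J * (M * (2 * k + 4)) ≤ n)
    (hJn : (finite_box (0 : V d) n).toFinset.card < 2 ^ J) :
    mu q {ξ | ¬ Glued n r ω (orc ω ξ)} ≤ J * ((finite_box (0 : V d) n).toFinset.card * (1 - ofReal s ^ (d * (2 * (k + 1)))) ^ M) := by
  set c : ENNReal := (finite_box 0 n).toFinset.card * (1 - ofReal s ^ (d * (2 * (k + 1)))) ^ M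
  have hmeas : ∀ r N, MeasurableSet {ξ | Merged n r N ω (orc ω ξ)} := fun r N =>
    meas_of_depOn (finite_edgesIn (finite_box _ _)) (depOn_merged n r N ω)
  have iter : ∀ j, j ≤ J → ∃ σ ∈ 𝕀, σ ≤ j * s ∧ mu σ {ξ | Merged n (r + (J - j) * (M * (2 * k + 4))) (2 ^ j) ω (orc ω ξ)}ᶜ ≤ j * c := by
    intro j; induction j with
    | zero =>
      intro _; refine ⟨0, by simp, by simp, ?_⟩
      have : {ξ | Merged n (r + (J - 0) * (M * (2 * k + 4))) (2 ^ 0) ω (orc ω ξ)}ᶜ = ∅ := by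
        refine eq_empty_of_forall_notMem fun ξ h => h fun v hv => .inr ?_; obtain ⟨_, x, _, hc⟩ := hv
        exact (ncard_pos ((fun η v => (finite_box _ _).subset fun y hy => Cn.right hy) _ _)).2 ⟨v, Cn.refl hc.left⟩
      rw [this]; simp
    | succ j ih =>
      intro hj; obtain ⟨σ, hσ, hσj, hμ⟩ := ih (by omega); refine ⟨uni σ s, uni_mem hσ hs, ?_, ?_⟩
      · unfold uni; push_cast; nlinarith [mul_nonneg hσ.1 hs.1]
      have hrad : r + (J - j) * (M * (2 * k + 4)) = r + (J - (j + 1)) * (M * (2 * k + 4)) + M * (2 * k + 4) := by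
        rw [show J - j = J - (j + 1) + 1 by omega, succ_mul]; ring
      have hle : r + (J - j) * (M * (2 * k + 4)) ≤ n := (Nat.add_le_add_left (Nat.mul_le_mul_right _ (Nat.sub_le J j)) r).trans hn
      rw [hrad] at hμ hle
      refine (mu_uni_compl_le hσ hs (hmeas _ _) (hmeas _ _) fun ξ hξ => ?_).trans ((add_le_add hμ le_rfl).trans (by push_cast; rw [add_mul, one_mul]))
      rw [pow_succ, mul_comm (2 ^ j) 2]; exact mu_not_merged_le hd hs hω hle hξ
  obtain ⟨σ, hσ, hσJ, hμ⟩ := iter J le_rfl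
  rw [Nat.sub_self, zero_mul, add_zero] at hμ
  have hgm : MeasurableSet {ξ | Glued n r ω (orc ω ξ)} := by
    exact meas_of_depOn (finite_edgesIn (finite_box 0 n)) fun ξ ξ' h hg v hv w hw => depOn_cn _ v w _ _ (fun e he => by simp [orc, h e he]) (hg v hv w hw)
  calc mu q {ξ | Glued n r ω (orc ω ξ)}ᶜ ≤ mu σ {ξ | Glued n r ω (orc ω ξ)}ᶜ := by
        rw [prob_compl_eq_one_sub hgm, prob_compl_eq_one_sub hgm]; refine tsub_le_tsub_left (mu_mono hσ.1 (hσJ.trans hJ) hq hgm ?_) _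
        exact fun ξ ξ' hξ hg v hv w hw => (hg v hv w hw).mono Subset.rfl fun e he => by
          simp [orc, Bool.or_eq_true] at he ⊢; exact he.imp_right (hξ e)
    _ ≤ _ := (measure_mono (compl_subset_compl.2 fun ξ hξ v hv w hw => ?_)).trans hμ
  refine ((hξ v hv).resolve_right fun h => ?_) w hw
  have h1 : (cl (box 0 n) (orc ω ξ) v).ncard ≤ (finite_box (0 : V d) n).toFinset.card := by
    rw [← ncard_eq_toFinset_card _ (finite_box 0 n)]; exact ncard_le_ncard (fun y hy => Cn.right hy) (finite_box _ _)
  omega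

end

noncomputable section

/-! ### Renormalization of planar dependent percolation -/

/-- The digits of a block: pairs of integers in `[0, 7)`. -/
def dig : Finset (ℤ × ℤ) := Finset.Ico 0 7 ×ˢ Finset.Ico 0 7

lemma mem_dig : i ∈ dig ↔ (0 ≤ i.1 ∧ i.1 < 7) ∧ 0 ≤ i.2 ∧ i.2 < 7 := by simp [dig]

/-- The points of the plane at sup-distance at least three. -/
def Apart (i j : ℤ × ℤ) : Prop := 3 ≤ |i.1 - j.1| ∨ 3 ≤ |i.2 - j.2|

/-- A block of the next scale is good when its bad sub-blocks are close together. -/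
def up (g : ℤ × ℤ → Prop) (Z : ℤ × ℤ) : Prop := ∀ i ∈ dig, ∀ j ∈ dig, Apart i j → g (7 • Z + i) ∨ g (7 • Z + j)

section Scale
variable {g : ℤ × ℤ → Prop} {r : ℤ × ℤ → ℤ × ℤ → Prop}

lemma rel_line (hr : Equivalence r) {f : ℤ → ℤ × ℤ} (hf : ∀ j, a ≤ j → j < b → g (f j)) (hs : ∀ j, g (f j) → g (f (j + 1)) → r (f j) (f (j + 1)))
    (hi : a ≤ i) (hi' : i < b) (hj : a ≤ j) (hj' : j < b) : r (f i) (f j) := by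
  have h : ∀ n : ℕ, a + n < b → r (f a) (f (a + n)) := by
    intro n; induction n with
    | zero => intro _; simpa using hr.refl _
    | succ n ih =>
      intro hn; push_cast at hn ⊢; rw [← add_assoc]; exact hr.trans (ih (by omega)) (hs _ (hf _ (by omega) (by omega)) (hf _ (by omega) (by omega)))
  have h' : ∀ i, a ≤ i → i < b → r (f a) (f i) := fun i h1 h2 => by
    have := h (i - a).toNat (by omega); simp_all
  exact hr.trans (hr.symm (h' i hi hi')) (h' j hj hj')

lemma exists_common {P Q : ℤ → Prop} (hP : ∀ b c : ℤ, 0 ≤ b → b < 7 → 0 ≤ c → c < 7 → 3 ≤ |b - c| → P b ∨ P c)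
    (hQ : ∀ b c : ℤ, 0 ≤ b → b < 7 → 0 ≤ c → c < 7 → 3 ≤ |b - c| → Q b ∨ Q c) : ∃ b, (0 ≤ b ∧ b < 7) ∧ P b ∧ Q b := by
  have p1 := hP 0 3 (by simp) (by simp) (by simp) (by simp) (by simp)
  have p2 := hP 0 6 (by simp) (by simp) (by simp) (by simp) (by simp)
  have p3 := hP 3 6 (by simp) (by simp) (by simp) (by simp) (by simp)
  have q1 := hQ 0 3 (by simp) (by simp) (by simp) (by simp) (by simp)
  have q2 := hQ 0 6 (by simp) (by simp) (by simp) (by simp) (by simp)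
  have q3 := hQ 3 6 (by simp) (by simp) (by simp) (by simp) (by simp)
  have h : (P 0 ∧ Q 0) ∨ (P 3 ∧ Q 3) ∨ P 6 ∧ Q 6 := by tauto
  rcases h with h | h | h
  exacts [⟨0, by simp, h⟩, ⟨3, by simp, h⟩, ⟨6, by simp, h⟩]

/-- The row `b` of the block `Z` is clean; `c` is the identity or the coordinate swap. -/
def Clean (g : ℤ × ℤ → Prop) (c : ℤ × ℤ → ℤ × ℤ) (Z : ℤ × ℤ) (b : ℤ) : Prop := ∀ a, 0 ≤ a → a < 7 → g (7 • Z + c (a, b))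

lemma up_clean (h : up g Z) (hc : c = id ∨ c = Prod.swap) (b b') (h1 : 0 ≤ b) (h2 : b < 7) (h3 : 0 ≤ b') (h4 : b' < 7)
    (hbb : 3 ≤ |b - b'|) : Clean g c Z b ∨ Clean g c Z b' := by
  by_contra hno
  simp [Clean, not_forall] at hno
  obtain ⟨⟨a, a1, a2, ha⟩, a', a1', a2', ha'⟩ := hno
  refine (h (c (a, b)) ?_ (c (a', b')) ?_ ?_).elim ha ha' <;> rcases hc with rfl | rfl <;> simp [mem_dig, Apart, *]

/-- The sub-blocks on a clean row and a clean column. -/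
def core (g : ℤ × ℤ → Prop) (Z i : ℤ × ℤ) : Prop := i ∈ dig ∧ Clean g id Z i.2 ∧ Clean g Prod.swap Z i.1

lemma exists_core (h : up g Z) : ∃ i, core g Z i := by
  obtain ⟨b, hb, h1, -⟩ := exists_common (up_clean h (.inl rfl)) (up_clean h (.inl rfl))
  obtain ⟨a, ha, h2, -⟩ := exists_common (up_clean h (.inr rfl)) (up_clean h (.inr rfl))
  exact ⟨(a, b), mem_dig.2 ⟨ha, hb⟩, h1, h2⟩

lemma rel_core (hr : Equivalence r) (hs : ∀ Y, ∀ e ∈ ({(1, 0), (0, 1)} : Set (ℤ × ℤ)), g Y → g (Y + e) → r Y (Y + e))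
    (hc : c = id ∨ c = Prod.swap) (hZ : up g Z) (hZ' : up g (Z + c (1, 0))) (hi : core g Z (c i)) (hi' : core g (Z + c (1, 0)) (c i')) :
    r (7 • Z + c i) (7 • (Z + c (1, 0)) + c i') := by
  have hadd : ∀ x y, c (x + y) = c x + c y := by aesop
  obtain ⟨b, ⟨hb0, hb7⟩, hb, hb'⟩ := exists_common (up_clean hZ hc) (up_clean hZ' hc)
  have hdig : ∀ {i}, c i ∈ dig → (0 ≤ i.1 ∧ i.1 < 7) ∧ 0 ≤ i.2 ∧ i.2 < 7 := fun {i} h => by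
    rcases hc with rfl | rfl <;> simpa [mem_dig, and_comm] using h
  have hcol : ∀ {Z i}, core g Z (c i) → ∀ j, 0 ≤ j → j < 7 → g (7 • Z + c (i.1, j)) := fun {Z i} h j h1 h2 => by
    rcases hc with rfl | rfl
    · exact h.2.2 j h1 h2
    · exact h.2.1 j h1 h2
  have e2 : c (0, 1) ∈ ({(1, 0), (0, 1)} : Set (ℤ × ℤ)) := by rcases hc with rfl | rfl <;> simp
  have s1 : ∀ W (b j : ℤ), W + c (j + 1, b) = W + c (j, b) + c (1, 0) := fun W b j => by rw [add_assoc, ← hadd]; simp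
  have s2 : ∀ W (a j : ℤ), W + c (a, j + 1) = W + c (a, j) + c (0, 1) := fun W a j => by rw [add_assoc, ← hadd]; simp
  have column : ∀ {Z i}, core g Z (c i) → r (7 • Z + c i) (7 • Z + c (i.1, b)) := fun {Z i} h =>
    rel_line hr (hcol h) (fun j h1 h2 => by rw [s2] at h2 ⊢; exact hs _ _ e2 h1 h2)
      (hdig h.1).2.1 (hdig h.1).2.2 hb0 hb7
  have hshift : ∀ a, 7 • (Z + c (1, 0)) + c (a, b) = 7 • Z + c (a + 7, b) := fun a => by
    have : c (a + 7, b) = 7 • c (1, 0) + c (a, b) := by rcases hc with rfl | rfl <;> simp [add_comm]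
    rw [this, smul_add, add_assoc]
  have row : r (7 • Z + c (i.1, b)) (7 • Z + c (i'.1 + 7, b)) := by
    refine rel_line hr (f := fun j => 7 • Z + c (j, b)) (b := 14) (fun j h1 h2 => ?_)
      (fun j h1 h2 => by rw [s1] at h2 ⊢; exact hs _ _ (by rcases hc with rfl | rfl <;> simp) h1 h2) (hdig hi.1).1.1 (by have := (hdig hi.1).1.2; omega)
      (by have := (hdig hi'.1).1.1; omega) (by have := (hdig hi'.1).1.2; omega)
    by_cases hj : j < 7
    · exact hb j h1 hj
    · have := hb' (j - 7) (by omega) (by omega); rwa [hshift, sub_add_cancel] at this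
  refine hr.trans (column hi) (hr.trans row (hr.symm ?_))
  rw [← hshift]; exact column hi'

end Scale

/-- Iterated goodness. -/
def lvl (g : ℤ × ℤ → Prop) : ℕ → ℤ × ℤ → Prop
  | 0 => g
  | k + 1 => up (lvl g k)

/-- The points of the block `Z` at scale `k`. -/
def blk (k : ℕ) (Z : ℤ × ℤ) : Set (ℤ × ℤ) := {Y | (7 ^ k * Z.1 ≤ Y.1 ∧ Y.1 < 7 ^ k * (Z.1 + 1)) ∧ 7 ^ k * Z.2 ≤ Y.2 ∧ Y.2 < 7 ^ k * (Z.2 + 1)}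

lemma blk_sub (hi : i ∈ dig) : blk k (7 • Z + i) ⊆ blk (k + 1) Z := by
  rintro Y ⟨⟨h1, h2⟩, h3, h4⟩
  obtain ⟨⟨i1, i2⟩, i3, i4⟩ := mem_dig.1 hi
  simp at h1 h2 h3 h4
  refine ⟨⟨?_, ?_⟩, ?_, ?_⟩ <;> rw [pow_succ] <;> nlinarith

lemma blk_apart (h : Apart Z Z') (hY : Y ∈ blk k Z) (hY' : Y' ∈ blk k Z') : Apart Y Y' := by
  obtain ⟨⟨h1, h2⟩, h3, h4⟩ := hY
  obtain ⟨⟨h1', h2'⟩, h3', h4'⟩ := hY'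
  refine h.imp (fun h => ?_) fun h => ?_ <;> rw [le_abs] at h ⊢ <;> refine h.imp (fun h => ?_) fun h => ?_ <;> nlinarith

lemma exists_reps (hr : Equivalence r)
    (hs : ∀ Y, ∀ e ∈ ({(1, 0), (0, 1)} : Set (ℤ × ℤ)), g Y → g (Y + e) → r Y (Y + e)) :
    ∃ ρ : ℕ → ℤ × ℤ → ℤ × ℤ, (∀ k Z, lvl g k Z → ρ k Z ∈ blk k Z ∧ g (ρ k Z)) ∧
      (∀ k Y, ∀ e ∈ ({(1, 0), (0, 1)} : Set (ℤ × ℤ)), lvl g k Y → lvl g k (Y + e) → r (ρ k Y) (ρ k (Y + e))) ∧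
      ∀ k Z, lvl g (k + 1) Z → ∃ i ∈ dig, lvl g k (7 • Z + i) ∧ ρ (k + 1) Z = ρ k (7 • Z + i) := by
  choose! σ hσ using (show ∀ k Z, lvl g (k + 1) Z → ∃ i, core (lvl g k) Z i from fun k Z h => exists_core h)
  set ρ : ℕ → ℤ × ℤ → ℤ × ℤ := fun k => Nat.rec id (fun k ρ Z => ρ (7 • Z + σ k Z)) k with hρ
  have hg : ∀ {k Z i}, core (lvl g k) Z i → lvl g k (7 • Z + i) := fun {k Z i} h => by
    have := mem_dig.1 h.1; exact h.2.1 i.1 this.1.1 this.1.2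
  refine ⟨ρ, fun k => ?_, fun k => ?_, fun k Z h => ⟨σ k Z, (hσ k Z h).1, hg (hσ k Z h), rfl⟩⟩
  · induction k with
    | zero => intro Z h; exact ⟨by simp [hρ, blk], h⟩
    | succ k ih => intro Z h; exact ⟨blk_sub (hσ k Z h).1 (ih _ (hg (hσ k Z h))).1, (ih _ (hg (hσ k Z h))).2⟩
  · induction k with
    | zero => exact hs
    | succ k ih =>
      intro Z e he hZ hZ'; have hr' : Equivalence fun Y Y' => r (ρ k Y) (ρ k Y') := ⟨fun _ => hr.refl _, hr.symm, hr.trans⟩; rcases he with rfl | rfl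
      exacts [rel_core hr' ih (.inl rfl) hZ hZ' (hσ k _ hZ) (hσ k _ hZ'), rel_core hr' ih (.inr rfl) (i := (σ k Z).swap) (i' := (σ k (Z + (0, 1))).swap) hZ hZ' (by simpa using hσ k _ hZ) (by simpa using hσ k _ hZ')]

lemma exists_class (hr : Equivalence r)
    (hs : ∀ Y, ∀ e ∈ ({(1, 0), (0, 1)} : Set (ℤ × ℤ)), g Y → g (Y + e) → r Y (Y + e)) (hk : ∀ k, k₀ ≤ k → ∀ i ∈ dig, lvl g k i) :
    ∃ Y₀, g Y₀ ∧ ∀ N : ℕ, ∃ Y, g Y ∧ r Y₀ Y ∧ (N:ℤ) ≤ Y.1 := by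
  obtain ⟨ρ, h1, h2, h3⟩ := exists_reps hr hs
  have h0 : 0 ∈ dig := by tauto
  have hall : ∀ k, k₀ ≤ k → ∀ i ∈ dig, r (ρ k 0) (ρ k i) := by
    intro k hk' i hi; obtain ⟨⟨i1, i2⟩, i3, i4⟩ := mem_dig.1 hi
    have hr' : Equivalence fun Y Y' => r (ρ k Y) (ρ k Y') := ⟨fun _ => hr.refl _, hr.symm, hr.trans⟩
    have a1 : r (ρ k (0, 0)) (ρ k (i.1, 0)) := rel_line hr' (f := fun j => (j, 0)) (fun j b1 b2 => hk k hk' _ (by simp [mem_dig, b1, b2]))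
      (fun j b1 b2 => by simpa using h2 k (j, 0) (1, 0) (by simp) b1 (by simpa using b2)) le_rfl (by norm_num) i1 i2
    have a2 : r (ρ k (i.1, 0)) (ρ k (i.1, i.2)) := rel_line hr' (fun j b1 b2 => hk k hk' _ (by simp [mem_dig, b1, b2, i1, i2]))
      (fun j b1 b2 => by simpa using h2 k (i.1, j) (0, 1) (by simp) b1 (by simpa using b2)) le_rfl (by norm_num) i3 i4
    exact hr.trans a1 a2
  have hchain : ∀ n, r (ρ k₀ 0) (ρ (k₀ + n) 0) := by
    intro n; induction n with
    | zero => exact hr.refl _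
    | succ n ih =>
      obtain ⟨i, hi, -, he⟩ := h3 (k₀ + n) 0 (hk (k₀ + n + 1) (by omega) 0 h0); rw [← add_assoc, he, smul_zero, zero_add]
      exact hr.trans ih (hall _ (by omega) i hi)
  refine ⟨ρ k₀ 0, (h1 _ _ (hk k₀ le_rfl 0 h0)).2, fun N => ⟨ρ (k₀ + N) (1, 0), ?_⟩⟩
  have h10 : ((1, 0) : ℤ × ℤ) ∈ dig := by simp [mem_dig]
  obtain ⟨a1, a2⟩ := h1 _ _ (hk (k₀ + N) (by omega) _ h10)
  refine ⟨a2, hr.trans (hchain N) (hall _ (by omega) _ h10), le_trans ?_ a1.1.1⟩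
  rw [mul_one]; exact_mod_cast (lt_of_lt_of_le (Nat.lt_pow_self (by norm_num)) (pow_le_pow_right (by norm_num) (by omega))).le

open Classical in
lemma ae_eventually_lvl {bad : ℤ × ℤ → Set (Pr E)} {A : ℤ × ℤ → Set E} (hm : ∀ Y, MeasurableSet (bad Y))
    (hd : ∀ Y, DepOn₂ (bad Y) (A Y) (A Y)) (hA : ∀ Y Y', Apart Y Y' → Disjoint (A Y) (A Y')) (hp : ∀ Y, ((mu p).prod (mu s)) (bad Y) ≤ 2⁻¹ ^ 13) :
    ∀ᵐ q ∂((mu p).prod (mu s) : Measure (Pr E)), ∃ k₀, ∀ k, k₀ ≤ k → ∀ i ∈ dig, lvl (fun Y => q ∉ bad Y) k i := by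
  set μ := ((mu p).prod (mu s) : Measure (Pr E))
  set B : ℕ → ℤ × ℤ → Set (Pr E) := fun k Z => {q | ¬ lvl (fun Y => q ∉ bad Y) k Z} with hB
  set T := (dig ×ˢ dig).filter fun x => Apart x.1 x.2 with hT
  have hsucc : ∀ k Z, B (k + 1) Z = ⋃ x ∈ T, B k (7 • Z + x.1) ∩ B k (7 • Z + x.2) := by
    intro k Z; ext q; simp only [hB, lvl, up, not_forall, not_or, mem_iUnion, hT, mem_filter, mem_product, mem_inter_iff]; constructor
    · rintro ⟨i, hi, j, hj, h1, h2, h3⟩; exact ⟨(i, j), ⟨⟨hi, hj⟩, h1⟩, h2, h3⟩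
    · rintro ⟨x, ⟨⟨hi, hj⟩, h1⟩, h2, h3⟩; exact ⟨_, hi, _, hj, h1, h2, h3⟩
  have hT4 : (T.card : ENNReal) ≤ 2 ^ 12 := by
    have : T.card ≤ 2 ^ 12 := (Finset.card_filter_le _ _).trans (by simp [dig]); exact_mod_cast this
  have h0 : ∀ Z, B 0 Z = bad Z := fun Z => by ext q; simp [hB, lvl]
  have key : ∀ k, (∀ Z, MeasurableSet (B k Z)) ∧ (∀ Z, DepOn₂ (B k Z) (⋃ Y ∈ blk k Z, A Y) (⋃ Y ∈ blk k Z, A Y)) ∧ ∀ Z, μ (B k Z) ≤ 2⁻¹ ^ (13 + k) := by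
    intro k; induction k with
    | zero =>
      refine ⟨fun Z => by rw [h0]; exact hm Z, fun Z => ?_, fun Z => by rw [h0]; exact hp Z⟩; rw [h0]
      have : A Z ⊆ ⋃ Y ∈ blk 0 Z, A Y := subset_biUnion_of_mem (by simp [blk]); exact (hd Z).mono this this
    | succ k ih =>
      obtain ⟨i1, i2, i3⟩ := ih; refine ⟨fun Z => ?_, fun Z => ?_, fun Z => ?_⟩ <;> rw [hsucc]
      · exact measurableSet_biUnion _ fun x _ => (i1 _).inter (i1 _)
      · intro q q' a1 a2 hq; obtain ⟨x, hx, b1, b2⟩ := mem_iUnion₂.1 hq; have hx' := Finset.mem_product.1 (Finset.mem_filter.1 hx).1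
        have hsub : ∀ i ∈ dig, (⋃ Y ∈ blk k (7 • Z + i), A Y) ⊆ ⋃ Y ∈ blk (k + 1) Z, A Y := fun i hi => biUnion_mono (blk_sub hi) fun _ _ => Subset.rfl
        exact mem_iUnion₂.2 ⟨x, hx, (i2 _).mono (hsub _ hx'.1) (hsub _ hx'.1) q q' a1 a2 b1, (i2 _).mono (hsub _ hx'.2) (hsub _ hx'.2) q q' a1 a2 b2⟩
      · refine (measure_biUnion_finset_le _ _).trans ((sum_le_card_nsmul _ _ ((2⁻¹ ^ (13 + k)) ^ 2) fun x hx => ?_).trans ?_)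
        · have hap := (Finset.mem_filter.1 hx).2
          have hdis : Disjoint (⋃ Y ∈ blk k (7 • Z + x.1), A Y) (⋃ Y ∈ blk k (7 • Z + x.2), A Y) := by
            refine disjoint_iUnion₂_left.2 fun Y hY => disjoint_iUnion₂_right.2 fun Y' hY' => hA _ _ (blk_apart ?_ hY hY'); simpa [Apart] using hap
          rw [prod_inter_of_depOn p s (i1 _) (i1 _) (i2 _) (i2 _) hdis hdis, pow_two]; exact mul_le_mul' (i3 _) (i3 _)
        · rw [nsmul_eq_mul]
          calc _ ≤ (2:ENNReal) ^ 12 * (2⁻¹ ^ (13 + k)) ^ 2 := mul_le_mul' hT4 le_rfl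
            _ = 2⁻¹ ^ (14 + 2 * k) := by
              rw [← pow_mul, show (13 + k) * 2 = 12 + (14 + 2 * k) by ring, pow_add, ← mul_assoc, ← mul_pow, ENNReal.mul_inv_cancel (by simp) (by simp), one_pow, one_mul]
            _ ≤ _ := pow_le_pow_right_of_le_one' (by simp) (by omega)
  have hsum : ∑' k, μ (⋃ i ∈ dig, B k i) ≠ ⊤ := by
    refine ne_top_of_le_ne_top (b := ∑' k, (49 * 2⁻¹ ^ 13) * (2⁻¹ : ENNReal) ^ k) ?_ (tsum_le_tsum fun k => ?_)
    · rw [tsum_mul_left, tsum_half_pow]; exact mul_ne_top (mul_ne_top (by simp) (pow_ne_top (by simp))) (by simp)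
    · refine (measure_biUnion_finset_le _ _).trans ((sum_le_card_nsmul _ _ _ fun i _ => (key k).2.2 i).trans (le_of_eq ?_))
      rw [pow_add, nsmul_eq_mul, ← mul_assoc]; simp [dig]
  filter_upwards [ae_eventually_notMem hsum] with q hq
  obtain ⟨k₀, hk⟩ := Filter.eventually_atTop.1 hq
  refine ⟨k₀, fun k hk' i hi => ?_⟩
  by_contra hc
  exact hk k hk' (mem_iUnion₂.2 ⟨i, hi, hc⟩)

end

noncomputable section

variable {d : ℕ} {p s : ℝ}

/-! ### Three independent layers -/

/-- Pairs of configurations on two copies of the edge set. -/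
abbrev Om (d : ℕ) : Type := (Edge d ⊕ Edge d → Bool) × (Edge d ⊕ Edge d → Bool)

/-- The base layer. -/
def om (q : Om d) : Config d := fun e => q.1 (.inl e)
/-- The first sprinkling layer. -/
def x₁ (q : Om d) : Config d := fun e => q.2 (.inl e)
/-- The second sprinkling layer. -/
def x₂ (q : Om d) : Config d := fun e => q.2 (.inr e)

lemma prod_layers_false (p s) (t u w : Finset (Edge d)) : ((mu p).prod (mu s)) {q | (∀ e ∈ t, om q e = false) ∧ (∀ e ∈ u, x₁ q e = false) ∧ ∀ e ∈ w, x₂ q e = false} =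
    wt p false ^ t.card * (wt s false ^ u.card * wt s false ^ w.card) := by
  have : {q | (∀ e ∈ t, om q e = false) ∧ (∀ e ∈ u, x₁ q e = false) ∧ ∀ e ∈ w, x₂ q e = false} =
      (cyl (t.disjSum ∅) fun _ => false) ×ˢ (cyl (u.disjSum w) fun _ => false) := by
    ext q; constructor
    · rintro ⟨a, b, c⟩; refine ⟨?_, ?_⟩
      · rintro (e | e) he; exacts [a e (Finset.inl_mem_disjSum.1 he), by simp at he]
      · rintro (e | e) he; exacts [b e (Finset.inl_mem_disjSum.1 he), c e (Finset.inr_mem_disjSum.1 he)]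
    · aesop
  rw [this, Measure.prod_prod, mu_cyl, mu_cyl]
  simp [pow_add]

lemma measurable_om : Measurable (om : Om d → Config d) := measurable_pi_iff.2 fun _ => (measurable_pi_apply _).comp measurable_fst
lemma measurable_x₁ : Measurable (x₁ : Om d → Config d) := measurable_pi_iff.2 fun _ => (measurable_pi_apply _).comp measurable_snd
lemma measurable_x₂ : Measurable (x₂ : Om d → Config d) := measurable_pi_iff.2 fun _ => (measurable_pi_apply _).comp measurable_snd

lemma wt_uni_false (hp : p ∈ 𝕀) (hs : s ∈ 𝕀) : wt (uni p s) false = wt p false * wt s false := by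
  rw [wt_false (uni_mem hp hs), wt_false hp, wt_false hs, ← ofReal_mul (sub_nonneg.2 hp.2)]
  congr 1; unfold uni; ring

lemma measurable_base : Measurable fun q : Om d => (orc (om q) (x₁ q), x₂ q) := (measurable_orc.comp (measurable_om.prodMk measurable_x₁)).prodMk measurable_x₂

lemma map_base (hp : p ∈ 𝕀) (hs : s ∈ 𝕀) :
    ((mu p).prod (mu s)).map (fun q : Om d => (orc (om q) (x₁ q), x₂ q)) = (mu (uni p s)).prod (mu s) := by
  refine (eq_mu_prod _ _ false false _ fun t u => ?_).symm
  rw [Measure.map_apply measurable_base ((meas_cyl _ _).prod (meas_cyl _ _)), wt_uni_false hp hs, mul_pow, mul_assoc, ← prod_layers_false]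
  congr 1; ext q; simp [cyl, orc, forall_and, and_assoc]

lemma measurable_sprinkle : Measurable fun q : Om d => (om q, orc (x₁ q) (x₂ q)) := measurable_om.prodMk (measurable_orc.comp (measurable_x₁.prodMk measurable_x₂))

lemma map_sprinkle (hs : s ∈ 𝕀) :
    ((mu p).prod (mu s)).map (fun q : Om d => (om q, orc (x₁ q) (x₂ q))) = (mu p).prod (mu (uni s s)) := by
  refine (eq_mu_prod _ _ false false _ fun t u => ?_).symm
  rw [Measure.map_apply measurable_sprinkle ((meas_cyl _ _).prod (meas_cyl _ _)), wt_uni_false hs hs, mul_pow, ← prod_layers_false]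
  congr 1; ext q; simp [cyl, orc, forall_and]

/-! ### Cells -/

variable {n r k L W : ℕ} {a u x y t t' : V d} {ω ω' ζ ζ' o o' ξ ξ' : Config d}

/-- Every small box reaches far beyond the cell. -/
def Hubby (n k : ℕ) (ζ : Config d) : Prop := ∀ u ∈ box (0 : V d) n, ∃ t ∈ box u k, ζ ∈ cnS (box u (2 * n + 1)) t (sphere u (2 * n + 1))

lemma hub_far (hu : u ∈ box 0 n) (ht : t ∈ box 0 n) (h : ζ ∈ cnS (box u (2 * n + 1)) t (sphere u (2 * n + 1))) : ζ ∈ cnS (box 0 n) t (sphere 0 n) := by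
  obtain ⟨x, ⟨-, i, hi⟩, hc⟩ := h
  have hx : x ∉ box 0 n := fun hx => by
    have h1 := abs_le.1 (hx i); have h2 := abs_le.1 (hu i); grind
  obtain ⟨y, hy, h⟩ := hc.exit_sphere ht hx
  exact ⟨y, hy, h.mono_set inter_subset_right⟩

lemma Hubby.dense (h : Hubby n k ζ) : Dense n k ζ := fun u hu hk => by
  obtain ⟨t, ht, hc⟩ := h u hu
  exact ⟨t, ht, hub_far hu (hk ht) hc⟩

/-- The cell at the origin is rich in long clusters of `ζ`, which are glued together by `ξ`. -/
def Good (n r k : ℕ) (ζ ξ : Config d) : Prop := Hubby n k ζ ∧ Glued n r ζ (orc ζ ξ)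

/-- The cell at the origin is good and does not touch long arms of the base `o`. -/
def cellOK (n r k L : ℕ) (o ζ ξ : Config d) : Prop := Good n r k ζ ξ ∧ ∀ y ∈ box (0 : V d) n, o ∉ arm L y

lemma box_add (hu : u ∈ box a m) : box u l ⊆ box a (m + l) := fun x hx i => by
  have h1 := abs_le.1 (hx i)
  have h2 := abs_le.1 (hu i)
  grind

lemma edgesIn_mono (h : S ⊆ R) : edgesIn S ⊆ edgesIn R := fun _ he x hx => h (he x hx)

lemma Good.congr (h : Good n r k ζ ξ) (hK : 3 * n + 1 ≤ K) (h2 : ∀ e ∈ edgesIn (box 0 K), ζ e = ζ' e)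
    (h3 : ∀ e ∈ edgesIn (box 0 K), ξ e = ξ' e) : Good n r k ζ' ξ' := by
  have hz : ∀ {S : Set (V d)} {x A}, S ⊆ box 0 K → (ζ ∈ cnS S x A ↔ ζ' ∈ cnS S x A) := fun {S x A} hS =>
    (depOn_cnS S x A).iff fun e he => h2 e (edgesIn_mono hS he)
  have hn : box (0 : V d) n ⊆ box 0 K := box_mono (by omega)
  refine ⟨fun u hu => ?_, fun v hv w hw => ?_⟩
  · obtain ⟨t, ht, hc⟩ := h.1 u hu; exact ⟨t, ht, (hz ((box_add hu).trans (box_mono (by omega)))).1 hc⟩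
  · refine depOn_cn _ v w _ _ (fun e he => ?_) (h.2 v ⟨hv.1, (hz hn).2 hv.2⟩ w ⟨hw.1, (hz hn).2 hw.2⟩)
    simp [orc, h2 e (edgesIn_mono hn he), h3 e (edgesIn_mono hn he)]

lemma cellOK.congr (h : cellOK n r k L o ζ ξ) (hK : 3 * n + 1 + L ≤ K) (h1 : ∀ e ∈ edgesIn (box 0 K), o e = o' e)
    (h2 : ∀ e ∈ edgesIn (box 0 K), ζ e = ζ' e) (h3 : ∀ e ∈ edgesIn (box 0 K), ξ e = ξ' e) : cellOK n r k L o' ζ' ξ' :=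
  ⟨h.1.congr (by omega) h2 h3, fun y hy hc => h.2 y hy
    (depOn_cnS _ _ _ _ _ (fun e he => (h1 e (edgesIn_mono ((box_add hy).trans (box_mono (by omega))) he)).symm) hc)⟩

/-- Translation of configurations. -/
def sh (a : V d) (ω : Config d) : Config d := (shift a).conf ω

lemma cn_sh : Cn (box u m) (sh a ω) x y ↔ Cn (box (u + a) m) ω (x + a) (y + a) :=
  (shift a).cn fun x => by simp [box]

lemma cnS_sh : sh a ω ∈ cnS (box u m) x (sphere u m) ↔ ω ∈ cnS (box (u + a) m) (x + a) (sphere (u + a) m) := by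
  constructor
  · rintro ⟨y, hy, h⟩; exact ⟨y + a, by simpa [sphere] using hy, cn_sh.1 h⟩
  · rintro ⟨y, hy, h⟩; refine ⟨y - a, by simpa [sphere, sub_sub, add_comm] using hy, cn_sh.2 (by simp_all)⟩

/-- `t` is a hub of the cell at `a`. -/
def Hub (n k : ℕ) (ζ : Config d) (a t : V d) : Prop := t ∈ box a k ∧ ζ ∈ cnS (box a (2 * n + 1)) t (sphere a (2 * n + 1))

/-- The configuration after the fire and the sprinkling. -/
def after (q : Om d) : Config d := fun e => burn (om q) e || orc (x₁ q) (x₂ q) e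

lemma mem_arm_of_infinite (h : InInfinite ω y) (L) : ω ∈ arm L y := by
  obtain ⟨x, hx, hxL⟩ := h.exists_notMem_finite (finite_box y L)
  obtain ⟨z, hz, hc⟩ := (cn_univ_iff.2 hx).exit_sphere (by intro i; simp) hxL
  exact ⟨z, hz, hc.mono_set inter_subset_right⟩

/-- The cell at `a` is good. -/
def cellAt (n r k L : ℕ) (q : Om d) (a : V d) : Prop := cellOK n r k L (sh a (om q)) (sh a (orc (om q) (x₁ q))) (sh a (x₂ q))

lemma cellAt.exists_hub (h : cellAt n r k L q a) : ∃ t, Hub n k (orc (om q) (x₁ q)) a t := by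
  obtain ⟨t, ht, hc⟩ := h.1.1 0 (by tauto)
  have := cnS_sh.1 hc
  rw [zero_add] at this
  exact ⟨t + a, by simpa [box] using ht, this⟩

lemma cellAt.connected (h : cellAt n r k L q a) (hr : W + k ≤ r) (hn : r ≤ n) (ha : a' ∈ box a W)
    (ht : Hub n k (orc (om q) (x₁ q)) a t) (ht' : Hub n k (orc (om q) (x₁ q)) a' t') : Connected (after q) t t' := by
  set ζ := orc (om q) (x₁ q)
  have hf : ∀ {b t}, b ∈ box a W → Hub n k ζ b t → t - a ∈ far n r (sh a ζ) := fun {b t} hb ht => by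
    have h1 : t - a ∈ box 0 r := by
      have := (box_mono hr) (box_add hb ht.1); simpa [box] using this
    refine ⟨h1, hub_far (u := b - a) ?_ (box_mono hn h1) (cnS_sh.2 (by simpa using ht.2))⟩; have := box_mono (show W ≤ n by omega) hb
    simpa [box] using this
  have hc := h.1.2 _ (hf (by intro i; simp) ht) _ (hf ha ht')
  have hc : Cn (box 0 n) (sh a (orc ζ (x₂ q))) (t - a) (t' - a) := hc
  rw [cn_sh, zero_add, sub_add_cancel, sub_add_cancel] at hc
  rw [← cn_univ_iff]
  refine hc.induct (Cn.refl trivial) fun x y _ hx hxb hyb hxy => hx.trans (Cn.step trivial trivial ?_)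
  obtain ⟨hadj, ho⟩ := openAdj_iff.1 hxy
  refine openAdj_iff.2 ⟨hadj, ?_⟩
  have hno : ∀ y ∈ box a n, y ∉ Cinf (om q) := fun y hy hi => by
    refine h.2 (y - a) (by simpa [box] using hy) ?_; rw [arm, cnS_sh, sub_add_cancel]; exact mem_arm_of_infinite hi L
  have hb : om q (mkE hadj) = true → burn (om q) (mkE hadj) = true := fun hop => by
    unfold burn closeOn; rw [if_neg, hop]; rintro ⟨z, hz, hzi⟩; rcases Sym2.mem_iff.1 hz with rfl | rfl; exacts [hno _ hxb hzi, hno _ hyb hzi]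
  simp [ζ, orc, after] at ho ⊢
  tauto

/-! ### Sites -/

/-- The centre of the `i`-th cell in direction `e` from the site `Y`. -/
def ctr (d L W : ℕ) (Y e : ℤ × ℤ) (i : ℕ) : V d := emb d ((W:ℤ) • ((L:ℤ) • Y + (i:ℤ) • e))

/-- All cells on the two segments issued from `Y` are good. -/
def siteOK (n r k L W : ℕ) (q : Om d) (Y : ℤ × ℤ) : Prop := ∀ e ∈ ({(1, 0), (0, 1)} : Set (ℤ × ℤ)), ∀ i ≤ L, cellAt n r k L q (ctr d L W Y e i)

lemma emb_mem_box (he : e ∈ ({(1, 0), (0, 1)} : Set (ℤ × ℤ))) {c : ℕ} {m : ℤ} (hm : |m| ≤ c) : emb d (Z + m • e) ∈ box (emb d Z) c := by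
  intro i
  rcases he with rfl | rfl <;> simp [emb, mul_zero] <;> split_ifs <;> simp [hm]

lemma ctr_mem (Y) (he : e ∈ ({(1, 0), (0, 1)} : Set (ℤ × ℤ))) (hi : i ≤ L) : ctr d L W Y e i ∈ box (emb d (((W * L : ℕ):ℤ) • Y)) (W * L) := by
  have := emb_mem_box (d := d) he (c := W * L) (m := ((W * i : ℕ):ℤ)) (Z := ((W * L : ℕ):ℤ) • Y) (by
    rw [Nat.abs_cast]; exact_mod_cast Nat.mul_le_mul_left _ hi)
  convert this using 2
  unfold ctr; push_cast; rw [smul_add, smul_smul, smul_smul]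

lemma siteOK.rel (hr : W + k ≤ r) (hn : r ≤ n) (he : e ∈ ({(1, 0), (0, 1)} : Set (ℤ × ℤ))) (h : siteOK n r k L W q Y)
    (ht : Hub n k (orc (om q) (x₁ q)) (ctr d L W Y e 0) t) (ht' : Hub n k (orc (om q) (x₁ q)) (ctr d L W Y e L) t') : Connected (after q) t t' := by
  have key : ∀ i, i ≤ L → ∀ t', Hub n k (orc (om q) (x₁ q)) (ctr d L W Y e i) t' → Connected (after q) t t' := by
    intro i; induction i with
    | zero => exact fun _ t' ht' => (h e he 0 (by omega)).connected hr hn (by intro i; simp) ht ht'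
    | succ i ih =>
      intro hi t' ht'; obtain ⟨t₁, ht₁⟩ := (h e he i (by omega)).exists_hub
      refine Relation.ReflTransGen.trans (ih (by omega) t₁ ht₁) ((h e he i (by omega)).connected hr hn ?_ ht₁ ht')
      have : (W:ℤ) • ((L:ℤ) • Y + ((i + 1 : ℕ):ℤ) • e) = (W:ℤ) • ((L:ℤ) • Y + (i:ℤ) • e) + (W:ℤ) • e := by
        grind
      unfold ctr; rw [this]; exact emb_mem_box he (by simp)
  exact key L le_rfl t' ht'

lemma connected_equivalence (ω : Config d) : Equivalence (Connected ω) :=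
  ⟨fun _ => .refl, fun h => cn_univ_iff.1 (cn_univ_iff.2 h).symm, fun h h' => h.trans h'⟩

lemma hasInfCluster_after {q : Om d} (hd : 2 ≤ d) (hr : W + k ≤ r) (hn : r ≤ n) (hL : 0 < L) (hW : 0 < W)
    (hk : ∀ j, k₀ ≤ j → ∀ i ∈ dig, lvl (siteOK n r k L W q) j i) : HasInfCluster (after q) := by
  have hex : ∀ Y, siteOK n r k L W q Y → ∃ t, Hub n k (orc (om q) (x₁ q)) (emb d ((W:ℤ) • (L:ℤ) • Y)) t := fun Y h => by
    obtain ⟨t, ht⟩ := (h (1, 0) (by simp) 0 (by omega)).exists_hub; exact ⟨t, by simpa [ctr] using ht⟩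
  choose! hub hhub using hex
  have heq := connected_equivalence (after q)
  obtain ⟨Y₀, hY₀, hfar⟩ := exists_class (r := fun Y Y' => Connected (after q) (hub Y) (hub Y'))
    ⟨fun _ => heq.refl _, heq.symm, heq.trans⟩ (fun Y e he h h' => h.rel hr hn he (by simpa [ctr] using hhub Y h) (by simpa [ctr, smul_add] using hhub _ h')) hk
  refine ⟨hub Y₀, fun hfin => ?_⟩
  set i₀ : Fin d := ⟨0, by omega⟩
  obtain ⟨B, hB⟩ := (hfin.image fun x => x i₀).bddAbove
  obtain ⟨Y, hY, hc, hN⟩ := hfar (B.toNat + k + 1)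
  have h1 : hub Y i₀ ≤ B := hB ⟨_, hc, rfl⟩
  have h2 := abs_le.1 ((hhub Y hY).1 i₀)
  rw [(show emb d ((W:ℤ) • (L:ℤ) • Y) i₀ = W * (L * Y.1) by simp [emb, i₀])] at h2
  have hWL : (1:ℤ) ≤ W * L := by exact_mod_cast Nat.mul_pos hW hL
  have h4 : Y.1 ≤ W * (L * Y.1) := by rw [← mul_assoc]; nlinarith
  push_cast at hN
  have := B.self_le_toNat
  linarith [h2.1]

/-- The edges relevant to the site `Y`. -/
def reg (d ρ m : ℕ) (Y : ℤ × ℤ) : Set (Edge d ⊕ Edge d) := {e | Sum.elim id id e ∈ edgesIn (box (emb d ((m:ℤ) • Y)) ρ)}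

lemma reg_disjoint (hd : 2 ≤ d) (h : 2 * ρ < 3 * m) (hY : Apart Y Y') : Disjoint (reg d ρ m Y) (reg d ρ m Y') := by
  rw [disjoint_left]
  intro e he he'
  obtain ⟨x, hx⟩ : ∃ x, x ∈ (Sum.elim id id e : Edge d).val := by
    obtain ⟨_, a, b, hab, he⟩ := (Sum.elim id id e : Edge d); simp_all
  have key : ∀ i (y y' : ℤ), emb d ((m:ℤ) • Y) i = m * y → emb d ((m:ℤ) • Y') i = m * y' → ¬ 3 ≤ |y - y'| := by
    intro i y y' e1 e2 h3; have h1 := abs_le.1 (he x hx i); have h2 := abs_le.1 (he' x hx i); have h4 : |(m:ℤ) * (y - y')| ≤ 2 * ρ := by grind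
    rw [abs_mul, Nat.abs_cast] at h4; nlinarith
  rcases hY with h3 | h3
  exacts [key ⟨0, by omega⟩ Y.1 Y'.1 (by simp [emb]) (by simp [emb]) h3, key ⟨1, by omega⟩ Y.2 Y'.2 (by simp [emb]) (by simp [emb]) h3]

lemma depOn₂_siteOK (hρ : W * L + (3 * n + 1 + L) ≤ ρ) (Y) : DepOn₂ {q | siteOK n r k L W q Y} (reg d ρ (W * L) Y) (reg d ρ (W * L) Y) := by
  intro q q' h1 h2 hq e he i hi
  set a := ctr d L W Y e i
  have hedge : ∀ b ∈ edgesIn (box 0 (3 * n + 1 + L)), (shift a).edge b ∈ edgesIn (box (emb d (((W * L : ℕ):ℤ) • Y)) ρ) := by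
    intro b hb x hx; obtain ⟨y, hy, rfl⟩ := Sym2.mem_map.1 hx; refine box_mono hρ (box_add (ctr_mem Y he hi) ?_); have := hb y hy
    simpa [box, a] using this
  refine (hq e he i hi).congr le_rfl (fun b hb => h1 (.inl _) (hedge b hb)) (fun b hb => ?_) fun b hb => h2 (.inr _) (hedge b hb)
  have h4 : om q ((shift a).edge b) = om q' ((shift a).edge b) := h1 (.inl _) (hedge b hb)
  show (om q ((shift a).edge b) || x₁ q ((shift a).edge b)) = _
  rw [(show x₁ q ((shift a).edge b) = x₁ q' ((shift a).edge b) from h2 (.inl _) (hedge b hb)), h4]; rfl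

lemma finite_reg (ρ m) (Y) : (reg d ρ m Y).Finite := by
  have h := finite_edgesIn (finite_box (emb d ((m:ℤ) • Y)) ρ)
  refine ((h.image Sum.inl).union (h.image Sum.inr)).subset ?_
  rintro (e | e) he
  exacts [.inl ⟨e, he, rfl⟩, .inr ⟨e, he, rfl⟩]

lemma meas_of_depOn₂ {F : Set (Pr E)} (hA : A.Finite) (h : DepOn₂ F A A) : MeasurableSet F := by
  have h1 : MeasurableSet {ω : E ⊕ E → Bool | (fun e => ω (.inl e), fun e => ω (.inr e)) ∈ F} :=
    meas_of_depOn ((hA.image Sum.inl).union (hA.image Sum.inr)) fun ω ω' hω =>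
      h _ _ (fun e he => hω _ (.inl ⟨e, he, rfl⟩)) fun e he => hω _ (.inr ⟨e, he, rfl⟩)
  have h2 : Measurable fun q : Pr E => (Sum.elim q.1 q.2 : E ⊕ E → Bool) := by
    refine measurable_pi_iff.2 ?_; rintro (e | e); exacts [(measurable_pi_apply e).comp measurable_fst, (measurable_pi_apply e).comp measurable_snd]
  exact h2 h1

end

noncomputable section

lemma eventually_pow_mul_exp_le (E) (hc : 0 < c) (hδ : 0 < δ) :
    ∀ᶠ k : ℕ in atTop, ((k:ℝ) ^ k) ^ E * exp (-(c * k ^ 2)) ≤ δ := by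
  have h1 : ∀ᶠ k : ℕ in atTop, log k ≤ c / (2 * (E + 1)) * k := by
    have := (Real.isLittleO_log_id_atTop.bound (show 0 < c / (2 * (E + 1)) by positivity)).natCast_atTop
    filter_upwards [this, eventually_ge_atTop 1] with k hk h; have hk' : (1:ℝ) ≤ k := by simp_all
    simpa [abs_of_nonneg (Real.log_nonneg hk'), abs_of_nonneg (zero_le_one.trans hk')] using hk
  filter_upwards [h1, (show ∀ᶠ k : ℕ in atTop, -log δ * (2 / c) ≤ k from tendsto_natCast_atTop_atTop.eventually_ge_atTop _), eventually_ge_atTop 1] with k hl hk h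
  have hk' : (1:ℝ) ≤ k := by simp_all
  rw [← Real.log_le_log_iff (by positivity) hδ, Real.log_mul (by simp) (by simp), Real.log_exp, Real.log_pow, Real.log_pow]
  have h3 : E * (k * log k) ≤ c / 2 * k ^ 2 := by
    calc (E:ℝ) * (k * log k) ≤ (E + 1) * (k * (c / (2 * (E + 1)) * k)) := by
          have : 0 ≤ k * log k := mul_nonneg (by linarith) (Real.log_nonneg hk')
          nlinarith [mul_le_mul_of_nonneg_left hl (show (0:ℝ) ≤ k by linarith)]
      _ = c / 2 * k ^ 2 := by grind
  have h4 : -log δ ≤ c / 2 * k := by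
    have := mul_le_mul_of_nonneg_left hk (show 0 ≤ c / 2 by positivity); have e : c / 2 * (-log δ * (2 / c)) = -log δ := by field_simp
    linarith
  have h5 : c / 2 * k ≤ c / 2 * k ^ 2 := mul_le_mul_of_nonneg_left (le_self_pow₀ hk' two_ne_zero) (by positivity)
  linarith

/-- The length scale of the cells. -/
def scale (d k : ℕ) : ℕ := k ^ 2 * (k ^ (12 * d * k + 2) * (k + 2))

lemma le_scale (hk : 1 ≤ k) : k ≤ scale d k := by
  calc k ≤ k + 2 := by omega
    _ ≤ _ := Nat.le_mul_of_pos_left _ (by positivity)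
    _ ≤ _ := Nat.le_mul_of_pos_left _ (by positivity)

lemma scale_le (hk : 2 ≤ k) : scale d k ≤ (k ^ k) ^ (12 * d + 6) := by
  calc scale d k ≤ k ^ 2 * (k ^ (12 * d * k + 2) * k ^ 2) := by unfold scale; gcongr; nlinarith
    _ = k ^ (12 * d * k + 6) := by ring
    _ ≤ k ^ (k * (12 * d + 6)) := pow_le_pow_right (by omega) (by nlinarith)
    _ = _ := pow_mul _ _ _

lemma glue_pow_le {d k : ℕ} (hk : 1 ≤ k) (hs : (1:ℝ) / k ≤ s) (hs1 : s ≤ 1) :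
    (1 - (s / (k ^ 2 : ℕ)) ^ (d * (2 * (k + 1)))) ^ k ^ (12 * d * k + 2) ≤ exp (-(1 * k ^ 2)) := by
  have hk' : (1:ℝ) ≤ k := by simp_all
  have h0 : 0 < s := lt_of_lt_of_le (by positivity) hs
  set x := (s / (k ^ 2 : ℕ)) ^ (d * (2 * (k + 1)))
  have hx1 : x ≤ 1 := pow_le_one₀ (by positivity) (by push_cast; rw [div_le_one (by positivity)]; nlinarith)
  have hx : 1 / (k:ℝ) ^ (12 * d * k) ≤ x := by
    calc 1 / (k:ℝ) ^ (12 * d * k) ≤ (1 / (k:ℝ) ^ 3) ^ (d * (2 * (k + 1))) := by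
          rw [one_div_pow, ← pow_mul]; exact one_div_le_one_div_of_le (by positivity) (pow_le_pow_right₀ hk' (by nlinarith))
      _ ≤ x := by
          refine pow_le_pow_left₀ (by simp) ?_ _; push_cast; rw [le_div_iff₀ (by positivity)]
          calc 1 / (k:ℝ) ^ 3 * k ^ 2 = 1 / k := by field_simp
            _ ≤ s := hs
  calc (1 - x) ^ k ^ (12 * d * k + 2) ≤ exp (-x) ^ k ^ (12 * d * k + 2) :=
        pow_le_pow_left₀ (by linarith) (by linarith [add_one_le_exp (-x)]) _
    _ = exp (-(k ^ (12 * d * k + 2) * x)) := by rw [← exp_nat_mul]; push_cast; ring_nf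
    _ ≤ _ := by
        refine Real.exp_le_exp.2 (neg_le_neg ?_)
        calc (1:ℝ) * k ^ 2 = k ^ (12 * d * k + 2) * (1 / (k:ℝ) ^ (12 * d * k)) := by rw [pow_add]; field_simp
          _ ≤ _ := by gcongr

lemma eventually_scales (hd : 1 ≤ d) (hs : 0 < s) (hs1 : s ≤ 1) (hc : 0 < c) (hC : 0 < C) : ∀ᶠ k : ℕ in atTop,
    ∀ W m N : ℕ, W = scale d k → m = W ^ (2 * d) → N = (8 * W + 1) ^ d → N < 2 ^ k ^ 2 ∧
      2 * ((m:ℝ) ^ 11 + 1) * (N * exp (1 - c * k ^ 2) + (k ^ 2 : ℕ) * (N * (1 - (s / (k ^ 2 : ℕ)) ^ (d * (2 * (k + 1)))) ^ k ^ (12 * d * k + 2)) + N * (2 * C / m ^ 12)) ≤ (1 / 2) ^ 13 := by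
  set D := 12 * d + 6
  set E := D * (22 * d) + 1 + ((D + 1) * d + 1)
  have hcub : ∀ᶠ k : ℕ in atTop, 8 * C * 9 ^ d * 2 ^ 15 ≤ (k:ℝ) := tendsto_natCast_atTop_atTop.eventually_ge_atTop _
  filter_upwards [eventually_pow_mul_exp_le E hc (show (0:ℝ) < (1 / 2) ^ 15 by simp), eventually_pow_mul_exp_le E one_pos (show (0:ℝ) < (1 / 2) ^ 15 by simp),
    eventually_pow_mul_exp_le E (Real.log_pos one_lt_two) (show (0:ℝ) < 1 / 2 by norm_num), (show ∀ᶠ k : ℕ in atTop, 1 / s ≤ (k:ℝ) from tendsto_natCast_atTop_atTop.eventually_ge_atTop _), hcub, eventually_ge_atTop 3] with k e1 e2 e3 hks hkC hk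
  rintro W m N hW hm hN
  have hk' : (3:ℝ) ≤ k := by simp_all
  have hW1 : k ≤ W := hW ▸ le_scale (by omega)
  have hW2 : W ≤ (k ^ k) ^ D := hW ▸ scale_le (by omega)
  set X := k ^ k with hX
  have hX2 : k ^ 2 ≤ X := pow_le_pow_right (by omega) (by omega)
  have hX9 : 9 ≤ X := le_trans (by nlinarith) hX2
  have hN9 : N ≤ (9 * W) ^ d := hN ▸ pow_le_pow_left (by omega) d
  have hNX : N ≤ X ^ ((D + 1) * d) := by
    rw [pow_mul]; refine hN9.trans (pow_le_pow_left ?_ d); rw [pow_succ, mul_comm]; exact Nat.mul_le_mul hW2 hX9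
  have hm1 : 1 ≤ m := by rw [hm]; exact Nat.one_le_pow _ _ (by omega)
  have hmX : 2 * (m ^ 11 + 1) ≤ X ^ (D * (22 * d) + 1) := by
    have h1 : m ^ 11 ≤ X ^ (D * (22 * d)) := by
      rw [hm, ← pow_mul, pow_mul X]; refine (pow_le_pow_left hW2 _).trans (pow_le_pow_right (by positivity) (by omega))
    have h2 : 1 ≤ m ^ 11 := Nat.one_le_pow _ _ hm1
    calc 2 * (m ^ 11 + 1) ≤ m ^ 11 * 9 := by omega
      _ ≤ _ := by rw [pow_succ X]; exact Nat.mul_le_mul h1 hX9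
  have hall : 2 * (m ^ 11 + 1) * (N * X) ≤ X ^ E := by
    rw [pow_add]; refine Nat.mul_le_mul hmX ?_; rw [pow_succ]; exact Nat.mul_le_mul_right _ hNX
  have hXr : (X : ℝ) = (k:ℝ) ^ k := by rw [hX]; push_cast; rfl
  have hall' : 2 * ((m:ℝ) ^ 11 + 1) * (N * (k:ℝ) ^ k) ≤ ((k:ℝ) ^ k) ^ E := by rw [← hXr]; exact_mod_cast hall
  constructor
  · have h1 : (N:ℝ) ≤ ((k:ℝ) ^ k) ^ E := by
      rw [← hXr]; exact_mod_cast hNX.trans (pow_le_pow_right (by omega) (by omega))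
    have h2 : exp (-(log 2 * k ^ 2)) = 1 / 2 ^ k ^ 2 := by
      rw [Real.exp_neg, ← Nat.cast_pow, mul_comm, exp_nat_mul, Real.exp_log two_pos, one_div]
    rw [h2, mul_one_div, div_le_iff₀ (by positivity)] at e3
    have h3 : (N:ℝ) < 2 ^ k ^ 2 := by
      have : (0:ℝ) < 2 ^ k ^ 2 := by positivity
      linarith
    exact_mod_cast h3
  · have hp : (0:ℝ) ≤ 2 * ((m:ℝ) ^ 11 + 1) := by positivity
    have t1 : 2 * ((m:ℝ) ^ 11 + 1) * (N * exp (1 - c * k ^ 2)) ≤ (1 / 2) ^ 15 := by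
      refine le_trans ?_ e1; rw [sub_eq_add_neg, Real.exp_add, ← mul_assoc (N:ℝ), ← mul_assoc]
      refine mul_le_mul_of_nonneg_right (le_trans ?_ hall') (exp_pos _).le
      have : exp 1 ≤ (k:ℝ) ^ k := by
        rw [← hXr]; exact Real.exp_one_lt_d9.le.trans (le_trans (by norm_num) (Nat.cast_le.2 hX9))
      gcongr
    have t2 : 2 * ((m:ℝ) ^ 11 + 1) * ((k ^ 2 : ℕ) * (N * (1 - (s / (k ^ 2 : ℕ)) ^ (d * (2 * (k + 1)))) ^ k ^ (12 * d * k + 2))) ≤ (1 / 2) ^ 15 := by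
      refine le_trans ?_ e2; have := glue_pow_le (d := d) (by omega : 1 ≤ k) (by rw [one_div_le (by linarith) hs]; exact hks) hs1
      calc _ ≤ 2 * ((m:ℝ) ^ 11 + 1) * ((k:ℝ) ^ k * (N * exp (-(1 * k ^ 2)))) := by
            refine mul_le_mul_of_nonneg_left ?_ hp
            exact (mul_le_mul_of_nonneg_left (mul_le_mul_of_nonneg_left this (Nat.cast_nonneg _)) (Nat.cast_nonneg _)).trans (mul_le_mul_of_nonneg_right (by rw [← hXr]; exact_mod_cast hX2) (by positivity))
        _ = 2 * ((m:ℝ) ^ 11 + 1) * (N * (k:ℝ) ^ k) * exp (-(1 * k ^ 2)) := by ring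
        _ ≤ _ := mul_le_mul_of_nonneg_right hall' (exp_pos _).le
    have t3 : 2 * ((m:ℝ) ^ 11 + 1) * (N * (2 * C / m ^ 12)) ≤ (1 / 2) ^ 15 := by
      have hWr : (k:ℝ) ≤ W := by exact_mod_cast hW1
      have hN' : (N:ℝ) ≤ (9 * W) ^ d := by exact_mod_cast hN9
      have hWd : (k:ℝ) ≤ (W:ℝ) ^ d := hWr.trans (le_self_pow₀ (by linarith) (by omega)); have hW0 : (0:ℝ) < (W:ℝ) ^ d := by linarith
      calc 2 * ((m:ℝ) ^ 11 + 1) * (N * (2 * C / m ^ 12)) ≤ 2 * ((m:ℝ) ^ 11 + m ^ 11) * ((9 * W) ^ d * (2 * C / m ^ 12)) := by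
            gcongr; exact one_le_pow₀ (by exact_mod_cast hm1)
        _ = 8 * C * 9 ^ d * W ^ d / m := by rw [mul_pow]; field_simp; ring
        _ = 8 * C * 9 ^ d / W ^ d := by rw [(show (m:ℝ) = (W:ℝ) ^ d * W ^ d by rw [hm]; push_cast; ring)]; field_simp
        _ ≤ (1 / 2) ^ 15 := by
            rw [div_le_iff₀ hW0]
            refine le_trans (le_of_eq ?_) (show (1 / 2 : ℝ) ^ 15 * (8 * C * 9 ^ d * 2 ^ 15) ≤ (1 / 2) ^ 15 * W ^ d by gcongr; exact hkC.trans hWd)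
            norm_num; ring
    calc _ = _ + _ + _ := by rw [mul_add, mul_add]
      _ ≤ (1 / 2 : ℝ) ^ 15 + (1 / 2) ^ 15 + (1 / 2) ^ 15 := add_le_add (add_le_add t1 t2) t3
      _ ≤ _ := by norm_num

/-! ### Probabilities -/

variable {d n r k L W J M : ℕ} {p q s σ : ℝ} {a u x y : V d} {ω ζ ξ : Config d}

/-- The number of vertices of a box. -/
def bc (d n : ℕ) : ℕ := (finite_box (0 : V d) n).toFinset.card

lemma bc_le (d n) : bc d n ≤ (2 * n + 1) ^ d := by
  calc bc d n ≤ (Fintype.piFinset fun _ => Finset.Icc (-n : ℤ) n).card := by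
        refine Finset.card_le_card fun x hx => ?_; rw [Finite.mem_toFinset] at hx; rw [Fintype.mem_piFinset]; intro i; have := hx i
        rwa [Pi.zero_apply, sub_zero, abs_le, ← Finset.mem_Icc] at this
    _ = (2 * n + 1) ^ d := by
        rw [Fintype.card_piFinset_const, Int.card_Icc]; congr 1; omega

lemma mu_biUnion_box_le {F : V d → Set (Config d)} (h : ∀ u, mu p (F u) ≤ c) : mu p {ω | ∃ u ∈ box 0 n, ω ∈ F u} ≤ bc d n * c := by
  calc _ ≤ mu p (⋃ u ∈ (finite_box 0 n).toFinset, F u) := measure_mono fun ω hω => by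
        simp_all
    _ ≤ ∑ u ∈ (finite_box 0 n).toFinset, mu p (F u) := measure_biUnion_finset_le _ _
    _ ≤ _ := by rw [bc, ← nsmul_eq_mul]; exact sum_le_card_nsmul _ _ _ fun u _ => h u

lemma mu_not_hubby_le (hq : pT d < q) (hq1 : q ≤ 1) (hA : A ⊆ box 0 k) (hk : k ≤ n) (hb : 0 ≤ b)
    (h : ∀ S : Set (V d), S.Finite → A ⊆ S → ofReal b ≤ phiA (pT d) S A) :
    mu q {ζ : Config d | ¬ Hubby n k ζ} ≤ bc d n * ofReal (exp (1 - (q - pT d) * b)) := by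
  refine le_trans (measure_mono ?_) (mu_biUnion_box_le (F := fun u => (shift u).conf ⁻¹' noFar (2 * n + 1) A) fun u => ?_)
  · intro ζ hζ; unfold Hubby at hζ; push Not at hζ; obtain ⟨u, hu, h⟩ := hζ; refine ⟨u, hu, fun x hx hc => h (x + u) (by simpa [box] using hA hx) ?_⟩
    have hc : sh u ζ ∈ _ := hc; rwa [cnS_sh, zero_add] at hc
  · rw [Aut.mu_preimage _ _ (meas_noFar _ _)]; exact noFar_le hq hq1 _ _ (hA.trans (box_mono (by omega))) hb h

lemma mu_exists_arm_le : mu p {o | ∃ y ∈ box (0 : V d) n, o ∈ arm L y} ≤ bc d n * mu p (arm L (0 : V d)) :=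
  mu_biUnion_box_le fun y => by
    unfold arm; rw [← Aut.mu_preimage (shift y) _ (meas_cnS (box 0 L) 0 (sphere 0 L))]; refine measure_mono fun ω h => ?_
    show sh y ω ∈ cnS (box 0 L) 0 (sphere 0 L); rwa [cnS_sh, zero_add]

lemma prod_not_good_le (hd : 2 ≤ d) (hq : pT d < q) (hq1 : q ≤ 1) (hs : s ≤ 1) (hA : A ⊆ box 0 k) (hk : k ≤ n) (hb : 0 ≤ b)
    (h : ∀ S : Set (V d), S.Finite → A ⊆ S → ofReal b ≤ phiA (pT d) S A) (hσ : σ ∈ 𝕀) (hJ : J * σ ≤ s)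
    (hn : r + J * (M * (2 * k + 4)) ≤ n) (hJn : bc d n < 2 ^ J) : ((mu q).prod (mu s)) {x : Pr (Edge d) | ¬ Good n r k x.1 x.2} ≤
      bc d n * ofReal (exp (1 - (q - pT d) * b)) + J * (bc d n * (1 - ofReal σ ^ (d * (2 * (k + 1)))) ^ M) := by
  have hm : MeasurableSet {x : Pr (Edge d) | ¬ Good n r k x.1 x.2} :=
    meas_of_depOn₂ (finite_edgesIn (finite_box 0 (3 * n + 1))) fun x y h1 h2 hx hy =>
      hx (hy.congr le_rfl (fun e he => (h1 e he).symm) fun e he => (h2 e he).symm)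
  rw [Measure.prod_apply hm]
  calc _ ≤ ∫⁻ ζ, ({ζ | ¬ Hubby n k ζ}.indicator 1 ζ + J * (bc d n * (1 - ofReal σ ^ (d * (2 * (k + 1)))) ^ M) : ENNReal) ∂mu q := by
        refine lintegral_mono fun ζ => ?_; by_cases hζ : Hubby n k ζ
        · rw [indicator_of_notMem (by simp_all), zero_add]
          exact le_trans (measure_mono fun ξ hξ => show ¬ Glued n r ζ (orc ζ ξ) from fun hg => hξ ⟨hζ, hg⟩) (mu_not_glued_le hd hσ hJ hs hζ.dense hn hJn)
        · rw [indicator_of_mem (by simpa using hζ)]; exact prob_le_one.trans le_self_add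
    _ ≤ _ := by
        rw [lintegral_add_right _ measurable_const, lintegral_const, measure_univ, mul_one]
        exact add_le_add ((lintegral_indicator_one_le _).trans (mu_not_hubby_le hq hq1 hA hk hb h)) le_rfl

lemma measurePreserving_sh (p) (a : V d) : MeasurePreserving (sh a) (mu p) (mu p) := ⟨(shift a).measurable_conf, (shift a).map_conf p⟩

lemma prod_not_cellAt_le (hp : p ∈ 𝕀) (hs : s ∈ 𝕀)
    (h : ((mu (uni p s)).prod (mu s)) {x : Pr (Edge d) | ¬ Good n r k x.1 x.2} ≤ c) (a) :
    ((mu p).prod (mu s)) {q : Om d | ¬ cellAt n r k L q a} ≤ c + bc d n * mu p (arm L (0 : V d)) := by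
  have h1 := ((measurePreserving_sh (uni p s) a).prod (measurePreserving_sh s a)).comp (⟨measurable_base, map_base hp hs⟩ : MeasurePreserving (fun q => (orc (om q) (x₁ q), x₂ q)) _ _)
  have h2 := (measurePreserving_sh p a).comp ((measurePreserving_fst).comp (⟨measurable_sprinkle, map_sprinkle hs⟩ : MeasurePreserving (fun q => (om q, orc (x₁ q) (x₂ q))) _ _))
  have b1 := Measure.le_map_apply h1.aemeasurable {x | ¬ Good n r k x.1 x.2}
  have b2 := Measure.le_map_apply h2.aemeasurable {o | ∃ y ∈ box 0 n, o ∈ arm L y}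
  rw [h1.map_eq] at b1
  rw [h2.map_eq] at b2
  refine le_trans (measure_mono ?_) ((measure_union_le _ _).trans (add_le_add (b1.trans h) (b2.trans mu_exists_arm_le)))
  intro q hq
  by_cases hg : Good n r k (sh a (orc (om q) (x₁ q))) (sh a (x₂ q))
  · refine .inr ?_; unfold cellAt cellOK at hq; push Not at hq; exact hq hg
  · exact .inl hg

lemma prod_not_siteOK_le {μ : Measure (Om d)} (h : ∀ a, μ {q | ¬ cellAt n r k L q a} ≤ c) (Y) :
    μ {q | ¬ siteOK n r k L W q Y} ≤ 2 * (L + 1) * c := by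
  have key : ∀ e, μ (⋃ i ∈ Finset.range (L + 1), {q | ¬ cellAt n r k L q (ctr d L W Y e i)}) ≤ (L + 1) * c := fun e => by
    refine (measure_biUnion_finset_le _ _).trans ((sum_le_card_nsmul _ _ c fun _ _ => h _).trans (le_of_eq ?_)); simp
  refine le_trans (measure_mono ?_) ((measure_union_le _ _).trans ((add_le_add (key (1, 0)) (key (0, 1))).trans (le_of_eq (by ring))))
  intro q hq
  unfold siteOK at hq
  push Not at hq
  simp_all

lemma ae_hasInfCluster_after (hd : 2 ≤ d) (hr : W + k ≤ r) (hn : r ≤ n) (hW : 0 < W) (hL : 2 * (3 * n + 1 + L) < W * L)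
    (h : ∀ Y, ((mu p).prod (mu s)) {q : Om d | ¬ siteOK n r k L W q Y} ≤ 2⁻¹ ^ 13) : ∀ᵐ q ∂((mu p).prod (mu s) : Measure (Om d)), HasInfCluster (after q) := by
  have hL0 : 0 < L := by
    grind
  have hD : ∀ Y, DepOn₂ {q | ¬ siteOK n r k L W q Y} (reg d (W * L + (3 * n + 1 + L)) (W * L) Y) (reg d (W * L + (3 * n + 1 + L)) (W * L) Y) := fun Y q q' h1 h2 hq hq' =>
    hq (depOn₂_siteOK le_rfl Y q' q (fun e he => (h1 e he).symm) (fun e he => (h2 e he).symm) hq')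
  filter_upwards [ae_eventually_lvl (fun Y => meas_of_depOn₂ (finite_reg _ _ _) (hD Y)) hD (fun Y Y' hY => reg_disjoint hd (by omega) hY) h] with q ⟨k₀, hk⟩
  refine hasInfCluster_after hd hr hn hL0 hW (k₀ := k₀) fun j hj i hi => ?_
  simp_all

end

noncomputable section

variable {d : ℕ} {p q s ε : ℝ}

/-! ### Measurability of infinite clusters -/

lemma inInfinite_iff : InInfinite ω x ↔ ∀ F : Finset (V d), ω ∈ cnS univ x (F : Set (V d))ᶜ := by
  constructor
  · intro h F; obtain ⟨y, hy, hF⟩ := Set.Infinite.exists_notMem_finset h F; exact ⟨y, hF, cn_univ_iff.2 hy⟩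
  · intro h hfin; obtain ⟨y, hy, hc⟩ := h (Set.Finite.toFinset hfin); exact hy ((Set.Finite.mem_toFinset hfin).2 (cn_univ_iff.1 hc))

lemma meas_inInfinite (x : V d) : MeasurableSet {ω | InInfinite ω x} := by
  simp [inInfinite_iff, ofPred_forall]
  exact MeasurableSet.iInter fun F => meas_cnS _ _ _

lemma meas_hasInfCluster : MeasurableSet {ω : Config d | HasInfCluster ω} := by
  simp [HasInfCluster, ofPred_exists]
  exact MeasurableSet.iUnion meas_inInfinite

open Classical in
lemma measurable_burn : Measurable (burn : Config d → Config d) := by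
  refine measurable_pi_iff.2 fun e => Measurable.ite ?_ measurable_const (measurable_pi_apply e)
  rw [(show {ω | ∃ x ∈ e.val, x ∈ Cinf ω} = ⋃ x ∈ {x | x ∈ e.val}, {ω | InInfinite ω x} by aesop)]
  exact MeasurableSet.biUnion (to_countable _) fun x _ => meas_inInfinite x

lemma meas_recovered : MeasurableSet {x : Pr (Edge d) | HasInfCluster (orc (burn x.1) x.2)} := by
  exact (measurable_orc.comp ((measurable_burn.comp measurable_fst).prodMk measurable_snd)) meas_hasInfCluster

lemma HasInfCluster.mono (h : HasInfCluster ω) (hω : ∀ e, ω e = true → ω' e = true) : HasInfCluster ω' := by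
  obtain ⟨x, hx⟩ := h
  exact ⟨x, Set.Infinite.mono (fun y hy => cn_univ_iff.1 ((cn_univ_iff.2 hy).mono Subset.rfl hω)) hx⟩

/-! ### Recovery -/

lemma ofReal_total (L N J : ℕ) (hx : 0 ≤ x) (hy : 0 ≤ y) (hz : 0 ≤ z) :
    2 * ((L : ENNReal) + 1) * (N * ofReal x + J * (N * ofReal y) + N * ofReal z) = ofReal (2 * (L + 1) * (N * x + J * (N * y) + N * z)) := by
  rw [ofReal_mul (by linarith), ofReal_add (by positivity) (by positivity), ofReal_add (by positivity) (by positivity),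
    ofReal_mul (by simp), ofReal_mul (by simp), ofReal_mul (by simp), ofReal_mul (by simp),
    ofReal_mul (by simp), ofReal_add (by simp) (by simp)]
  simp

lemma exists_arm_le (hq : pT d < q) (hT : pT d < 1) (L) (hc : 0 < c) (h : mu (pT d) (arm L (0 : V d)) ≤ ofReal c) :
    ∃ p, pT d < p ∧ p < q ∧ p ≤ 1 ∧ mu p (arm L (0 : V d)) ≤ ofReal (2 * c) := by
  set A := (finite_edgesIn (finite_box (0 : V d) L)).toFinset
  set t := min (min 1 ((q - pT d) / 2)) (c / (A.card + 1))
  have ht0 : 0 < t := by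
    positivity
  have ht1 : t ≤ 1 := (min_le_left _ _).trans (min_le_left _ _)
  have htq : t ≤ (q - pT d) / 2 := (min_le_left _ _).trans (min_le_right _ _)
  have htc : t * (A.card + 1) ≤ c := (le_div_iff₀ (by linarith)).1 (min_le_right _ _)
  have h0 := pT_nonneg d
  have hu : uni (pT d) t = pT d + t * (1 - pT d) := by unfold uni; ring
  refine ⟨uni (pT d) t, by rw [hu]; nlinarith, by rw [hu]; nlinarith, (uni_mem ⟨h0, hT.le⟩ ⟨ht0.le, ht1⟩).2, ?_⟩
  refine (mu_uni_le ⟨h0, hT.le⟩ ⟨ht0.le, ht1⟩ (meas_cnS _ _ _) A ((depOn_cnS _ _ _).mono (by simp [A]))).trans ?_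
  rw [two_mul, ofReal_add hc.le hc.le, ← ofReal_natCast, ← ofReal_mul (by positivity)]
  exact add_le_add h (ofReal_le_ofReal (by nlinarith))

theorem exists_recovery (h : Big d) (hε : 0 < ε) (hε1 : ε ≤ 1) (hq : pT d < q) : ∃ p, pT d < p ∧ p < q ∧ p ≤ 1 ∧
    ∀ᵐ x ∂((mu p).prod (mu ε) : Measure (Pr (Edge d))), HasInfCluster (orc (burn x.1) x.2) := by
  have hd := h.d26
  have hT : pT d < 1 := by linarith [h.pT_le]
  have hT0 := pT_nonneg d
  obtain ⟨s, hs0, hs1, hss⟩ : ∃ s, 0 < s ∧ s ≤ 1 ∧ uni s s = ε := by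
    refine ⟨1 - √(1 - ε), ?_, by linarith [Real.sqrt_nonneg (1 - ε)], ?_⟩
    · have : √(1 - ε) < 1 := by rw [Real.sqrt_lt' one_pos]; linarith
      linarith
    · unfold uni; simp_all
  obtain ⟨g, hg, hgrid⟩ := exists_grid h
  obtain ⟨C, hC, harm⟩ := one_arm h
  set c := (1 - pT d) * s / (2 * g ^ 2)
  have hm : Tendsto (fun k => scale d k ^ (2 * d)) atTop atTop := by
    refine Filter.tendsto_atTop_mono' _ ?_ Filter.tendsto_id; filter_upwards [eventually_ge_atTop 1] with k hk
    exact (le_scale hk).trans (Nat.le_self_pow (by omega) _)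
  obtain ⟨k₀, hk₀⟩ := Filter.eventually_atTop.1 (((eventually_scales (by omega : 1 ≤ d) hs0 hs1 (show 0 < c from div_pos (mul_pos (by linarith) hs0) (by positivity)) hC).and (hm.eventually harm)).and (eventually_ge_atTop 100))
  set m₀ := k₀
  set k := g * m₀
  obtain ⟨⟨hsc, harm⟩, hk⟩ := hk₀ k (Nat.le_mul_of_pos_left _ hg)
  set W := scale d k
  set m := W ^ (2 * d)
  have hkW : k ≤ W := le_scale (by omega)
  obtain ⟨hN, hbound⟩ := hsc W m _ rfl rfl rfl
  obtain ⟨A, hAc, hAb, hA⟩ := hgrid m₀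
  have hWm : W ≤ m := Nat.le_self_pow (by omega) _
  have hmL : m ≤ m ^ 11 := Nat.le_self_pow (by omega) _
  have hm0 : (0:ℝ) < m := by exact_mod_cast (show 0 < m by omega)
  obtain ⟨p, hp, hpq, hp1, hparm⟩ := exists_arm_le hq hT (m ^ 11) (by positivity) harm
  refine ⟨p, hp, hpq, hp1, ?_⟩
  have hpI : p ∈ 𝕀 := ⟨by linarith, hp1⟩
  have hsI : s ∈ 𝕀 := ⟨hs0.le, hs1⟩
  have hbc : bc d (4 * W) ≤ (8 * W + 1) ^ d := by simpa [← mul_assoc] using bc_le d (4 * W)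
  have hun : (1 - pT d) * s ≤ uni p s - pT d := by unfold uni; nlinarith
  have hJ : (1:ℝ) ≤ (k ^ 2 : ℕ) := by exact_mod_cast Nat.one_le_pow 2 k (by omega)
  have hσ : s / (k ^ 2 : ℕ) ∈ 𝕀 := ⟨by positivity, by rw [div_le_one (by positivity)]; linarith⟩
  have hpos : 0 < (1 - pT d) * s := mul_pos (by linarith) hs0
  have hgood := prod_not_good_le (b := m₀ ^ 2 / 2) (by omega : 2 ≤ d) (by linarith : pT d < uni p s) (uni_mem hpI hsI).2 hs1
    hAb (by omega) (by positivity) (fun S hS hAS => le_trans (le_of_eq ?_) (hA S hS hAS)) hσ (by rw [mul_div_cancel₀ _ (by positivity)])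
    (by show 2 * W + _ ≤ _; rw [show k ^ 2 * (k ^ (12 * d * k + 2) * (2 * k + 4)) = 2 * W by simp [W, scale]; ring]; omega) (hbc.trans_lt hN)
  swap
  · rw [div_eq_mul_inv, ofReal_mul (by positivity), ofReal_inv_of_pos two_pos]; simp
  have hsite := prod_not_siteOK_le (W := W) (prod_not_cellAt_le (L := m ^ 11) hpI hsI hgood)
  have hae := ae_hasInfCluster_after (by omega : 2 ≤ d) (by omega) (by omega) (by omega) (by nlinarith) fun Y => (hsite Y).trans (le_trans ?_ (?_ : ofReal ((1 / 2) ^ 13) ≤ _))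
  rotate_left
  · refine le_trans ?_ (ofReal_le_ofReal hbound)
    have e : (1 - ofReal (s / (k ^ 2 : ℕ)) ^ (d * (2 * (k + 1)))) ^ k ^ (12 * d * k + 2) = ofReal ((1 - (s / (k ^ 2 : ℕ)) ^ (d * (2 * (k + 1)))) ^ k ^ (12 * d * k + 2)) := by
      have hle := pow_le_one₀ hσ.1 hσ.2 (n := d * (2 * (k + 1)))
      rw [ofReal_pow (by linarith), ENNReal.ofReal_sub _ (pow_nonneg hσ.1 _), ofReal_one, ofReal_pow hσ.1]
    have := ofReal_total (m ^ 11) ((8 * W + 1) ^ d) (k ^ 2) (exp_pos (1 - c * k ^ 2)).le (pow_nonneg (sub_nonneg.2 (pow_le_one₀ hσ.1 hσ.2 (n := d * (2 * (k + 1))))) (k ^ (12 * d * k + 2))) (show 0 ≤ 2 * C / (m:ℝ) ^ 12 by positivity)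
    push_cast at this ⊢; rw [← this]; push_cast at e; rw [e]; have hbc' : (bc d (4 * W) : ENNReal) ≤ (8 * W + 1) ^ d := by exact_mod_cast hbc
    refine mul_le_mul' le_rfl (add_le_add (add_le_add (mul_le_mul' hbc' ?_) (mul_le_mul' le_rfl (mul_le_mul' hbc' le_rfl))) (mul_le_mul' hbc' (hparm.trans (by rw [mul_div_assoc]))))
    refine ofReal_le_ofReal (Real.exp_le_exp.2 (sub_le_sub_left ?_ _))
    rw [(show c * (k:ℝ) ^ 2 = (1 - pT d) * s * (m₀ ^ 2 / 2) by simp [c, k]; field_simp)]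
    exact mul_le_mul_of_nonneg_right hun (by positivity)
  · rw [ofReal_pow (by positivity), one_div, ofReal_inv_of_pos two_pos]; simp
  rw [← hss, ← map_sprinkle hsI]
  exact (ae_map_iff measurable_sprinkle.aemeasurable meas_recovered).2 hae

lemma measure_eq_one_of_ae [MeasurableSpace α] {μ : Measure α} [IsProbabilityMeasure μ] (h : ∀ᵐ x ∂μ, x ∈ S) : μ S = 1 := by
  exact (measure_congr (Filter.eventuallyEq_univ.2 h)).trans measure_univ

lemma pcOf_le (h : Big d) (hP : ∀ p ∈ 𝕀, IsBernoulli d p (P p)) : pcOf d P ≤ pT d := by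
  refine le_of_forall_gt_imp_ge_of_dense fun q hq => ?_
  obtain ⟨p, hp, hpq, hp1, hae⟩ := exists_recovery h (ε := min 1 ((q - pT d) / 2)) (q := (q + pT d) / 2) (lt_min one_pos (by linarith)) (min_le_left _ _) (by linarith)
  set ε := min 1 ((q - pT d) / 2)
  have hε : ε ∈ 𝕀 := ⟨le_min zero_le_one (by linarith), min_le_left _ _⟩
  have hεq : ε ≤ (q - pT d) / 2 := min_le_right _ _
  have hp0 : 0 ≤ p := (pT_nonneg d).trans hp.le
  have hu := uni_mem ⟨hp0, hp1⟩ hε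
  refine le_trans (csInf_le ⟨0, fun x hx => hx.1.1⟩ ⟨hu, ?_⟩) (show uni p ε ≤ q by unfold uni; nlinarith [mul_nonneg hp0 hε.1])
  rw [IsBernoulli_eq hu (hP _ hu), mu_uni ⟨hp0, hp1⟩ hε meas_hasInfCluster, measure_eq_one_of_ae]
  · simp
  filter_upwards [hae] with x hx
  refine hx.mono fun e he => ?_
  simp only [orc, burn, closeOn, Bool.or_eq_true] at he ⊢
  aesop

end

/-- For all sufficiently large `d`, the lattice `ℤ^d` recovers from
fires: for every `ε ∈ (0,1]` there is `p ∈ (p_c(d), 1]` such that the configuration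
`ω̃_{p,ε}` (the maximum of the burnt configuration `ω̃_p` and an independent
Bernoulli(`ε`) configuration) has an infinite open cluster almost surely. -/
theorem recovers_from_fires :
    ∃ d₀ : ℕ, ∀ d : ℕ, d₀ ≤ d →
      ∀ P : ℝ → Measure (Config d), (∀ p ∈ Icc (0 : ℝ) 1, IsBernoulli d p (P p)) →
        ∀ ε : ℝ, 0 < ε → ε ≤ 1 →
          ∀ Q : Measure ((Edge d → ℝ) × Config d), IsUniformWithBernoulli d ε Q →
            ∃ p : ℝ, pcOf d P < p ∧ p ≤ 1 ∧
              Q {x | HasInfCluster (fun e => burn (level p x.1) e || x.2 e)} = 1 := by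
  obtain ⟨d₀, hd₀⟩ := eventually_atTop.1 eventually_big
  refine ⟨d₀, fun d hd P hP ε hε hε1 Q hQ => ?_⟩
  have hB := hd₀ d hd
  have := hQ.1
  obtain ⟨p, hp, -, hp1, hae⟩ := exists_recovery hB hε hε1 (lt_add_one (pT d))
  refine ⟨p, (pcOf_le hB hP).trans_lt hp, hp1, ?_⟩
  rw [← map_level_eq ⟨(pT_nonneg d).trans hp.le, hp1⟩ ⟨hε.le, hε1⟩ hQ] at hae
  have hm : Measurable fun x : (Edge d → ℝ) × Config d => (level p x.1, x.2) :=
    ((measurable_level p).comp measurable_fst).prodMk measurable_snd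
  exact measure_eq_one_of_ae (ae_of_ae_map hm.aemeasurable hae)

end Perc
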